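/- There exists an absolute constant c₀ > 0 with the following property. Suppose T ≥ 3 and P ≥ T^{1/log log T}. Among all moduli q ≤ T whose greatest prime factor P⁺(q) is at most P, and all primitive Dirichlet characters χ modulo q, there is at most one modulus q₀ and one primitive character χ₀ modulo q₀ such that the Dirichlet L-function L(s, χ₀) has a zero s in the region Re(s) > 1 − c₀/log P, |Im(s)| ≤ exp(log P/√(log T)). Moreover, if such a zero exists, it is unique, real and simple, the character χ₀ is real, and there are absolute constants A, B > 0 such that P⁺(q₀) ≥ A·log q₀ and log q₀ ≥ B·log log T. -/

import Mathlib

open scoped Classical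

/-- The largest prime factor of `q` (`0` if `q` has no prime factor). -/
def maxPrimeFac (q : ℕ) : ℕ := q.primeFactors.sup id

/-- The Dirichlet L-function of a character mod `q`, defined to be `0` for the junk
modulus `q = 0` (which is excluded in the statement below). -/
noncomputable def LFun (q : ℕ) (χ : DirichletCharacter ℂ q) (s : ℂ) : ℂ :=
  if hq : q ≠ 0 then @DirichletCharacter.LFunction q ⟨hq⟩ χ s else 0

namespace LandauPage
open Polynomial Finset

section Stepanov
variable {F : Type*} [Field F] [Fintype F]

/-- The exponent `(j_b R + b) / d` for `R = d s + 1`. -/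
def stepU (d s b : ℕ) : ℕ := if b = 0 then 0 else (d - b) * s + 1

/-- The exponent `(j_b + b R) / d` for `R = d s + 1`. -/
def stepV (s b : ℕ) : ℕ := if b = 0 then 0 else b * s + 1

lemma stepU_le {d s b : ℕ} : stepU d s b ≤ d * s + 1 := by
  unfold stepU; split_ifs
  · omega
  · have : (d - b) * s ≤ d * s := Nat.mul_le_mul_right _ (Nat.sub_le _ _)
    omega

lemma stepV_le {d s b : ℕ} (hb : b < d) : stepV s b ≤ d * s + 1 := by
  unfold stepV; split_ifs
  · omega
  · have : b * s ≤ d * s := Nat.mul_le_mul_right _ hb.le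
    omega

lemma step_mul_eq {d s b : ℕ} (hb : b < d) :
    (d * s + 1) * stepV s b = stepU d s b + b * (s * (d * s + 2)) := by
  unfold stepU stepV; split_ifs with h
  · simp [h]
  · obtain ⟨c, rfl⟩ := Nat.exists_eq_add_of_lt hb
    have : b + c + 1 - b = c + 1 := by omega
    rw [this]; ring

/-- The auxiliary relation in Stepanov's method. -/
lemma exists_stepanov_relation (p r d s D : ℕ) [Fact p.Prime] [CharP F p]
    (hR : p ^ r = d * s + 1) (f : F[X])
    (hD : f.natDegree = D) (hs : D + 1 ≤ s) (hlarge : (d * D + 3) * (d * D + 2) < d * s + 1)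
    (hd : 2 ≤ d) :
    ∃ ν : Fin (s + (d * D + 3)) × Fin d → Fin (s - D) → F, ν ≠ 0 ∧
      ∑ i, (ofFn (s - D) (ν i)) ^ (d * s + 1) * X ^ (i.1 : ℕ) * f ^ stepU d s i.2 = 0 := by
  set l := s - D with hl
  set m := s + (d * D + 3) with hm
  set R := d * s + 1 with hRR
  set N := R * l + m + D * R with hN
  have hl1 : 1 ≤ l := by omega
  let E : (Fin m × Fin d → Fin l → F) → F[X] := fun ν =>
    ∑ i, (ofFn l (ν i)) ^ R * X ^ (i.1 : ℕ) * f ^ stepU d s i.2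
  have hdeg : ∀ ν, (E ν).natDegree < N := by
    intro ν
    refine lt_of_le_of_lt (natDegree_sum_le_of_forall_le (n := R * (l - 1) + (m - 1) + D * R)
      _ _ ?_) ?_
    · intro i _
      refine (natDegree_mul_le).trans (add_le_add ((natDegree_mul_le).trans (add_le_add ?_ ?_)) ?_)
      · refine natDegree_pow_le.trans ?_
        have := ofFn_natDegree_lt hl1 (ν i)
        exact Nat.mul_le_mul_left _ (by omega)
      · rw [natDegree_X_pow]; have := i.1.2; omega
      · refine natDegree_pow_le.trans ?_
        rw [hD, mul_comm]
        exact Nat.mul_le_mul_left _ stepU_le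
    · have : R * (l - 1) ≤ R * l := Nat.mul_le_mul_left _ (by omega)
      omega
  have hcard : Fintype.card (Fin N → F) < Fintype.card (Fin m × Fin d → Fin l → F) := by
    rw [Fintype.card_fun, Fintype.card_fun, Fintype.card_fun, Fintype.card_fin, Fintype.card_prod,
      Fintype.card_fin, Fintype.card_fin, Fintype.card_fin, ← pow_mul]
    refine Nat.pow_lt_pow_right Fintype.one_lt_card ?_
    have e1 : s = l + D := by omega
    rw [hN, hm, hRR]
    rw [hRR] at hlarge
    clear_value l
    subst e1
    have h3 : (l + D) * (d * D + 2) ≤ (d * (l + D) + 1) * (d * D + 2) :=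
      Nat.mul_le_mul_right _ (by nlinarith)
    nlinarith
  obtain ⟨ν₁, ν₂, hne, heq⟩ := Fintype.exists_ne_map_eq_of_card_lt (fun ν => toFn N (E ν)) hcard
  have hE : E ν₁ = E ν₂ := by
    rw [← ofFn_comp_toFn_eq_id_of_natDegree_lt (hdeg ν₁),
      ← ofFn_comp_toFn_eq_id_of_natDegree_lt (hdeg ν₂)]
    exact congrArg _ heq
  refine ⟨ν₁ - ν₂, sub_ne_zero.mpr hne, ?_⟩
  have : ∀ i, (ofFn l ((ν₁ - ν₂) i)) ^ R * X ^ (i.1 : ℕ) * f ^ stepU d s i.2 =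
      (ofFn l (ν₁ i)) ^ R * X ^ (i.1 : ℕ) * f ^ stepU d s i.2 -
      (ofFn l (ν₂ i)) ^ R * X ^ (i.1 : ℕ) * f ^ stepU d s i.2 := by
    intro i
    rw [Pi.sub_apply, map_sub, ← hR, sub_pow_char_pow]; ring
  rw [Finset.sum_congr rfl fun i _ => this i, Finset.sum_sub_distrib]
  exact sub_eq_zero.mpr hE

lemma stepanov_w_ne_zero {F : Type*} [Field F] (d s D m l : ℕ) (f : F[X]) (hf0 : f ≠ 0)
    (hD : f.natDegree = D) (hcop : D.Coprime d) (hl : l + D ≤ s) (hl1 : 1 ≤ l) 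
    (ν : Fin m × Fin d → Fin l → F) (hν : ν ≠ 0) :
    ∑ i, ofFn l (ν i) * X ^ ((i.1 : ℕ) * (d * s + 1)) * f ^ stepV s i.2 ≠ 0 := by
  set R := d * s + 1 with hRR
  set g : Fin m × Fin d → F[X] := fun i =>
    ofFn l (ν i) * X ^ ((i.1 : ℕ) * R) * f ^ stepV s i.2 with hg
  have hg0 : ∀ i, g i ≠ 0 → ofFn l (ν i) ≠ 0 := by
    intro i h h'; apply h; simp [hg, h']
  have hdeg : ∀ i, g i ≠ 0 → (g i).natDegree = (ofFn l (ν i)).natDegree + i.1 * R +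
      stepV s i.2 * D := by
    intro i h
    have h1 := hg0 i h
    simp only [hg]
    rw [natDegree_mul (mul_ne_zero h1 (pow_ne_zero _ X_ne_zero)) (pow_ne_zero _ hf0),
      natDegree_mul h1 (pow_ne_zero _ X_ne_zero), natDegree_X_pow, natDegree_pow, hD]
  have key : ∀ i j, g i ≠ 0 → g j ≠ 0 → (g i).natDegree = (g j).natDegree → i = j := by
    intro i j hi hj hij
    rw [hdeg i hi, hdeg j hj] at hij
    have hi2 := ofFn_natDegree_lt hl1 (ν i)
    have hj2 := ofFn_natDegree_lt hl1 (ν j)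
    obtain ⟨⟨a, ha⟩, ⟨b, hb⟩⟩ := i
    obtain ⟨⟨a', ha'⟩, ⟨b', hb'⟩⟩ := j
    simp only at hij
    set n₁ := (ofFn l (ν (⟨a, ha⟩, ⟨b, hb⟩))).natDegree
    set n₂ := (ofFn l (ν (⟨a', ha'⟩, ⟨b', hb'⟩))).natDegree
    have hj' : ∀ b < d, ∃ t ≤ d, d * stepV s b = t + b * R := by
      intro b hb
      unfold stepV
      split_ifs with h
      · exact ⟨0, by omega, by simp [h]⟩
      · exact ⟨d - b, by omega, by rw [hRR]; zify [hb.le]; ring⟩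
    obtain ⟨t, ht, e⟩ := hj' b hb
    obtain ⟨t', ht', e'⟩ := hj' b' hb'
    have h1 : (d * n₁ + t * D) + R * (d * a + b * D) = (d * n₂ + t' * D) + R * (d * a' + b' * D) := by
      have : d * (n₁ + a * R + stepV s b * D) = d * (n₂ + a' * R + stepV s b' * D) := by rw [hij]
      have e1 : d * (n₁ + a * R + stepV s b * D) = d * n₁ + d * a * R + (d * stepV s b) * D := by ring
      have e2 : d * (n₂ + a' * R + stepV s b' * D) = d * n₂ + d * a' * R + (d * stepV s b') * D := by ring
      rw [e1, e2, e, e'] at this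
      linarith
    have small : ∀ n t, n < l → t ≤ d → d * n + t * D < R := by
      intro n t hn ht
      have : d * n + t * D ≤ d * (l + D) := by
        have := Nat.mul_le_mul_right D ht
        have := Nat.mul_le_mul_left d hn.le
        linarith
      have := Nat.mul_le_mul_left d hl
      omega
    have h2 : d * a + b * D = d * a' + b' * D := by
      have := congrArg (· / R) h1
      have hR0 : 0 < R := by omega
      simpa [Nat.add_mul_div_left _ _ hR0, Nat.div_eq_of_lt (small _ _ hi2 ht),
        Nat.div_eq_of_lt (small _ _ hj2 ht')] using this
    have h3 : b = b' := by
      have h4 : b * D ≡ b' * D [MOD d] := by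
        have : d * a + b * D ≡ d * a' + b' * D [MOD d] := by rw [h2]
        simpa [Nat.ModEq] using this
      have h5 := Nat.ModEq.cancel_right_of_coprime (by rw [Nat.gcd_comm]; exact hcop) h4
      exact Nat.ModEq.eq_of_lt_of_lt h5 hb hb'
    subst h3
    have : a = a' := by
      have : d * a = d * a' := by omega
      exact Nat.eq_of_mul_eq_mul_left (by omega) this
    subst this
    rfl
  intro h0
  have h := degree_sum_eq_of_disjoint g Finset.univ (by
    intro i hi j hj hij hd
    apply hij
    refine key i j hi.2 hj.2 ?_
    exact natDegree_eq_of_degree_eq hd)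
  have h0' : ∑ i, g i = 0 := h0
  rw [h0', degree_zero] at h
  have hall : ∀ i, ν i = 0 := by
    intro i
    have h1 : degree (g i) ≤ ⊥ := by
      rw [h]; exact Finset.le_sup (f := fun i => degree (g i)) (Finset.mem_univ i)
    have h2 : g i = 0 := degree_eq_bot.mp (le_bot_iff.mp h1)
    by_contra h3
    have : ofFn l (ν i) ≠ 0 := by
      intro h4; apply h3; exact injective_ofFn l (by rw [h4, map_zero])
    exact mul_ne_zero (mul_ne_zero this (pow_ne_zero _ X_ne_zero)) (pow_ne_zero _ hf0) h2
  exact hν (funext hall)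

/-- Stepanov's bound for the number of `x` such that `f x` is a non-zero `d`-th power. -/
theorem stepanov_count_le (p r d s D : ℕ) [Fact p.Prime] [CharP F p]
    (hF : Fintype.card F = (p ^ r) ^ 2) (hR : p ^ r = d * s + 1) (hd : 2 ≤ d) (f : F[X])
    (hf0 : f ≠ 0) (hD : f.natDegree = D) (hcop : D.Coprime d) (hs : D + 1 ≤ s)
    (hlarge : (d * D + 3) * (d * D + 2) < d * s + 1) :
    #{x : F | f.eval x ^ (s * (d * s + 2)) = 1} ≤
      s * (d * s + 1) + (d * D + D + 3) * (d * s + 1) := by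
  obtain ⟨ν, hν, hE⟩ := exists_stepanov_relation p r d s D hR f hD hs hlarge hd
  have hl1 : 1 ≤ s - D := by omega
  set w := ∑ i, ofFn (s - D) (ν i) * X ^ ((i.1 : ℕ) * (d * s + 1)) * f ^ stepV s i.2 with hw
  have hw0 : w ≠ 0 := stepanov_w_ne_zero d s D _ (s - D) f hf0 hD hcop (by omega) hl1 ν hν
  have hsub : ({x : F | f.eval x ^ (s * (d * s + 2)) = 1} : Finset F) ⊆ w.roots.toFinset := by
    intro x hx
    rw [Finset.mem_filter] at hx
    rw [Multiset.mem_toFinset, mem_roots hw0, IsRoot.def]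
    have hx1 := hx.2
    have hxQ : x ^ ((d * s + 1) * (d * s + 1)) = x := by
      have := FiniteField.pow_card x
      rwa [hF, hR, sq] at this
    have : (eval x w) ^ (d * s + 1) = 0 := by
      have h1 : (eval x w) ^ (d * s + 1) = eval x (∑ i, (ofFn (s - D) (ν i)) ^ (d * s + 1) * X ^ (i.1 : ℕ) * f ^ stepU d s i.2) := by
        rw [hw, eval_finsetSum, eval_finsetSum, ← hR, sum_pow_char_pow]
        refine Finset.sum_congr rfl fun i _ => ?_
        simp only [eval_mul, eval_pow, eval_X, hR]
        have hxa : (x ^ ((i.1 : ℕ) * (d * s + 1))) ^ (d * s + 1) = x ^ (i.1 : ℕ) := by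
          rw [← pow_mul, mul_assoc, pow_mul', hxQ]
        rw [mul_pow, mul_pow, hxa, ← pow_mul (eval x f),
          mul_comm (stepV s _), step_mul_eq i.2.2, pow_add (eval x f), pow_mul' (eval x f), hx1, one_pow,
          mul_one]
      rw [h1, hE, eval_zero]
    exact pow_eq_zero_iff (by omega) |>.mp this
  refine (Finset.card_le_card hsub).trans ((Multiset.toFinset_card_le _).trans
    ((card_roots' w).trans ?_))
  refine natDegree_sum_le_of_forall_le _ _ ?_
  intro i _
  refine (natDegree_mul_le).trans ?_
  have h1 : (ofFn (s - D) (ν i) * X ^ ((i.1 : ℕ) * (d * s + 1))).natDegree ≤ (s - D - 1) + i.1 * (d * s + 1) := by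
    refine (natDegree_mul_le).trans (add_le_add ?_ ?_)
    · have := ofFn_natDegree_lt hl1 (ν i); omega
    · rw [natDegree_X_pow]
  have h2 : (f ^ stepV s i.2).natDegree ≤ (d * s + 1) * D := by
    refine natDegree_pow_le.trans ?_
    rw [hD]; exact Nat.mul_le_mul_right _ (stepV_le i.2.2)
  have h3 : (i.1 : ℕ) * (d * s + 1) ≤ (s + (d * D + 2)) * (d * s + 1) :=
    Nat.mul_le_mul_right _ (by have := i.1.2; omega)
  have h4 : s - D - 1 ≤ d * s + 1 := by
    have : s ≤ d * s := Nat.le_mul_of_pos_left _ (by omega)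
    omega
  nlinarith

end Stepanov
end LandauPage

namespace LandauPage
open Polynomial Finset

theorem stepanov_two_sided {F : Type*} [Field F] [Fintype F] (p r d s D : ℕ) [Fact p.Prime]
    [CharP F p] (hF : Fintype.card F = (p ^ r) ^ 2) (hR : p ^ r = d * s + 1) (hd : 2 ≤ d)
    (f : F[X]) (hf0 : f ≠ 0) (hD : f.natDegree = D) (hcop : D.Coprime d) (hs : D + 1 ≤ s)
    (hlarge : (d * D + 3) * (d * D + 2) < d * s + 1) :
    |(d : ℝ) * #{x : F | f.eval x ^ (s * (d * s + 2)) = 1} - #{x : F | f.eval x ≠ 0}| ≤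
      d * (d * (d * D + D + 3) + D) * (d * s + 1) := by
  set n := s * (d * s + 2) with hn
  set B := s * (d * s + 1) + (d * D + D + 3) * (d * s + 1) with hB
  set N := #{x : F | f.eval x ^ n = 1} with hN
  have hn0 : n ≠ 0 := by
    have : s ≠ 0 := by omega
    positivity
  have hcard : Fintype.card F = (d * s + 1) ^ 2 := by rw [hF, hR]
  have hN1 : N ≤ B := stepanov_count_le p r d s D hF hR hd f hf0 hD hcop hs hlarge
  have hNZ : (d * s + 1) ^ 2 ≤ #{x : F | f.eval x ≠ 0} + D := by
    have h1 := Finset.card_filter_add_card_filter_not (s := (Finset.univ : Finset F)) (fun x => f.eval x ≠ 0)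
    have h2 : #{x : F | ¬ f.eval x ≠ 0} ≤ D := by
      have : ({x : F | ¬ f.eval x ≠ 0} : Finset F) ⊆ f.roots.toFinset := by
        intro x hx
        rw [Multiset.mem_toFinset, mem_roots hf0, IsRoot.def]
        simpa using hx
      exact (Finset.card_le_card this).trans ((Multiset.toFinset_card_le _).trans
        ((card_roots' f).trans hD.le))
    rw [Finset.card_univ, hcard] at h1
    omega
  have hcls : ∀ ζ : F, ζ ≠ 0 → #{x : F | f.eval x ^ n = ζ} ≤ B := by
    intro ζ hζ
    by_cases hex : ∃ x, f.eval x ^ n = ζ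
    · obtain ⟨x₀, hx₀⟩ := hex
      have hy : f.eval x₀ ≠ 0 := by
        intro h; rw [h, zero_pow hn0] at hx₀; exact hζ hx₀.symm
      set y := f.eval x₀
      have := stepanov_count_le p r d s D hF hR hd (C y⁻¹ * f)
        (mul_ne_zero (by simpa using hy) hf0)
        (by rw [natDegree_C_mul (inv_ne_zero hy), hD]) hcop hs hlarge
      refine le_trans (le_of_eq ?_) this
      congr 1
      ext x
      simp only [Finset.mem_filter, Finset.mem_univ, true_and, eval_mul, eval_C, mul_pow, inv_pow]
      rw [← hn, hx₀]
      constructor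
      · intro h; rw [h]; field_simp
      · intro h; field_simp at h; exact h
    · have : ({x : F | f.eval x ^ n = ζ} : Finset F) = ∅ := by
        rw [Finset.filter_eq_empty_iff]; intro x _ h; exact hex ⟨x, h⟩
      rw [this]; simp
  have hNZle : #{x : F | f.eval x ≠ 0} ≤ N + (d - 1) * B := by
    set Z : Finset F := (nthRoots d (1 : F)).toFinset with hZ
    have hZd : #Z ≤ d := (Multiset.toFinset_card_le _).trans (card_nthRoots d 1)
    have h1Z : (1 : F) ∈ Z := by
      rw [hZ, Multiset.mem_toFinset, mem_nthRoots (by omega), one_pow]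
    have hmaps : ∀ x ∈ ({x : F | f.eval x ≠ 0} : Finset F), f.eval x ^ n ∈ Z := by
      intro x hx
      rw [Finset.mem_filter] at hx
      rw [hZ, Multiset.mem_toFinset, mem_nthRoots (by omega), ← pow_mul]
      have : n * d = Fintype.card F - 1 := by
        rw [hcard, hn]; symm; rw [Nat.sub_eq_iff_eq_add (by nlinarith)]; ring
      rw [this]
      exact FiniteField.pow_card_sub_one_eq_one _ hx.2
    rw [Finset.card_eq_sum_card_fiberwise hmaps, ← Finset.add_sum_erase _ _ h1Z]
    refine add_le_add ?_ ?_
    · refine Finset.card_le_card ?_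
      intro x hx
      simp only [Finset.mem_filter, Finset.mem_univ, true_and] at hx ⊢
      exact hx.2
    · refine (Finset.sum_le_card_nsmul _ _ B ?_).trans ?_
      · intro ζ hζ
        have hζ0 : ζ ≠ 0 := by
          intro h
          have := (Finset.mem_erase.mp hζ).2
          rw [hZ, Multiset.mem_toFinset, mem_nthRoots (by omega), h, zero_pow (by omega)] at this
          exact zero_ne_one this
        refine le_trans (Finset.card_le_card ?_) (hcls ζ hζ0)
        intro x hx
        simp only [Finset.mem_filter, Finset.mem_univ, true_and] at hx ⊢
        exact hx.2
      · rw [Finset.card_erase_of_mem h1Z, smul_eq_mul]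
        exact Nat.mul_le_mul_right _ (by omega)
  set Z := #{x : F | f.eval x ≠ 0}
  have hd1 : ((d - 1 : ℕ) : ℝ) = d - 1 := by rw [Nat.cast_sub (by omega)]; simp
  have r1 : (N : ℝ) ≤ B := by exact_mod_cast hN1
  have r2 : ((d : ℝ) * s + 1) ^ 2 ≤ Z + D := by exact_mod_cast hNZ
  have r3 : (Z : ℝ) ≤ N + (d - 1) * B := by rw [← hd1]; exact_mod_cast hNZle
  have hBr : (B : ℝ) = s * (d * s + 1) + (d * D + D + 3) * (d * s + 1) := by
    rw [hB]; push_cast; ring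
  have hd' : (2 : ℝ) ≤ d := by exact_mod_cast hd
  have hs' : (0 : ℝ) ≤ s := by positivity
  have hD' : (0 : ℝ) ≤ D := by positivity
  set R : ℝ := d * s + 1 with hRr
  have hR1 : 1 ≤ R := by rw [hRr]; nlinarith
  have hDR : (D : ℝ) ≤ D * R := by nlinarith
  have hdB : (d : ℝ) * B = (R - 1) * R + d * (d * D + D + 3) * R := by rw [hBr, hRr]; ring
  have key : (d : ℝ) * B - Z ≤ (d * (d * D + D + 3) + D) * R := by nlinarith
  have hpos : 0 ≤ (d * (d * D + D + 3) + D) * R := by positivity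
  rw [abs_le]
  constructor
  · have : ((d : ℝ) - 1) * (Z - d * B) ≤ d * N - Z := by nlinarith
    nlinarith
  · nlinarith

/-- For a character `χ` of order `d` of the prime field, `χ u = 1` iff `u ^ ((p-1)/d) = 1`. -/
lemma mulChar_eq_one_iff {p : ℕ} [Fact p.Prime] (χ : MulChar (ZMod p) ℂ) (u : (ZMod p)ˣ) (M : ℕ)
    (hM : orderOf χ * M = p - 1) : χ u = 1 ↔ u ^ M = 1 := by
  obtain ⟨g, hg⟩ := IsCyclic.exists_generator (α := (ZMod p)ˣ)
  have hp1 : 0 < p - 1 := Nat.sub_pos_of_lt (Fact.out : p.Prime).one_lt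
  have hM0 : M ≠ 0 := by rintro rfl; simp at hM; omega
  have hog : orderOf g = p - 1 := by
    rw [orderOf_eq_card_of_forall_mem_zpowers hg, Nat.card_eq_fintype_card, ZMod.card_units]
  have hord : orderOf (χ g) = orderOf χ := by
    refine orderOf_eq_orderOf_iff.mpr fun n => ?_
    rw [← MulChar.pow_apply_coe]
    constructor
    · intro h
      refine (MulChar.eq_iff hg _ _).mpr ?_
      rw [h, MulChar.one_apply_coe]
    · intro h; rw [h, MulChar.one_apply_coe]
  obtain ⟨i, rfl⟩ : ∃ i : ℕ, g ^ i = u := by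
    have := hg u
    rwa [← mem_powers_iff_mem_zpowers] at this
  rw [Units.val_pow_eq_pow_val, map_pow, ← orderOf_dvd_iff_pow_eq_one, hord, ← pow_mul,
    ← orderOf_dvd_iff_pow_eq_one, hog, ← hM]
  exact (Nat.mul_dvd_mul_iff_right (Nat.pos_of_ne_zero hM0)).symm

lemma sum_mulChar_pow {p : ℕ} [Fact p.Prime] (χ : MulChar (ZMod p) ℂ) (u : ZMod p)
    (hd : 2 ≤ orderOf χ) :
    ∑ j ∈ Icc 1 (orderOf χ - 1), (χ ^ j) u =
      orderOf χ * (if χ u = 1 then 1 else 0) - (if u ≠ 0 then 1 else 0) := by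
  set d := orderOf χ
  by_cases hu : u = 0
  · subst hu
    have h0 : χ 0 = 0 := χ.map_zero
    have : ∀ j ∈ Icc 1 (d - 1), (χ ^ j) (0 : ZMod p) = 0 := fun j _ => MulChar.map_zero _
    rw [Finset.sum_congr rfl this]
    simp [h0]
  · have h1 : ∀ j ∈ Icc 1 (d - 1), (χ ^ j) u = χ u ^ j := fun j hj =>
      MulChar.pow_apply' _ (by have := (Finset.mem_Icc.mp hj).1; omega) _
    rw [Finset.sum_congr rfl h1]
    have h2 : ∑ j ∈ Icc 1 (d - 1), χ u ^ j = ∑ j ∈ range d, χ u ^ j - 1 := by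
      rw [Finset.range_eq_Ico, Finset.sum_eq_sum_Ico_succ_bot (by omega)]
      have : Icc 1 (d - 1) = Ico (0 + 1) d := by ext; simp; omega
      rw [this]; simp
    rw [h2, if_pos hu]
    congr 1
    by_cases h : χ u = 1
    · simp [h]
    · rw [if_neg h, geom_sum_eq h, ← MulChar.pow_apply' _ (by omega), pow_orderOf_eq_one,
        MulChar.one_apply (isUnit_iff_ne_zero.mpr hu)]
      simp

theorem sum_norm_char_le {F : Type*} [Field F] [Fintype F] {p : ℕ} [Fact p.Prime]
    [Algebra (ZMod p) F] (χ : MulChar (ZMod p) ℂ) (hd : 2 ≤ orderOf χ) (r D : ℕ)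
    (hF : Fintype.card F = (p ^ r) ^ 2) (f : F[X]) (hf0 : f ≠ 0) (hD : f.natDegree = D)
    (hcop : D.Coprime (orderOf χ)) (hr : 2 * ((orderOf χ * D + 3) * (orderOf χ * D + 3)) < p ^ r) :
    ‖∑ j ∈ Icc 1 (orderOf χ - 1), ∑ x : F, (χ ^ j) (Algebra.norm (ZMod p) (f.eval x))‖ ≤
      (orderOf χ * (orderOf χ * (orderOf χ * D + D + 3) + D)) * p ^ r := by
  set d := orderOf χ with hdd
  have hp2 : 2 ≤ p := (Fact.out : p.Prime).two_le
  have : CharP F p := (Algebra.charP_iff (ZMod p) F p).mp inferInstance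
  have hdp : d ∣ p - 1 := by
    have := MulChar.orderOf_dvd_card_sub_one (ZMod p) χ
    rwa [ZMod.card] at this
  obtain ⟨M, hM⟩ := hdp
  obtain ⟨s, hs⟩ : ∃ s, p ^ r = d * s + 1 := by
    have h1 : p - 1 ∣ p ^ r - 1 := by simpa using Nat.sub_dvd_pow_sub_pow p 1 r
    obtain ⟨s, hs⟩ := (Dvd.intro M hM.symm).trans h1
    exact ⟨s, by have : 0 < p ^ r := by positivity
                 omega⟩
  have hsD : D + 1 ≤ s := by
    by_contra h
    have : d * s ≤ d * D := Nat.mul_le_mul_left _ (by omega)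
    nlinarith
  have hiff : ∀ y : F, χ (Algebra.norm (ZMod p) y) = 1 ↔ y ^ (s * (d * s + 2)) = 1 := by
    intro y
    by_cases hy : y = 0
    · subst hy
      have : s ≠ 0 := by omega
      have : s * (d * s + 2) ≠ 0 := by positivity
      rw [Algebra.norm_zero, MulChar.map_zero, zero_pow this]
      simp
    · have hN : Algebra.norm (ZMod p) y ≠ 0 := Algebra.norm_ne_zero_iff.mpr hy
      have h1 := mulChar_eq_one_iff χ (Units.mk0 _ hN) M hM.symm
      rw [Units.val_mk0] at h1
      rw [h1, Units.ext_iff, Units.val_pow_eq_pow_val, Units.val_mk0, Units.val_one,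
        ← (algebraMap (ZMod p) F).injective.eq_iff, map_pow, map_one,
        FiniteField.algebraMap_norm_eq_pow, ← pow_mul]
      have h2 : (Nat.card F - 1) / (Nat.card (ZMod p) - 1) * M = s * (d * s + 2) := by
        rw [Nat.card_eq_fintype_card, Nat.card_eq_fintype_card, hF, ZMod.card, hs]
        have h3 : p - 1 ∣ (d * s + 1) ^ 2 - 1 := by
          rw [← hs, ← pow_mul]; simpa using Nat.sub_dvd_pow_sub_pow p 1 (r * 2)
        have h4 : (d * s + 1) ^ 2 - 1 = d * (s * (d * s + 2)) := by
          rw [Nat.sub_eq_iff_eq_add (by nlinarith)]; ring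
        rw [h4] at h3 ⊢
        have hd0 : 0 < d := by omega
        refine Nat.eq_of_mul_eq_mul_left hd0 ?_
        rw [mul_left_comm, ← hM, Nat.div_mul_cancel h3]
      rw [h2]
  have hsum : ∑ j ∈ Icc 1 (d - 1), ∑ x : F, (χ ^ j) (Algebra.norm (ZMod p) (f.eval x)) =
      (((d : ℝ) * #{x : F | f.eval x ^ (s * (d * s + 2)) = 1} - #{x : F | f.eval x ≠ 0} : ℝ) : ℂ) := by
    rw [Finset.sum_comm]
    rw [Finset.sum_congr rfl fun x _ => sum_mulChar_pow χ _ hd]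
    rw [Finset.sum_sub_distrib, ← Finset.mul_sum, Finset.sum_boole, Finset.sum_boole]
    push_cast
    simp only [hiff, Algebra.norm_ne_zero_iff, ne_eq]
    rfl
  rw [hsum, Complex.norm_real, Real.norm_eq_abs]
  have := stepanov_two_sided p r d s D hF hs hd f hf0 hD hcop hsD (by nlinarith)
  have hs' : (p : ℝ) ^ r = d * s + 1 := by exact_mod_cast hs
  rw [hs']
  exact this

end LandauPage

namespace LandauPage
open Polynomial Finset

section MonicPolynomials
variable {K : Type*} [Field K] [Fintype K]

/-- The monic polynomials of degree `n` over a finite field. -/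
noncomputable def monicPolys (K : Type*) [Field K] [Fintype K] (n : ℕ) : Finset K[X] :=
  univ.image fun v : Fin n → K => X ^ n + ofFn n v

lemma mem_monicPolys {n : ℕ} {g : K[X]} : g ∈ monicPolys K n ↔ g.Monic ∧ g.natDegree = n := by
  unfold monicPolys
  rw [Finset.mem_image]
  constructor
  · rintro ⟨v, -, rfl⟩
    have h1 := ofFn_degree_lt v
    have hm : (X ^ n + ofFn n v).Monic := monic_X_pow_add h1
    refine ⟨hm, ?_⟩
    rw [natDegree_add_eq_left_of_degree_lt (by rwa [degree_X_pow]), natDegree_X_pow]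
  · rintro ⟨hm, hn⟩
    refine ⟨fun i => (g - X ^ n).coeff i, mem_univ _, ?_⟩
    ext i
    rcases lt_or_ge i n with hi | hi
    · rw [coeff_add, ofFn_coeff_eq_val_of_lt _ hi, coeff_sub]; ring
    · rw [coeff_add, ofFn_coeff_eq_zero_of_ge _ hi, add_zero, coeff_X_pow]
      split_ifs with h
      · subst h; rw [← hn]; exact hm.symm
      · rw [coeff_eq_zero_of_natDegree_lt (by omega)]

lemma monicPolys_zero : monicPolys K 0 = {1} := by
  ext g
  rw [mem_monicPolys, mem_singleton]
  exact ⟨fun h => h.1.natDegree_eq_zero.mp h.2, by rintro rfl; simp⟩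

lemma natDegree_eq_sum_irreducible {n : ℕ} {g : K[X]} (hg : g ∈ monicPolys K n) :
    (n : ℂ) = ∑ d ∈ Icc 1 n, ∑ P ∈ (monicPolys K d).filter Irreducible, ∑ i ∈ Icc 1 n,
      (d : ℂ) * if P ^ i ∣ g then 1 else 0 := by
  obtain ⟨hm, hn⟩ := mem_monicPolys.mp hg
  have hg0 : g ≠ 0 := hm.ne_zero
  have hmon : ∀ P ∈ UniqueFactorizationMonoid.normalizedFactors g, P.Monic := by
    intro P hP
    have h1 := UniqueFactorizationMonoid.normalize_normalized_factor P hP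
    rw [← h1]
    exact monic_normalize (UniqueFactorizationMonoid.irreducible_of_normalized_factor P hP).ne_zero
  have hprod : (UniqueFactorizationMonoid.normalizedFactors g).prod = g := by
    have := UniqueFactorizationMonoid.prod_normalizedFactors_eq hg0
    rw [this, hm.normalize_eq_self]
  have hcount : ∀ P : K[X], P.Monic → Irreducible P →
      (UniqueFactorizationMonoid.normalizedFactors g).count P = #{i ∈ Icc 1 n | P ^ i ∣ g} := by
    intro P hPm hPi
    have hiff : ∀ i, P ^ i ∣ g ↔ i ≤ (UniqueFactorizationMonoid.normalizedFactors g).count P := by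
      intro i
      rw [pow_dvd_iff_le_emultiplicity,
        UniqueFactorizationMonoid.emultiplicity_eq_count_normalizedFactors hPi hg0,
        hPm.normalize_eq_self]
      exact Nat.cast_le
    have hle : (UniqueFactorizationMonoid.normalizedFactors g).count P ≤ n := by
      have h1 : P ^ ((UniqueFactorizationMonoid.normalizedFactors g).count P) ∣ g :=
        (hiff _).mpr le_rfl
      have h2 := natDegree_le_of_dvd h1 hg0
      rw [natDegree_pow, hn] at h2
      have h3 := hPi.natDegree_pos
      nlinarith
    have : {i ∈ Icc 1 n | P ^ i ∣ g} =
        Icc 1 ((UniqueFactorizationMonoid.normalizedFactors g).count P) := by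
      ext i; rw [mem_filter, hiff, mem_Icc, mem_Icc]; omega
    rw [this]; simp
  have hdeg : g.natDegree = ∑ P ∈ (UniqueFactorizationMonoid.normalizedFactors g).toFinset,
      (UniqueFactorizationMonoid.normalizedFactors g).count P * P.natDegree := by
    conv_lhs => rw [← hprod]
    rw [natDegree_multiset_prod_of_monic _ hmon, Finset.sum_multiset_map_count]
    simp
  have hinner : ∀ d ∈ Icc 1 n, ∀ P ∈ (monicPolys K d).filter Irreducible,
      ∑ i ∈ Icc 1 n, (d : ℂ) * (if P ^ i ∣ g then 1 else 0) =
      (((UniqueFactorizationMonoid.normalizedFactors g).count P * P.natDegree : ℕ) : ℂ) := by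
    intro d _ P hP
    rw [mem_filter, mem_monicPolys] at hP
    rw [← Finset.mul_sum, Finset.sum_boole, hcount P hP.1.1 hP.2, hP.1.2]
    push_cast; ring
  rw [Finset.sum_congr rfl fun d hd => Finset.sum_congr rfl fun P hP => hinner d hd P hP]
  rw [show (n : ℂ) = _ from congrArg Nat.cast (hn.symm.trans hdeg)]
  push_cast
  rw [← Finset.sum_biUnion]
  · refine Finset.sum_subset ?_ ?_
    · intro P hP
      rw [Multiset.mem_toFinset] at hP
      have hirr := UniqueFactorizationMonoid.irreducible_of_normalized_factor P hP
      rw [mem_biUnion]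
      refine ⟨P.natDegree, ?_, ?_⟩
      · rw [mem_Icc]
        refine ⟨hirr.natDegree_pos, ?_⟩
        rw [← hn]
        exact natDegree_le_of_dvd (UniqueFactorizationMonoid.dvd_of_mem_normalizedFactors hP) hg0
      · rw [mem_filter, mem_monicPolys]
        exact ⟨⟨hmon P hP, rfl⟩, hirr⟩
    · intro P _ hP
      rw [Multiset.mem_toFinset] at hP
      rw [Multiset.count_eq_zero_of_notMem hP]; simp
  · intro d _ d' _ hdd
    rw [Function.onFun, Finset.disjoint_left]
    intro P hP hP'
    rw [mem_filter, mem_monicPolys] at hP hP'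
    exact hdd (hP.1.2.symm.trans hP'.1.2)

lemma sum_monicPolys_dvd (ξ : K[X] → ℂ) (hmul : ∀ g h, ξ (g * h) = ξ g * ξ h) {h : K[X]}
    (hh : h.Monic) (n : ℕ) :
    ∑ g ∈ monicPolys K n, ξ g * (if h ∣ g then 1 else 0) =
      if h.natDegree ≤ n then ξ h * ∑ g ∈ monicPolys K (n - h.natDegree), ξ g else 0 := by
  simp_rw [mul_ite, mul_one, mul_zero]
  rw [← Finset.sum_filter]
  split_ifs with hle
  · rw [Finset.mul_sum]
    symm
    refine Finset.sum_bij (fun g _ => h * g) ?_ ?_ ?_ ?_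
    · intro g hg
      rw [mem_monicPolys] at hg
      rw [mem_filter, mem_monicPolys]
      refine ⟨⟨hh.mul hg.1, ?_⟩, dvd_mul_right _ _⟩
      rw [hh.natDegree_mul hg.1, hg.2]; omega
    · intro g _ g' _ he
      exact mul_left_cancel₀ hh.ne_zero he
    · intro g hg
      rw [mem_filter, mem_monicPolys] at hg
      obtain ⟨⟨hm, hn⟩, k, rfl⟩ := hg
      have hk := hh.of_mul_monic_left hm
      refine ⟨k, ?_, rfl⟩
      rw [mem_monicPolys]
      rw [hh.natDegree_mul hk] at hn
      exact ⟨hk, by omega⟩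
    · intro g _; rw [hmul]
  · rw [Finset.filter_eq_empty_iff.mpr, Finset.sum_empty]
    intro g hg hd
    rw [mem_monicPolys] at hg
    have := natDegree_le_of_dvd hd hg.1.ne_zero
    omega

/-- The weighted sum over monic irreducible polynomials of degree dividing `j`. -/
noncomputable def irrSum (ξ : K[X] → ℂ) (j : ℕ) : ℂ :=
  ∑ d ∈ j.divisors, ∑ P ∈ (monicPolys K d).filter Irreducible, (d : ℂ) * ξ P ^ (j / d)

theorem monic_sum_recursion (ξ : K[X] → ℂ) (hmul : ∀ g h, ξ (g * h) = ξ g * ξ h) (h1 : ξ 1 = 1)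
    (n : ℕ) :
    (n : ℂ) * ∑ g ∈ monicPolys K n, ξ g =
      ∑ j ∈ Icc 1 n, irrSum ξ j * ∑ g ∈ monicPolys K (n - j), ξ g := by
  set c : ℕ → ℂ := fun m => ∑ g ∈ monicPolys K m, ξ g with hc
  have hpow : ∀ (P : K[X]) i, ξ (P ^ i) = ξ P ^ i := by
    intro P i
    induction i with
    | zero => simp [h1]
    | succ i ih => rw [pow_succ, hmul, ih, pow_succ]
  have hL : (n : ℂ) * c n = ∑ d ∈ Icc 1 n, ∑ P ∈ (monicPolys K d).filter Irreducible,
      ∑ i ∈ Icc 1 n, (d : ℂ) * (if i * d ≤ n then ξ P ^ i * c (n - i * d) else 0) := by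
    calc (n : ℂ) * c n = ∑ g ∈ monicPolys K n, ξ g * ∑ d ∈ Icc 1 n,
          ∑ P ∈ (monicPolys K d).filter Irreducible, ∑ i ∈ Icc 1 n,
          (d : ℂ) * (if P ^ i ∣ g then 1 else 0) := by
          rw [hc, Finset.mul_sum]
          refine Finset.sum_congr rfl fun g hg => ?_
          rw [← natDegree_eq_sum_irreducible hg]; ring
      _ = ∑ d ∈ Icc 1 n, ∑ P ∈ (monicPolys K d).filter Irreducible, ∑ i ∈ Icc 1 n,
          (d : ℂ) * ∑ g ∈ monicPolys K n, ξ g * (if P ^ i ∣ g then 1 else 0) := by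
          simp_rw [Finset.mul_sum]
          rw [Finset.sum_comm]
          refine Finset.sum_congr rfl fun d _ => ?_
          rw [Finset.sum_comm]
          refine Finset.sum_congr rfl fun P _ => ?_
          rw [Finset.sum_comm]
          refine Finset.sum_congr rfl fun i _ => ?_
          refine Finset.sum_congr rfl fun g _ => ?_
          ring
      _ = _ := by
          refine Finset.sum_congr rfl fun d _ => Finset.sum_congr rfl fun P hP =>
            Finset.sum_congr rfl fun i _ => ?_
          rw [mem_filter, mem_monicPolys] at hP
          rw [sum_monicPolys_dvd ξ hmul (hP.1.1.pow i), natDegree_pow, hP.1.2, hpow]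
  have hS : ∀ j ∈ Icc 1 n, irrSum ξ j = ∑ d ∈ Icc 1 n, ∑ i ∈ Icc 1 n,
      if i * d = j then ∑ P ∈ (monicPolys K d).filter Irreducible, (d : ℂ) * ξ P ^ i else 0 := by
    intro j hj
    rw [mem_Icc] at hj
    unfold irrSum
    have hsub : j.divisors ⊆ Icc 1 n := by
      intro d hd
      rw [mem_Icc]
      have := Nat.divisor_le hd
      have := Nat.pos_of_mem_divisors hd
      omega
    rw [← Finset.sum_subset hsub (f := fun d => ∑ i ∈ Icc 1 n,
      if i * d = j then ∑ P ∈ (monicPolys K d).filter Irreducible, (d : ℂ) * ξ P ^ i else 0)]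
    · refine Finset.sum_congr rfl fun d hd => ?_
      have hdj := Nat.dvd_of_mem_divisors hd
      have hd0 := Nat.pos_of_mem_divisors hd
      rw [Finset.sum_eq_single (j / d)]
      · rw [if_pos (Nat.div_mul_cancel hdj)]
      · intro i _ hi
        rw [if_neg]
        rintro rfl
        exact hi (Nat.mul_div_cancel _ hd0).symm
      · intro hn
        exfalso; apply hn
        rw [mem_Icc]
        exact ⟨Nat.div_pos (Nat.le_of_dvd (by omega) hdj) hd0, (Nat.div_le_self _ _).trans hj.2⟩
    · intro d _ hd
      refine Finset.sum_eq_zero fun i _ => ?_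
      rw [if_neg]
      rintro rfl
      exact hd (Nat.mem_divisors.mpr ⟨dvd_mul_left _ _, by omega⟩)
  have hR : ∑ j ∈ Icc 1 n, irrSum ξ j * c (n - j) = ∑ j ∈ Icc 1 n, (∑ d ∈ Icc 1 n, ∑ i ∈ Icc 1 n,
      if i * d = j then ∑ P ∈ (monicPolys K d).filter Irreducible, (d : ℂ) * ξ P ^ i else 0) *
        c (n - j) := Finset.sum_congr rfl fun j hj => by rw [hS j hj]
  rw [hL, hR]
  simp_rw [Finset.sum_mul]
  rw [Finset.sum_comm]
  refine Finset.sum_congr rfl fun d hd => ?_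
  rw [Finset.sum_comm, Finset.sum_comm (s := Icc 1 n) (t := Icc 1 n)]
  refine Finset.sum_congr rfl fun i hi => ?_
  rw [mem_Icc] at hd hi
  simp_rw [ite_mul, zero_mul]
  rw [Finset.sum_ite_eq (Icc 1 n) (i * d) (fun j => (∑ P ∈ (monicPolys K d).filter Irreducible, (d : ℂ) * ξ P ^ i) * c (n - j))]
  have hpos : 1 ≤ i * d := Nat.mul_pos hi.1 hd.1
  by_cases h : i * d ≤ n
  · rw [if_pos (mem_Icc.mpr ⟨hpos, h⟩), Finset.sum_mul]
    refine Finset.sum_congr rfl fun P _ => ?_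
    rw [if_pos h]; ring
  · rw [if_neg (by rw [mem_Icc]; omega)]
    refine Finset.sum_eq_zero fun P _ => ?_
    rw [if_neg h, mul_zero]

end MonicPolynomials
end LandauPage

namespace LandauPage
open Polynomial Finset

section FieldSide

lemma norm_algebraMap_sub {K L : Type*} [Field K] [Field L] [Fintype L] [Algebra K L] (x : L) (b : K) :
    Algebra.norm K (algebraMap K L b - x) =
      (minpoly K x).eval b ^ (Module.finrank K L / (minpoly K x).natDegree) := by
  have hx : IsIntegral K x := Algebra.IsIntegral.isIntegral x
  set pb := IntermediateField.adjoin.powerBasis hx with hpb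
  have hgen : pb.gen = IntermediateField.AdjoinSimple.gen K x := rfl
  have h1 : algebraMap K L b - x =
      algebraMap (IntermediateField.adjoin K {x}) L (algebraMap K _ b - pb.gen) := by
    rw [map_sub, ← IsScalarTower.algebraMap_apply, hgen,
      IntermediateField.AdjoinSimple.algebraMap_gen]
  have h2 : Algebra.norm K (algebraMap K (IntermediateField.adjoin K {x}) b - pb.gen) =
      (minpoly K x).eval b := by
    have h3 := charpoly_leftMulMatrix pb
    rw [hgen, IntermediateField.minpoly_gen] at h3
    rw [← h3, Matrix.eval_charpoly, Algebra.norm_eq_matrix_det pb.basis, map_sub]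
    congr 1
    rw [AlgHom.commutes, hgen]
    rfl
  have h4 : Module.finrank K L / (minpoly K x).natDegree =
      Module.finrank (IntermediateField.adjoin K {x}) L := by
    rw [← IntermediateField.adjoin.finrank hx,
      ← Module.finrank_mul_finrank K (IntermediateField.adjoin K {x}) L]
    exact Nat.mul_div_cancel_left _ Module.finrank_pos
  rw [h1, ← Algebra.norm_norm (S := IntermediateField.adjoin K {x}), Algebra.norm_algebraMap,
    map_pow, h2, h4]

variable {K L : Type*} [Field K] [Fintype K] [Field L] [Fintype L] [Algebra K L]

lemma card_minpoly_fiber {P : K[X]} (hm : P.Monic) (hi : Irreducible P)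
    (hd : P.natDegree ∣ Module.finrank K L) :
    #{x : L | minpoly K x = P} = P.natDegree := by
  have hiff : ∀ x : L, minpoly K x = P ↔ aeval x P = 0 := by
    intro x
    constructor
    · rintro rfl; exact minpoly.aeval K x
    · intro h; exact (minpoly.eq_of_irreducible_of_monic hi h hm).symm
  have hcardL : Nat.card K ^ Module.finrank K L = Nat.card L :=
    (Module.natCard_eq_pow_finrank (K := K) (V := L)).symm
  have hdvd : P ∣ X ^ (Nat.card K) ^ (Module.finrank K L) - X :=
    hi.natDegree_dvd_iff_dvd_X_pow_card_pow_sub_X.mp hd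
  have hsplit : (P.map (algebraMap K L)).Splits := by
    have h1 : ((X ^ (Nat.card L) - X : L[X])).Splits := by
      have := (FiniteField.isSplittingField_sub L K).splits
      rw [← Nat.card_eq_fintype_card] at this
      simpa using this
    refine Splits.of_dvd h1 ?_ ?_
    · exact FiniteField.X_pow_card_sub_X_ne_zero L Finite.one_lt_card
    · have := Polynomial.map_dvd (algebraMap K L) hdvd
      rw [hcardL] at this
      simpa using this
  have := card_rootSet_eq_natDegree (K := L) (PerfectField.separable_of_irreducible hi) hsplit
  rw [← this, Fintype.card_subtype]
  congr 1
  ext x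
  simp only [mem_filter, mem_univ, true_and]
  rw [hiff, mem_rootSet_of_ne hm.ne_zero]

lemma sum_norm_eq_irrSum {n : ℕ} (hn : Module.finrank K L = n) (B : Finset K)
    (ψ : K → MulChar K ℂ) :
    ∑ x : L, ∏ b ∈ B, ψ b (Algebra.norm K (algebraMap K L b - x)) =
      irrSum (fun g : K[X] => ∏ b ∈ B, ψ b (g.eval b)) n := by
  have hn0 : 0 < n := hn ▸ Module.finrank_pos
  unfold irrSum
  set I := n.divisors.biUnion fun d => (monicPolys K d).filter Irreducible with hI
  have hmaps : ∀ x ∈ (univ : Finset L), minpoly K x ∈ I := by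
    intro x _
    have hx : IsIntegral K x := Algebra.IsIntegral.isIntegral x
    rw [hI, mem_biUnion]
    refine ⟨(minpoly K x).natDegree, ?_, ?_⟩
    · rw [Nat.mem_divisors, ← hn]
      exact ⟨minpoly.degree_dvd hx, by omega⟩
    · rw [mem_filter, mem_monicPolys]
      exact ⟨⟨minpoly.monic hx, rfl⟩, minpoly.irreducible hx⟩
  have hx : ∀ x : L, ∏ b ∈ B, ψ b (Algebra.norm K (algebraMap K L b - x)) =
      (∏ b ∈ B, ψ b ((minpoly K x).eval b)) ^ (n / (minpoly K x).natDegree) := by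
    intro x
    rw [← Finset.prod_pow]
    refine Finset.prod_congr rfl fun b _ => ?_
    rw [norm_algebraMap_sub, map_pow, hn]
  have hR : ∀ d ∈ n.divisors, ∑ P ∈ (monicPolys K d).filter Irreducible,
      (d : ℂ) * (∏ b ∈ B, ψ b (P.eval b)) ^ (n / d) =
      ∑ P ∈ (monicPolys K d).filter Irreducible,
      (P.natDegree : ℂ) * (∏ b ∈ B, ψ b (P.eval b)) ^ (n / P.natDegree) := by
    intro d _
    refine Finset.sum_congr rfl fun P hP => ?_
    rw [mem_filter, mem_monicPolys] at hP
    rw [hP.1.2]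
  rw [Finset.sum_congr rfl hR, ← Finset.sum_biUnion]
  · rw [Finset.sum_congr rfl fun x _ => hx x, ← Finset.sum_fiberwise_of_maps_to hmaps]
    refine Finset.sum_congr rfl fun P hP => ?_
    rw [mem_biUnion] at hP
    obtain ⟨d, hd, hP⟩ := hP
    rw [mem_filter, mem_monicPolys] at hP
    have hc := card_minpoly_fiber (L := L) hP.1.1 hP.2
      (by rw [hP.1.2, hn]; exact Nat.dvd_of_mem_divisors hd)
    rw [← hc, ← nsmul_eq_mul, ← Finset.sum_const]
    refine Finset.sum_congr rfl fun x hx => ?_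
    rw [mem_filter] at hx
    rw [hc, hx.2]
  · intro d _ d' _ hdd
    rw [Function.onFun, Finset.disjoint_left]
    intro P hP hP'
    rw [mem_filter, mem_monicPolys] at hP hP'
    exact hdd (hP.1.2.symm.trans hP'.1.2)

lemma monic_sum_eq_zero (B : Finset K) (ψ : K → MulChar K ℂ) {b₀ : K} (hb₀ : b₀ ∈ B)
    (hψ : ψ b₀ ≠ 1) {n : ℕ} (hn : #B ≤ n) :
    ∑ g ∈ monicPolys K n, ∏ b ∈ B, ψ b (g.eval b) = 0 := by
  obtain ⟨u, hu⟩ := MulChar.ne_one_iff.mp hψ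
  set ℓ := Lagrange.basis B id b₀ with hℓ
  have hinj : Set.InjOn (id : K → K) B := Set.injOn_id _
  have h1 : ℓ.eval b₀ = 1 := Lagrange.eval_basis_self hinj hb₀
  have h0 : ∀ b ∈ B, b ≠ b₀ → ℓ.eval b = 0 := fun b hb hne =>
    Lagrange.eval_basis_of_ne (v := id) hne.symm hb
  have hdeg : ℓ.degree < n := by
    rw [hℓ, Lagrange.degree_basis hinj hb₀]
    have := Finset.card_pos.mpr ⟨b₀, hb₀⟩
    exact_mod_cast (by omega : #B - 1 < n)
  have hmem : ∀ (c : K) g, g ∈ monicPolys K n → g + C c * ℓ ∈ monicPolys K n := by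
    intro c g hg
    rw [mem_monicPolys] at hg ⊢
    have h2 : (C c * ℓ).degree < g.degree := by
      rw [degree_eq_natDegree hg.1.ne_zero, hg.2]
      refine lt_of_le_of_lt (degree_mul_le _ _) (lt_of_le_of_lt ?_ hdeg)
      calc (C c).degree + ℓ.degree ≤ 0 + ℓ.degree := by gcongr; exact degree_C_le
        _ = ℓ.degree := zero_add _
    exact ⟨hg.1.add_of_left h2, by rw [natDegree_add_eq_left_of_degree_lt h2, hg.2]⟩
  have heval : ∀ (v : K) (g : K[X]), (g + C ((v - 1) * g.eval b₀) * ℓ).eval b₀ = v * g.eval b₀ := by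
    intro v g
    rw [eval_add, eval_mul, eval_C, h1]; ring
  have key : ∑ g ∈ monicPolys K n, ∏ b ∈ B, ψ b (g.eval b) =
      ∑ g ∈ monicPolys K n, ψ b₀ u * ∏ b ∈ B, ψ b (g.eval b) := by
    symm
    refine Finset.sum_bij' (fun g _ => g + C (((u : K) - 1) * g.eval b₀) * ℓ)
      (fun g _ => g + C ((((u⁻¹ : Kˣ) : K) - 1) * g.eval b₀) * ℓ) ?_ ?_ ?_ ?_ ?_
    · intro g hg; exact hmem _ g hg
    · intro g hg; exact hmem _ g hg
    · intro g hg
      simp only [heval]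
      rw [add_assoc, ← add_mul, ← C_add]
      have : ((u : K) - 1) * eval b₀ g + (((u⁻¹ : Kˣ) : K) - 1) * (u * eval b₀ g) = 0 := by
        have := u.inv_mul; linear_combination eval b₀ g * this
      rw [this]; simp
    · intro g hg
      simp only [heval]
      rw [add_assoc, ← add_mul, ← C_add]
      have : (((u⁻¹ : Kˣ) : K) - 1) * eval b₀ g + ((u : K) - 1) * (((u⁻¹ : Kˣ) : K) * eval b₀ g) = 0 := by
        have := u.mul_inv; linear_combination eval b₀ g * this
      rw [this]; simp
    · intro g hg
      rw [← Finset.mul_prod_erase _ _ hb₀, ← Finset.mul_prod_erase _ _ hb₀, heval, map_mul,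
        mul_assoc]
      congr 2
      refine Finset.prod_congr rfl fun b hb => ?_
      rw [Finset.mem_erase] at hb
      rw [eval_add, eval_mul, h0 b hb.2 hb.1]; simp
  rw [← Finset.mul_sum] at key
  have : (1 - ψ b₀ u) * ∑ g ∈ monicPolys K n, ∏ b ∈ B, ψ b (g.eval b) = 0 := by
    linear_combination key
  rcases mul_eq_zero.mp this with h | h
  · exact absurd (sub_eq_zero.mp h).symm hu
  · exact h

end FieldSide

lemma newton_power_sums (m : Multiset ℂ) (n : ℕ) :
    (n : ℂ) * ((m.map fun ω => (1 - C ω * X : ℂ[X])).prod).coeff n =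
      ∑ j ∈ Icc 1 n, -(m.map fun ω => ω ^ j).sum *
        ((m.map fun ω => (1 - C ω * X : ℂ[X])).prod).coeff (n - j) := by
  have key : ∀ m : Multiset ℂ,
      (PowerSeries.X : PowerSeries ℂ) * ((derivative (m.map fun ω => (1 - C ω * X : ℂ[X])).prod : ℂ[X]) : PowerSeries ℂ) =
      PowerSeries.mk (fun j => if j = 0 then 0 else -(m.map fun ω => ω ^ j).sum) *
        (((m.map fun ω => (1 - C ω * X : ℂ[X])).prod : ℂ[X]) : PowerSeries ℂ) := by
    intro m
    induction m using Multiset.induction_on with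
    | empty =>
      have : PowerSeries.mk (fun j => if j = 0 then (0 : ℂ) else
          -((0 : Multiset ℂ).map fun ω => ω ^ j).sum) = 0 := by
        ext j; simp
      rw [this]; simp
    | cons ω m ih =>
      set L := (m.map fun ω => (1 - C ω * X : ℂ[X])).prod
      have h1 : (PowerSeries.mk (fun j => if j = 0 then (0 : ℂ) else -((ω ::ₘ m).map fun ω => ω ^ j).sum)) =
        PowerSeries.mk (fun j => if j = 0 then (0 : ℂ) else -ω ^ j) +
        PowerSeries.mk (fun j => if j = 0 then (0 : ℂ) else -(m.map fun ω => ω ^ j).sum) := by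
        ext j
        simp only [PowerSeries.coeff_mk, map_add, Multiset.map_cons, Multiset.sum_cons]
        split_ifs <;> ring
      have h2 : PowerSeries.mk (fun j => if j = 0 then (0 : ℂ) else -ω ^ j) *
          (((1 - C ω * X : ℂ[X])) : PowerSeries ℂ) = - (PowerSeries.C ω * PowerSeries.X) := by
        ext j
        push_cast
        rw [mul_sub, mul_one, ← mul_assoc, mul_comm _ (PowerSeries.C ω), mul_assoc]
        rcases j with _ | j
        · simp
        · rw [map_sub, PowerSeries.coeff_C_mul, PowerSeries.coeff_succ_mul_X, PowerSeries.coeff_mk,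
            PowerSeries.coeff_mk, map_neg, PowerSeries.coeff_C_mul, PowerSeries.coeff_X]
          rcases j with _ | j
          · simp
          · simp; ring
      rw [Multiset.map_cons, Multiset.prod_cons, h1, derivative_mul]
      push_cast
      push_cast at h2 ih
      simp only [derivative_sub, derivative_one, derivative_mul, derivative_C, derivative_X,
        zero_mul, zero_add, mul_one, zero_sub]
      push_cast
      rw [add_mul, ← mul_assoc, h2]
      linear_combination (1 - PowerSeries.C ω * PowerSeries.X) * ih
  have h := congrArg (PowerSeries.coeff n) (key m)
  set L := (m.map fun ω => (1 - C ω * X : ℂ[X])).prod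
  rcases n with _ | n
  · simp
  · rw [mul_comm, PowerSeries.coeff_succ_mul_X, Polynomial.coeff_coe, coeff_derivative] at h
    rw [mul_comm]
    push_cast
    rw [h, PowerSeries.coeff_mul, Finset.Nat.sum_antidiagonal_eq_sum_range_succ_mk,
      Finset.sum_range_succ']
    simp only [PowerSeries.coeff_mk, Polynomial.coeff_coe]
    rw [if_pos trivial, zero_mul, add_zero, Finset.range_eq_Ico]
    have : Icc 1 (n + 1) = Ico (0 + 1) (n + 1 + 1) := by ext; rw [mem_Icc, mem_Ico]; omega
    rw [this, ← Finset.sum_Ico_add' _ 0 (n + 1) 1]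
    refine Finset.sum_congr rfl fun j _ => ?_
    rw [if_neg (by omega)]

lemma exists_inverse_roots (L : ℂ[X]) (h : L.coeff 0 = 1) :
    ∃ m : Multiset ℂ, L = (m.map fun ω => (1 - C ω * X : ℂ[X])).prod ∧
      Multiset.card m = L.natDegree := by
  have hL0 : L ≠ 0 := by rintro rfl; simp at h
  have hs : L.Splits := IsAlgClosed.splits L
  have hr : ∀ r ∈ L.roots, r ≠ 0 := by
    rintro r hr rfl
    rw [mem_roots hL0, IsRoot.def, ← coeff_zero_eq_eval_zero, h] at hr
    exact one_ne_zero hr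
  refine ⟨L.roots.map fun r => r⁻¹, ?_, ?_⟩
  · rw [Multiset.map_map]
    have h1 : L = C L.leadingCoeff * (L.roots.map fun r => X - C r).prod :=
      hs.eq_prod_roots
    have h2 : (L.roots.map fun r => (X - C r : ℂ[X])) =
        L.roots.map fun r => C (-r) * (1 - C r⁻¹ * X) := by
      refine Multiset.map_congr rfl fun r hr' => ?_
      rw [mul_sub, ← mul_assoc, ← C_mul, neg_mul, mul_inv_cancel₀ (hr r hr')]
      simp only [C_neg, C_1, mul_one]
      ring
    rw [h2, Multiset.prod_map_mul, ← mul_assoc] at h1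
    obtain ⟨c, hc⟩ : ∃ c, C L.leadingCoeff * (L.roots.map fun r => C (-r)).prod = C c := by
      refine ⟨L.leadingCoeff * (L.roots.map fun r => (-r)).prod, ?_⟩
      rw [C_mul, ← Multiset.prod_hom, Multiset.map_map]; rfl
    rw [hc] at h1
    have h3 : c = 1 := by
      have := congrArg (fun g => g.eval 0) h1
      simp only [← coeff_zero_eq_eval_zero, h] at this
      rw [coeff_zero_eq_eval_zero, eval_mul, eval_C, eval_multiset_prod, Multiset.map_map] at this
      simp at this
      exact this.symm
    rw [h3, C_1, one_mul] at h1
    exact h1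
  · rw [Multiset.card_map]; exact hs.natDegree_eq_card_roots.symm

open Filter in
lemma norm_le_of_power_sums {k : ℕ} (ω : Fin k → ℂ) {ρ : ℝ} (hρ : 0 < ρ) {A : ℝ} {n₀ : ℕ}
    (h : ∀ n ≥ n₀, ‖∑ i, ω i ^ (2 * n)‖ ≤ A * ρ ^ (2 * n)) (i : Fin k) : ‖ω i‖ ≤ ρ := by
  have hu : ∀ i, ∃ u : Circle, ω i ^ 2 = ((‖ω i‖ ^ 2 : ℝ) : ℂ) * u := by
    intro i
    refine ⟨Circle.exp (Complex.arg (ω i ^ 2)), ?_⟩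
    rw [Circle.coe_exp, ← norm_pow]
    exact (Complex.norm_mul_exp_arg_mul_I _).symm
  choose u hu using hu
  have hcl : MapClusterPt (1 : Fin k → Circle) atTop (fun n : ℕ => u ^ n) :=
    mapClusterPt_one_atTop_pow u
  have hnhds : {v : Fin k → Circle | ∀ i, 1 / 2 < ((v i : Circle) : ℂ).re} ∈ nhds (1 : Fin k → Circle) := by
    refine IsOpen.mem_nhds ?_ ?_
    · rw [Set.ofPred_forall]
      refine isOpen_iInter_of_finite fun i => ?_
      exact isOpen_lt continuous_const (by fun_prop)
    · intro i; simp; norm_num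
  have hfreq := hcl.frequently hnhds
  by_contra hlt
  push Not at hlt
  have hgt : 1 < (‖ω i‖ / ρ) ^ 2 := by
    have : 1 < ‖ω i‖ / ρ := (one_lt_div hρ).mpr hlt
    nlinarith
  have htend := tendsto_pow_atTop_atTop_of_one_lt hgt
  obtain ⟨n, hn, hn1, hn2⟩ := (hfreq.and_eventually
    ((htend.eventually_gt_atTop (2 * A)).and (eventually_ge_atTop n₀))).exists
  have h1 := h n hn2
  have h2 : ∀ j, (‖ω j‖ ^ 2) ^ n * (1 / 2) ≤ (ω j ^ (2 * n)).re := by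
    intro j
    rw [pow_mul, hu j, mul_pow, ← Complex.ofReal_pow, Complex.re_ofReal_mul]
    refine mul_le_mul_of_nonneg_left ?_ (by positivity)
    have := hn j
    simpa using this.le
  have h3 : (‖ω i‖ ^ 2) ^ n * (1 / 2) ≤ A * ρ ^ (2 * n) := by
    calc (‖ω i‖ ^ 2) ^ n * (1 / 2) ≤ (ω i ^ (2 * n)).re := h2 i
      _ ≤ ∑ j, (ω j ^ (2 * n)).re :=
        Finset.single_le_sum (f := fun j => (ω j ^ (2 * n)).re)
          (fun j _ => le_trans (by positivity) (h2 j)) (mem_univ i)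
      _ = (∑ j, ω j ^ (2 * n)).re := by rw [Complex.re_sum]
      _ ≤ _ := (Complex.re_le_norm _).trans h1
  rw [div_pow, div_pow, lt_div_iff₀ (by positivity), ← pow_mul ρ] at hn1
  linarith

end LandauPage

namespace LandauPage
open Polynomial Finset

lemma power_sum_eq_of_recursion (m : Multiset ℂ) (S : ℕ → ℂ)
    (hS : ∀ n : ℕ, (n : ℂ) * ((m.map fun ω => (1 - C ω * X : ℂ[X])).prod).coeff n =
      ∑ j ∈ Icc 1 n, S j * ((m.map fun ω => (1 - C ω * X : ℂ[X])).prod).coeff (n - j))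
    (h0 : ((m.map fun ω => (1 - C ω * X : ℂ[X])).prod).coeff 0 = 1) (n : ℕ) (hn : 1 ≤ n) :
    (m.map fun ω => ω ^ n).sum = -S n := by
  induction n using Nat.strong_induction_on with
  | _ n ih =>
    have h1 := hS n
    rw [newton_power_sums] at h1
    have hI : Icc 1 n = insert n (Icc 1 (n - 1)) := by ext; simp; omega
    have hni : n ∉ Icc 1 (n - 1) := by simp; omega
    rw [hI, Finset.sum_insert hni, Finset.sum_insert hni, Nat.sub_self, h0, mul_one, mul_one] at h1
    have h2 : ∑ j ∈ Icc 1 (n - 1), -(m.map fun ω => ω ^ j).sum *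
        ((m.map fun ω => (1 - C ω * X : ℂ[X])).prod).coeff (n - j) =
        ∑ j ∈ Icc 1 (n - 1), S j *
        ((m.map fun ω => (1 - C ω * X : ℂ[X])).prod).coeff (n - j) := by
      refine Finset.sum_congr rfl fun j hj => ?_
      rw [mem_Icc] at hj
      rw [ih j (by omega) hj.1, neg_neg]
    rw [h2] at h1
    linear_combination -h1

/-- The Weil bound for character sums `∑ ∏ χ(b - x)^{e b}` over a prime field. -/
theorem weil_bound {p : ℕ} [Fact p.Prime] (χ : MulChar (ZMod p) ℂ) (hd : 2 ≤ orderOf χ)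
    (B : Finset (ZMod p)) (e : ZMod p → ℕ)
    (he : ∀ b ∈ B, ∀ j ∈ Icc 1 (orderOf χ - 1), ¬ orderOf χ ∣ j * e b)
    (hcop : (∑ b ∈ B, e b).Coprime (orderOf χ)) :
    ‖∑ x : ZMod p, ∏ b ∈ B, χ (b - x) ^ e b‖ ≤ #B * Real.sqrt p := by
  set d := orderOf χ with hd'
  have hB : B.Nonempty := by
    rw [Finset.nonempty_iff_ne_empty]
    rintro rfl
    simp at hcop; omega
  obtain ⟨b₀, hb₀⟩ := hB
  have hepos : ∀ b ∈ B, e b ≠ 0 := by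
    intro b hb h0
    exact he b hb 1 (by simp; omega) (by simp [h0])
  set ψ : ℕ → ZMod p → MulChar (ZMod p) ℂ := fun j b => χ ^ (j * e b) with hψ
  set ξ : ℕ → (ZMod p)[X] → ℂ := fun j g => ∏ b ∈ B, ψ j b (g.eval b) with hξ
  have hmul : ∀ j g h, ξ j (g * h) = ξ j g * ξ j h := by
    intro j g h
    simp only [hξ, eval_mul, map_mul, Finset.prod_mul_distrib]
  have hone : ∀ j, ξ j 1 = 1 := by intro j; simp [hξ]
  set c : ℕ → ℕ → ℂ := fun j n => ∑ g ∈ monicPolys (ZMod p) n, ξ j g with hc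
  have hc0 : ∀ j, c j 0 = 1 := by
    intro j; simp only [hc, monicPolys_zero, Finset.sum_singleton, hone]
  have hcz : ∀ j ∈ Icc 1 (d - 1), ∀ n, #B ≤ n → c j n = 0 := by
    intro j hj n hn
    refine monic_sum_eq_zero B (ψ j) hb₀ ?_ hn
    intro h
    exact he b₀ hb₀ j hj (orderOf_dvd_of_pow_eq_one h)
  set Lp : ℕ → ℂ[X] := fun j => ∑ n ∈ range #B, C (c j n) * X ^ n with hLp
  have hBpos : 0 < #B := Finset.card_pos.mpr ⟨b₀, hb₀⟩
  have hcoeff : ∀ j ∈ Icc 1 (d - 1), ∀ n, (Lp j).coeff n = c j n := by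
    intro j hj n
    simp only [hLp, finsetSum_coeff, coeff_C_mul, coeff_X_pow, mul_ite, mul_one, mul_zero]
    rw [Finset.sum_ite_eq]
    split_ifs with h
    · rfl
    · rw [hcz j hj n (by simpa using h)]
  have hL0 : ∀ j ∈ Icc 1 (d - 1), (Lp j).coeff 0 = 1 := fun j hj => by rw [hcoeff j hj, hc0]
  have hdeg : ∀ j, (Lp j).natDegree ≤ #B - 1 := by
    intro j
    refine natDegree_sum_le_of_forall_le _ _ fun n hn => ?_
    rw [mem_range] at hn
    exact (natDegree_C_mul_X_pow_le _ _).trans (by omega)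
  have hex : ∀ j, ∃ m : Multiset ℂ, j ∈ Icc 1 (d - 1) →
      (Lp j = (m.map fun ω => (1 - C ω * X : ℂ[X])).prod ∧ Multiset.card m ≤ #B - 1) := by
    intro j
    by_cases hj : j ∈ Icc 1 (d - 1)
    · obtain ⟨m, h1, h2⟩ := exists_inverse_roots (Lp j) (hL0 j hj)
      exact ⟨m, fun _ => ⟨h1, h2 ▸ hdeg j⟩⟩
    · exact ⟨0, fun h => absurd h hj⟩
  choose m hm using hex
  have hpow : ∀ j ∈ Icc 1 (d - 1), ∀ n, 1 ≤ n →
      ((m j).map fun ω => ω ^ n).sum = -irrSum (ξ j) n := by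
    intro j hj n hn
    refine power_sum_eq_of_recursion (m j) (irrSum (ξ j)) ?_ ?_ n hn
    · intro n
      rw [← (hm j hj).1, hcoeff j hj, monic_sum_recursion (ξ j) (hmul j) (hone j) n]
      refine Finset.sum_congr rfl fun i _ => ?_
      rw [hcoeff j hj]
    · rw [← (hm j hj).1, hL0 j hj]
  set M : Multiset ℂ := ∑ j ∈ Icc 1 (d - 1), m j with hM
  have hMsum : ∀ n, 1 ≤ n → (M.map fun ω => ω ^ n).sum = -∑ j ∈ Icc 1 (d - 1), irrSum (ξ j) n := by
    intro n hn
    have : (M.map fun ω => ω ^ n).sum = ∑ j ∈ Icc 1 (d - 1), ((m j).map fun ω => ω ^ n).sum := by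
      rw [hM]
      have := map_sum ((Multiset.sumAddMonoidHom (M := ℂ)).comp
        (Multiset.mapAddMonoidHom fun ω : ℂ => ω ^ n)) m (Icc 1 (d - 1))
      simpa only [AddMonoidHom.coe_comp, Function.comp_apply, Multiset.coe_mapAddMonoidHom, Multiset.coe_sumAddMonoidHom] using this
    rw [this, ← Finset.sum_neg_distrib]
    exact Finset.sum_congr rfl fun j hj => hpow j hj n hn
  set D := ∑ b ∈ B, e b with hD
  set A : ℝ := (d * (d * (d * D + D + 3) + D) : ℝ) with hA
  have hbound : ∀ n ≥ 2 * ((d * D + 3) * (d * D + 3)),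
      ‖(M.map fun ω => ω ^ (2 * n)).sum‖ ≤ A * Real.sqrt p ^ (2 * n) := by
    intro n hn
    have hn1 : 1 ≤ n := le_trans (by nlinarith [Nat.zero_le (d * D)]) hn
    rw [hMsum _ (by omega), norm_neg]
    have : NeZero (2 * n) := ⟨by omega⟩
    have : Fintype (GaloisField p (2 * n)) := Fintype.ofFinite _
    set F := GaloisField p (2 * n) with hF
    set f : F[X] := ∏ b ∈ B, (C (algebraMap (ZMod p) F b) - X) ^ e b with hf
    have hfac : ∀ b : F, (C b - X : F[X]) ≠ 0 := by
      intro b h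
      have := congrArg (fun g => g.coeff 1) h
      simp at this
    have hfdeg : f.natDegree = D := by
      rw [hf, natDegree_prod _ _ fun b _ => pow_ne_zero _ (hfac _)]
      refine Finset.sum_congr rfl fun b _ => ?_
      rw [natDegree_pow]
      have : (C (algebraMap (ZMod p) F b) - X : F[X]).natDegree = 1 := by
        rw [← natDegree_neg, neg_sub, natDegree_X_sub_C]
      rw [this, mul_one]
    have hf0 : f ≠ 0 := Finset.prod_ne_zero_iff.mpr fun b _ => pow_ne_zero _ (hfac _)
    have hcard : Fintype.card F = (p ^ n) ^ 2 := by
      rw [← Nat.card_eq_fintype_card, GaloisField.card p (2 * n) (by omega), ← pow_mul, mul_comm]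
    have hlt : 2 * ((d * D + 3) * (d * D + 3)) < p ^ n :=
      lt_of_le_of_lt hn (Nat.lt_pow_self (Fact.out : p.Prime).one_lt)
    have key := sum_norm_char_le χ hd n D hcard f hf0 hfdeg hcop hlt
    have heq : ∀ j ∈ Icc 1 (d - 1), ∑ x : F, (χ ^ j) (Algebra.norm (ZMod p) (f.eval x)) =
        irrSum (ξ j) (2 * n) := by
      intro j hj
      rw [← sum_norm_eq_irrSum (L := F) (GaloisField.finrank p (by omega)) B (ψ j)]
      refine Finset.sum_congr rfl fun x _ => ?_
      rw [hf, eval_prod, map_prod, map_prod]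
      refine Finset.prod_congr rfl fun b hb => ?_
      simp only [hψ]
      rw [eval_pow, map_pow, map_pow, eval_sub, eval_C, eval_X, pow_mul,
        MulChar.pow_apply' _ (hepos b hb)]
    rw [Finset.sum_congr rfl heq] at key
    refine key.trans (le_of_eq ?_)
    rw [pow_mul, Real.sq_sqrt (by positivity)]
  have hall : ∀ ω ∈ M, ‖ω‖ ≤ Real.sqrt p := by
    have hp0 : 0 < Real.sqrt p := Real.sqrt_pos.mpr (by exact_mod_cast (Fact.out : p.Prime).pos)
    intro ω hω
    have hl : ∀ n, ∑ i : Fin M.toList.length, (M.toList.get i) ^ (2 * n) =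
        (M.map fun ω => ω ^ (2 * n)).sum := by
      intro n
      conv_rhs => rw [← Multiset.coe_toList M]
      rw [Multiset.map_coe, Multiset.sum_coe, ← List.sum_ofFn]
      congr 1
      apply List.ext_get <;> simp
    rw [← Multiset.mem_toList] at hω
    obtain ⟨i, hi⟩ := List.get_of_mem hω
    rw [← hi]
    refine norm_le_of_power_sums (fun i => M.toList.get i) hp0 (A := A)
      (n₀ := 2 * ((d * D + 3) * (d * D + 3))) ?_ i
    intro n hn
    rw [hl]
    exact hbound n hn
  have h1mem : 1 ∈ Icc 1 (d - 1) := by simp; omega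
  have hfin : ∑ x : ZMod p, ∏ b ∈ B, χ (b - x) ^ e b = -((m 1).map fun ω => ω ^ 1).sum := by
    rw [hpow 1 h1mem 1 le_rfl, neg_neg,
      ← sum_norm_eq_irrSum (L := ZMod p) (Module.finrank_self _) B (ψ 1)]
    refine Finset.sum_congr rfl fun x _ => Finset.prod_congr rfl fun b hb => ?_
    simp only [hψ, one_mul]
    rw [MulChar.pow_apply' _ (hepos b hb)]
    simp
  rw [hfin, norm_neg]
  have hcardm := (hm 1 h1mem).2
  have hle : m 1 ≤ M := Finset.single_le_sum (f := m) (fun _ _ => Multiset.zero_le _) h1mem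
  calc ‖((m 1).map fun ω => ω ^ 1).sum‖ ≤ (((m 1).map fun ω => ω ^ 1).map fun x => ‖x‖).sum :=
        norm_multiset_sum_le _
    _ ≤ Multiset.card (((m 1).map fun ω => ω ^ 1).map fun x => ‖x‖) • Real.sqrt p := by
        refine Multiset.sum_le_card_nsmul _ _ ?_
        intro x hx
        rw [Multiset.map_map, Multiset.mem_map] at hx
        obtain ⟨ω, hω, rfl⟩ := hx
        simpa using hall ω (Multiset.mem_of_le hle hω)
    _ ≤ #B * Real.sqrt p := by
        rw [nsmul_eq_mul, Multiset.card_map, Multiset.card_map]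
        gcongr
        omega

end LandauPage

namespace LandauPage
open Polynomial Finset

lemma norm_prod_char_le {q : ℕ} (χ : DirichletCharacter ℂ q) {κ : Type*} (s : Finset κ)
    (z : κ → ZMod q) (f : κ → ℕ) : ‖∏ i ∈ s, χ (z i) ^ f i‖ ≤ 1 := by
  rw [norm_prod]
  refine Finset.prod_le_one (fun _ _ => norm_nonneg _) fun i _ => ?_
  rw [norm_pow]
  exact pow_le_one₀ (norm_nonneg _) (DirichletCharacter.norm_le_one χ _)

/-- Weil bound for a product of shifts of a character and its conjugate, of total degree zero. -/
theorem weil_cube {p : ℕ} [Fact p.Prime] (χ : DirichletCharacter ℂ p) (hχ : χ ≠ 1) {ι : Type*}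
    [Fintype ι] [Nonempty ι] (a : ι → ZMod p) (ha : Function.Injective a) (e : ι → ℕ)
    (he : ∀ i, e i = 1 ∨ e i = orderOf χ - 1) (hsum : orderOf χ ∣ ∑ i, e i) :
    ‖∑ x : ZMod p, ∏ i, χ (x + a i) ^ e i‖ ≤ Fintype.card ι * Real.sqrt p + 1 := by
  set d := orderOf χ with hd
  have hd2 : 2 ≤ d := by
    have h1 : 0 < d := orderOf_pos χ
    have h2 : d ≠ 1 := fun h => hχ (orderOf_eq_one_iff.mp h)
    omega
  obtain ⟨i₀⟩ := ‹Nonempty ι›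
  have hepos : ∀ i, e i ≠ 0 := fun i => by rcases he i with h | h <;> omega
  set g : ι → ZMod p := fun i => (a i₀ - a i)⁻¹ with hg
  have hginj : Function.Injective g := by
    intro i j hij
    exact ha (sub_right_injective (inv_injective hij))
  have : Nonempty ι := ⟨i₀⟩
  set B := (univ.erase i₀).image g with hB
  set e' : ZMod p → ℕ := fun b => e (Function.invFun g b) with he'
  have heg : ∀ i, e' (g i) = e i := fun i => by
    simp only [he', Function.leftInverse_invFun hginj i]
  have hBsum : ∑ b ∈ B, e' b = ∑ i ∈ univ.erase i₀, e i := by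
    rw [hB, Finset.sum_image (fun _ _ _ _ h => hginj h)]
    exact Finset.sum_congr rfl fun i _ => heg i
  have htot : e i₀ + ∑ i ∈ univ.erase i₀, e i = ∑ i, e i := Finset.add_sum_erase _ _ (mem_univ _)
  have hec : ∀ i, (e i).Coprime d := by
    intro i
    rcases he i with h | h
    · rw [h]; exact Nat.coprime_one_left _
    · rw [h]; exact (Nat.coprime_self_sub_left (by omega)).mpr (Nat.coprime_one_left d)
  have hcop : (∑ b ∈ B, e' b).Coprime d := by
    rw [hBsum]
    rw [← htot] at hsum
    have hg1 := Nat.gcd_dvd_left (∑ i ∈ univ.erase i₀, e i) d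
    have hg2 := Nat.gcd_dvd_right (∑ i ∈ univ.erase i₀, e i) d
    have hg3 : Nat.gcd (∑ i ∈ univ.erase i₀, e i) d ∣ e i₀ :=
      (Nat.dvd_add_left hg1).mp (hg2.trans hsum)
    exact Nat.eq_one_of_dvd_coprimes (hec i₀) hg3 hg2
  have hB' : ∀ b ∈ B, ∀ j ∈ Icc 1 (d - 1), ¬ d ∣ j * e' b := by
    intro b hb j hj hdvd
    rw [hB, mem_image] at hb
    obtain ⟨i, -, rfl⟩ := hb
    rw [heg] at hdvd
    have := (hec i).symm.dvd_of_dvd_mul_right hdvd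
    rw [mem_Icc] at hj
    have := Nat.le_of_dvd (by omega) this
    omega
  set G : ZMod p → ℂ := fun u => ∏ b ∈ B, χ (b - u) ^ e' b with hG
  have hW : ‖∑ u, G u‖ ≤ #B * Real.sqrt p := weil_bound χ hd2 B e' hB' hcop
  set K : ℂ := ∏ i ∈ univ.erase i₀, χ (a i₀ - a i) ^ e i with hK
  set F : ZMod p → ℂ := fun x => ∏ i, χ (x + a i) ^ e i with hF
  have h2 : ‖G 0‖ ≤ 1 := norm_prod_char_le χ B (fun b => b - 0) e'
  have hK1 : ‖K‖ ≤ 1 := norm_prod_char_le χ _ _ _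
  have hFG : ∀ u : ZMod p, F (-a i₀ + u⁻¹) = if u = 0 then 0 else K * G u := by
    intro u
    split_ifs with hu
    · rw [hu]
      simp only [hF]
      apply Finset.prod_eq_zero (mem_univ i₀)
      rw [inv_zero, add_zero, neg_add_cancel, MulChar.map_zero, zero_pow (hepos _)]
    · have hone : χ u⁻¹ ^ (∑ i, e i) = 1 := by
        obtain ⟨t, ht⟩ := hsum
        rw [ht, pow_mul, ← MulChar.pow_apply' χ (by omega), pow_orderOf_eq_one,
          MulChar.one_apply (isUnit_iff_ne_zero.mpr (inv_ne_zero hu)), one_pow]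
      have hfac : ∀ i, χ (-a i₀ + u⁻¹ + a i) ^ e i =
          χ u⁻¹ ^ e i * χ (1 - (a i₀ - a i) * u) ^ e i := by
        intro i
        rw [← mul_pow, ← map_mul]
        congr 2
        rw [mul_sub, mul_one, mul_comm (a i₀ - a i) u, ← mul_assoc, inv_mul_cancel₀ hu]
        ring
      simp only [hF, hfac]
      rw [Finset.prod_mul_distrib, Finset.prod_pow_eq_pow_sum, hone, one_mul,
        ← Finset.mul_prod_erase _ _ (mem_univ i₀)]
      rw [sub_self, zero_mul, sub_zero, map_one, one_pow, one_mul, hK, hG]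
      simp only
      rw [hB, Finset.prod_image (fun _ _ _ _ h => hginj h), ← Finset.prod_mul_distrib]
      refine Finset.prod_congr rfl fun i hi => ?_
      rw [heg, ← mul_pow, ← map_mul]
      congr 2
      have : a i₀ - a i ≠ 0 := by
        rw [Finset.mem_erase] at hi
        exact sub_ne_zero.mpr fun h => hi.1 (ha h.symm)
      simp only [hg]
      rw [mul_sub, mul_inv_cancel₀ this]
  clear_value F G K
  have hsumF : ∑ x, F x = K * (∑ u, G u - G 0) := by
    have h1 : ∑ x, F x = ∑ u : ZMod p, F (-a i₀ + u⁻¹) := by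
      rw [← Equiv.sum_comp ((Equiv.inv (ZMod p)).trans (Equiv.addLeft (-a i₀))) F]
      simp only [Equiv.trans_apply, Equiv.inv_apply, Equiv.coe_addLeft]
    rw [h1, ← Finset.add_sum_erase _ G (mem_univ (0 : ZMod p)), add_sub_cancel_left,
      ← Finset.add_sum_erase _ _ (mem_univ (0 : ZMod p)), hFG, if_pos rfl, zero_add, Finset.mul_sum]
    refine Finset.sum_congr rfl fun u hu => ?_
    rw [hFG, if_neg (Finset.ne_of_mem_erase hu)]
  have hcardB : (#B : ℝ) ≤ Fintype.card ι := by
    exact_mod_cast (Finset.card_image_le.trans (Finset.card_le_univ _))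
  rw [hsumF, norm_mul]
  calc ‖K‖ * ‖∑ u, G u - G 0‖ ≤ 1 * (‖∑ u, G u‖ + ‖G 0‖) :=
        mul_le_mul hK1 (norm_sub_le _ _) (norm_nonneg _) zero_le_one
    _ ≤ _ := by
        rw [one_mul]
        have h3 : (#B : ℝ) * Real.sqrt p ≤ Fintype.card ι * Real.sqrt p := by gcongr
        linarith

end LandauPage

namespace LandauPage
open Finset
open scoped BigOperators ComplexConjugate

section BoxLemma
variable {X : Type*}

/-- Functions of `k` variables annihilated by the `k`-fold Cauchy–Schwarz differencing. -/
def Deg : (k : ℕ) → ((Fin k → X) → ℂ) → Prop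
  | 0, Q => ∀ t, Q t = 1
  | k + 1, Q => ∃ Q₁ : (Fin k → X) → ℂ, ∃ Q₂ : X → (Fin k → X) → ℂ,
      (∀ x t, Q (Fin.cons x t) = Q₁ t * Q₂ x t) ∧ (∀ t, ‖Q₁ t‖ ≤ 1) ∧
        ∀ x y, Deg k fun t => Q₂ x t * conj (Q₂ y t)

/-- The Gowers-type kernel `∏ C^{|ω|} G(h^ω)` over the vertices of a box. -/
def Kern : (k : ℕ) → ((Fin k → X) → ℂ) → (Fin k → X) → (Fin k → X) → ℂ
  | 0, G, h, _ => G h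
  | k + 1, G, h, h' => Kern k (fun t => G (Fin.cons (h 0) t) * conj (G (Fin.cons (h' 0) t)))
      (Fin.tail h) (Fin.tail h')

lemma deg_const_one (k : ℕ) : Deg k fun _ : Fin k → X => (1 : ℂ) := by
  induction k with
  | zero => intro t; rfl
  | succ k ih =>
    refine ⟨fun _ => 1, fun _ _ => 1, by simp, by simp, fun x x' => ?_⟩
    simpa using ih

lemma Deg.mul {k : ℕ} {Q R : (Fin k → X) → ℂ} (hQ : Deg k Q) (hR : Deg k R) :
    Deg k fun t => Q t * R t := by
  induction k with
  | zero => intro t; beta_reduce; rw [hQ t, hR t, mul_one]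
  | succ k ih =>
    obtain ⟨Q₁, Q₂, h1, h2, h3⟩ := hQ
    obtain ⟨R₁, R₂, g1, g2, g3⟩ := hR
    refine ⟨fun t => Q₁ t * R₁ t, fun x t => Q₂ x t * R₂ x t, ?_, ?_, fun x x' => ?_⟩
    · intro x t; beta_reduce; rw [h1, g1]; ring
    · intro t; rw [norm_mul]; exact mul_le_one₀ (h2 t) (norm_nonneg _) (g2 t)
    · convert ih (h3 x x') (g3 x x') using 2
      rw [map_mul]; ring

lemma deg_prod {k : ℕ} {ι : Type*} (s : Finset ι) (Q : ι → (Fin k → X) → ℂ)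
    (h : ∀ i ∈ s, Deg k (Q i)) : Deg k fun t => ∏ i ∈ s, Q i t := by
  induction s using Finset.induction_on with
  | empty => simpa using deg_const_one k
  | insert a s ha ih =>
    simp only [Finset.prod_insert ha]
    exact (h a (mem_insert_self _ _)).mul (ih fun i hi => h i (mem_insert_of_mem hi))

lemma Deg.conj {k : ℕ} {Q : (Fin k → X) → ℂ} (hQ : Deg k Q) : Deg k fun t => conj (Q t) := by
  induction k with
  | zero => intro t; beta_reduce; rw [hQ t, map_one]
  | succ k ih =>
    obtain ⟨Q₁, Q₂, h1, h2, h3⟩ := hQ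
    refine ⟨fun t => (starRingEnd ℂ) (Q₁ t), fun x t => (starRingEnd ℂ) (Q₂ x t), ?_, ?_,
      fun x x' => ?_⟩
    · intro x t; beta_reduce; rw [h1, map_mul]
    · intro t; rw [RCLike.norm_conj]; exact h2 t
    · convert ih (h3 x x') using 2
      rw [map_mul]

lemma kern_prod {ι : Type*} (s : Finset ι) : ∀ (k : ℕ) (G : ι → (Fin k → X) → ℂ)
    (h h' : Fin k → X), Kern k (fun t => ∏ i ∈ s, G i t) h h' = ∏ i ∈ s, Kern k (G i) h h'
  | 0, _, _, _ => rfl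
  | k + 1, G, h, h' => by
    simp only [Kern]
    rw [← kern_prod s k]
    congr 1
    funext t
    rw [map_prod, Finset.prod_mul_distrib]

variable [Fintype X]

lemma expect_cons {M : Type*} [AddCommMonoid M] [Module ℚ≥0 M] (k : ℕ) (F : (Fin (k + 1) → X) → M) :
    𝔼 h, F h = 𝔼 x, 𝔼 t, F (Fin.cons x t) := by
  rw [← Finset.expect_product', ← univ_product_univ.symm]
  exact (Fintype.expect_equiv (Fin.consEquiv fun _ => X) _ _ fun _ => rfl).symm

lemma pow_expect_le {ι : Type*} [Fintype ι] [Nonempty ι] (f : ι → ℝ) (hf : ∀ i, 0 ≤ f i) (n : ℕ) :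
    (𝔼 i, f i) ^ n ≤ 𝔼 i, f i ^ n := by
  have h := Real.pow_arith_mean_le_arith_mean_pow (univ : Finset ι)
    (fun _ => (1 / Fintype.card ι : ℝ)) f (fun _ _ => by positivity)
    (by simp) (fun i _ => hf i) n
  rw [← Finset.mul_sum, ← Finset.mul_sum] at h
  rw [Fintype.expect_eq_sum_div_card, Fintype.expect_eq_sum_div_card]
  convert h using 2 <;> ring

lemma re_expect {ι : Type*} (s : Finset ι) (f : ι → ℂ) : (𝔼 i ∈ s, f i).re = 𝔼 i ∈ s, (f i).re := by
  rw [Finset.expect_eq_sum_div_card, Finset.expect_eq_sum_div_card, ← Complex.re_sum]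
  exact_mod_cast Complex.div_natCast_re _ _

lemma conj_expect {ι : Type*} (s : Finset ι) (f : ι → ℂ) :
    conj (𝔼 i ∈ s, f i) = 𝔼 i ∈ s, conj (f i) := by
  rw [Finset.expect_eq_sum_div_card, Finset.expect_eq_sum_div_card, map_div₀, map_sum, map_natCast]

variable [Nonempty X]

lemma cauchy_schwarz_step {k : ℕ} (G : (Fin (k + 1) → X) → ℂ) (Q₁ : (Fin k → X) → ℂ)
    (Q₂ : X → (Fin k → X) → ℂ) (h1 : ∀ t, ‖Q₁ t‖ ≤ 1) :
    ‖𝔼 x, 𝔼 t, G (Fin.cons x t) * (Q₁ t * Q₂ x t)‖ ^ 2 ≤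
      (𝔼 x, 𝔼 x', 𝔼 t, G (Fin.cons x t) * conj (G (Fin.cons x' t)) *
        (Q₂ x t * conj (Q₂ x' t))).re := by
  set S : (Fin k → X) → ℂ := fun t => 𝔼 x, G (Fin.cons x t) * Q₂ x t with hS
  have e1 : 𝔼 x, 𝔼 t, G (Fin.cons x t) * (Q₁ t * Q₂ x t) = 𝔼 t, Q₁ t * S t := by
    rw [Finset.expect_comm]
    refine Finset.expect_congr rfl fun t _ => ?_
    rw [hS, Finset.mul_expect]
    exact Finset.expect_congr rfl fun x _ => by ring
  have e2 : ‖𝔼 t, Q₁ t * S t‖ ≤ 𝔼 t, ‖S t‖ := by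
    refine (RCLike.norm_expect_le (K := ℂ)).trans (Finset.expect_le_expect fun t _ => ?_)
    rw [norm_mul]
    exact mul_le_of_le_one_left (norm_nonneg _) (h1 t)
  have e3 : (𝔼 t, ‖S t‖) ^ 2 ≤ 𝔼 t, ‖S t‖ ^ 2 := pow_expect_le _ (fun _ => norm_nonneg _) 2
  have e4 : 𝔼 x, 𝔼 x', 𝔼 t, G (Fin.cons x t) * conj (G (Fin.cons x' t)) *
        (Q₂ x t * conj (Q₂ x' t)) = 𝔼 t, S t * conj (S t) := by
    have : ∀ x, 𝔼 x', 𝔼 t, G (Fin.cons x t) * conj (G (Fin.cons x' t)) *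
        (Q₂ x t * conj (Q₂ x' t)) = 𝔼 t, 𝔼 x', G (Fin.cons x t) * conj (G (Fin.cons x' t)) *
        (Q₂ x t * conj (Q₂ x' t)) := fun x => Finset.expect_comm _ _ _
    simp only [this]
    rw [Finset.expect_comm]
    refine Finset.expect_congr rfl fun t _ => ?_
    simp only [hS]
    rw [conj_expect, Finset.expect_mul_expect]
    refine Finset.expect_congr rfl fun x _ => Finset.expect_congr rfl fun x' _ => ?_
    rw [map_mul]; ring
  rw [e1, e4, re_expect]
  refine (pow_le_pow_left₀ (norm_nonneg _) e2 2).trans (e3.trans (le_of_eq ?_))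
  refine Finset.expect_congr rfl fun t _ => ?_
  rw [Complex.mul_conj, Complex.normSq_eq_norm_sq, Complex.ofReal_re]

theorem box_lemma (k : ℕ) (G Q : (Fin (k + 1) → X) → ℂ) (hQ : Deg (k + 1) Q) :
    ‖𝔼 h, G h * Q h‖ ^ 2 ^ (k + 1) ≤ (𝔼 h, 𝔼 h', Kern (k + 1) G h h').re := by
  induction k with
  | zero =>
    obtain ⟨Q₁, Q₂, h1, h2, h3⟩ := hQ
    rw [expect_cons]
    simp only [h1]
    refine (cauchy_schwarz_step G Q₁ Q₂ h2).trans (le_of_eq ?_)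
    congr 1
    rw [expect_cons]
    refine Finset.expect_congr rfl fun x _ => ?_
    rw [Finset.expect_comm]
    have : ∀ t : Fin 0 → X, 𝔼 h', Kern (0 + 1) G (Fin.cons x t) h' =
        𝔼 x', G (Fin.cons x t) * conj (G (Fin.cons x' t)) := by
      intro t
      rw [expect_cons]
      refine Finset.expect_congr rfl fun x' _ => ?_
      have : ∀ t' : Fin 0 → X, Kern (0 + 1) G (Fin.cons x t) (Fin.cons x' t') =
        G (Fin.cons x t) * conj (G (Fin.cons x' t)) := fun t' => rfl
      simp only [this]
      exact Fintype.expect_const _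
    refine Finset.expect_congr rfl fun t _ => ?_
    rw [this]
    refine Finset.expect_congr rfl fun x' _ => ?_
    have h4 : Q₂ x t * conj (Q₂ x' t) = 1 := h3 x x' t
    rw [h4, mul_one]
  | succ k ih =>
    obtain ⟨Q₁, Q₂, h1, h2, h3⟩ := hQ
    rw [expect_cons]
    simp only [h1]
    have hstep := cauchy_schwarz_step G Q₁ Q₂ h2
    set T : X → X → ℂ := fun x x' => 𝔼 t, G (Fin.cons x t) * conj (G (Fin.cons x' t)) *
        (Q₂ x t * conj (Q₂ x' t)) with hT
    have hT2 : (𝔼 x, 𝔼 x', T x x').re ≤ 𝔼 x, 𝔼 x', ‖T x x'‖ := by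
      rw [re_expect]
      refine Finset.expect_le_expect fun x _ => ?_
      rw [re_expect]
      exact Finset.expect_le_expect fun x' _ => Complex.re_le_norm _
    calc ‖𝔼 x, 𝔼 t, G (Fin.cons x t) * (Q₁ t * Q₂ x t)‖ ^ 2 ^ (k + 1 + 1)
        = (‖𝔼 x, 𝔼 t, G (Fin.cons x t) * (Q₁ t * Q₂ x t)‖ ^ 2) ^ 2 ^ (k + 1) := by
          rw [← pow_mul]; congr 1; ring
      _ ≤ (𝔼 x, 𝔼 x', ‖T x x'‖) ^ 2 ^ (k + 1) :=
          pow_le_pow_left₀ (by positivity) (hstep.trans hT2) _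
      _ ≤ 𝔼 x, (𝔼 x', ‖T x x'‖) ^ 2 ^ (k + 1) :=
          pow_expect_le _ (fun _ => Finset.expect_nonneg fun _ _ => norm_nonneg _) _
      _ ≤ 𝔼 x, 𝔼 x', ‖T x x'‖ ^ 2 ^ (k + 1) :=
          Finset.expect_le_expect fun x _ => pow_expect_le _ (fun _ => norm_nonneg _) _
      _ ≤ 𝔼 x, 𝔼 x', (𝔼 h, 𝔼 h', Kern (k + 1)
            (fun t => G (Fin.cons x t) * conj (G (Fin.cons x' t))) h h').re :=
          Finset.expect_le_expect fun x _ => Finset.expect_le_expect fun x' _ =>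
            ih _ _ (h3 x x')
      _ = _ := by
          rw [expect_cons, re_expect]
          refine Finset.expect_congr rfl fun x _ => ?_
          simp only [expect_cons (k + 1) (fun h' => Kern _ _ _ h')]
          rw [Finset.expect_comm, re_expect]
          refine Finset.expect_congr rfl fun x' _ => rfl

end BoxLemma
end LandauPage

namespace LandauPage
open Finset
open scoped BigOperators ComplexConjugate

section Differences
variable {A B : Type*} [AddCommGroup A] [AddCommGroup B]

/-- The multiplicative difference `f(x) * conj f(x + δ)`. -/
noncomputable def mdiff (δ : A) (f : A → ℂ) : A → ℂ := fun x => f x * conj (f (x + δ))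

/-- Iterated multiplicative differences. -/
noncomputable def DD : List A → (A → ℂ) → A → ℂ
  | [], f => f
  | δ :: l, f => mdiff δ (DD l f)

lemma mdiff_comm (δ ε : A) (f : A → ℂ) : mdiff δ (mdiff ε f) = mdiff ε (mdiff δ f) := by
  funext x
  simp only [mdiff, map_mul, Complex.conj_conj]
  rw [add_right_comm]
  ring

lemma DD_mdiff (δ : A) (l : List A) (f : A → ℂ) : DD l (mdiff δ f) = mdiff δ (DD l f) := by
  induction l with
  | nil => rfl
  | cons ε l ih => simp only [DD]; rw [ih, mdiff_comm]

lemma DD_append (l l' : List A) (f : A → ℂ) : DD (l ++ l') f = DD l (DD l' f) := by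
  induction l with
  | nil => rfl
  | cons ε l ih => simp only [DD, List.cons_append]; rw [ih]

lemma DD_perm {l l' : List A} (h : l.Perm l') (f : A → ℂ) : DD l f = DD l' f := by
  induction h with
  | nil => rfl
  | cons x _ ih => simp only [DD]; rw [ih]
  | swap x y l => simp only [DD]; rw [mdiff_comm]
  | trans _ _ h1 h2 => exact h1.trans h2

lemma DD_map (φ : A →+ B) (l : List A) (f : B → ℂ) (x : A) :
    DD l (fun y => f (φ y)) x = DD (l.map φ) f (φ x) := by
  induction l generalizing x with
  | nil => rfl
  | cons δ l ih => simp only [DD, List.map_cons, mdiff]; rw [ih, ih, map_add]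

lemma norm_DD_le_one {f : A → ℂ} (hf : ∀ x, ‖f x‖ ≤ 1) (l : List A) (x : A) : ‖DD l f x‖ ≤ 1 := by
  induction l generalizing x with
  | nil => exact hf x
  | cons δ l ih =>
    simp only [DD, mdiff]
    rw [norm_mul, RCLike.norm_conj]
    exact mul_le_one₀ (ih x) (norm_nonneg _) (ih _)

lemma DD_eq_zero {f : A → ℂ} (l : List A) {x : A} (hx : f x = 0) : DD l f x = 0 := by
  induction l with
  | nil => exact hx
  | cons δ l ih => simp only [DD, mdiff]; rw [ih, zero_mul]

lemma kern_linear {X : Type*} (c : X → ℤ) : ∀ (k : ℕ) (f : ℤ → ℂ) (n : ℤ) (g : Fin k → ℤ)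
    (h h' : Fin k → X), Kern k (fun t => f (n + ∑ i, g i * c (t i))) h h' =
      DD (List.ofFn fun i => g i * (c (h' i) - c (h i))) f (n + ∑ i, g i * c (h i))
  | 0, f, n, g, h, h' => by simp [Kern, DD]
  | k + 1, f, n, g, h, h' => by
    simp only [Kern, Fin.sum_univ_succ, Fin.cons_zero, Fin.cons_succ]
    have h1 : (fun t : Fin k → X => f (n + (g 0 * c (h 0) + ∑ i : Fin k, g i.succ * c (t i))) *
        conj (f (n + (g 0 * c (h' 0) + ∑ i : Fin k, g i.succ * c (t i))))) =
        fun t => mdiff (g 0 * (c (h' 0) - c (h 0))) f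
          ((n + g 0 * c (h 0)) + ∑ i : Fin k, g i.succ * c (t i)) := by
      funext t
      simp only [mdiff]
      congr 2
      · ring_nf
      · congr 1; ring
    rw [h1, kern_linear c k _ _ (fun i => g i.succ), DD_mdiff, List.ofFn_succ]
    simp only [DD, Fin.tail]
    rw [add_assoc]

end Differences

/-- A primitive multiplicative function modulo the prime power `p ^ a`, as a function on `ℤ`. -/
structure PComp (p a : ℕ) (f : ℤ → ℂ) : Prop where
  prime : p.Prime
  pos : 0 < a
  mul : ∀ x y, f (x * y) = f x * f y
  per : ∀ x y, (p ^ a : ℤ) ∣ x - y → f x = f y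
  zero : ∀ x, (p : ℤ) ∣ x → f x = 0
  norm : ∀ x, ¬ (p : ℤ) ∣ x → ‖f x‖ = 1
  prim : ∃ z : ℤ, ¬ (p : ℤ) ∣ 1 + p ^ (a - 1) * z ∧ f (1 + p ^ (a - 1) * z) ≠ 1

section PolyDifference
open Polynomial

lemma exists_shift_expansion (P : ℤ[X]) (δ : ℤ) :
    ∃ P₁ : ℤ[X], P.comp (X + C δ) = P + C δ * P₁ ∧ C δ ∣ P₁ - derivative P := by
  obtain ⟨k, hk⟩ := (P.map (C : ℤ →+* ℤ[X])).binomExpansion X (C δ)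
  refine ⟨derivative P + k * C δ, ?_, ?_⟩
  · have h1 : ∀ Q R : ℤ[X], eval R (Q.map C) = Q.comp R := fun Q R => by rw [eval_map]; rfl
    rw [derivative_map, h1, h1, h1, comp_X, comp_X] at hk
    rw [hk]; ring
  · rw [add_sub_cancel_left]; exact Dvd.intro_left _ rfl

lemma derivative_congr_mod {M : ℤ} {P Q : ℤ[X]} (h : C M ∣ P - Q) :
    C M ∣ derivative P - derivative Q := by
  obtain ⟨R, hR⟩ := h
  rw [← derivative_sub, hR, derivative_C_mul]
  exact Dvd.intro _ rfl

/-- The numerator and denominator of an iterated difference, as polynomials. -/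
lemma exists_difference_polys (l : List ℤ) (hl : l ≠ []) :
    ∃ N D V : ℤ[X], N - D = C l.prod * V ∧
      (∀ f : ℤ → ℂ, (∀ x y, f (x * y) = f x * f y) → ∀ x,
        DD l f x = f (N.eval x) * conj (f (D.eval x))) ∧
      ∀ M : ℤ, (∀ δ ∈ l, M ∣ δ) →
        C M ∣ D - X ^ 2 ^ (l.length - 1) ∧
        C M ∣ V + C (((l.length - 1).factorial : ℕ) : ℤ) * X ^ (2 ^ (l.length - 1) - l.length) := by
  induction l with
  | nil => exact absurd rfl hl
  | cons δ l ih =>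
    rcases eq_or_ne l [] with rfl | hne
    · refine ⟨X, X + C δ, -1, ?_, ?_, ?_⟩
      · simp
      · intro f hf x; simp [DD, mdiff]
      · intro M hM
        simp only [List.length_singleton, Nat.sub_self, pow_zero, pow_one, Nat.factorial_zero]
        refine ⟨?_, by simp⟩
        rw [add_sub_cancel_left]
        exact C_dvd_iff_dvd_coeff _ _ |>.mpr fun i => by
          rw [coeff_C]; split_ifs <;> simp [hM δ (by simp)]
    · obtain ⟨N, D, V, h1, h2, h3⟩ := ih hne
      obtain ⟨D₁, hD₁, hD₁'⟩ := exists_shift_expansion D δ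
      obtain ⟨V₁, hV₁, hV₁'⟩ := exists_shift_expansion V δ
      refine ⟨N * D.comp (X + C δ), D * N.comp (X + C δ), V * D₁ - D * V₁, ?_, ?_, ?_⟩
      · have hN : N = D + C l.prod * V := by rw [← h1]; ring
        have hNc : N.comp (X + C δ) = D.comp (X + C δ) + C l.prod * V.comp (X + C δ) := by
          rw [hN, add_comp, mul_comp, C_comp]
        rw [hNc, hD₁, hV₁, hN, List.prod_cons, C_mul]
        ring
      · intro f hf x
        simp only [DD, mdiff]
        rw [h2 f hf, h2 f hf, eval_mul, eval_mul, hf, hf, eval_comp, eval_comp, eval_add, eval_X,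
          eval_C, map_mul, map_mul, Complex.conj_conj]
        ring
      · intro M hM
        obtain ⟨h4, h5⟩ := h3 M fun ε hε => hM ε (List.mem_cons_of_mem _ hε)
        have hMδ : (C M : ℤ[X]) ∣ C δ := map_dvd C (hM δ (by simp))
        obtain ⟨s, hs⟩ : ∃ s, l.length = s + 1 :=
          ⟨l.length - 1, by have := List.length_pos_iff.mpr hne; omega⟩
        simp only [List.length_cons, hs, Nat.add_sub_cancel] at h4 h5 ⊢
        have h6 := derivative_congr_mod h4
        have h7 : (C M : ℤ[X]) ∣ derivative V -
            derivative (-(C ((s.factorial : ℕ) : ℤ) * X ^ (2 ^ s - (s + 1)) : ℤ[X])) :=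
          derivative_congr_mod (by rwa [sub_neg_eq_add])
        have h8 := hMδ.trans hD₁'
        have h9 := hMδ.trans hV₁'
        have hDmod : (C M : ℤ[X]) ∣ D₁ - derivative (X ^ 2 ^ s : ℤ[X]) := by
          have := dvd_add h8 h6; rwa [sub_add_sub_cancel] at this
        have hVmod : (C M : ℤ[X]) ∣ V₁ -
            derivative (-(C ((s.factorial : ℕ) : ℤ) * X ^ (2 ^ s - (s + 1)) : ℤ[X])) := by
          have := dvd_add h9 h7; rwa [sub_add_sub_cancel] at this
        have hle : s + 1 ≤ 2 ^ s := Nat.lt_two_pow_self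
        obtain ⟨m, hm⟩ : ∃ m, 2 ^ s = m + (s + 1) := ⟨2 ^ s - (s + 1), by omega⟩
        have hm2 : 2 ^ (s + 1) = 2 * m + 2 * (s + 1) := by rw [pow_succ, hm]; ring
        rw [hm, Nat.add_sub_cancel] at h5 hVmod
        rw [hm] at h4 hDmod
        constructor
        · have hshift : (C M : ℤ[X]) ∣ N.comp (X + C δ) - X ^ (m + (s + 1)) := by
            have e1 : N.comp (X + C δ) - X ^ (m + (s + 1)) =
                (D - X ^ (m + (s + 1))) + C δ * D₁ + C l.prod * V.comp (X + C δ) := by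
              have hN : N = D + C l.prod * V := by rw [← h1]; ring
              rw [hN, add_comp, mul_comp, C_comp, hD₁]; ring
            rw [e1]
            refine dvd_add (dvd_add h4 (hMδ.mul_right _)) (Dvd.dvd.mul_right ?_ _)
            refine map_dvd C ?_
            obtain ⟨ε, hε⟩ := List.exists_mem_of_ne_nil l hne
            exact (hM ε (List.mem_cons_of_mem _ hε)).trans (List.dvd_prod hε)
          have e2 : D * N.comp (X + C δ) - X ^ 2 ^ (s + 1) =
              (D - X ^ (m + (s + 1))) * N.comp (X + C δ) +
                X ^ (m + (s + 1)) * (N.comp (X + C δ) - X ^ (m + (s + 1))) := by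
            rw [pow_succ 2 s, hm]; ring
          rw [e2]
          exact dvd_add (h4.mul_right _) (hshift.mul_left _)
        · have hder1 : derivative (X ^ (m + (s + 1)) : ℤ[X]) =
              C ((m + s + 1 : ℕ) : ℤ) * X ^ (m + s) := by
            rw [derivative_X_pow]; rfl
          have hder2 : X * derivative (-(C ((s.factorial : ℕ) : ℤ) * X ^ m : ℤ[X])) =
              -(C ((s.factorial : ℕ) : ℤ) * (C (m : ℤ) * X ^ m)) := by
            rw [derivative_neg, derivative_C_mul, derivative_X_pow]
            rcases m with _ | m
            · simp
            · simp; ring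
          have he : 2 ^ (s + 1) - (s + 1 + 1) = m + (m + s) := by omega
          have key : (V * D₁ - D * V₁) + C (((s + 1).factorial : ℕ) : ℤ) *
                X ^ (2 ^ (s + 1) - (s + 1 + 1)) =
              (V + C ((s.factorial : ℕ) : ℤ) * X ^ m) * D₁ -
              C ((s.factorial : ℕ) : ℤ) * X ^ m * (D₁ - derivative (X ^ (m + (s + 1)) : ℤ[X])) -
              (D - X ^ (m + (s + 1))) * V₁ -
              X ^ (m + (s + 1)) * (V₁ -
                derivative (-(C ((s.factorial : ℕ) : ℤ) * X ^ m : ℤ[X]))) := by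
            have e3 : (X : ℤ[X]) ^ (m + (s + 1)) *
                derivative (-(C ((s.factorial : ℕ) : ℤ) * X ^ m : ℤ[X])) =
                X ^ (m + s) * -(C ((s.factorial : ℕ) : ℤ) * (C (m : ℤ) * X ^ m)) := by
              rw [← hder2]; ring
            rw [mul_sub (X ^ (m + (s + 1)) : ℤ[X]), e3, hder1, he, Nat.factorial_succ]
            push_cast
            simp only [map_mul, map_add, map_one, map_natCast]
            ring
          rw [key]
          exact dvd_sub (dvd_sub (dvd_sub (h5.mul_right _) (hDmod.mul_left _)) (h4.mul_right _))
            (hVmod.mul_left _)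

end PolyDifference
end LandauPage

namespace LandauPage
open Finset
open scoped BigOperators ComplexConjugate

namespace PComp
variable {p a : ℕ} {f : ℤ → ℂ}

lemma map_one (hf : PComp p a f) : f 1 = 1 := by
  have h1 := hf.mul 1 1
  have h2 : ‖f 1‖ = 1 := hf.norm 1 fun h => by
    have := Int.eq_one_of_dvd_one (by positivity) h
    exact hf.prime.one_lt.ne' (by exact_mod_cast this)
  have h3 : f 1 ≠ 0 := by rw [← norm_ne_zero_iff, h2]; exact one_ne_zero
  rw [mul_one] at h1
  exact (mul_left_cancel₀ h3 (by rw [mul_one]; exact h1)).symm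

lemma norm_le_one (hf : PComp p a f) (x : ℤ) : ‖f x‖ ≤ 1 := by
  by_cases h : (p : ℤ) ∣ x
  · rw [hf.zero x h, norm_zero]; exact zero_le_one
  · exact (hf.norm x h).le

lemma prime_int (hf : PComp p a f) : Prime (p : ℤ) := Nat.prime_iff_prime_int.mp hf.prime

lemma exists_inv (hf : PComp p a f) (e : ℕ) {x : ℤ} (hx : ¬ (p : ℤ) ∣ x) :
    ∃ y : ℤ, (p ^ e : ℤ) ∣ x * y - 1 := by
  have h1 : IsCoprime x ((p : ℤ) ^ e) :=
    ((hf.prime_int.coprime_iff_not_dvd.mpr hx).symm).pow_right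
  obtain ⟨u, v, huv⟩ := h1
  exact ⟨u, -v, by linear_combination huv⟩

lemma conj_eq (hf : PComp p a f) {x y : ℤ} (hxy : (p ^ a : ℤ) ∣ x * y - 1) :
    conj (f x) = f y := by
  have hx : ¬ (p : ℤ) ∣ x := fun h => by
    have h1 : (p : ℤ) ∣ x * y - 1 := (dvd_pow_self (p : ℤ) hf.pos.ne').trans hxy
    have h2 : (p : ℤ) ∣ 1 := by
      have := dvd_sub (h.mul_right y) h1; rwa [sub_sub_cancel] at this
    exact hf.prime_int.not_dvd_one h2
  have h1 : f x * f y = 1 := by rw [← hf.mul, hf.per _ 1 hxy, hf.map_one]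
  have h2 : f x * conj (f x) = 1 := by
    rw [Complex.mul_conj, Complex.normSq_eq_norm_sq, hf.norm x hx]; norm_num
  have h3 : f x ≠ 0 := left_ne_zero_of_mul (h1.trans_ne one_ne_zero)
  exact mul_left_cancel₀ h3 (h2.trans h1.symm)

lemma DD_zero (hf : PComp p a f) (l : List ℤ) {x : ℤ} (hx : (p : ℤ) ∣ x) : DD l f x = 0 :=
  DD_eq_zero l (hf.zero x hx)

lemma norm_DD (hf : PComp p a f) {l : List ℤ} (hl : ∀ δ ∈ l, (p : ℤ) ∣ δ) {x : ℤ}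
    (hx : ¬ (p : ℤ) ∣ x) : ‖DD l f x‖ = 1 := by
  induction l generalizing x with
  | nil => exact hf.norm x hx
  | cons δ l ih =>
    have hl' : ∀ δ ∈ l, (p : ℤ) ∣ δ := fun ε hε => hl ε (List.mem_cons_of_mem _ hε)
    simp only [DD, mdiff]
    rw [norm_mul, RCLike.norm_conj, ih hl' hx, ih hl', mul_one]
    rwa [← dvd_add_left (hl δ (by simp))] at hx

lemma DD_periodic (hf : PComp p a f) {l : List ℤ} (hl : ∀ δ ∈ l, (p : ℤ) ∣ δ) {g : ℤ}
    (hg : (p : ℤ) ∣ g) (h : (p ^ a : ℤ) ∣ l.prod * g) (x : ℤ) : DD l f (x + g) = DD l f x := by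
  by_cases hx : (p : ℤ) ∣ x
  · rw [hf.DD_zero l hx, hf.DD_zero l ((dvd_add_left hg).mpr hx)]
  · obtain ⟨N, D, V, h1, h2, h3⟩ := exists_difference_polys (g :: l) (by simp)
    have hall : ∀ δ ∈ g :: l, (p : ℤ) ∣ δ := by
      intro δ hδ
      rcases List.mem_cons.mp hδ with rfl | hδ
      · exact hg
      · exact hl δ hδ
    have hD : (p : ℤ) ∣ D.eval x - x ^ 2 ^ ((g :: l).length - 1) := by
      obtain ⟨R, hR⟩ := (h3 p hall).1
      have := congrArg (Polynomial.eval x) hR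
      simp only [Polynomial.eval_sub, Polynomial.eval_pow, Polynomial.eval_X, Polynomial.eval_mul,
        Polynomial.eval_C] at this
      exact ⟨_, this⟩
    have hDx : ¬ (p : ℤ) ∣ D.eval x := fun h => by
      have := dvd_sub h hD
      rw [sub_sub_cancel] at this
      exact hx (hf.prime_int.dvd_of_dvd_pow this)
    have hND : f (N.eval x) = f (D.eval x) := by
      apply hf.per
      have := congrArg (Polynomial.eval x) h1
      simp only [Polynomial.eval_sub, Polynomial.eval_mul, Polynomial.eval_C, List.prod_cons] at this
      rw [this, mul_comm g]
      exact h.mul_right _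
    have h4 : DD l f x * conj (DD l f (x + g)) = 1 := by
      have := h2 f hf.mul x
      rw [hND, Complex.mul_conj, Complex.normSq_eq_norm_sq, hf.norm _ hDx] at this
      simpa [DD, mdiff] using this
    have h5 : ‖DD l f (x + g)‖ = 1 := hf.norm_DD hl (by rwa [dvd_add_left hg])
    have h6 : conj (DD l f (x + g)) * DD l f (x + g) = 1 := by
      rw [mul_comm, Complex.mul_conj, Complex.normSq_eq_norm_sq, h5]; norm_num
    calc DD l f (x + g) = (DD l f x * conj (DD l f (x + g))) * DD l f (x + g) := by rw [h4, one_mul]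
      _ = DD l f x * (conj (DD l f (x + g)) * DD l f (x + g)) := by ring
      _ = _ := by rw [h6, mul_one]

lemma DD_eq (hf : PComp p a f) {l : List ℤ} (hne : l ≠ []) {c e : ℕ} (hc : 1 ≤ c)
    (hl : ∀ δ ∈ l, (p ^ c : ℤ) ∣ δ) {Z : ℤ} (hZ : l.prod = p ^ e * Z) (hec : a ≤ e + c)
    {x y : ℤ} (hxy : (p ^ c : ℤ) ∣ x * y - 1) :
    DD l f x = f (1 + p ^ e * (-(((l.length - 1).factorial : ℕ) : ℤ) * Z * y ^ l.length)) := by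
  obtain ⟨N, D, V, h1, h2, h3⟩ := exists_difference_polys l hne
  obtain ⟨⟨R, hR⟩, ⟨R', hR'⟩⟩ := h3 _ hl
  have hR := congrArg (Polynomial.eval x) hR
  have hR' := congrArg (Polynomial.eval x) hR'
  have h1 := congrArg (Polynomial.eval x) h1
  simp only [Polynomial.eval_sub, Polynomial.eval_add, Polynomial.eval_pow, Polynomial.eval_X,
    Polynomial.eval_mul, Polynomial.eval_C] at hR hR' h1
  have hpc : (p : ℤ) ∣ (p : ℤ) ^ c := dvd_pow_self _ (by omega)
  have hx : ¬ (p : ℤ) ∣ x := fun h => by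
    have h1 := hpc.trans hxy
    have := dvd_sub (h.mul_right y) h1
    rw [sub_sub_cancel] at this
    exact hf.prime_int.not_dvd_one this
  have hDx : ¬ (p : ℤ) ∣ D.eval x := fun h => by
    have hd := dvd_sub h (hpc.trans (Dvd.intro _ hR.symm))
    rw [sub_sub_cancel] at hd
    exact hx (hf.prime_int.dvd_of_dvd_pow hd)
  obtain ⟨E, hE0⟩ := hf.exists_inv (a + c) hDx
  have hE : (p ^ a : ℤ) ∣ D.eval x * E - 1 := (pow_dvd_pow _ (Nat.le_add_right a c)).trans hE0
  have hcE : (p ^ c : ℤ) ∣ D.eval x * E - 1 := (pow_dvd_pow _ (Nat.le_add_left c a)).trans hE0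
  rw [h2 f hf.mul x, hf.conj_eq hE, ← hf.mul]
  apply hf.per
  set s := l.length with hs
  have hs1 : 1 ≤ s := List.length_pos_iff.mpr hne
  obtain ⟨t, ht⟩ : ∃ t, s = t + 1 := ⟨s - 1, by omega⟩
  obtain ⟨m, hm⟩ : ∃ m, 2 ^ (s - 1) = m + s := ⟨2 ^ (s - 1) - s, by
    have : t < 2 ^ t := Nat.lt_two_pow_self
    rw [ht, Nat.add_sub_cancel]; omega⟩
  rw [hm, Nat.add_sub_cancel] at hR'
  rw [hm] at hR
  set w : ℤ := (((s - 1).factorial : ℕ) : ℤ) with hw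
  obtain ⟨E', hE'⟩ := hE
  have hys : (p ^ c : ℤ) ∣ x ^ s * y ^ s - 1 := by
    rw [← mul_pow]; have := sub_dvd_pow_sub_pow (x * y) 1 s
    rw [one_pow] at this; exact hxy.trans this
  have hVE : (p ^ c : ℤ) ∣ V.eval x * E + w * y ^ s := by
    obtain ⟨k1, hk1⟩ := hcE
    obtain ⟨k2, hk2⟩ := hys
    have : V.eval x * E + w * y ^ s =
      (V.eval x + w * x ^ m) * E - w * x ^ m * E * (1 - x ^ s * y ^ s) -
        w * y ^ s * ((D.eval x * E - 1) - (D.eval x - x ^ (m + s)) * E) := by ring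
    rw [this, hR', hR, hk1, show 1 - x ^ s * y ^ s = -((p : ℤ) ^ c * k2) by rw [← hk2]; ring]
    refine ⟨R'.eval x * E + w * x ^ m * E * k2 - w * y ^ s * (k1 - R.eval x * E), by ring⟩
  obtain ⟨k3, hk3⟩ := hVE
  have hN : N.eval x = D.eval x + p ^ e * Z * V.eval x := by rw [← hZ, ← h1]; ring
  have e4 : N.eval x * E - (1 + p ^ e * (-w * Z * y ^ s)) =
      (D.eval x * E - 1) + p ^ e * Z * (V.eval x * E + w * y ^ s) := by rw [hN]; ring
  rw [e4, hE', hk3]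
  refine dvd_add (Dvd.intro _ rfl) ?_
  have : (p : ℤ) ^ e * Z * (p ^ c * k3) = p ^ (e + c) * (Z * k3) := by rw [pow_add]; ring
  rw [this]
  exact (pow_dvd_pow _ hec).mul_right _

lemma deg_DD (hf : PComp p a f) {X : Type*} (c : X → ℤ) : ∀ (k : ℕ) (l : List ℤ) (e : ℕ) (n : ℤ)
    (g : Fin k → ℤ), (∀ δ ∈ l, (p : ℤ) ∣ δ) → (p ^ e : ℤ) ∣ l.prod → e < a →
    (p ^ a : ℤ) ∣ p ^ e * ∏ i, g i → Deg k fun t : Fin k → X => DD l f (n + ∑ i, g i * c (t i))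
  | 0, l, e, n, g, hl, he, hea, h => by
    rw [Fin.prod_univ_zero, mul_one] at h
    exfalso
    have h0 : (p : ℤ) ≠ 0 := hf.prime_int.ne_zero
    have hu : ¬ IsUnit (p : ℤ) := hf.prime_int.not_isUnit
    have := (pow_dvd_pow_iff h0 hu).mp h
    omega
  | k + 1, l, e, n, g, hl, he, hea, h => by
    rw [Fin.prod_univ_succ] at h
    by_cases hp : (p : ℤ) ∣ g 0
    · by_cases hper : (p ^ a : ℤ) ∣ p ^ e * g 0
      · refine ⟨fun t => DD l f (n + ∑ i : Fin k, g i.succ * c (t i)), fun _ _ => 1, ?_, ?_, ?_⟩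
        · intro x t
          beta_reduce
          rw [Fin.sum_univ_succ, mul_one]
          simp only [Fin.cons_zero, Fin.cons_succ]
          rw [add_comm (g 0 * c x), ← add_assoc]
          refine hf.DD_periodic hl (hp.mul_right _) ?_ _
          rw [← mul_assoc]
          exact (hper.trans (mul_dvd_mul_right he _)).mul_right _
        · intro t; exact norm_DD_le_one hf.norm_le_one _ _
        · intro x x'; simpa using deg_const_one k
      · have hfin : FiniteMultiplicity (p : ℤ) (p ^ e * g 0) := by
          rw [Int.finiteMultiplicity_iff]
          refine ⟨by simpa using hf.prime.one_lt.ne', fun h0 => hper (h0 ▸ dvd_zero _)⟩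
        obtain ⟨u, hu, hu'⟩ := hfin.exists_eq_pow_mul_and_not_dvd
        set e' := multiplicity (p : ℤ) (p ^ e * g 0)
        have hea' : e' < a := by
          by_contra hcon
          exact hper (hu ▸ (pow_dvd_pow _ (by omega)).mul_right _)
        refine ⟨fun _ => 1, fun x t => DD l f (n + (g 0 * c x + ∑ i : Fin k, g i.succ * c (t i))),
          ?_, ?_, ?_⟩
        · intro x t
          beta_reduce
          rw [Fin.sum_univ_succ, one_mul]
          simp only [Fin.cons_zero, Fin.cons_succ]
        · simp
        · intro x x'
          have := deg_DD hf c k (g 0 * (c x' - c x) :: l) e' (n + g 0 * c x) (fun i => g i.succ)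
            ?_ ?_ hea' ?_
          · have hfun : (fun t : Fin k → X =>
                DD l f (n + (g 0 * c x + ∑ i : Fin k, g i.succ * c (t i))) *
                conj (DD l f (n + (g 0 * c x' + ∑ i : Fin k, g i.succ * c (t i))))) =
                fun t => DD (g 0 * (c x' - c x) :: l) f
                  (n + g 0 * c x + ∑ i : Fin k, g i.succ * c (t i)) := by
              funext t
              simp only [DD, mdiff]
              rw [show n + g 0 * c x + ∑ i : Fin k, g i.succ * c (t i) + g 0 * (c x' - c x) =
                n + (g 0 * c x' + ∑ i : Fin k, g i.succ * c (t i)) by ring, add_assoc n]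
            rw [hfun]
            exact this
          · intro δ hδ
            rcases List.mem_cons.mp hδ with rfl | hδ
            · exact hp.mul_right _
            · exact hl δ hδ
          · rw [List.prod_cons, mul_comm, ← mul_assoc]
            refine Dvd.dvd.mul_right ?_ _
            exact (Dvd.intro _ hu.symm).trans (mul_dvd_mul_right he _)
          · rw [← mul_assoc, hu, mul_assoc, mul_left_comm] at h
            have hcop : IsCoprime ((p : ℤ) ^ a) u :=
              (hf.prime_int.coprime_iff_not_dvd.mpr hu').pow_left
            exact hcop.dvd_of_dvd_mul_left h
    · refine ⟨fun _ => 1, fun x t => DD l f (n + (g 0 * c x + ∑ i : Fin k, g i.succ * c (t i))),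
          ?_, ?_, ?_⟩
      · intro x t
        beta_reduce
        rw [Fin.sum_univ_succ, one_mul]
        simp only [Fin.cons_zero, Fin.cons_succ]
      · simp
      · have hcop : IsCoprime ((p : ℤ) ^ a) (g 0) :=
          (hf.prime_int.coprime_iff_not_dvd.mpr hp).pow_left
        have h' : (p ^ a : ℤ) ∣ p ^ e * ∏ i : Fin k, g i.succ := by
          rw [mul_left_comm] at h
          exact hcop.dvd_of_dvd_mul_left h
        have key : ∀ x, Deg k fun t : Fin k → X =>
            DD l f (n + (g 0 * c x + ∑ i : Fin k, g i.succ * c (t i))) := by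
          intro x
          simpa only [add_assoc] using
            deg_DD hf c k l e (n + g 0 * c x) (fun i => g i.succ) hl he hea h'
        intro x y
        exact (key x).mul (key y).conj

/-- The components whose modulus divides the product of the steps are annihilated. -/
lemma deg (hf : PComp p a f) {X : Type*} (c : X → ℤ) (k : ℕ) (n : ℤ) (g : Fin k → ℤ)
    (h : (p ^ a : ℤ) ∣ ∏ i, g i) : Deg k fun t : Fin k → X => f (n + ∑ i, g i * c (t i)) :=
  hf.deg_DD c k [] 0 n g (by simp) (by simp) hf.pos (by simpa using h)

end PComp
end LandauPage

namespace LandauPage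
open Finset
open scoped BigOperators ComplexConjugate

section Cube
variable {A : Type*} [AddCommGroup A]

/-- The signed vertices of the cube spanned by a list of steps. -/
def cube : List A → List (A × Bool)
  | [] => [(0, true)]
  | δ :: l => cube l ++ (cube l).map fun q => (δ + q.1, !q.2)

lemma length_cube (l : List A) : (cube l).length = 2 ^ l.length := by
  induction l with
  | nil => rfl
  | cons δ l ih => simp [cube, ih, pow_succ]; ring

lemma DD_cube (l : List A) (f : A → ℂ) (x : A) :
    DD l f x = ((cube l).map fun q => if q.2 then f (x + q.1) else conj (f (x + q.1))).prod := by
  induction l generalizing x with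
  | nil => simp [DD, cube]
  | cons δ l ih =>
    simp only [DD, mdiff, cube, List.map_append, List.prod_append, List.map_map]
    rw [ih, ih, map_list_prod, List.map_map]
    congr 2
    refine List.map_congr_left fun q _ => ?_
    simp only [Function.comp, add_assoc]
    cases q.2 <;> simp

lemma cube_sum_dvd {l : List A} (hl : l ≠ []) {m : ℕ} (hm : 1 ≤ m) :
    m ∣ ((cube l).map fun q => if q.2 then 1 else m - 1).sum := by
  cases l with
  | nil => exact absurd rfl hl
  | cons δ l =>
    simp only [cube, List.map_append, List.sum_append, List.map_map]
    rw [← List.sum_map_add]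
    refine List.dvd_sum fun y hy => ?_
    obtain ⟨q, _, rfl⟩ := List.mem_map.mp hy
    simp only [Function.comp]
    have h1 : m - 1 + 1 = m := by omega
    have h2 : 1 + (m - 1) = m := by omega
    rcases q with ⟨u, _ | _⟩ <;> simp [h1, h2]

lemma cube_nodup_cons {δ : A} {l : List A} (h : ((cube l).map Prod.fst).Nodup)
    (hδ : ∀ u ∈ (cube l).map Prod.fst, ∀ v ∈ (cube l).map Prod.fst, δ ≠ u - v) :
    ((cube (δ :: l)).map Prod.fst).Nodup := by
  simp only [cube, List.map_append, List.map_map]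
  have : (Prod.fst ∘ fun q : A × Bool => (δ + q.1, !q.2)) = (δ + ·) ∘ Prod.fst := rfl
  rw [this, ← List.map_map]
  refine List.Nodup.append h (h.map (add_right_injective δ)) ?_
  intro u hu hv
  obtain ⟨v, hv', huv⟩ := List.mem_map.mp hv
  exact hδ u hu v hv' (by rw [← huv]; simp)

end Cube

section Averages
variable {p : ℕ} [NeZero p] {k : ℕ} {M : Type*} [AddCommMonoid M] [Module ℚ≥0 M]

lemma expect_update (i : Fin k) (φ : (Fin k → ZMod p) → M) :
    𝔼 d, φ d = 𝔼 d, 𝔼 y, φ (Function.update d i y) := by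
  have h1 : ∀ y : ZMod p, 𝔼 d, φ d = 𝔼 d, φ (d + (Pi.single i y : Fin k → ZMod p)) := fun y =>
    (Fintype.expect_equiv (Equiv.addRight (Pi.single i y : Fin k → ZMod p)) (fun d => φ (d + (Pi.single i y : Fin k → ZMod p))) φ
      fun d => rfl).symm
  have h2 : 𝔼 d, φ d = 𝔼 y : ZMod p, 𝔼 d, φ (d + (Pi.single i y : Fin k → ZMod p)) := by
    rw [Finset.expect_congr rfl fun y _ => (h1 y).symm, Fintype.expect_const]
  rw [h2, Finset.expect_comm]
  refine Finset.expect_congr rfl fun d _ => ?_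
  refine Fintype.expect_equiv (Equiv.addLeft (d i)) _ _ fun y => ?_
  congr 1
  funext j
  by_cases hj : j = i
  · subst hj; simp
  · simp [hj]

lemma expect_affine [Fact p.Prime] (u : Fin k → ZMod p) {i : Fin k} (hi : u i ≠ 0) (n : ZMod p)
    (φ : ZMod p → M) : 𝔼 h : Fin k → ZMod p, φ (n + ∑ j, u j * h j) = 𝔼 x, φ x := by
  rw [expect_update i]
  have : ∀ d : Fin k → ZMod p,
      𝔼 y, φ (n + ∑ j, u j * Function.update d i y j) = 𝔼 x, φ x := by
    intro d
    refine Fintype.expect_equiv ((Equiv.mulLeft₀ (u i) hi).trans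
      (Equiv.addLeft (n + ∑ j ∈ univ.erase i, u j * d j))) _ _ fun y => ?_
    congr 1
    rw [← Finset.add_sum_erase univ (fun j => u j * Function.update d i y j) (mem_univ i), Function.update_self,
      Finset.sum_congr rfl fun j hj => by rw [Function.update_of_ne (Finset.ne_of_mem_erase hj)]]
    simp only [Equiv.trans_apply, Equiv.coe_addLeft, Equiv.mulLeft₀_apply]
    ring
  simp_rw [this]
  rw [Fintype.expect_const]

/-- Replacing a second average by an average over differences. -/
lemma expect_shift (φ : (Fin k → ZMod p) → (Fin k → ZMod p) → M) :
    𝔼 h, 𝔼 h', φ h h' = 𝔼 h, 𝔼 d, φ h (h + d) :=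
  Finset.expect_congr rfl fun h _ =>
    (Fintype.expect_equiv (Equiv.addLeft h) (fun d => φ h (h + d)) (φ h) fun _ => rfl).symm

end Averages

section Probability
variable {p : ℕ} [Fact p.Prime]

lemma expect_mem_le (L : List (ZMod p)) {u : ZMod p} (hu : u ≠ 0) :
    𝔼 y : ZMod p, (if u * y ∈ L then (1 : ℝ) else 0) ≤ L.length / p := by
  rw [Fintype.expect_eq_sum_div_card, ZMod.card]
  gcongr
  rw [Finset.sum_boole]
  have : (univ.filter fun y => u * y ∈ L).card ≤ L.toFinset.card := by
    refine Finset.card_le_card_of_injOn (u * ·) ?_ ((mul_right_injective₀ hu).injOn)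
    intro y hy
    simpa using hy
  exact_mod_cast this.trans L.toFinset_card_le

lemma expect_cube_nodup {k : ℕ} (u : Fin k → ZMod p) : ∀ J : List (Fin k), J.Nodup →
    (∀ j ∈ J, u j ≠ 0) →
    𝔼 d : Fin k → ZMod p, (if ((cube (J.map fun j => u j * d j)).map Prod.fst).Nodup
      then (0 : ℝ) else 1) ≤ 4 ^ J.length / p
  | [], _, _ => by
    simp [cube]
  | i :: J, hJ, hu => by
    have ih := expect_cube_nodup u J (List.nodup_cons.mp hJ).2
      fun j hj => hu j (List.mem_cons_of_mem _ hj)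
    have hiJ := (List.nodup_cons.mp hJ).1
    set V : (Fin k → ZMod p) → List (ZMod p) :=
      fun d => (cube (J.map fun j => u j * d j)).map Prod.fst with hV
    set W : (Fin k → ZMod p) → List (ZMod p) :=
      fun d => (V d ×ˢ V d).map fun w => w.1 - w.2 with hW
    have h1 : ∀ d : Fin k → ZMod p,
        (if ((cube ((i :: J).map fun j => u j * d j)).map Prod.fst).Nodup then (0 : ℝ) else 1) ≤
        (if (V d).Nodup then (0 : ℝ) else 1) + if u i * d i ∈ W d then 1 else 0 := by
      intro d
      by_cases h2 : (V d).Nodup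
      · by_cases h3 : u i * d i ∈ W d
        · rw [if_pos h2, if_pos h3]; split_ifs <;> norm_num
        · rw [if_pos]
          · rw [if_pos h2, if_neg h3, add_zero]
          · refine cube_nodup_cons h2 fun a ha b hb hab => h3 ?_
            rw [hW]
            exact List.mem_map.mpr ⟨(a, b), List.mem_product.mpr ⟨ha, hb⟩, hab.symm⟩
      · rw [if_neg h2]; split_ifs <;> norm_num
    have h2 : 𝔼 d : Fin k → ZMod p, (if u i * d i ∈ W d then (1 : ℝ) else 0) ≤
        4 ^ J.length / p := by
      rw [expect_update i]
      have h3 : ∀ d : Fin k → ZMod p, 𝔼 y, (if u i * Function.update d i y i ∈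
          W (Function.update d i y) then (1 : ℝ) else 0) ≤ 4 ^ J.length / p := by
        intro d
        have h4 : ∀ y, W (Function.update d i y) = W d := by
          intro y
          have : V (Function.update d i y) = V d := by
            simp only [hV]
            congr 2
            refine List.map_congr_left fun j hj => ?_
            rw [Function.update_of_ne (fun hji : j = i => hiJ (by rwa [hji] at hj))]
          simp only [hW, this]
        simp_rw [h4, Function.update_self]
        refine (expect_mem_le _ (hu i (by simp))).trans (le_of_eq ?_)
        congr 1
        simp only [hW, hV, List.length_map, List.length_product, length_cube]
        push_cast
        rw [← mul_pow]; norm_num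
      calc _ ≤ 𝔼 d : Fin k → ZMod p, (4 ^ J.length / p : ℝ) :=
            Finset.expect_le_expect fun d _ => h3 d
        _ = _ := Fintype.expect_const _
    calc _ ≤ 𝔼 d : Fin k → ZMod p, ((if (V d).Nodup then (0 : ℝ) else 1) +
          if u i * d i ∈ W d then 1 else 0) := Finset.expect_le_expect fun d _ => h1 d
      _ = _ := Finset.expect_add_distrib _ _ _
      _ ≤ 4 ^ J.length / p + 4 ^ J.length / p := add_le_add ih h2
      _ ≤ 4 ^ (i :: J).length / p := by
        rw [← add_div, List.length_cons, pow_succ]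
        gcongr
        have : (0 : ℝ) ≤ 4 ^ J.length := by positivity
        linarith

end Probability

section Prime
variable {p : ℕ} [Fact p.Prime]

lemma norm_expect_DD_le (χ : DirichletCharacter ℂ p) (hχ : χ ≠ 1) {l : List (ZMod p)} (hl : l ≠ [])
    (hnd : ((cube l).map Prod.fst).Nodup) :
    ‖𝔼 x, DD l χ x‖ ≤ (2 ^ l.length * Real.sqrt p + 1) / p := by
  have hd : 2 ≤ orderOf χ := by
    have h0 : 0 < orderOf χ := orderOf_pos χ
    have h1 : orderOf χ ≠ 1 := by rwa [Ne, orderOf_eq_one_iff]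
    omega
  have hlen := length_cube l
  have : Nonempty (Fin (cube l).length) := ⟨⟨0, by rw [hlen]; positivity⟩⟩
  set a : Fin (cube l).length → ZMod p := fun i => ((cube l)[i]).1 with ha
  set e : Fin (cube l).length → ℕ := fun i => if ((cube l)[i]).2 then 1 else orderOf χ - 1 with he
  have key := weil_cube χ hχ a ?_ e ?_ ?_
  · rw [Fintype.card_fin] at key
    rw [Fintype.expect_eq_sum_div_card, ZMod.card, norm_div, Complex.norm_natCast]
    gcongr
    refine le_trans (le_of_eq ?_) (key.trans (le_of_eq (by rw [hlen]; push_cast; rfl)))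
    congr 1
    refine Finset.sum_congr rfl fun x _ => ?_
    rw [DD_cube, ← Fin.prod_univ_fun_getElem]
    refine Finset.prod_congr rfl fun i _ => ?_
    simp only [ha, he, Fin.getElem_fin]
    cases ((cube l)[i]).2
    · simp only [Bool.false_eq_true, if_false]
      set z := x + ((cube l)[(i : ℕ)]).1
      by_cases hz : IsUnit z
      · have h1 : χ z * χ z ^ (orderOf χ - 1) = 1 := by
          rw [← pow_succ', Nat.sub_add_cancel (by omega), ← MulChar.pow_apply' _ (by omega),
            pow_orderOf_eq_one, MulChar.one_apply hz]
        have h2 : χ z * conj (χ z) = 1 := by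
          rw [Complex.mul_conj, Complex.normSq_eq_norm_sq]
          have := DirichletCharacter.unit_norm_eq_one χ hz.unit
          rw [IsUnit.unit_spec] at this
          rw [this]; norm_num
        exact mul_left_cancel₀ (left_ne_zero_of_mul (h1.trans_ne one_ne_zero)) (h2.trans h1.symm)
      · rw [χ.map_nonunit hz, map_zero, zero_pow (by omega)]
    · simp
  · have := List.nodup_iff_injective_get.mp hnd
    intro i j hij
    have h1 := @this ⟨i, by simp⟩ ⟨j, by simp⟩ (by simpa [ha] using hij)
    exact Fin.ext (by simpa using h1)
  · intro i; simp only [he]; split_ifs <;> simp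
  · have := cube_sum_dvd hl (m := orderOf χ) (by omega)
    rw [← Fin.sum_univ_fun_getElem] at this
    exact this

lemma PComp.exists_char {f : ℤ → ℂ} (hf : PComp p 1 f) :
    ∃ χ : DirichletCharacter ℂ p, χ ≠ 1 ∧ ∀ x : ℤ, f x = χ x := by
  have hval : ∀ x : ℤ, f x = f ((x : ZMod p).val : ℤ) := fun x => hf.per _ _ (by
    rw [pow_one, ← ZMod.intCast_eq_intCast_iff_dvd_sub]; simp)
  let χ : DirichletCharacter ℂ p :=
    { toFun := fun z => f (z.val : ℤ)
      map_one' := by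
        have := hval 1
        rw [Int.cast_one] at this
        rw [← this, hf.map_one]
      map_mul' := fun y z => by
        rw [← hf.mul, hval (_ * _)]; simp
      map_nonunit' := fun z hz => by
        have : z = 0 := by simpa using hz
        subst this
        exact hf.zero _ (by simp) }
  have hχ : ∀ x : ℤ, f x = χ x := fun x => hval x
  refine ⟨χ, ?_, hχ⟩
  obtain ⟨z, hz1, hz2⟩ := hf.prim
  intro h
  rw [hχ, h] at hz2
  apply hz2
  refine MulChar.one_apply ?_
  rw [isUnit_iff_ne_zero, Ne, ZMod.intCast_zmod_eq_zero_iff_dvd]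
  exact hz1

end Prime
end LandauPage

namespace LandauPage
open Finset
open scoped BigOperators ComplexConjugate

lemma PComp.exists_addChar {p a : ℕ} [Fact p.Prime] {f : ℤ → ℂ} (hf : PComp p a f) (ha : 2 ≤ a) :
    ∃ ψ : AddChar (ZMod p) ℂ, ψ ≠ 1 ∧ ∀ z : ℤ, f (1 + p ^ (a - 1) * z) = ψ z := by
  have hpa : (p : ℤ) ^ a = p ^ (a - 1) * p := by rw [← pow_succ]; congr 1; omega
  have hval : ∀ z w : ℤ, (z : ZMod p) = w → f (1 + p ^ (a - 1) * z) = f (1 + p ^ (a - 1) * w) := by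
    intro z w h
    apply hf.per
    rw [ZMod.intCast_eq_intCast_iff_dvd_sub] at h
    rw [add_sub_add_left_eq_sub, ← mul_sub, hpa]
    exact mul_dvd_mul_left _ (by rw [← neg_sub]; exact (dvd_neg).mpr h)
  have hadd : ∀ z w : ℤ, f (1 + p ^ (a - 1) * (z + w)) =
      f (1 + p ^ (a - 1) * z) * f (1 + p ^ (a - 1) * w) := by
    intro z w
    rw [← hf.mul]
    apply hf.per
    obtain ⟨b, hb⟩ : ∃ b, a = b + 2 := ⟨a - 2, by omega⟩
    refine ⟨-(p ^ b * z * w), ?_⟩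
    subst hb
    rw [show b + 2 - 1 = b + 1 by omega]
    ring
  let ψ : AddChar (ZMod p) ℂ :=
    { toFun := fun z => f (1 + p ^ (a - 1) * (z.val : ℤ))
      map_zero_eq_one' := by simp [hf.map_one]
      map_add_eq_mul' := fun y z => by
        rw [← hadd]
        exact hval _ _ (by simp) }
  have hψ : ∀ z : ℤ, f (1 + p ^ (a - 1) * z) = ψ z := fun z => hval _ _ (by simp)
  refine ⟨ψ, ?_, hψ⟩
  obtain ⟨z, _, hz⟩ := hf.prim
  intro h
  rw [hψ, h] at hz
  exact hz (AddChar.one_apply _)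

section LocalFactors
variable {p : ℕ} [Fact p.Prime]

lemma expect_zero_le {k : ℕ} (i : Fin k) :
    𝔼 d : Fin k → ZMod p, (if d i = 0 then (1 : ℝ) else 0) ≤ 1 / p := by
  rw [expect_update i]
  simp_rw [Function.update_self]
  rw [Fintype.expect_const]
  have := expect_mem_le (p := p) [0] (one_ne_zero)
  simpa only [one_mul, List.mem_singleton, List.length_singleton, Nat.cast_one] using this

lemma local_factor_one {f : ℤ → ℂ} (hf : PComp p 1 f) {k : ℕ} (hk : 0 < k) (g : Fin k → ℤ)
    (hg : ∀ i, ¬ (p : ℤ) ∣ g i) (n : ℤ) :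
    ∃ κ : (Fin k → ZMod p) → (Fin k → ZMod p) → ℂ,
      (∀ (X : Type) (c : X → ℤ) (h h' : Fin k → X),
        Kern k (fun t => f (n + ∑ i, g i * c (t i))) h h' =
          κ (fun i => (c (h i) : ZMod p)) (fun i => (c (h' i) : ZMod p))) ∧
      ‖𝔼 h, 𝔼 h', κ h h'‖ ≤ (2 ^ k * Real.sqrt p + 1) / p + 4 ^ k / p := by
  obtain ⟨χ, hχ, hfχ⟩ := hf.exists_char
  have hg' : ∀ i, (g i : ZMod p) ≠ 0 := fun i => by
    rw [Ne, ZMod.intCast_zmod_eq_zero_iff_dvd]; exact hg i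
  refine ⟨fun h h' => DD (List.ofFn fun i => (g i : ZMod p) * (h' i - h i)) χ
    (n + ∑ i, (g i : ZMod p) * h i), ?_, ?_⟩
  · intro X c h h'
    rw [kern_linear, show f = fun x : ℤ => χ (Int.castAddHom (ZMod p) x) from funext hfχ, DD_map,
      List.map_ofFn]
    simp [Function.comp_def]
  · rw [expect_shift]
    simp only [Pi.add_apply, add_sub_cancel_left]
    rw [Finset.expect_comm]
    have h1 : ∀ d : Fin k → ZMod p,
        𝔼 h : Fin k → ZMod p, DD (List.ofFn fun i => (g i : ZMod p) * d i) χ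
          (n + ∑ i, (g i : ZMod p) * h i) =
        𝔼 x, DD (List.ofFn fun i => (g i : ZMod p) * d i) χ x := fun d =>
      expect_affine _ (hg' ⟨0, hk⟩) _ (DD (List.ofFn fun i => (g i : ZMod p) * d i) χ)
    simp_rw [h1]
    have h2 : ∀ d : Fin k → ZMod p,
        ‖𝔼 x, DD (List.ofFn fun i => (g i : ZMod p) * d i) χ x‖ ≤
        (2 ^ k * Real.sqrt p + 1) / p +
        if ((cube ((List.finRange k).map fun j => (g j : ZMod p) * d j)).map Prod.fst).Nodup
          then (0 : ℝ) else 1 := by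
      intro d
      rw [List.ofFn_eq_map]
      split_ifs with hd
      · rw [add_zero]
        refine (norm_expect_DD_le χ hχ ?_ hd).trans (le_of_eq (by simp))
        intro h
        have := congrArg List.length h
        simp at this
        omega
      · refine (RCLike.norm_expect_le (K := ℂ)).trans ?_
        calc _ ≤ 𝔼 x : ZMod p, (1 : ℝ) := Finset.expect_le_expect fun x _ =>
              norm_DD_le_one (fun y => χ.norm_le_one y) _ _
          _ = 1 := Fintype.expect_const _
          _ ≤ _ := le_add_of_nonneg_left (by positivity)
    calc _ ≤ 𝔼 d : Fin k → ZMod p, ‖𝔼 x, DD (List.ofFn fun i => (g i : ZMod p) * d i) χ x‖ :=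
          RCLike.norm_expect_le (K := ℂ)
      _ ≤ _ := Finset.expect_le_expect fun d _ => h2 d
      _ ≤ _ := by
        rw [Finset.expect_add_distrib, Fintype.expect_const]
        gcongr
        refine (expect_cube_nodup (fun i => (g i : ZMod p)) (List.finRange k)
          (List.nodup_finRange k) fun j _ => hg' j).trans (le_of_eq (by simp))

lemma prod_addChar_inv_pow (ψ : AddChar (ZMod p) ℂ) (t : ZMod p) (s : ℕ) (x : ZMod p)
    (C : List (ZMod p × Bool)) :
    (C.map fun q => if q.2 then (if x + q.1 = 0 then 0 else ψ (t * (x + q.1)⁻¹ ^ s))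
        else conj (if x + q.1 = 0 then 0 else ψ (t * (x + q.1)⁻¹ ^ s))).prod =
      if ∃ q ∈ C, x + q.1 = 0 then 0
        else ψ (t * (C.map fun q => (if q.2 then 1 else -1) * (x + q.1)⁻¹ ^ s).sum) := by
  induction C with
  | nil => simp
  | cons q C ih =>
    rw [List.map_cons, List.prod_cons, ih]
    by_cases hq : x + q.1 = 0
    · simp [hq]
    · by_cases hC : ∃ q ∈ C, x + q.1 = 0
      · simp [hC]
      · have hqC : ¬ ∃ q' ∈ q :: C, x + q'.1 = 0 := by
          rintro ⟨q', hq', h⟩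
          rcases List.mem_cons.mp hq' with rfl | hq'
          · exact hq h
          · exact hC ⟨q', hq', h⟩
        rw [if_neg hC, if_neg hqC, List.map_cons, List.sum_cons, mul_add,
          AddChar.map_add_eq_mul, if_neg hq]
        congr 1
        cases q.2
        · simp only [Bool.false_eq_true, if_false]
          rw [neg_one_mul, mul_neg, AddChar.map_neg_eq_conj]
        · simp

open Polynomial in
lemma card_zeros_le {s : ℕ} (hs : 0 < s) (B : List (ZMod p × Bool)) (hne : B ≠ [])
    (hnd : (B.map Prod.fst).Nodup) :
    (univ.filter fun x : ZMod p => (¬ ∃ q ∈ B, x + q.1 = 0) ∧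
      (B.map fun q => (if q.2 then 1 else -1) * (x + q.1)⁻¹ ^ s).sum = 0).card ≤ s * B.length := by
  set N := B.length
  set a : Fin N → ZMod p := fun i => (B[(i : ℕ)]).1 with ha
  set ε : Fin N → ZMod p := fun i => if (B[(i : ℕ)]).2 then 1 else -1 with hε
  have hinj : Function.Injective a := by
    have := List.nodup_iff_injective_get.mp hnd
    intro i j hij
    have h1 := @this ⟨i, by rw [List.length_map]; exact i.2⟩ ⟨j, by rw [List.length_map]; exact j.2⟩ (by simpa [ha] using hij)
    exact Fin.ext (by simpa using h1)
  set Q : (ZMod p)[X] := ∑ i, C (ε i) * ∏ j ∈ univ.erase i, (X + C (a j)) ^ s with hQ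
  have hQ0 : Q ≠ 0 := by
    have hN : 0 < N := List.length_pos_iff.mpr hne
    set i0 : Fin N := ⟨0, hN⟩
    intro h
    have h1 : Q.eval (-a i0) = 0 := by rw [h, eval_zero]
    rw [hQ, eval_finsetSum, Finset.sum_eq_single i0] at h1
    · simp only [eval_mul, eval_C, eval_prod, eval_pow, eval_add, eval_X] at h1
      rcases mul_eq_zero.mp h1 with h2 | h2
      · simp only [hε] at h2
        split_ifs at h2 <;> simp at h2
      · obtain ⟨j, hj, hj'⟩ := Finset.prod_eq_zero_iff.mp h2
        have h3 := pow_eq_zero_iff hs.ne' |>.mp hj'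
        have h4 : a j = a i0 := by linear_combination h3
        exact (Finset.ne_of_mem_erase hj) (hinj h4)
    · intro i _ hi
      simp only [eval_mul, eval_C, eval_prod, eval_pow, eval_add, eval_X]
      rw [Finset.prod_eq_zero (Finset.mem_erase.mpr ⟨hi.symm, mem_univ i0⟩), mul_zero]
      rw [neg_add_cancel, zero_pow hs.ne']
    · simp
  have hdeg : Q.natDegree ≤ s * N := by
    refine natDegree_sum_le_of_forall_le _ _ fun i _ => ?_
    refine (natDegree_C_mul_le _ _).trans ((natDegree_prod_le _ _).trans ?_)
    calc ∑ j ∈ univ.erase i, ((X + C (a j)) ^ s).natDegree ≤ ∑ j ∈ univ.erase i, s := by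
          refine Finset.sum_le_sum fun j _ => ?_
          refine natDegree_pow_le.trans ?_
          rw [natDegree_X_add_C, mul_one]
      _ ≤ ∑ j : Fin N, s := Finset.sum_le_sum_of_subset (Finset.subset_univ _)
      _ = s * N := by simp [mul_comm]
  refine le_trans ?_ hdeg
  refine le_trans (Finset.card_le_card (t := Q.roots.toFinset) ?_)
    ((Multiset.toFinset_card_le _).trans (card_roots' Q))
  intro x hx
  rw [Finset.mem_filter] at hx
  obtain ⟨-, hx1, hx2⟩ := hx
  rw [Multiset.mem_toFinset, mem_roots hQ0, IsRoot.def]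
  have hx3 : ∀ j, x + a j ≠ 0 := fun j h => hx1 ⟨B[(j : ℕ)], List.getElem_mem _, h⟩
  rw [← Fin.sum_univ_fun_getElem] at hx2
  have : Q.eval x = (∑ i, ε i * (x + a i)⁻¹ ^ s) * ∏ j, (x + a j) ^ s := by
    rw [hQ, eval_finsetSum, Finset.sum_mul]
    refine Finset.sum_congr rfl fun i _ => ?_
    simp only [eval_mul, eval_C, eval_prod, eval_pow, eval_add, eval_X]
    rw [← Finset.mul_prod_erase univ (fun j => (x + a j) ^ s) (mem_univ i), mul_assoc,
      ← mul_assoc ((x + a i)⁻¹ ^ s), ← mul_pow, inv_mul_cancel₀ (hx3 i), one_pow, one_mul]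
  rw [this]
  have h5 : (∑ i, ε i * (x + a i)⁻¹ ^ s) = 0 := hx2
  rw [h5, zero_mul]

lemma expect_zeros_le {k s : ℕ} (hs : 0 < s) (u : Fin k → ZMod p) (N : List (Fin k)) (hN : N.Nodup)
    (hu : ∀ j ∈ N, u j ≠ 0) (n : ZMod p) :
    𝔼 d : Fin k → ZMod p, 𝔼 h : Fin k → ZMod p,
      (if (¬ ∃ q ∈ cube (N.map fun j => u j * d j), n + ∑ j, u j * h j + q.1 = 0) ∧
        ((cube (N.map fun j => u j * d j)).map fun q =>
          (if q.2 then 1 else -1) * (n + ∑ j, u j * h j + q.1)⁻¹ ^ s).sum = 0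
        then (1 : ℝ) else 0) ≤ (4 ^ k + s * 2 ^ k) / p := by
  have hlen : N.length ≤ k := by simpa using hN.length_le_card
  rcases eq_or_ne N [] with rfl | hne
  · have h0 : ∀ x : ZMod p, ¬ ((¬ ∃ q ∈ cube ([] : List (ZMod p)), x + q.1 = 0) ∧
        ((cube ([] : List (ZMod p))).map fun q =>
          (if q.2 then 1 else -1) * (x + q.1)⁻¹ ^ s).sum = 0) := by
      intro x
      simp [cube, hs.ne']
    simp only [List.map_nil, h0, if_false, Finset.expect_const_zero]
    positivity
  · obtain ⟨i, hi⟩ := List.exists_mem_of_ne_nil N hne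
    set L : (Fin k → ZMod p) → List (ZMod p) := fun d => N.map fun j => u j * d j with hL
    set φ : (Fin k → ZMod p) → ZMod p → ℝ := fun d x =>
      if (¬ ∃ q ∈ cube (L d), x + q.1 = 0) ∧ ((cube (L d)).map fun q =>
          (if q.2 then 1 else -1) * (x + q.1)⁻¹ ^ s).sum = 0 then (1 : ℝ) else 0 with hφ
    have h1 : ∀ d : Fin k → ZMod p, 𝔼 h : Fin k → ZMod p, φ d (n + ∑ j, u j * h j) = 𝔼 x, φ d x :=
      fun d => expect_affine u (hu i hi) n (φ d)
    have h2 : ∀ d, 𝔼 x, φ d x ≤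
        (if ((cube (L d)).map Prod.fst).Nodup then (0 : ℝ) else 1) + s * 2 ^ k / p := by
      intro d
      split_ifs with hd
      · rw [zero_add, Fintype.expect_eq_sum_div_card, ZMod.card]
        gcongr
        simp only [hφ]
        rw [Finset.sum_boole]
        have hB : cube (L d) ≠ [] := by
          intro h
          have := length_cube (L d)
          rw [h, List.length_nil] at this
          exact (pow_pos (by norm_num) _).ne this
        have := card_zeros_le hs (cube (L d)) hB hd
        rw [length_cube] at this
        have h3 : s * 2 ^ (L d).length ≤ s * 2 ^ k :=
          Nat.mul_le_mul_left _ (Nat.pow_le_pow_right (by norm_num) (by simpa [hL] using hlen))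
        exact_mod_cast this.trans h3
      · calc 𝔼 x, φ d x ≤ 𝔼 x : ZMod p, (1 : ℝ) := Finset.expect_le_expect fun x _ => by
              simp only [hφ]; split_ifs <;> norm_num
          _ = 1 := Fintype.expect_const _
          _ ≤ _ := le_add_of_nonneg_right (by positivity)
    calc _ = 𝔼 d, 𝔼 x, φ d x := Finset.expect_congr rfl fun d _ => h1 d
      _ ≤ _ := Finset.expect_le_expect fun d _ => h2 d
      _ ≤ _ := by
        rw [Finset.expect_add_distrib, Fintype.expect_const, add_div]
        gcongr
        refine (expect_cube_nodup u N hN hu).trans ?_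
        gcongr
        norm_num

lemma norm_expect_addChar_mul {ψ : AddChar (ZMod p) ℂ} (hψ : ψ ≠ 1) (w : ZMod p) :
    𝔼 y, ψ (w * y) = if w = 0 then 1 else 0 := by
  split_ifs with hw
  · simp [hw]
  · have h1 : 𝔼 y, ψ (w * y) = 𝔼 y, ψ y :=
      Fintype.expect_equiv (Equiv.mulLeft₀ w hw) _ _ fun y => rfl
    rw [h1, Fintype.expect_eq_sum_div_card, AddChar.sum_eq_zero_of_ne_one hψ, zero_div]

lemma local_factor_pow {f : ℤ → ℂ} {a : ℕ} (hf : PComp p a f) (ha : 2 ≤ a) {k : ℕ} (hk : k < p)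
    (g : Fin k → ℤ) (hg : (p ^ (a - 1) : ℤ) ∣ ∏ i, g i) (hg' : ¬ (p ^ a : ℤ) ∣ ∏ i, g i) (n : ℤ) :
    ∃ κ : (Fin k → ZMod p) → (Fin k → ZMod p) → ℂ,
      (∀ (X : Type) (c : X → ℤ) (h h' : Fin k → X),
        Kern k (fun t => f (n + ∑ i, g i * c (t i))) h h' =
          κ (fun i => (c (h i) : ZMod p)) (fun i => (c (h' i) : ZMod p))) ∧
      ‖𝔼 h, 𝔼 h', κ h h'‖ ≤ (k + (4 ^ k + k * 2 ^ k)) / p := by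
  obtain ⟨ψ, hψ, hfψ⟩ := hf.exists_addChar ha
  set N := (List.finRange k).filter fun i => ¬ (p : ℤ) ∣ g i with hN
  set S := (List.finRange k).filter fun i => (p : ℤ) ∣ g i with hS
  have hperm : (N ++ S).Perm (List.finRange k) := by
    refine List.perm_append_comm.trans ?_
    have := List.filter_append_perm (fun i => decide ((p : ℤ) ∣ g i)) (List.finRange k)
    simpa [hN, hS] using this
  have hNS : (N ++ S).Nodup := hperm.nodup_iff.mpr (List.nodup_finRange k)
  have hNnd := (List.nodup_append.mp hNS).1
  have hSnd := (List.nodup_append.mp hNS).2.1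
  have hNp : ∀ i ∈ N, ¬ (p : ℤ) ∣ g i := fun i hi => by simpa [hN] using hi
  have hSp : ∀ i ∈ S, (p : ℤ) ∣ g i := fun i hi => by simpa [hS] using hi
  have hprod : ∏ i, g i = (N.map g).prod * (S.map g).prod := by
    rw [← List.prod_append, ← List.map_append, (hperm.map g).prod_eq, ← List.ofFn_eq_map,
      List.prod_ofFn]
  have hcop : IsCoprime ((p : ℤ) ^ (a - 1)) (N.map g).prod := by
    refine ((hf.prime_int.coprime_iff_not_dvd).mpr fun h => ?_).pow_left
    obtain ⟨b, hb, hb'⟩ := (Prime.dvd_prod_iff hf.prime_int).mp h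
    obtain ⟨i, hi, rfl⟩ := List.mem_map.mp hb
    exact hNp i hi hb'
  obtain ⟨Z₀, hZ₀⟩ : (p : ℤ) ^ (a - 1) ∣ (S.map g).prod := by
    rw [hprod] at hg
    exact hcop.dvd_of_dvd_mul_left hg
  have hpa : (p : ℤ) ^ a = p ^ (a - 1) * p := by rw [← pow_succ]; congr 1; omega
  have hZp : (Z₀ : ZMod p) ≠ 0 := by
    rw [Ne, ZMod.intCast_zmod_eq_zero_iff_dvd]
    rintro ⟨w, rfl⟩
    apply hg'
    rw [hprod, hZ₀, hpa]
    exact Dvd.intro_left ((N.map g).prod * w) (by ring)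
  have hS0 : S ≠ [] := by
    intro h
    rw [h, List.map_nil, List.prod_nil] at hZ₀
    have : (p : ℤ) ∣ 1 := by
      rw [hZ₀, show a - 1 = (a - 2) + 1 by omega, pow_succ]
      exact Dvd.intro_left (p ^ (a - 2) * Z₀) (by ring)
    exact hf.prime_int.not_dvd_one this
  set s := S.length with hs
  have hs0 : 0 < s := List.length_pos_iff.mpr hS0
  have hsk : s ≤ k := by simpa using hSnd.length_le_card
  set w₀ : ZMod p := -((s - 1).factorial : ℕ) * Z₀ with hw₀
  have hw : w₀ ≠ 0 := by
    refine mul_ne_zero (neg_ne_zero.mpr ?_) hZp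
    rw [Ne, ZMod.natCast_eq_zero_iff, hf.prime.dvd_factorial]
    omega
  -- the function obtained after taking the differences along the steps divisible by `p`
  set G : ZMod p → ZMod p → ℂ := fun t x => if x = 0 then 0 else ψ (t * x⁻¹ ^ s) with hG
  have hDS : ∀ δ : Fin k → ℤ, DD (S.map fun i => g i * δ i) f =
      fun x => G (w₀ * (S.map fun i => (δ i : ZMod p)).prod) (Int.castAddHom (ZMod p) x) := by
    intro δ
    funext x
    simp only [hG, Int.coe_castAddHom]
    by_cases hx : (p : ℤ) ∣ x
    · rw [hf.DD_zero _ hx, if_pos ((ZMod.intCast_zmod_eq_zero_iff_dvd _ _).mpr hx)]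
    · rw [if_neg (by rwa [ZMod.intCast_zmod_eq_zero_iff_dvd])]
      obtain ⟨y, hy⟩ := hf.exists_inv 1 hx
      have hyx : (x : ZMod p)⁻¹ = y := by
        have : ((x * y - 1 : ℤ) : ZMod p) = 0 := by
          rw [ZMod.intCast_zmod_eq_zero_iff_dvd]; simpa using hy
        push_cast at this
        exact inv_eq_of_mul_eq_one_right (sub_eq_zero.mp this)
      rw [hf.DD_eq (c := 1) (e := a - 1) (Z := Z₀ * (S.map δ).prod) ?_ le_rfl ?_ ?_ (by omega) hy,
        hfψ, hyx]
      · rw [List.length_map, ← hs, hw₀]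
        congr 1
        push_cast
        rw [List.map_map]
        rw [show (Int.cast ∘ δ : Fin k → ZMod p) = fun i => (δ i : ZMod p) from rfl]
        ring
      · simpa using hS0
      · intro ε hε
        obtain ⟨i, hi, rfl⟩ := List.mem_map.mp hε
        rw [pow_one]
        exact (hSp i hi).mul_right _
      · rw [List.prod_map_mul, hZ₀]; ring
  refine ⟨fun h h' => DD (N.map fun i => (g i : ZMod p) * (h' i - h i))
    (G (w₀ * (S.map fun i => h' i - h i).prod)) (n + ∑ i, (g i : ZMod p) * h i), ?_, ?_⟩
  · intro X c h h'
    rw [kern_linear, List.ofFn_eq_map, ← DD_perm (hperm.map _), List.map_append, DD_append, hDS,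
      DD_map, List.map_map]
    simp [Function.comp_def]
  · rw [expect_shift]
    simp only [Pi.add_apply, add_sub_cancel_left]
    obtain ⟨i, S', hSS⟩ := List.exists_cons_of_ne_nil hS0
    have hiN : i ∉ N := fun h => hNp i h (hSp i (by rw [hSS]; simp))
    have hiS : i ∉ S' := by rw [hSS] at hSnd; exact (List.nodup_cons.mp hSnd).1
    set u : Fin k → ZMod p := fun j => (g j : ZMod p) with hu
    set x : (Fin k → ZMod p) → ZMod p := fun h => n + ∑ j, u j * h j with hx
    set C : (Fin k → ZMod p) → List (ZMod p × Bool) :=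
      fun d => cube (N.map fun j => u j * d j) with hC
    set R : (Fin k → ZMod p) → (Fin k → ZMod p) → ZMod p := fun h d =>
      ((C d).map fun q => (if q.2 then 1 else -1) * (x h + q.1)⁻¹ ^ s).sum with hR
    set Z : (Fin k → ZMod p) → (Fin k → ZMod p) → Prop := fun h d => ∃ q ∈ C d, x h + q.1 = 0 with hZ
    have hK : ∀ h d : Fin k → ZMod p, DD (N.map fun j => u j * d j)
        (G (w₀ * (S.map fun j => d j).prod)) (x h) =
        if Z h d then 0 else ψ (w₀ * (S.map fun j => d j).prod * R h d) := by
      intro h d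
      rw [DD_cube]
      exact prod_addChar_inv_pow ψ _ s (x h) (C d)
    have hCu : ∀ d y, C (Function.update d i y) = C d := by
      intro d y
      simp only [hC]
      congr 1
      refine List.map_congr_left fun j hj => ?_
      rw [Function.update_of_ne (fun hji : j = i => hiN (by rwa [hji] at hj))]
    have hprodu : ∀ (d : Fin k → ZMod p) y, (S.map fun j => Function.update d i y j).prod =
        y * (S'.map fun j => d j).prod := by
      intro d y
      rw [hSS, List.map_cons, List.prod_cons, Function.update_self]
      congr 2
      refine List.map_congr_left fun j hj => ?_
      rw [Function.update_of_ne (fun hji : j = i => hiS (by rwa [hji] at hj))]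
    have hpt : ∀ h d : Fin k → ZMod p,
        ‖𝔼 y, DD (N.map fun j => u j * Function.update d i y j)
          (G (w₀ * (S.map fun j => Function.update d i y j).prod)) (x h)‖ ≤
        (∑ j, if d j = 0 then (1 : ℝ) else 0) + if ¬ Z h d ∧ R h d = 0 then 1 else 0 := by
      intro h d
      have h1 : ∀ y, DD (N.map fun j => u j * Function.update d i y j)
          (G (w₀ * (S.map fun j => Function.update d i y j).prod)) (x h) =
          if Z h d then 0 else ψ (w₀ * (S'.map fun j => d j).prod * R h d * y) := by
        intro y
        rw [hK]
        simp only [hZ, hR, hCu, hprodu]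
        congr 2
        ring
      simp_rw [h1]
      have hnn : 0 ≤ ∑ j, if d j = 0 then (1 : ℝ) else 0 :=
        Finset.sum_nonneg fun j _ => by split_ifs <;> norm_num
      have hnn2 : (0 : ℝ) ≤ if ¬ Z h d ∧ R h d = 0 then 1 else 0 := by split_ifs <;> norm_num
      by_cases hZd : Z h d
      · simp only [hZd, if_true, Finset.expect_const_zero, norm_zero]
        simpa using hnn
      · simp only [hZd, if_false]
        rw [norm_expect_addChar_mul hψ]
        split_ifs with h2 h3 h3
        · rw [norm_one]; linarith
        · rw [norm_one, add_zero]
          have h4 : (S'.map fun j => d j).prod = 0 := by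
            rcases mul_eq_zero.mp h2 with h5 | h5
            · rcases mul_eq_zero.mp h5 with h6 | h6
              · exact absurd h6 hw
              · exact h6
            · exact absurd ⟨not_false, h5⟩ h3
          obtain ⟨j, _, hj⟩ := List.mem_map.mp (List.prod_eq_zero_iff.mp h4)
          calc (1 : ℝ) = if d j = 0 then (1 : ℝ) else 0 := by rw [if_pos hj]
            _ ≤ _ := Finset.single_le_sum (f := fun j => if d j = 0 then (1 : ℝ) else 0)
              (fun j _ => by split_ifs <;> norm_num) (mem_univ j)
        · rw [norm_zero]; linarith
        · rw [norm_zero]; linarith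
    have hrow : ∀ h : Fin k → ZMod p,
        ‖𝔼 d : Fin k → ZMod p, DD (N.map fun j => u j * d j)
          (G (w₀ * (S.map fun j => d j).prod)) (x h)‖ ≤
        𝔼 d : Fin k → ZMod p, ((∑ j, if d j = 0 then (1 : ℝ) else 0) +
          if ¬ Z h d ∧ R h d = 0 then 1 else 0) := by
      intro h
      rw [expect_update i]
      exact (RCLike.norm_expect_le (K := ℂ)).trans (Finset.expect_le_expect fun d _ => hpt h d)
    calc _ ≤ 𝔼 h, ‖𝔼 d : Fin k → ZMod p, DD (N.map fun j => u j * d j)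
          (G (w₀ * (S.map fun j => d j).prod)) (x h)‖ := RCLike.norm_expect_le (K := ℂ)
      _ ≤ 𝔼 h, 𝔼 d : Fin k → ZMod p, ((∑ j, if d j = 0 then (1 : ℝ) else 0) +
          if ¬ Z h d ∧ R h d = 0 then 1 else 0) := Finset.expect_le_expect fun h _ => hrow h
      _ = 𝔼 d : Fin k → ZMod p, (∑ j, if d j = 0 then (1 : ℝ) else 0) +
          𝔼 d, 𝔼 h, (if ¬ Z h d ∧ R h d = 0 then (1 : ℝ) else 0) := by
        simp_rw [Finset.expect_add_distrib]
        rw [Fintype.expect_const]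
        congr 1
        exact Finset.expect_comm _ _ _
      _ ≤ k / p + (4 ^ k + k * 2 ^ k) / p := by
        refine add_le_add ?_ ?_
        · rw [Finset.expect_sum_comm]
          calc _ ≤ ∑ j : Fin k, (1 / p : ℝ) := Finset.sum_le_sum fun j _ => expect_zero_le j
            _ = k / p := by simp [div_eq_mul_inv]
        · refine (expect_zeros_le hs0 u N hNnd (fun j hj => ?_) n).trans ?_
          · rw [hu, Ne, ZMod.intCast_zmod_eq_zero_iff_dvd]; exact hNp j hj
          · gcongr
      _ = _ := by rw [← add_div]

end LocalFactors
end LandauPage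

namespace LandauPage
open Finset
open scoped BigOperators ComplexConjugate

lemma prod_expect {ι : Type*} [Fintype ι] {κ : ι → Type*} [∀ i, Fintype (κ i)]
    (f : ∀ i, κ i → ℂ) : ∏ i, 𝔼 j, f i j = 𝔼 x : ∀ i, κ i, ∏ i, f i (x i) := by
  simp only [Fintype.expect_eq_sum_div_card]
  rw [Finset.prod_div_distrib, Finset.prod_univ_sum, Fintype.piFinset_univ, Fintype.card_pi]
  push_cast
  rfl

lemma expect_crt {ι : Type} [Fintype ι] (a : ι → ℕ) [∀ i, NeZero (a i)] [NeZero (∏ i, a i)]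
    (ha : Pairwise (Function.onFun Nat.Coprime a)) (k : ℕ)
    (κ : ∀ i, (Fin k → ZMod (a i)) → (Fin k → ZMod (a i)) → ℂ) :
    𝔼 h : Fin k → ZMod (∏ i, a i), 𝔼 h' : Fin k → ZMod (∏ i, a i),
      ∏ i, κ i (fun j => (((h j).val : ℤ) : ZMod (a i))) (fun j => (((h' j).val : ℤ) : ZMod (a i))) =
    ∏ i, 𝔼 h, 𝔼 h', κ i h h' := by
  set E : (Fin k → ZMod (∏ i, a i)) ≃ ∀ i, Fin k → ZMod (a i) :=
    (Equiv.piCongrRight fun _ => (ZMod.prodEquivPi a ha).toEquiv).trans (Equiv.piComm _) with hE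
  have hval : ∀ h : Fin k → ZMod (∏ i, a i), ∀ i,
      (fun j => (((h j).val : ℤ) : ZMod (a i))) = E h i := by
    intro h i
    funext j
    have : E h i j = ZMod.prodEquivPi a ha (h j) i := rfl
    rw [this, ZMod.prodEquivPi_apply, ZMod.castHom_apply, Int.cast_natCast, ZMod.natCast_val]
  simp_rw [hval]
  calc _ = 𝔼 H : ∀ i, Fin k → ZMod (a i), 𝔼 H' : ∀ i, Fin k → ZMod (a i),
        ∏ i, κ i (H i) (H' i) :=
        Fintype.expect_equiv E _ _ fun h => Fintype.expect_equiv E _ _ fun h' => rfl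
    _ = 𝔼 H : ∀ i, Fin k → ZMod (a i), ∏ i, 𝔼 y, κ i (H i) y :=
        Finset.expect_congr rfl fun H _ => (prod_expect fun i y => κ i (H i) y).symm
    _ = _ := (prod_expect fun i x => 𝔼 y, κ i x y).symm

lemma local_factor {p : ℕ} [Fact p.Prime] {f : ℤ → ℂ} {a : ℕ} (hf : PComp p a f) {k : ℕ}
    (hk : 0 < k) (hp : 16 ^ (k + 2) ≤ p) (g : Fin k → ℤ) (hg : (p ^ (a - 1) : ℤ) ∣ ∏ i, g i)
    (hg' : ¬ (p ^ a : ℤ) ∣ ∏ i, g i) (n : ℤ) :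
    ∃ κ : (Fin k → ZMod p) → (Fin k → ZMod p) → ℂ,
      (∀ (X : Type) (c : X → ℤ) (h h' : Fin k → X),
        Kern k (fun t => f (n + ∑ i, g i * c (t i))) h h' =
          κ (fun i => (c (h i) : ZMod p)) (fun i => (c (h' i) : ZMod p))) ∧
      ‖𝔼 h, 𝔼 h', κ h h'‖ ≤ (p : ℝ) ^ (-(1 / 4) : ℝ) := by
  set z : ℝ := (p : ℝ) ^ (1 / 4 : ℝ) with hz
  have hp0 : (0 : ℝ) < p := by exact_mod_cast hf.prime.pos
  have hz4 : z ^ 4 = p := by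
    rw [hz, ← Real.rpow_natCast, ← Real.rpow_mul hp0.le]; norm_num
  have hz0 : 0 < z := by positivity
  have hzinv : (p : ℝ) ^ (-(1 / 4) : ℝ) = z⁻¹ := by rw [Real.rpow_neg hp0.le]
  set w : ℝ := 2 ^ k with hw
  have hw1 : 1 ≤ w := one_le_pow₀ (by norm_num)
  have hzw : 4 * w ≤ z := by
    by_contra hcon
    push Not at hcon
    have h1 : z ^ 4 < (4 * w) ^ 4 := pow_lt_pow_left₀ hcon hz0.le (by norm_num)
    have h2 : (4 * w) ^ 4 = 16 ^ (k + 2) := by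
      rw [mul_pow, hw, ← pow_mul, mul_comm k 4, pow_mul, pow_add]; norm_num; ring
    rw [h2, hz4] at h1
    have : (16 : ℝ) ^ (k + 2) ≤ p := by exact_mod_cast hp
    linarith
  have h4 : (4 : ℝ) ^ k = w ^ 2 := by
    rw [hw, ← pow_mul, mul_comm k 2, pow_mul]; norm_num
  rcases Nat.lt_or_ge a 2 with ha | ha
  · have ha1 : a = 1 := by have := hf.pos; omega
    subst ha1
    obtain ⟨κ, h1, h2⟩ := local_factor_one hf hk g (fun i hi => hg' (by
      rw [pow_one]; exact hi.trans (Finset.dvd_prod_of_mem g (mem_univ i)))) n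
    refine ⟨κ, h1, h2.trans ?_⟩
    have hsq : Real.sqrt p = z ^ 2 := by
      rw [← hz4, show z ^ 4 = (z ^ 2) ^ 2 by ring, Real.sqrt_sq (by positivity)]
    rw [hzinv, ← add_div, hsq, h4, ← hz4, div_le_iff₀ (by positivity),
      show z⁻¹ * z ^ 4 = z ^ 3 by field_simp]
    nlinarith [mul_le_mul_of_nonneg_right hzw (sq_nonneg z), mul_le_mul hzw hzw (by positivity) hz0.le]
  · have hk2 : (k : ℝ) ≤ w := by
      rw [hw]; exact_mod_cast (Nat.lt_two_pow_self (n := k)).le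
    have hkp : k < p := by
      have h1 : k < 2 ^ k := Nat.lt_two_pow_self
      have h2 : 2 ^ k ≤ 16 ^ (k + 2) := (Nat.pow_le_pow_left (by norm_num) k).trans
        (Nat.pow_le_pow_right (by norm_num) (by omega))
      omega
    obtain ⟨κ, h1, h2⟩ := local_factor_pow hf ha hkp g hg hg' n
    refine ⟨κ, h1, h2.trans ?_⟩
    rw [hzinv, h4, ← hz4, div_le_iff₀ (by positivity),
      show z⁻¹ * z ^ 4 = z ^ 3 by field_simp]
    nlinarith [mul_le_mul hzw hzw (by positivity) hz0.le, mul_le_mul_of_nonneg_right hk2 (by positivity : 0 ≤ w),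
      mul_le_mul_of_nonneg_right hzw (sq_nonneg z)]

/-- The averaged product of components, when the steps leave exactly one factor of each prime in
`t` uncancelled. -/
theorem norm_expect_prod_le (s t : Finset ℕ) (hts : t ⊆ s) (a : ℕ → ℕ) (F : ℕ → ℤ → ℂ)
    (hF : ∀ p ∈ s, PComp p (a p) (F p)) {k : ℕ} (hk : 0 < k) (g : Fin k → ℤ)
    (ht : ∀ p ∈ t, 16 ^ (k + 2) ≤ p ∧ (p ^ (a p - 1) : ℤ) ∣ ∏ i, g i ∧ ¬ (p ^ a p : ℤ) ∣ ∏ i, g i)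
    (hst : ∀ p ∈ s \ t, (p ^ a p : ℤ) ∣ ∏ i, g i) :
    ∃ (X : Type) (_ : Fintype X) (_ : Nonempty X) (c : X → ℤ),
      (∀ x, 0 ≤ c x ∧ c x ≤ ∏ p ∈ t, (p : ℤ)) ∧ ∀ n : ℤ,
      ‖𝔼 h : Fin k → X, ∏ p ∈ s, F p (n + ∑ i, g i * c (h i))‖ ^ 2 ^ k ≤
        ((∏ p ∈ t, p : ℕ) : ℝ) ^ (-(1 / 4) : ℝ) := by
  have hprime : ∀ p : t, Nat.Prime p := fun p => (hF p (hts p.2)).prime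
  have : ∀ p : t, Fact (Nat.Prime p) := fun p => ⟨hprime p⟩
  have hne : (∏ p : t, (p : ℕ)) ≠ 0 := Finset.prod_ne_zero_iff.mpr fun p _ => (hprime p).ne_zero
  have : NeZero (∏ p : t, (p : ℕ)) := ⟨hne⟩
  have hcop : Pairwise (Function.onFun Nat.Coprime fun p : t => (p : ℕ)) := fun p r hpr =>
    (Nat.coprime_primes (hprime p) (hprime r)).mpr fun h => hpr (Subtype.ext h)
  obtain ⟨k, rfl⟩ : ∃ k', k = k' + 1 := ⟨k - 1, by omega⟩
  set c : ZMod (∏ p : t, (p : ℕ)) → ℤ := fun x => (x.val : ℤ) with hc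
  refine ⟨ZMod (∏ p : t, (p : ℕ)), inferInstance, inferInstance, c, fun x => ⟨by positivity, ?_⟩, ?_⟩
  · have h1 : x.val ≤ ∏ p ∈ t, p :=
      (ZMod.val_lt x).le.trans_eq (Finset.prod_coe_sort t fun p => p)
    simp only [hc]
    rw [← Nat.cast_prod]
    exact Int.ofNat_le.mpr h1
  · intro n
    have hloc : ∀ p : t, _ := fun p => local_factor (hF p (hts p.2)) hk (ht p p.2).1 g
      (ht p p.2).2.1 (ht p p.2).2.2 n
    choose κ hκ hκn using hloc
    have hdeg : Deg (k + 1) fun h : Fin (k + 1) → ZMod (∏ p : t, (p : ℕ)) =>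
        ∏ p ∈ s \ t, F p (n + ∑ i, g i * c (h i)) := deg_prod _ _ fun p hp =>
      (hF p (Finset.mem_sdiff.mp hp).1).deg c (k + 1) n g (hst p hp)
    have hbox := box_lemma k (fun h : Fin (k + 1) → ZMod (∏ p : t, (p : ℕ)) =>
        ∏ p ∈ t, F p (n + ∑ i, g i * c (h i))) _ hdeg
    have hker : ∀ h h' : Fin (k + 1) → ZMod (∏ p : t, (p : ℕ)),
        Kern (k + 1) (fun h : Fin (k + 1) → ZMod (∏ p : t, (p : ℕ)) =>
        ∏ p ∈ t, F p (n + ∑ i, g i * c (h i))) h h' =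
        ∏ p : t, κ p (fun j => (((h j).val : ℤ) : ZMod p)) (fun j => (((h' j).val : ℤ) : ZMod p)) := by
      intro h h'
      rw [kern_prod t (k + 1) (fun p h => F p (n + ∑ i, g i * c (h i))),
        ← Finset.prod_coe_sort t]
      exact Finset.prod_congr rfl fun p _ => hκ p _ c h h'
    simp_rw [hker] at hbox
    rw [expect_crt (fun p : t => (p : ℕ)) hcop (k + 1) κ] at hbox
    have hsplit : ∀ h : Fin (k + 1) → ZMod (∏ p : t, (p : ℕ)),
        ∏ p ∈ s, F p (n + ∑ i, g i * c (h i)) = (∏ p ∈ t, F p (n + ∑ i, g i * c (h i))) *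
          ∏ p ∈ s \ t, F p (n + ∑ i, g i * c (h i)) := fun h => by
      rw [mul_comm, Finset.prod_sdiff hts]
    simp_rw [hsplit]
    refine hbox.trans ((Complex.re_le_norm _).trans ?_)
    rw [norm_prod, ← Finset.prod_coe_sort t fun p => p, Nat.cast_prod,
      ← Real.finsetProd_rpow _ _ fun p _ => Nat.cast_nonneg _]
    exact Finset.prod_le_prod (fun p _ => norm_nonneg _) fun p _ => hκn p

end LandauPage

namespace LandauPage
open Finset
open scoped BigOperators ComplexConjugate

lemma PComp.exists_primitive_addChar {p a : ℕ} {f : ℤ → ℂ} (hf : PComp p a f)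
    {e c : ℕ} (hc : 0 < c) (hec : a = e + c) (hce : c ≤ e) [NeZero (p ^ c)] :
    ∃ ψ : AddChar (ZMod (p ^ c)) ℂ, (∀ w, w ≠ 0 → ψ.mulShift w ≠ 1) ∧
      ∀ z : ℤ, f (1 + p ^ e * z) = ψ z := by
  have hval : ∀ z w : ℤ, (z : ZMod (p ^ c)) = w → f (1 + p ^ e * z) = f (1 + p ^ e * w) := by
    intro z w h
    apply hf.per
    rw [ZMod.intCast_eq_intCast_iff_dvd_sub] at h
    rw [add_sub_add_left_eq_sub, ← mul_sub, hec, pow_add]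
    refine mul_dvd_mul_left _ ?_
    rw [← neg_sub]
    exact (dvd_neg).mpr (by exact_mod_cast h)
  have hadd : ∀ z w : ℤ, f (1 + p ^ e * (z + w)) = f (1 + p ^ e * z) * f (1 + p ^ e * w) := by
    intro z w
    rw [← hf.mul]
    apply hf.per
    obtain ⟨b, hb⟩ : ∃ b, e = c + b := ⟨e - c, by omega⟩
    refine ⟨-(p ^ b * z * w), ?_⟩
    subst hb hec
    ring
  let ψ : AddChar (ZMod (p ^ c)) ℂ :=
    { toFun := fun z => f (1 + p ^ e * (z.val : ℤ))
      map_zero_eq_one' := by simp [hf.map_one]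
      map_add_eq_mul' := fun y z => by
        rw [← hadd]
        exact hval _ _ (by simp) }
  have hψ : ∀ z : ℤ, f (1 + p ^ e * z) = ψ z := fun z => hval _ _ (by simp)
  refine ⟨ψ, ?_, hψ⟩
  intro w hw h
  obtain ⟨z, _, hz⟩ := hf.prim
  obtain ⟨W, rfl⟩ : ∃ W : ℤ, (W : ZMod (p ^ c)) = w := ⟨w.val, by simp⟩
  have hW : ¬ (p ^ c : ℤ) ∣ W := by
    intro h'
    exact hw ((ZMod.intCast_zmod_eq_zero_iff_dvd _ _).mpr (by exact_mod_cast h'))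
  have hW0 : W ≠ 0 := fun h0 => hW (h0 ▸ dvd_zero _)
  obtain ⟨j, u, hu, rfl⟩ : ∃ (j : ℕ) (u : ℤ), ¬ (p : ℤ) ∣ u ∧ W = p ^ j * u := by
    obtain ⟨u, h1, h2⟩ := (Int.finiteMultiplicity_iff.mpr
      ⟨fun h1 => hf.prime.one_lt.ne' (by simpa using h1), hW0⟩ :
        FiniteMultiplicity (p : ℤ) W).exists_eq_pow_mul_and_not_dvd
    exact ⟨_, _, h2, h1⟩
  have hjc : j < c := by
    by_contra hjc
    exact hW (Dvd.dvd.mul_right (pow_dvd_pow _ (by omega)) _)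
  obtain ⟨y, hy⟩ := hf.exists_inv c hu
  apply hz
  have h1 : f (1 + p ^ (a - 1) * z) = ψ ((p ^ (c - 1) * z : ℤ) : ZMod (p ^ c)) := by
    rw [← hψ, ← mul_assoc, ← pow_add]
    congr 4
    omega
  have h2 : (((p ^ (c - 1) * z : ℤ) : ZMod (p ^ c))) =
      ((p ^ j * u : ℤ) : ZMod (p ^ c)) * ((p ^ (c - 1 - j) * y * z : ℤ) : ZMod (p ^ c)) := by
    rw [← Int.cast_mul, ZMod.intCast_eq_intCast_iff_dvd_sub]
    push_cast
    have h3 : (p : ℤ) ^ (c - 1) = p ^ j * p ^ (c - 1 - j) := by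
      rw [← pow_add]; congr 1; omega
    rw [show (p : ℤ) ^ j * u * (p ^ (c - 1 - j) * y * z) - p ^ (c - 1) * z =
      (u * y - 1) * (p ^ (c - 1) * z) by rw [h3]; ring]
    exact Dvd.dvd.mul_right hy _
  rw [h1, h2, ← AddChar.mulShift_apply, h, AddChar.one_apply]

lemma not_pow_dvd_factorial_mul_prod {p : ℕ} (hp : p.Prime) {k τ c : ℕ} (hτ : 0 < τ)
    (hc : k * τ < c) (t : Fin k → ℕ) (ht : ∀ i, ¬ p ^ τ ∣ t i) :
    ¬ p ^ c ∣ k.factorial * ∏ i, t i := by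
  have h0 : ∀ i ∈ univ, t i ≠ 0 := fun i _ h => ht i (h ▸ dvd_zero _)
  have h1 : ∏ i, t i ≠ 0 := Finset.prod_ne_zero_iff.mpr h0
  rw [hp.pow_dvd_iff_le_factorization (mul_ne_zero (Nat.factorial_ne_zero k) h1),
    Nat.factorization_mul (Nat.factorial_ne_zero k) h1, Finsupp.add_apply,
    Nat.factorization_prod h0, Finset.sum_apply']
  have h2 : ∀ i ∈ univ, (t i).factorization p ≤ τ - 1 := fun i hi => by
    have := ht i
    rw [hp.pow_dvd_iff_le_factorization (h0 i hi)] at this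
    omega
  have h3 := Finset.sum_le_card_nsmul univ (fun i => (t i).factorization p) _ h2
  have h4 : k.factorial.factorization p ≤ k := by
    have := Fact.mk hp
    rw [Nat.factorization_def _ hp]
    have h5 := sub_one_mul_padicValNat_factorial (p := p) k
    have h6 : 1 * padicValNat p k.factorial ≤ (p - 1) * padicValNat p k.factorial :=
      Nat.mul_le_mul_right _ (by have := hp.two_le; omega)
    omega
  simp only [card_univ, Fintype.card_fin, smul_eq_mul] at h3
  have h5 : k * (τ - 1) + k = k * τ := by
    rw [← Nat.mul_succ]; congr 1; omega
  omega

lemma expect_dvd_val {p c τ : ℕ} (hp : p.Prime) [NeZero (p ^ c)] (hτ : τ ≤ c) :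
    𝔼 x : ZMod (p ^ c), (if p ^ τ ∣ x.val then (1 : ℝ) else 0) = ((p : ℝ) ^ τ)⁻¹ := by
  have hpτ : 0 < p ^ τ := pow_pos hp.pos _
  have hcard : (univ.filter fun x : ZMod (p ^ c) => p ^ τ ∣ x.val).card = p ^ (c - τ) := by
    have h1 : (univ.filter fun x : ZMod (p ^ c) => p ^ τ ∣ x.val).card =
        ((range (p ^ (c - τ))).image fun j => ((p ^ τ * j : ℕ) : ZMod (p ^ c))).card := by
      congr 1
      ext x
      simp only [mem_filter, mem_univ, true_and, mem_image, mem_range]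
      constructor
      · rintro ⟨j, hj⟩
        refine ⟨j, ?_, by rw [← hj]; simp⟩
        have := ZMod.val_lt x
        rw [hj, show p ^ c = p ^ τ * p ^ (c - τ) by rw [← pow_add]; congr 1; omega] at this
        exact lt_of_mul_lt_mul_left this (Nat.zero_le _)
      · rintro ⟨j, _, rfl⟩
        rw [ZMod.val_natCast]
        exact (Nat.dvd_mod_iff (pow_dvd_pow p hτ)).mpr (dvd_mul_right _ _)
    rw [h1, Finset.card_image_of_injOn, card_range]
    intro i hi j hj hij
    simp only [coe_range, Set.mem_Iio] at hi hj
    have hlt : ∀ i, i < p ^ (c - τ) → p ^ τ * i < p ^ c := fun i hi => by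
      rw [show p ^ c = p ^ τ * p ^ (c - τ) by rw [← pow_add]; congr 1; omega]
      exact Nat.mul_lt_mul_of_pos_left hi hpτ
    have := congrArg ZMod.val hij
    simp only [ZMod.val_natCast, Nat.mod_eq_of_lt (hlt i hi), Nat.mod_eq_of_lt (hlt j hj)] at this
    exact Nat.eq_of_mul_eq_mul_left hpτ this
  rw [Fintype.expect_eq_sum_div_card, ZMod.card, Finset.sum_boole, hcard]
  push_cast
  have : (p : ℝ) ≠ 0 := by exact_mod_cast hp.ne_zero
  rw [eq_comm, ← one_div, div_eq_div_iff (by positivity) (by positivity), one_mul, ← pow_add]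
  congr 1
  omega

lemma expect_factorial_mul_prod_le {p : ℕ} (hp : p.Prime) {k τ c : ℕ} (hτ : 0 < τ)
    (hτc : τ ≤ c) (hc : k * τ < c) [NeZero (p ^ c)] :
    𝔼 t : Fin k → ZMod (p ^ c), (if (k.factorial : ZMod (p ^ c)) * ∏ i, t i = 0 then (1 : ℝ) else 0)
      ≤ k * ((p : ℝ) ^ τ)⁻¹ := by
  have h1 : ∀ t : Fin k → ZMod (p ^ c),
      (if (k.factorial : ZMod (p ^ c)) * ∏ i, t i = 0 then (1 : ℝ) else 0) ≤
        ∑ i, if p ^ τ ∣ (t i).val then (1 : ℝ) else 0 := by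
    intro t
    have hpos : ∀ i ∈ univ, 0 ≤ if p ^ τ ∣ (t i).val then (1 : ℝ) else 0 := fun i _ => by
      split_ifs <;> norm_num
    split_ifs with h
    · by_contra! hlt
      have h2 : ∀ i, ¬ p ^ τ ∣ (t i).val := fun i hi => by
        have := Finset.single_le_sum hpos (mem_univ i)
        rw [if_pos hi] at this
        linarith
      apply not_pow_dvd_factorial_mul_prod hp hτ hc _ h2
      rw [← ZMod.natCast_eq_zero_iff]
      push_cast
      simpa using h
    · exact Finset.sum_nonneg hpos
  refine (Finset.expect_le_expect fun t _ => h1 t).trans ?_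
  rw [Finset.expect_sum_comm]
  refine (Finset.sum_le_card_nsmul _ _ (((p : ℝ) ^ τ)⁻¹) fun i _ => ?_).trans (by simp)
  rw [expect_update i]
  simp_rw [Function.update_self]
  rw [Fintype.expect_const, expect_dvd_val hp hτc]

/-- The averaged product of components, when one prime appears to a high power. -/
theorem norm_expect_prod_le_of_pow (s : Finset ℕ) (a : ℕ → ℕ) (F : ℕ → ℤ → ℂ)
    (hF : ∀ p ∈ s, PComp p (a p) (F p)) {p : ℕ} (hp : p ∈ s) {k b c τ : ℕ}
    (hac : a p = (k + 1) * b + c) (hc : 0 < c) (hcb : c ≤ b) (hτ : 0 < τ) (hkτ : k * τ < c)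
    (hτc : τ ≤ c) (g : Fin (k + 1) → ℤ) (hg : ∏ i, g i = ∏ r ∈ s.erase p, (r ^ a r : ℤ)) :
    ∃ (X : Type) (_ : Fintype X) (_ : Nonempty X) (x : X → ℤ),
      (∀ t, 0 ≤ x t ∧ x t ≤ p ^ c) ∧ ∀ n : ℤ,
      ‖𝔼 h : Fin (k + 1) → X, ∏ r ∈ s, F r (n + ∑ i, (p ^ b * g i) * x (h i))‖ ^ 2 ^ (k + 1) ≤
        k * ((p : ℝ) ^ τ)⁻¹ := by
  have hf := hF p hp
  have hpr := hf.prime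
  have : NeZero (p ^ c) := ⟨pow_ne_zero _ hpr.ne_zero⟩
  set x : ZMod (p ^ c) → ℤ := fun x => (x.val : ℤ) with hx
  refine ⟨ZMod (p ^ c), inferInstance, inferInstance, x, fun t => ⟨by positivity, ?_⟩, ?_⟩
  · simp only [hx]
    exact_mod_cast (ZMod.val_lt t).le
  intro n
  have hprod : ∏ i, ((p : ℤ) ^ b * g i) = p ^ ((k + 1) * b) * ∏ i, g i := by
    rw [Finset.prod_mul_distrib, Finset.prod_const, card_univ, Fintype.card_fin, ← pow_mul,
      mul_comm b]
  have hdeg : Deg (k + 1) fun h : Fin (k + 1) → ZMod (p ^ c) =>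
      ∏ r ∈ s.erase p, F r (n + ∑ i, (p ^ b * g i) * x (h i)) := by
    refine deg_prod _ _ fun r hr => (hF r (Finset.mem_of_mem_erase hr)).deg x (k + 1) n _ ?_
    rw [hprod, hg]
    exact Dvd.dvd.mul_left (Finset.dvd_prod_of_mem (fun r : ℕ => (r : ℤ) ^ a r) hr) _
  have hbox := box_lemma k (fun h : Fin (k + 1) → ZMod (p ^ c) =>
      F p (n + ∑ i, (p ^ b * g i) * x (h i))) _ hdeg
  have hsplit : ∀ h : Fin (k + 1) → ZMod (p ^ c),
      ∏ r ∈ s, F r (n + ∑ i, (p ^ b * g i) * x (h i)) = F p (n + ∑ i, (p ^ b * g i) * x (h i)) *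
        ∏ r ∈ s.erase p, F r (n + ∑ i, (p ^ b * g i) * x (h i)) := fun h =>
    (Finset.mul_prod_erase s _ hp).symm
  simp_rw [hsplit]
  refine hbox.trans ((Complex.re_le_norm _).trans ?_)
  simp_rw [kern_linear x (k + 1) (F p) n]
  have hmod : ∀ h : Fin (k + 1) → ZMod (p ^ c), (p ^ b : ℤ) ∣ ∑ i, (p ^ b * g i) * x (h i) :=
    fun h => Finset.dvd_sum fun i _ => Dvd.dvd.mul_right (dvd_mul_right _ _) _
  have hb : 0 < b := hc.trans_le hcb
  have hpb : (p : ℤ) ∣ p ^ b := dvd_pow_self _ hb.ne'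
  by_cases hpn : (p : ℤ) ∣ n
  · have h0 : ∀ h h' : Fin (k + 1) → ZMod (p ^ c),
        DD (List.ofFn fun i => (p ^ b * g i) * (x (h' i) - x (h i))) (F p)
          (n + ∑ i, (p ^ b * g i) * x (h i)) = 0 := fun h h' =>
      hf.DD_zero _ (dvd_add hpn (hpb.trans (hmod h)))
    simp_rw [h0]
    rw [Finset.expect_const_zero, Finset.expect_const_zero, norm_zero]
    positivity
  obtain ⟨y, hy⟩ := hf.exists_inv b hpn
  obtain ⟨ψ, hψ, hψf⟩ := hf.exists_primitive_addChar hc hac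
    (hcb.trans (Nat.le_mul_of_pos_left b (Nat.succ_pos k)))
  set u : ℤ := -((∏ i, g i) * y ^ (k + 1)) with hu
  have hup : ¬ (p : ℤ) ∣ u := by
    rw [hu, dvd_neg]
    intro h
    rcases hf.prime_int.dvd_mul.mp h with h | h
    · rw [hg] at h
      obtain ⟨r, hr, hr'⟩ := (Prime.dvd_finsetProd_iff hf.prime_int _).mp h
      have h1 := hf.prime_int.dvd_of_dvd_pow hr'
      have h2 := (Nat.prime_dvd_prime_iff_eq hpr (hF r (Finset.mem_of_mem_erase hr)).prime).mp
        (by exact_mod_cast h1)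
      exact Finset.ne_of_mem_erase hr h2.symm
    · have h1 := hf.prime_int.dvd_of_dvd_pow h
      have h2 : (p : ℤ) ∣ n * y - 1 := hpb.trans hy
      have h3 : (p : ℤ) ∣ 1 := by
        have := dvd_sub (Dvd.dvd.mul_left h1 n) h2
        rwa [sub_sub_cancel] at this
      exact hf.prime_int.not_isUnit (isUnit_of_dvd_one h3)
  obtain ⟨v, hv⟩ := hf.exists_inv c hup
  have huv : (u : ZMod (p ^ c)) * v = 1 := by
    have h1 : (((u * v - 1 : ℤ)) : ZMod (p ^ c)) = 0 :=
      (ZMod.intCast_zmod_eq_zero_iff_dvd _ _).mpr (by exact_mod_cast hv)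
    push_cast at h1
    exact sub_eq_zero.mp h1
  have hker : ∀ h h' : Fin (k + 1) → ZMod (p ^ c),
      DD (List.ofFn fun i => (p ^ b * g i) * (x (h' i) - x (h i))) (F p)
        (n + ∑ i, (p ^ b * g i) * x (h i)) =
      ψ ((u : ZMod (p ^ c)) * (k.factorial * ∏ i, (h' - h) i)) := by
    intro h h'
    have hlp : (List.ofFn fun i => ((p : ℤ) ^ b * g i) * (x (h' i) - x (h i))).prod =
        p ^ ((k + 1) * b) * ((∏ i, g i) * ∏ i, (x (h' i) - x (h i))) := by
      rw [List.prod_ofFn, Finset.prod_mul_distrib, hprod, mul_assoc]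
    rw [hf.DD_eq (c := b) (e := (k + 1) * b) (by rw [Ne, List.ofFn_eq_nil_iff]; omega) hb ?_ hlp
      (by rw [hac]; omega) (y := y) ?_, hψf]
    · rw [List.length_ofFn, Nat.add_sub_cancel]
      congr 1
      simp only [hu, hx, Pi.sub_apply]
      push_cast
      simp only [ZMod.natCast_val, ZMod.cast_id', id]
      ring
    · intro δ hδ
      obtain ⟨i, rfl⟩ := (List.mem_ofFn' _ _).mp hδ
      exact Dvd.dvd.mul_right (dvd_mul_right _ _) _
    · rw [add_mul, add_sub_right_comm]
      exact dvd_add hy (Dvd.dvd.mul_right (hmod h) _)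
  simp_rw [hker]
  have hshift : ∀ h : Fin (k + 1) → ZMod (p ^ c),
      𝔼 h' : Fin (k + 1) → ZMod (p ^ c), ψ ((u : ZMod (p ^ c)) * (k.factorial * ∏ i, (h' - h) i)) =
      𝔼 d : Fin (k + 1) → ZMod (p ^ c), ψ ((u : ZMod (p ^ c)) * (k.factorial * ∏ i, d i)) := fun h =>
    Fintype.expect_equiv (Equiv.subRight h) _ _ fun h' => rfl
  simp_rw [hshift]
  rw [Fintype.expect_const, expect_cons, Finset.expect_comm]
  simp_rw [Fin.prod_univ_succ, Fin.cons_zero, Fin.cons_succ]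
  have hin : ∀ t : Fin k → ZMod (p ^ c),
      𝔼 y : ZMod (p ^ c), ψ ((u : ZMod (p ^ c)) * (k.factorial * (y * ∏ i, t i))) =
      ((if (k.factorial : ZMod (p ^ c)) * ∏ i, t i = 0 then (1 : ℝ) else 0 : ℝ) : ℂ) := by
    intro t
    have h1 : ∀ y : ZMod (p ^ c), ψ ((u : ZMod (p ^ c)) * (k.factorial * (y * ∏ i, t i))) =
        ψ.mulShift (u * (k.factorial * ∏ i, t i)) y := fun y => by
      rw [AddChar.mulShift_apply]
      congr 1
      ring
    simp_rw [h1]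
    split_ifs with h
    · rw [h, mul_zero, AddChar.mulShift_zero]
      simp
    · rw [Fintype.expect_eq_sum_div_card, AddChar.sum_eq_zero_of_ne_one, zero_div,
        Complex.ofReal_zero]
      apply hψ
      intro h0
      apply h
      rw [← one_mul ((k.factorial : ZMod (p ^ c)) * ∏ i, t i), ← huv, mul_comm (u : ZMod (p ^ c)),
        mul_assoc, h0, mul_zero]
  simp_rw [hin]
  refine (RCLike.norm_expect_le (K := ℂ)).trans ?_
  refine le_trans (le_of_eq ?_) (expect_factorial_mul_prod_le hpr hτ hτc hkτ)
  refine Finset.expect_congr rfl fun t _ => ?_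
  rw [Complex.norm_real, Real.norm_of_nonneg (by split_ifs <;> norm_num)]

end LandauPage

namespace LandauPage
open Finset
open scoped BigOperators ComplexConjugate

/-- A primitive character is the product of its components at the primes dividing the modulus. -/
theorem exists_components {q : ℕ} [NeZero q] (χ : DirichletCharacter ℂ q) (hχ : χ.IsPrimitive) :
    ∃ F : ℕ → ℤ → ℂ, (∀ p ∈ q.primeFactors, PComp p (q.factorization p) (F p)) ∧
      ∀ n : ℤ, χ n = ∏ p ∈ q.primeFactors, F p n := by
  have hq : q ≠ 0 := NeZero.ne q
  have hidem : ∀ p : ℕ, ∃ e : ℤ, p ∈ q.primeFactors →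
      (p ^ q.factorization p : ℤ) ∣ e - 1 ∧ ((q / p ^ q.factorization p : ℕ) : ℤ) ∣ e := by
    intro p
    by_cases hp : p ∈ q.primeFactors
    · have hpr := Nat.prime_of_mem_primeFactors hp
      have hc := (Nat.isCoprime_iff_coprime.mpr (Nat.coprime_ordCompl hpr hq)).pow_left
        (m := q.factorization p)
      obtain ⟨u, v, huv⟩ := hc
      exact ⟨v * ((q / p ^ q.factorization p : ℕ) : ℤ), fun _ =>
        ⟨⟨-u, by rw [← huv]; ring⟩, dvd_mul_left _ _⟩⟩
    · exact ⟨0, fun h => absurd h hp⟩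
  choose e he using hidem
  have hqsplit : ∀ p, (q : ℤ) = p ^ q.factorization p * ((q / p ^ q.factorization p : ℕ) : ℤ) :=
    fun p => by exact_mod_cast (Nat.ordProj_mul_ordCompl_eq_self q p).symm
  have hχeq : ∀ x y : ℤ, (q : ℤ) ∣ x - y → χ x = χ y := fun x y h => by
    have h1 := (ZMod.intCast_zmod_eq_zero_iff_dvd _ _).mpr h
    push_cast at h1
    rw [sub_eq_zero.mp h1]
  have hχne : ∀ x : ℤ, IsUnit (x : ZMod q) ↔ ∀ r ∈ q.primeFactors, ¬ (r : ℤ) ∣ x := by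
    intro x
    rw [ZMod.coe_int_isUnit_iff_isCoprime]
    constructor
    · intro h r hr hrx
      have h1 : (r : ℤ) ∣ q := by exact_mod_cast Nat.dvd_of_mem_primeFactors hr
      exact (Nat.prime_iff_prime_int.mp (Nat.prime_of_mem_primeFactors hr)).not_isUnit
        (h.isUnit_of_dvd' h1 hrx)
    · intro h
      rw [Int.isCoprime_iff_gcd_eq_one]
      refine Nat.coprime_of_dvd fun r hr hrq hrx => ?_
      exact h r (Nat.mem_primeFactors.mpr ⟨hr, hrq, hq⟩) (Int.natCast_dvd.mpr hrx)
  refine ⟨fun p n => χ ((1 + e p * (n - 1) : ℤ) : ZMod q), fun p hp => ?_, fun n => ?_⟩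
  · have hpr := Nat.prime_of_mem_primeFactors hp
    obtain ⟨h1, h2⟩ := he p hp
    have ha : q.factorization p ≠ 0 := by
      have := (hpr.dvd_iff_one_le_factorization hq).mp (Nat.dvd_of_mem_primeFactors hp)
      omega
    have hpe : (p : ℤ) ∣ e p - 1 := (dvd_pow_self _ ha).trans h1
    have hpx : ∀ x : ℤ, (p : ℤ) ∣ 1 + e p * (x - 1) ↔ (p : ℤ) ∣ x := fun x => by
      rw [show 1 + e p * (x - 1) = x + (e p - 1) * (x - 1) by ring]
      exact dvd_add_left (Dvd.dvd.mul_right hpe _)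
    refine ⟨hpr, Nat.pos_of_ne_zero ha, fun x y => ?_, fun x y h => ?_, fun x h => ?_, fun x h => ?_,
      ?_⟩
    · rw [← map_mul, ← Int.cast_mul]
      apply hχeq
      rw [show 1 + e p * (x * y - 1) - (1 + e p * (x - 1)) * (1 + e p * (y - 1)) =
        (e p - 1) * e p * (-(x - 1) * (y - 1)) by ring, hqsplit p]
      exact Dvd.dvd.mul_right (mul_dvd_mul h1 h2) _
    · apply hχeq
      rw [show 1 + e p * (x - 1) - (1 + e p * (y - 1)) = (x - y) * e p by ring, hqsplit p]
      exact mul_dvd_mul h h2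
    · apply χ.map_nonunit
      rw [hχne]
      push Not
      exact ⟨p, hp, (hpx x).mpr h⟩
    · have hu : IsUnit ((1 + e p * (x - 1) : ℤ) : ZMod q) := by
        rw [hχne]
        intro r hr hrx
        by_cases hrp : r = p
        · subst hrp
          exact h ((hpx x).mp hrx)
        · have hrpr := Nat.prime_of_mem_primeFactors hr
          have hre : (r : ℤ) ∣ e p := by
            refine Dvd.dvd.trans ?_ h2
            rw [Int.natCast_dvd_natCast]
            have h3 : r ∣ p ^ q.factorization p * (q / p ^ q.factorization p) := by
              rw [Nat.ordProj_mul_ordCompl_eq_self]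
              exact Nat.dvd_of_mem_primeFactors hr
            rcases hrpr.dvd_mul.mp h3 with h3 | h3
            · exact absurd ((Nat.prime_dvd_prime_iff_eq hrpr hpr).mp (hrpr.dvd_of_dvd_pow h3)) hrp
            · exact h3
          have h4 := (Int.dvd_add_left (Dvd.dvd.mul_right hre (x - 1))).mp hrx
          exact (Nat.prime_iff_prime_int.mp hrpr).not_isUnit (isUnit_of_dvd_one h4)
      have := DirichletCharacter.unit_norm_eq_one χ hu.unit
      simpa using this
    · by_contra! hcon
      have hdvd : q / p ∣ q := Nat.div_dvd_of_dvd (Nat.dvd_of_mem_primeFactors hp)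
      have hpa : (p : ℤ) ^ q.factorization p = p ^ (q.factorization p - 1) * p := by
        rw [← pow_succ]; congr 1; omega
      have hqp : ((q / p : ℕ) : ℤ) =
          p ^ (q.factorization p - 1) * ((q / p ^ q.factorization p : ℕ) : ℤ) := by
        have h3 := hqsplit p
        rw [hpa] at h3
        have h4 : (q : ℤ) = p * ((q / p : ℕ) : ℤ) := by
          exact_mod_cast (Nat.mul_div_cancel' (Nat.dvd_of_mem_primeFactors hp)).symm
        have hp0 : (p : ℤ) ≠ 0 := by exact_mod_cast hpr.ne_zero
        apply mul_left_cancel₀ hp0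
        rw [← h4, h3]
        ring
      have hfac : χ.FactorsThrough (q / p) := by
        rw [DirichletCharacter.factorsThrough_iff_ker_unitsMap hdvd]
        intro u hu
        rw [MonoidHom.mem_ker] at hu ⊢
        obtain ⟨U, hU⟩ : ∃ U : ℤ, (U : ZMod q) = u := ⟨(u : ZMod q).val, by simp⟩
        have hU1 : ((q / p : ℕ) : ℤ) ∣ U - 1 := by
          rw [← ZMod.intCast_zmod_eq_zero_iff_dvd]
          have h3 := congrArg Units.val hu
          rw [ZMod.unitsMap_val, ← hU, Units.val_one, ZMod.cast_intCast hdvd] at h3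
          push_cast
          rw [h3, sub_self]
        obtain ⟨w, hw⟩ := hU1
        have hUp : ¬ (p : ℤ) ∣ U := (hχne U).mp (hU ▸ u.isUnit) p hp
        have hU2 : U = 1 + p ^ (q.factorization p - 1) *
            (((q / p ^ q.factorization p : ℕ) : ℤ) * w) := by
          rw [← mul_assoc, ← hqp, ← hw]
          ring
        have h4 := hcon (((q / p ^ q.factorization p : ℕ) : ℤ) * w) (hU2 ▸ hUp)
        rw [← hU2] at h4
        apply Units.ext
        rw [MulChar.coe_toUnitHom, Units.val_one, ← hU, ← h4]
        apply hχeq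
        rw [show U - (1 + e p * (U - 1)) = (e p - 1) * (-(U - 1)) by ring, hqsplit p]
        refine mul_dvd_mul h1 ?_
        rw [dvd_neg, hw, hqp]
        exact Dvd.dvd.mul_right (dvd_mul_left _ _) _
      have h3 := DirichletCharacter.conductor_dvd_of_mem_conductorSet (χ := χ) hfac
      rw [(DirichletCharacter.isPrimitive_def χ).mp hχ] at h3
      have h4 := Nat.le_of_dvd (Nat.div_pos (Nat.le_of_dvd (Nat.pos_of_ne_zero hq)
        (Nat.dvd_of_mem_primeFactors hp)) hpr.pos) h3
      exact absurd h4 (not_le.mpr (Nat.div_lt_self (Nat.pos_of_ne_zero hq) hpr.one_lt))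
  · rw [← map_prod, ← Int.cast_prod]
    apply hχeq
    have hqprod : (q : ℤ) = ∏ p ∈ q.primeFactors, (p ^ q.factorization p : ℤ) := by
      exact_mod_cast (Nat.prod_factorization_pow_eq_self hq).symm
    rw [hqprod]
    refine Finset.prod_dvd_of_coprime (fun p hp r hr hpr => ?_) fun p hp => ?_
    · exact (Nat.isCoprime_iff_coprime.mpr ((Nat.coprime_primes (Nat.prime_of_mem_primeFactors hp)
        (Nat.prime_of_mem_primeFactors hr)).mpr hpr)).pow
    · have h1 : ∀ r ∈ q.primeFactors.erase p,
          1 + e r * (n - 1) ≡ 1 [ZMOD p ^ q.factorization p] := by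
        intro r hr
        have hrq := Finset.mem_of_mem_erase hr
        have h2 : (p ^ q.factorization p : ℤ) ∣ e r := by
          refine Dvd.dvd.trans ?_ (he r hrq).2
          have h3 : p ^ q.factorization p ∣ q / r ^ q.factorization r := by
            refine Nat.Coprime.dvd_of_dvd_mul_left (Nat.Coprime.pow _ (q.factorization r) ((Nat.coprime_primes
              (Nat.prime_of_mem_primeFactors hp) (Nat.prime_of_mem_primeFactors hrq)).mpr
              (Finset.ne_of_mem_erase hr).symm)) ?_
            rw [Nat.ordProj_mul_ordCompl_eq_self]
            exact Nat.ordProj_dvd q p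
          exact_mod_cast h3
        rw [Int.modEq_iff_dvd]
        rw [show 1 - (1 + e r * (n - 1)) = e r * (-(n - 1)) by ring]
        exact Dvd.dvd.mul_right h2 _
      have h2 : ∏ r ∈ q.primeFactors.erase p, (1 + e r * (n - 1)) ≡ 1
          [ZMOD p ^ q.factorization p] := Int.ModEq.prod_one h1
      rw [← Finset.mul_prod_erase _ _ hp]
      have h3 : 1 + e p * (n - 1) ≡ n [ZMOD p ^ q.factorization p] := by
        rw [Int.modEq_iff_dvd, show n - (1 + e p * (n - 1)) = (e p - 1) * (-(n - 1)) by ring]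
        exact Dvd.dvd.mul_right (he p hp).1 _
      have h4 := h3.mul h2
      rw [mul_one] at h4
      exact h4.dvd

end LandauPage

namespace LandauPage
open Finset
open scoped BigOperators ComplexConjugate

lemma exists_dvd_between {r : ℕ} {Y P : ℝ} (hY : 1 ≤ Y) (hr : Y < r)
    (hP : ∀ p : ℕ, p.Prime → p ∣ r → (p : ℝ) ≤ P) : ∃ d, d ∣ r ∧ Y < d ∧ (d : ℝ) ≤ Y * P := by
  have hex : ∃ d : ℕ, d ∣ r ∧ Y < d := ⟨r, dvd_rfl, hr⟩
  obtain ⟨h1, h2⟩ := Nat.find_spec hex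
  set d := Nat.find hex with hd
  refine ⟨d, h1, h2, ?_⟩
  have hd1 : d ≠ 1 := by
    intro h
    rw [h, Nat.cast_one] at h2
    linarith
  obtain ⟨p, hp, hpd⟩ := Nat.exists_prime_and_dvd hd1
  have hd0 : 0 < d := by
    rcases Nat.eq_zero_or_pos d with h | h
    · rw [h, Nat.cast_zero] at h2
      linarith
    · exact h
  have h3 : ((d / p : ℕ) : ℝ) ≤ Y := by
    have := Nat.find_min hex (Nat.div_lt_self hd0 hp.one_lt)
    push Not at this
    exact this ((Nat.div_dvd_of_dvd hpd).trans h1)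
  have h4 : (d : ℝ) = ((d / p : ℕ) : ℝ) * p := by exact_mod_cast (Nat.div_mul_cancel hpd).symm
  rw [h4]
  exact mul_le_mul h3 (hP p hp (hpd.trans h1)) (Nat.cast_nonneg _) (by linarith)

lemma exists_factors {Y P : ℝ} (hY : 1 ≤ Y) (hP1 : 1 ≤ P) : ∀ (k r : ℕ), r ≠ 0 → (r : ℝ) ≤ Y ^ k →
    (∀ p : ℕ, p.Prime → p ∣ r → (p : ℝ) ≤ P) →
    ∃ g : Fin k → ℕ, ∏ i, g i = r ∧ ∀ i, (g i : ℝ) ≤ Y * P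
  | 0, r, h0, hr, _ => by
    rw [pow_zero] at hr
    have : r ≤ 1 := by exact_mod_cast hr
    exact ⟨Fin.elim0, by simp; omega, fun i => i.elim0⟩
  | k + 1, r, h0, hr, hP => by
    have hYP : 1 ≤ Y * P := one_le_mul_of_one_le_of_one_le hY hP1
    by_cases hrY : (r : ℝ) ≤ Y
    · refine ⟨Fin.cons r fun _ => 1, by simp [Fin.prod_univ_succ], fun i => ?_⟩
      refine Fin.cases ?_ (fun j => ?_) i
      · rw [Fin.cons_zero]
        exact hrY.trans (le_mul_of_one_le_right (by linarith) hP1)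
      · rw [Fin.cons_succ, Nat.cast_one]
        exact hYP
    · obtain ⟨d, h1, h2, h3⟩ := exists_dvd_between hY (not_le.mp hrY) hP
      have hd0 : (0 : ℝ) < d := by linarith
      have h4 : (r : ℝ) = ((r / d : ℕ) : ℝ) * d := by exact_mod_cast (Nat.div_mul_cancel h1).symm
      have h5 : r / d ≠ 0 := by
        intro h
        rw [h, Nat.cast_zero, zero_mul] at h4
        exact h0 (by exact_mod_cast h4)
      obtain ⟨g, hg, hg'⟩ := exists_factors hY hP1 k (r / d) h5 (by
        have h6 : ((r / d : ℕ) : ℝ) * Y ≤ Y ^ k * Y := by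
          rw [← pow_succ]
          refine le_trans ?_ hr
          rw [h4]
          exact mul_le_mul_of_nonneg_left h2.le (Nat.cast_nonneg _)
        exact le_of_mul_le_mul_right h6 (by linarith))
        fun p hp hpr => hP p hp (hpr.trans (Nat.div_dvd_of_dvd h1))
      refine ⟨Fin.cons d g, ?_, fun i => ?_⟩
      · rw [Fin.prod_univ_succ, Fin.cons_zero]
        simp_rw [Fin.cons_succ]
        rw [hg, Nat.mul_div_cancel' h1]
      · refine Fin.cases ?_ (fun j => ?_) i
        · rwa [Fin.cons_zero]
        · rw [Fin.cons_succ]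
          exact hg' j

lemma norm_sum_sub_shift_le (f : ℤ → ℂ) (hf : ∀ x, ‖f x‖ ≤ 1) (M : ℤ) (N σ : ℕ) :
    ‖∑ j ∈ range N, f (M + j) - ∑ j ∈ range N, f (M + j + σ)‖ ≤ 2 * σ := by
  induction σ with
  | zero => simp
  | succ σ ih =>
    have h1 : ∑ j ∈ range N, f (M + j + σ) - ∑ j ∈ range N, f (M + j + (σ + 1 : ℕ)) =
        f (M + σ) - f (M + N + σ) := by
      have h2 := Finset.sum_range_succ (fun j : ℕ => f (M + j + σ)) N
      have h3 := Finset.sum_range_succ' (fun j : ℕ => f (M + j + σ)) N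
      rw [h2] at h3
      have h4 : ∀ j : ℕ, f (M + (j + 1 : ℕ) + σ) = f (M + j + (σ + 1 : ℕ)) := fun j => by
        congr 1; push_cast; ring
      simp_rw [h4] at h3
      rw [Nat.cast_zero, add_zero] at h3
      linear_combination h3
    rw [show ∑ j ∈ range N, f (M + j) - ∑ j ∈ range N, f (M + j + (σ + 1 : ℕ)) =
      (∑ j ∈ range N, f (M + j) - ∑ j ∈ range N, f (M + j + σ)) +
        (f (M + σ) - f (M + N + σ)) by rw [← h1]; ring]
    refine (norm_add_le _ _).trans ?_
    have := norm_sub_le (f (M + σ)) (f (M + N + σ))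
    have h5 := hf (M + σ)
    have h6 := hf (M + N + σ)
    push_cast
    linarith

lemma norm_sum_le_of_expect (f : ℤ → ℂ) (hf : ∀ x, ‖f x‖ ≤ 1) {X : Type*} [Fintype X] [Nonempty X]
    (σ : X → ℤ) {B ε : ℝ} (hσ : ∀ x, 0 ≤ σ x ∧ (σ x : ℝ) ≤ B) (hε : ∀ n, ‖𝔼 x, f (n + σ x)‖ ≤ ε)
    (M : ℤ) (N : ℕ) : ‖∑ j ∈ range N, f (M + j)‖ ≤ N * ε + 2 * B := by
  have h1 : ∑ j ∈ range N, f (M + j) =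
      (𝔼 x, (∑ j ∈ range N, f (M + j) - ∑ j ∈ range N, f (M + j + σ x))) +
        ∑ j ∈ range N, 𝔼 x, f (M + j + σ x) := by
    rw [Finset.expect_sub_distrib, Fintype.expect_const, Finset.expect_sum_comm]
    ring
  rw [h1]
  refine (norm_add_le _ _).trans ?_
  rw [add_comm]
  refine add_le_add ?_ ?_
  · refine (norm_sum_le _ _).trans ?_
    refine (Finset.sum_le_card_nsmul _ _ ε fun j _ => hε _).trans ?_
    rw [card_range, nsmul_eq_mul]
  · refine (RCLike.norm_expect_le (K := ℂ)).trans ?_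
    refine (Finset.expect_le_expect (g := fun _ => 2 * B) fun x _ => ?_).trans
      (Fintype.expect_const _).le
    obtain ⟨s, hs⟩ := Int.eq_ofNat_of_zero_le (hσ x).1
    have h2 := norm_sum_sub_shift_le f hf M N s
    have h3 := (hσ x).2
    rw [hs] at h3 ⊢
    refine h2.trans ?_
    have : (s : ℝ) ≤ B := by exact_mod_cast h3
    linarith

lemma sum_char_period {q : ℕ} [NeZero q] {χ : DirichletCharacter ℂ q} (hχ : χ ≠ 1) (M : ℤ) :
    ∑ j ∈ range q, χ ((M + j : ℤ) : ZMod q) = 0 := by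
  rw [← MulChar.sum_eq_zero_of_ne_one hχ]
  refine Finset.sum_nbij' (fun j : ℕ => ((M + j : ℤ) : ZMod q)) (fun x => (x - M).val)
    (fun j _ => mem_univ _) (fun x _ => mem_range.mpr (ZMod.val_lt _)) (fun j hj => ?_)
    (fun x _ => ?_) fun j _ => rfl
  · push_cast
    rw [add_sub_cancel_left, ZMod.val_cast_of_lt (mem_range.mp hj)]
  · push_cast
    rw [ZMod.natCast_zmod_val, add_sub_cancel]

lemma norm_sum_char_le {q : ℕ} [NeZero q] {χ : DirichletCharacter ℂ q} (hχ : χ ≠ 1) (N : ℕ) :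
    ∀ M : ℤ, ‖∑ j ∈ range N, χ ((M + j : ℤ) : ZMod q)‖ ≤ q := by
  induction N using Nat.strong_induction_on with
  | _ N ih =>
    intro M
    by_cases hN : N < q
    · refine (norm_sum_le _ _).trans ((Finset.sum_le_card_nsmul _ _ 1 fun j _ =>
        χ.norm_le_one _).trans ?_)
      rw [card_range, nsmul_eq_mul, mul_one]
      exact_mod_cast hN.le
    · obtain ⟨N', rfl⟩ : ∃ N', N = q + N' := ⟨N - q, by omega⟩
      have h1 := ih N' (by have := NeZero.pos q; omega) (M + q)
      rw [Finset.sum_range_add, sum_char_period hχ, zero_add]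
      have h2 : ∀ j : ℕ, M + ((q + j : ℕ) : ℤ) = M + q + j := fun j => by push_cast; ring
      simp_rw [h2]
      exact h1

end LandauPage

namespace LandauPage
open Finset
open scoped BigOperators ComplexConjugate

lemma le_of_pow_le_pow {x y z : ℝ} {n : ℕ} (hn : n ≠ 0) (hy : 0 ≤ y) (h : x ^ n ≤ z)
    (hz : z ≤ y ^ n) : x ≤ y :=
  le_of_pow_le_pow_left₀ hn hy (h.trans hz)

lemma norm_sum_char_le_of_large_primes {q : ℕ} [NeZero q] (χ : DirichletCharacter ℂ q)
    (hχ : χ.IsPrimitive) {Y P V ε : ℝ} (hY : 1 ≤ Y) (hP : 1 ≤ P) (hV : 1 ≤ V) {k : ℕ} (hk : 0 < k)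
    (hq : (q : ℝ) ≤ Y ^ k) (hsm : ∀ p : ℕ, p.Prime → p ∣ q → (p : ℝ) ≤ P)
    (hbig : V < ((∏ p ∈ q.primeFactors.filter fun p => 16 ^ (k + 2) ≤ p, p : ℕ) : ℝ))
    (hε : 0 ≤ ε) (hVε : V ^ (-(1 / 4) : ℝ) ≤ ε ^ 2 ^ k) (M : ℤ) (N : ℕ) :
    ‖∑ j ∈ range N, χ ((M + j : ℤ) : ZMod q)‖ ≤ N * ε + 2 * (k * (Y * P * (V * P))) := by
  have hq0 : q ≠ 0 := NeZero.ne q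
  set S := q.primeFactors.filter fun p => 16 ^ (k + 2) ≤ p with hS
  have hSp : ∀ p ∈ S, p.Prime := fun p hp =>
    Nat.prime_of_mem_primeFactors (Finset.mem_filter.mp hp).1
  have hSq : ∏ p ∈ S, p ∣ q :=
    (Finset.prod_dvd_prod_of_subset _ _ _ (Finset.filter_subset _ _)).trans
      (Nat.prod_primeFactors_dvd q)
  have hSsq : Squarefree (∏ p ∈ S, p) := by
    refine Squarefree.squarefree_of_dvd (Finset.prod_dvd_prod_of_subset _ _ _
      (Finset.filter_subset (fun p => 16 ^ (k + 2) ≤ p) q.primeFactors)) ?_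
    rw [← Nat.radical_eq_prod_primeFactors]
    exact UniqueFactorizationMonoid.squarefree_radical
  obtain ⟨d, hd, hd1, hd2⟩ := exists_dvd_between hV hbig
    fun p hp h => hsm p hp (h.trans hSq)
  have hdsq : Squarefree d := hSsq.squarefree_of_dvd hd
  have hdq : d ∣ q := hd.trans hSq
  have hd0 : d ≠ 0 := hdsq.ne_zero
  have hprod : ∏ p ∈ d.primeFactors, p = d := Nat.prod_primeFactors_of_squarefree hdsq
  have hts : d.primeFactors ⊆ q.primeFactors := Nat.primeFactors_mono hdq hq0
  have hqd0 : q / d ≠ 0 := (Nat.div_pos (Nat.le_of_dvd (Nat.pos_of_ne_zero hq0) hdq)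
    (Nat.pos_of_ne_zero hd0)).ne'
  obtain ⟨g, hg, hg'⟩ := exists_factors hY hP k (q / d) hqd0
    (le_trans (by exact_mod_cast Nat.div_le_self q d) hq)
    fun p hp h => hsm p hp (h.trans (Nat.div_dvd_of_dvd hdq))
  have hgz : ∏ i, ((g i : ℕ) : ℤ) = ((q / d : ℕ) : ℤ) := by rw [← hg]; push_cast; rfl
  obtain ⟨F, hF, hχF⟩ := exists_components χ hχ
  have hfac : ∀ p : ℕ, p.Prime → ∀ e : ℕ, ((p : ℤ) ^ e ∣ ∏ i, ((g i : ℕ) : ℤ)) ↔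
      e ≤ q.factorization p - d.factorization p := by
    intro p hp e
    rw [hgz, show ((p : ℤ) ^ e) = ((p ^ e : ℕ) : ℤ) by push_cast; rfl, Int.natCast_dvd_natCast,
      hp.pow_dvd_iff_le_factorization hqd0, Nat.factorization_div hdq, Finsupp.tsub_apply]
  obtain ⟨X, hX, hX', c, hc, hcb⟩ := norm_expect_prod_le q.primeFactors d.primeFactors hts
    (fun p => q.factorization p) F hF hk (fun i => (g i : ℤ)) (fun p hp => by
      have hpp := Nat.prime_of_mem_primeFactors hp
      have hdp : d.factorization p = 1 := by
        have h1 := hdsq.natFactorization_le_one p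
        have h2 := (hpp.dvd_iff_one_le_factorization hd0).mp (Nat.dvd_of_mem_primeFactors hp)
        omega
      have hqp := (hpp.dvd_iff_one_le_factorization hq0).mp
        ((Nat.dvd_of_mem_primeFactors hp).trans hdq)
      refine ⟨?_, ?_, ?_⟩
      · have h1 := (Nat.dvd_of_mem_primeFactors hp).trans hd
        obtain ⟨r, hr, hr'⟩ := (Prime.dvd_finsetProd_iff hpp.prime _).mp h1
        have h2 := (Nat.prime_dvd_prime_iff_eq hpp (hSp r hr)).mp hr'
        subst h2
        exact (Finset.mem_filter.mp hr).2
      · rw [hfac p hpp, hdp]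
      · rw [hfac p hpp, hdp]
        omega) fun p hp => by
      have hpp := Nat.prime_of_mem_primeFactors (Finset.mem_sdiff.mp hp).1
      have hdp : d.factorization p = 0 := Nat.factorization_eq_zero_of_not_dvd fun h =>
        (Finset.mem_sdiff.mp hp).2 (Nat.mem_primeFactors.mpr ⟨hpp, h, hd0⟩)
      rw [hfac p hpp, hdp, Nat.sub_zero]
  refine norm_sum_le_of_expect (fun n => χ n) (fun n => χ.norm_le_one _)
    (fun h : Fin k → X => ∑ i, (g i : ℤ) * c (h i)) (fun h => ⟨?_, ?_⟩) (fun n => ?_) M N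
  · exact Finset.sum_nonneg fun i _ => mul_nonneg (Int.natCast_nonneg _) (hc _).1
  · push_cast
    refine (Finset.sum_le_card_nsmul _ _ (Y * P * (V * P)) fun i _ => ?_).trans ?_
    · refine mul_le_mul (hg' i) ?_ (by exact_mod_cast (hc _).1) (by positivity)
      refine le_trans ?_ hd2
      have h1 := (hc (h i)).2
      have h2 : ∏ p ∈ d.primeFactors, (p : ℤ) = d := by rw [← Nat.cast_prod, hprod]
      rw [h2] at h1
      exact_mod_cast h1
    · rw [card_univ, Fintype.card_fin, nsmul_eq_mul]
  · simp_rw [hχF]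
    refine le_of_pow_le_pow (pow_ne_zero k two_ne_zero) hε (hcb n) ?_
    rw [hprod]
    refine le_trans ?_ hVε
    exact Real.rpow_le_rpow_of_nonpos (by linarith) hd1.le (by norm_num)

lemma norm_sum_char_le_of_prime_power {q : ℕ} [NeZero q] (χ : DirichletCharacter ℂ q)
    (hχ : χ.IsPrimitive) {Y P ε : ℝ} (hY : 1 ≤ Y) (hP : 1 ≤ P) {k : ℕ}
    (hq : (q : ℝ) ≤ Y ^ (k + 1)) (hsm : ∀ p : ℕ, p.Prime → p ∣ q → (p : ℝ) ≤ P)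
    {p b c τ : ℕ} (hp : p ∈ q.primeFactors) (hac : q.factorization p = (k + 1) * b + c)
    (hc : 0 < c) (hcb : c ≤ b) (hτ : 0 < τ) (hkτ : k * τ < c) (hτc : τ ≤ c)
    (hε : 0 ≤ ε) (hVε : k * ((p : ℝ) ^ τ)⁻¹ ≤ ε ^ 2 ^ (k + 1)) (M : ℤ) (N : ℕ) :
    ‖∑ j ∈ range N, χ ((M + j : ℤ) : ZMod q)‖ ≤
      N * ε + 2 * ((k + 1) * (p ^ b * (Y * P) * p ^ b)) := by
  have hq0 : q ≠ 0 := NeZero.ne q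
  have hpp := Nat.prime_of_mem_primeFactors hp
  have hdvd : q / p ^ q.factorization p ∣ q := Nat.ordCompl_dvd q p
  have h0 : q / p ^ q.factorization p ≠ 0 := (Nat.ordCompl_pos p hq0).ne'
  obtain ⟨g, hg, hg'⟩ := exists_factors hY hP (k + 1) _ h0
    (le_trans (by exact_mod_cast Nat.div_le_self q _) hq)
    fun r hr h => hsm r hr (h.trans hdvd)
  obtain ⟨F, hF, hχF⟩ := exists_components χ hχ
  have hgz : ∏ i, ((g i : ℕ) : ℤ) = ∏ r ∈ q.primeFactors.erase p, (r ^ q.factorization r : ℤ) := by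
    have h1 : ∏ r ∈ q.primeFactors.erase p, r ^ q.factorization r = q / p ^ q.factorization p := by
      have h2 := Finset.mul_prod_erase q.primeFactors (fun r => r ^ q.factorization r) hp
      have h3 : ∏ r ∈ q.primeFactors, r ^ q.factorization r = q :=
        Nat.prod_factorization_pow_eq_self hq0
      rw [h3] at h2
      exact (Nat.div_eq_of_eq_mul_right (pow_pos hpp.pos _) h2.symm).symm
    rw [← h1] at hg
    exact_mod_cast hg
  obtain ⟨X, hX, hX', x, hx, hxb⟩ := norm_expect_prod_le_of_pow q.primeFactors
    (fun r => q.factorization r) F hF hp hac hc hcb hτ hkτ hτc (fun i => (g i : ℤ)) hgz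
  have hp1 : (1 : ℝ) ≤ p := by exact_mod_cast hpp.one_lt.le
  refine norm_sum_le_of_expect (fun n => χ n) (fun n => χ.norm_le_one _)
    (fun h : Fin (k + 1) → X => ∑ i, (p ^ b * g i : ℤ) * x (h i)) (fun h => ⟨?_, ?_⟩)
    (fun n => ?_) M N
  · exact Finset.sum_nonneg fun i _ => mul_nonneg (by positivity) (hx _).1
  · push_cast
    refine (Finset.sum_le_card_nsmul _ _ (p ^ b * (Y * P) * p ^ b) fun i _ => ?_).trans ?_
    · refine mul_le_mul (mul_le_mul_of_nonneg_left (hg' i) (by positivity)) ?_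
        (by exact_mod_cast (hx _).1) (by positivity)
      refine le_trans ?_ (pow_le_pow_right₀ hp1 hcb)
      exact_mod_cast (hx (h i)).2
    · rw [card_univ, Fintype.card_fin, nsmul_eq_mul]
      push_cast
      rfl
  · simp_rw [hχF]
    exact le_of_pow_le_pow (pow_ne_zero _ two_ne_zero) hε (hxb n) hVε

end LandauPage

namespace LandauPage
open Finset
open scoped BigOperators ComplexConjugate

lemma exists_split_exponent {a κ : ℕ} (hκ : 0 < κ) (ha : 2 * (κ ^ 2 + κ * (κ + 1)) ≤ a) :
    ∃ b c τ : ℕ, a = κ * b + c ∧ 0 < c ∧ c ≤ b ∧ 0 < τ ∧ (κ - 1) * τ < c ∧ τ ≤ c ∧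
      (κ + 1) * b ≤ a + κ ∧ a ≤ 2 * (κ * (κ + 1) * τ) := by
  obtain ⟨b, hb1, hb2⟩ : ∃ b, a ≤ (κ + 1) * b ∧ (κ + 1) * b ≤ a + κ := by
    refine ⟨(a + κ) / (κ + 1), ?_, Nat.mul_div_le _ _⟩
    have := Nat.lt_mul_div_succ (a + κ) (Nat.succ_pos κ)
    rw [Nat.mul_succ] at this
    simp only [Nat.succ_eq_add_one] at this
    omega
  have h1 : (κ + 1) * (κ * b) ≤ κ * (a + κ) := by nlinarith
  have hκb : κ * b < a := by
    by_contra! h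
    nlinarith
  obtain ⟨c, hc⟩ : ∃ c, a = κ * b + c := ⟨a - κ * b, by omega⟩
  have hc2 : a ≤ (κ + 1) * c + κ ^ 2 := by nlinarith
  obtain ⟨τ, hτ1, hτ2⟩ : ∃ τ, κ * τ < c ∧ c ≤ κ * τ + κ := by
    refine ⟨(c - 1) / κ, ?_, ?_⟩
    · have := Nat.mul_div_le (c - 1) κ
      omega
    · have := Nat.lt_mul_div_succ (c - 1) hκ
      rw [Nat.mul_succ] at this
      omega
  have h3 : a ≤ 2 * (κ * (κ + 1) * τ) := by nlinarith
  have hτ0 : 0 < τ := by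
    rcases Nat.eq_zero_or_pos τ with h | h
    · rw [h, mul_zero, mul_zero] at h3
      have : 0 < κ ^ 2 := pow_pos hκ 2
      omega
    · exact h
  refine ⟨b, c, τ, hc, by omega, by nlinarith, hτ0, ?_, ?_, hb2, h3⟩
  · exact lt_of_le_of_lt (Nat.mul_le_mul_right _ (Nat.sub_le _ _)) hτ1
  · nlinarith

lemma card_le_of_prod_le {S : Finset ℕ} (hS : ∀ p ∈ S, p.Prime) {B : ℝ}
    (h : ((∏ p ∈ S, p : ℕ) : ℝ) ≤ Real.exp B) : (S.card : ℝ) ≤ 2 * B := by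
  have h1 : (2 : ℝ) ^ S.card ≤ ((∏ p ∈ S, p : ℕ) : ℝ) := by
    have : 2 ^ S.card ≤ ∏ p ∈ S, p := by
      rw [← Finset.prod_const]
      exact Finset.prod_le_prod' fun p hp => (hS p hp).two_le
    exact_mod_cast this
  have h2 := Real.log_le_log (by positivity) (h1.trans h)
  rw [Real.log_exp, Real.log_pow] at h2
  have := Real.log_two_gt_d9
  nlinarith [Nat.cast_nonneg (α := ℝ) S.card]

lemma exists_large_prime_power {q : ℕ} {Λ W : ℝ} (hW : 0 < W) (hΛ : Λ < Real.log q)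
    (hΛ0 : 0 ≤ Λ) (hω : (q.primeFactors.card : ℝ) ≤ W) :
    ∃ p ∈ q.primeFactors, Λ ≤ W * (q.factorization p * Real.log p) := by
  by_contra! h
  have h1 : Real.log q = ∑ p ∈ q.primeFactors, q.factorization p * Real.log p := by
    rw [Real.log_nat_eq_sum_factorization]
    rfl
  have h2 : Real.log q ≤ ∑ p ∈ q.primeFactors, Λ / W := by
    rw [h1]
    refine Finset.sum_le_sum fun p hp => ?_
    rw [le_div_iff₀ hW]
    linarith [h p hp]
  rw [Finset.sum_const, nsmul_eq_mul] at h2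
  have h3 : (q.primeFactors.card : ℝ) * (Λ / W) ≤ W * (Λ / W) :=
    mul_le_mul_of_nonneg_right hω (by positivity)
  rw [mul_div_cancel₀ _ hW.ne'] at h3
  linarith

set_option maxHeartbeats 1000000 in
/-- Short sums of primitive characters to smooth moduli exhibit cancellation. -/
theorem norm_sum_char_smooth_le {x Λ : ℝ} (hx : 10 ^ 20 ≤ x) (hΛ1 : x ^ 99 ≤ 100 * Λ)
    (hΛ3 : x ^ 100 ≤ 100 * Real.log x * Λ) {q : ℕ} [NeZero q]
    (χ : DirichletCharacter ℂ q) (hχ : χ.IsPrimitive) (hχ1 : χ ≠ 1)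
    (hq : Real.log q ≤ 2 * x ^ 100) (hsm : ∀ p : ℕ, p.Prime → p ∣ q → (p : ℝ) ≤ Real.exp Λ)
    (M : ℤ) (N : ℕ) (hN : Real.exp (1000 * Λ) ≤ N) :
    ‖∑ j ∈ range N, χ ((M + j : ℤ) : ZMod q)‖ ≤ N * Real.exp (-x ^ 10) := by
  have hq0 : q ≠ 0 := NeZero.ne q
  have hx1 : (1 : ℝ) ≤ x := by linarith
  have hpow : ∀ m n : ℕ, m ≤ n → x ^ m ≤ x ^ n := fun m n h => pow_le_pow_right₀ hx1 h
  have hup : ∀ n m : ℕ, n + 1 = m → 10 ^ 20 * x ^ n ≤ x ^ m := fun n m h => by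
    rw [← h, pow_succ, mul_comm]
    exact mul_le_mul_of_nonneg_left hx (by positivity)
  have h98 : x ^ 98 ≤ Λ := by linarith [(hup 98 99 rfl), pow_nonneg (zero_le_one.trans hx1) 98]
  have hΛx : ∀ n, n ≤ 98 → x ^ n ≤ Λ := fun n hn => (hpow n 98 hn).trans h98
  have hΛ0 : 1 ≤ Λ := by simpa using hΛx 0 (by norm_num)
  have hfin : ∀ B : ℝ, B ≤ Real.exp (900 * Λ) →
      N * Real.exp (-x ^ 18) + B ≤ N * Real.exp (-x ^ 10) := by
    intro B hB
    have h1 : B ≤ N * Real.exp (-x ^ 18) := by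
      have h2 : Real.exp (900 * Λ) ≤ Real.exp (1000 * Λ) * Real.exp (-x ^ 18) := by
        rw [← Real.exp_add]
        exact Real.exp_le_exp.mpr (by linarith [hΛx 18 (by norm_num)])
      exact hB.trans (h2.trans (mul_le_mul_of_nonneg_right hN (Real.exp_pos _).le))
    have h3 : 2 * Real.exp (-x ^ 18) ≤ Real.exp (-x ^ 10) := by
      have h4 : (2 : ℝ) ≤ Real.exp 1 := by linarith [Real.add_one_le_exp (1 : ℝ)]
      calc 2 * Real.exp (-x ^ 18) ≤ Real.exp 1 * Real.exp (-x ^ 18) :=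
            mul_le_mul_of_nonneg_right h4 (Real.exp_pos _).le
        _ ≤ Real.exp (-x ^ 10) := by
            rw [← Real.exp_add]
            refine Real.exp_le_exp.mpr ?_
            have := hup 10 11 rfl
            have := hpow 11 18 (by norm_num)
            have := hpow 0 10 (by norm_num)
            norm_num at *
            linarith
    have hN0 : (0 : ℝ) ≤ N := Nat.cast_nonneg N
    nlinarith
  by_cases hqΛ : Real.log q ≤ Λ
  · refine (norm_sum_char_le hχ1 N M).trans ?_
    have hq1 : (0 : ℝ) < q := by exact_mod_cast Nat.pos_of_ne_zero hq0
    have h1 : (q : ℝ) ≤ Real.exp Λ := (Real.log_le_iff_le_exp hq1).mp hqΛ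
    have h2 : Real.exp Λ ≤ Real.exp (900 * Λ) := Real.exp_le_exp.mpr (by linarith)
    have h3 := hfin q (h1.trans h2)
    have : (0 : ℝ) ≤ N * Real.exp (-x ^ 18) := by positivity
    linarith
  push Not at hqΛ
  obtain ⟨k, hk1, hk2, hk0⟩ : ∃ k : ℕ, 2 * x ^ 100 ≤ (k + 1) * (200 * Λ) ∧
      (k : ℝ) ≤ Real.log x + 2 ∧ 0 < k := by
    refine ⟨⌈x ^ 100 / (100 * Λ)⌉₊ + 1, ?_, ?_, Nat.succ_pos _⟩
    · have h1 := Nat.le_ceil (x ^ 100 / (100 * Λ))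
      rw [div_le_iff₀ (by positivity)] at h1
      push_cast
      nlinarith
    · have h1 := (Nat.ceil_lt_add_one (a := x ^ 100 / (100 * Λ)) (by positivity)).le
      have h2 : x ^ 100 / (100 * Λ) ≤ Real.log x := by
        rw [div_le_iff₀ (by positivity)]
        linarith
      push_cast
      linarith
  have h2k : (2 : ℝ) ^ (k + 1) ≤ 8 * x := by
    have h1 : (2 : ℝ) ^ k ≤ 4 * x := by
      have h2 : (2 : ℝ) ^ (k : ℝ) ≤ (2 : ℝ) ^ (Real.log x + 2) :=
        Real.rpow_le_rpow_of_exponent_le one_le_two hk2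
      rw [Real.rpow_natCast, Real.rpow_add two_pos] at h2
      have h3 : (2 : ℝ) ^ Real.log x ≤ x := by
        calc (2 : ℝ) ^ Real.log x ≤ (Real.exp 1) ^ Real.log x :=
              Real.rpow_le_rpow two_pos.le (by linarith [Real.add_one_le_exp (1 : ℝ)])
                (Real.log_nonneg hx1)
          _ = x := by rw [Real.exp_one_rpow, Real.exp_log (by linarith)]
      have h4 : (2 : ℝ) ^ (2 : ℝ) = 4 := by norm_num
      rw [h4] at h2
      linarith
    rw [pow_succ]
    linarith
  have hκx : ((k : ℝ) + 1) ≤ 8 * x := by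
    refine le_trans ?_ h2k
    exact_mod_cast (Nat.lt_two_pow_self (n := k + 1)).le
  have h16 : ((16 ^ (k + 1 + 2) : ℕ) : ℝ) ≤ 2 ^ 20 * x ^ 4 := by
    have h1 : ((16 ^ (k + 1 + 2) : ℕ) : ℝ) = 256 * ((2 : ℝ) ^ (k + 1)) ^ 4 := by
      rw [← pow_mul, mul_comm (k + 1), pow_mul]
      push_cast
      norm_num [pow_succ]
      ring
    have h2 : ((2 : ℝ) ^ (k + 1)) ^ 4 ≤ (8 * x) ^ 4 := pow_le_pow_left₀ (by positivity) h2k 4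
    rw [h1]
    nlinarith
  have hqY : (q : ℝ) ≤ Real.exp (200 * Λ) ^ (k + 1) := by
    rw [← Real.exp_nat_mul, ← Real.log_le_iff_le_exp (by exact_mod_cast Nat.pos_of_ne_zero hq0)]
    push_cast
    linarith
  have hY : 1 ≤ Real.exp (200 * Λ) := Real.one_le_exp (by linarith)
  have hP : 1 ≤ Real.exp Λ := Real.one_le_exp (by linarith)
  have hεpow : Real.exp (-(x ^ 18 * (8 * x))) ≤ Real.exp (-x ^ 18) ^ 2 ^ (k + 1) := by
    rw [← Real.exp_nat_mul]
    refine Real.exp_le_exp.mpr ?_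
    push_cast
    have := mul_le_mul_of_nonneg_left h2k (by positivity : 0 ≤ x ^ 18)
    linarith
  have h16x : 2 * (8 * x) ≤ Real.exp Λ := by
    have h1 := hup 1 2 rfl
    have h2 := hΛx 2 (by norm_num)
    have h3 := Real.add_one_le_exp Λ
    norm_num at h1
    linarith
  by_cases hbig : Real.exp (x ^ 25) <
      ((∏ p ∈ q.primeFactors.filter fun p => 16 ^ (k + 1 + 2) ≤ p, p : ℕ) : ℝ)
  · refine (norm_sum_char_le_of_large_primes χ hχ hY hP (Real.one_le_exp (by positivity))
      (Nat.succ_pos k) hqY hsm hbig (Real.exp_pos (-x ^ 18)).le ?_ M N).trans (hfin _ ?_)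
    · refine le_trans ?_ hεpow
      rw [← Real.exp_mul]
      refine Real.exp_le_exp.mpr ?_
      have h1 := hup 19 20 rfl
      have h2 := hpow 20 25 (by norm_num)
      have h3 : x ^ 19 = x ^ 18 * x := pow_succ _ _
      have h4 : 0 ≤ x ^ 18 * x := by positivity
      linarith
    · rw [← Real.exp_add, ← Real.exp_add, ← Real.exp_add]
      push_cast
      have h1 : 2 * ((k : ℝ) + 1) ≤ Real.exp Λ := by linarith
      calc 2 * (((k : ℝ) + 1) * Real.exp (200 * Λ + Λ + (x ^ 25 + Λ)))
          = (2 * ((k : ℝ) + 1)) * Real.exp (200 * Λ + Λ + (x ^ 25 + Λ)) := by ring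
        _ ≤ Real.exp Λ * Real.exp (200 * Λ + Λ + (x ^ 25 + Λ)) :=
            mul_le_mul_of_nonneg_right h1 (Real.exp_pos _).le
        _ ≤ Real.exp (900 * Λ) := by
            rw [← Real.exp_add]
            exact Real.exp_le_exp.mpr (by linarith [hΛx 25 (by norm_num)])
  push Not at hbig
  have hSp : ∀ p ∈ q.primeFactors.filter fun p => 16 ^ (k + 1 + 2) ≤ p, p.Prime := fun p hp =>
    Nat.prime_of_mem_primeFactors (Finset.mem_filter.mp hp).1
  have h425 : 2 ^ 20 * x ^ 4 ≤ x ^ 25 := by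
    have h1 := hup 4 5 rfl
    have h2 := hpow 5 25 (by norm_num)
    have h3 : 0 ≤ x ^ 4 := by positivity
    linarith
  have hω : (q.primeFactors.card : ℝ) ≤ x ^ 26 := by
    have h1 := card_le_of_prod_le hSp hbig
    have h2 : (q.primeFactors.filter fun p => ¬ 16 ^ (k + 1 + 2) ≤ p).card ≤ 16 ^ (k + 1 + 2) := by
      rw [← Finset.card_range (16 ^ (k + 1 + 2))]
      refine Finset.card_le_card fun p hp => ?_
      simp only [Finset.mem_filter, Finset.card_range, not_le] at hp
      exact Finset.mem_range.mpr hp.2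
    have h3 := Finset.card_filter_add_card_filter_not (s := q.primeFactors)
      (fun p => 16 ^ (k + 1 + 2) ≤ p)
    have h4 : (q.primeFactors.card : ℝ) ≤ 2 * x ^ 25 + 2 ^ 20 * x ^ 4 := by
      rw [← h3]
      push_cast
      refine add_le_add h1 (le_trans ?_ h16)
      exact_mod_cast h2
    have h5 := hup 25 26 rfl
    have h6 : 0 ≤ x ^ 25 := by positivity
    linarith
  obtain ⟨p, hp, hpa⟩ := exists_large_prime_power (by positivity) hqΛ (by linarith) hω
  have hpp := Nat.prime_of_mem_primeFactors hp
  have hp0 : (0 : ℝ) < p := by exact_mod_cast hpp.pos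
  have hlp : Real.log p ≤ x ^ 25 := by
    by_cases hps : 16 ^ (k + 1 + 2) ≤ p
    · rw [Real.log_le_iff_le_exp hp0]
      refine le_trans ?_ hbig
      have h1 : p ∣ ∏ p ∈ q.primeFactors.filter fun p => 16 ^ (k + 1 + 2) ≤ p, p :=
        Finset.dvd_prod_of_mem (fun p => p) (Finset.mem_filter.mpr ⟨hp, hps⟩)
      exact_mod_cast Nat.le_of_dvd (Finset.prod_pos fun p hp => (hSp p hp).pos) h1
    · have h1 := Real.log_le_sub_one_of_pos hp0
      have h2 : (p : ℝ) ≤ ((16 ^ (k + 1 + 2) : ℕ) : ℝ) := by exact_mod_cast (not_le.mp hps).le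
      linarith
  have hlp0 : 0 < Real.log p := Real.log_pos (by exact_mod_cast hpp.one_lt)
  set a := q.factorization p with ha
  have halp : x ^ 72 ≤ a * Real.log p := by
    have h1 : x ^ 26 * x ^ 72 ≤ x ^ 26 * (a * Real.log p) := by
      rw [← pow_add]
      exact h98.trans hpa
    exact le_of_mul_le_mul_left h1 (by positivity)
  have halq : a * Real.log p ≤ Real.log q := by
    have h1 : p ^ a ≤ q := Nat.le_of_dvd (Nat.pos_of_ne_zero hq0) (Nat.ordProj_dvd q p)
    rw [← Real.log_pow]
    refine Real.log_le_log (by positivity) ?_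
    exact_mod_cast h1
  have ha47 : x ^ 47 ≤ a := by
    have h1 : x ^ 25 * x ^ 47 ≤ x ^ 25 * a := by
      rw [← pow_add]
      refine halp.trans ?_
      rw [mul_comm]
      exact mul_le_mul_of_nonneg_right hlp (Nat.cast_nonneg a)
    exact le_of_mul_le_mul_left h1 (by positivity)
  have hκ2 : ((k : ℝ) + 1) ^ 2 ≤ 64 * x ^ 2 := by
    have := pow_le_pow_left₀ (by positivity) hκx 2
    linarith [mul_pow 8 x 2]
  have hκa : 2 * ((k + 1) ^ 2 + (k + 1) * (k + 1 + 1)) ≤ a := by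
    have h1 : (2 * (((k : ℝ) + 1) ^ 2 + ((k : ℝ) + 1) * ((k : ℝ) + 1 + 1))) ≤ a := by
      refine le_trans ?_ ha47
      have h2 := hup 2 3 rfl
      have h3 := hpow 3 47 (by norm_num)
      nlinarith [Nat.cast_nonneg (α := ℝ) k]
    exact_mod_cast h1
  obtain ⟨b, c, τ, hac, hc, hcb, hτ, hkτ, hτc, hb, haτ⟩ :=
    exists_split_exponent (Nat.succ_pos k) hκa
  have hbl : b * Real.log p ≤ 201 * Λ := by
    have h1 : (((k : ℝ) + 1) + 1) * b ≤ a + (k + 1) := by exact_mod_cast hb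
    have h2 : (((k : ℝ) + 1) + 1) * (b * Real.log p) ≤ (((k : ℝ) + 1) + 1) * (201 * Λ) := by
      have h3 := mul_le_mul_of_nonneg_right h1 hlp0.le
      have h4 : ((k : ℝ) + 1) * Real.log p ≤ ((k : ℝ) + 1) * Λ :=
        mul_le_mul_of_nonneg_left (hlp.trans (hΛx 25 (by norm_num))) (by positivity)
      nlinarith
    exact le_of_mul_le_mul_left h2 (by positivity)
  have hpb : (p : ℝ) ^ b ≤ Real.exp (201 * Λ) := by
    rw [← Real.log_le_iff_le_exp (by positivity), Real.log_pow]
    exact hbl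
  have hτl : x ^ 69 ≤ τ * Real.log p := by
    have h1 : (a : ℝ) ≤ 2 * (((k : ℝ) + 1) * ((k : ℝ) + 1 + 1) * τ) := by exact_mod_cast haτ
    have h2 : ((k : ℝ) + 1) * ((k : ℝ) + 1 + 1) ≤ 128 * x ^ 2 := by
      have h3 : 0 ≤ ((k : ℝ) + 1) * k := by positivity
      linarith [sq ((k : ℝ) + 1), mul_add ((k : ℝ) + 1) k 1, mul_add ((k : ℝ) + 1) (k + 1) 1]
    have h3 : (a : ℝ) * Real.log p ≤ 256 * x ^ 2 * (τ * Real.log p) := by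
      have h4 : (a : ℝ) ≤ 256 * x ^ 2 * τ := by
        have := mul_le_mul_of_nonneg_right h2 (Nat.cast_nonneg (α := ℝ) τ)
        linarith
      have := mul_le_mul_of_nonneg_right h4 hlp0.le
      linarith
    have h5 : 256 * x ^ 2 * x ^ 69 ≤ x ^ 72 := by
      have h6 := hup 71 72 rfl
      have h7 : x ^ 71 = x ^ 2 * x ^ 69 := by rw [← pow_add]
      have h8 : 0 ≤ x ^ 71 := by positivity
      linarith
    exact le_of_mul_le_mul_left (h5.trans (halp.trans h3)) (by positivity)
  refine (norm_sum_char_le_of_prime_power χ hχ hY hP hqY hsm hp hac hc hcb hτ hkτ hτc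
    (Real.exp_pos (-x ^ 18)).le ?_ M N).trans (hfin _ ?_)
  · refine le_trans ?_ hεpow
    have h1 : (k : ℝ) ≤ Real.exp (8 * x) := by
      linarith [Real.add_one_le_exp (8 * x)]
    have h2 : ((p : ℝ) ^ τ)⁻¹ ≤ Real.exp (-x ^ 69) := by
      rw [Real.exp_neg]
      refine inv_anti₀ (Real.exp_pos _) ?_
      rw [← Real.le_log_iff_exp_le (by positivity), Real.log_pow]
      exact hτl
    refine (mul_le_mul h1 h2 (by positivity) (Real.exp_pos _).le).trans ?_
    rw [← Real.exp_add]
    refine Real.exp_le_exp.mpr ?_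
    have h3 := hup 19 20 rfl
    have h4 := hpow 20 69 (by norm_num)
    have h5 : x ^ 19 = x ^ 18 * x := pow_succ _ _
    have h6 := hpow 1 19 (by norm_num)
    rw [pow_one] at h6
    have h7 : 0 ≤ x ^ 19 := by positivity
    linarith
  · rw [← Real.exp_add]
    have h1 : 2 * ((k : ℝ) + 1) ≤ Real.exp Λ := by linarith
    have h3 : (p : ℝ) ^ b * Real.exp (200 * Λ + Λ) * p ^ b ≤
        Real.exp (201 * Λ) * Real.exp (200 * Λ + Λ) * Real.exp (201 * Λ) := by
      gcongr
    calc 2 * (((k : ℝ) + 1) * (p ^ b * Real.exp (200 * Λ + Λ) * p ^ b))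
        = (2 * ((k : ℝ) + 1)) * (p ^ b * Real.exp (200 * Λ + Λ) * p ^ b) := by ring
      _ ≤ Real.exp Λ * (Real.exp (201 * Λ) * Real.exp (200 * Λ + Λ) * Real.exp (201 * Λ)) :=
          mul_le_mul h1 h3 (by positivity) (Real.exp_pos _).le
      _ ≤ Real.exp (900 * Λ) := by
          rw [← Real.exp_add, ← Real.exp_add, ← Real.exp_add]
          exact Real.exp_le_exp.mpr (by linarith)

end LandauPage

namespace LandauPage
open Finset Set Filter Topology
open scoped BigOperators ComplexConjugate

lemma hasDerivAt_cpow_neg {t : ℝ} (ht : 0 < t) (s : ℂ) :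
    HasDerivAt (fun y : ℝ => (y : ℂ) ^ (-s)) (-s * (t : ℂ) ^ (-s - 1)) t := by
  by_cases hs : s = 0
  · subst hs
    simpa using hasDerivAt_const t (1 : ℂ)
  · exact hasDerivAt_ofReal_cpow_const ht.ne' (neg_ne_zero.mpr hs)

lemma norm_cpow_neg {t : ℝ} (ht : 0 < t) (s : ℂ) : ‖(t : ℂ) ^ (-s)‖ = t ^ (-s.re) := by
  rw [Complex.norm_cpow_eq_rpow_re_of_pos ht, Complex.neg_re]

lemma norm_deriv_cpow_neg {t : ℝ} (ht : 0 < t) (s : ℂ) :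
    ‖-s * (t : ℂ) ^ (-s - 1)‖ = ‖s‖ * t ^ (-s.re - 1) := by
  rw [norm_mul, norm_neg, Complex.norm_cpow_eq_rpow_re_of_pos ht]
  simp

lemma norm_cpow_neg_sub_le {a b : ℝ} (ha : 0 < a) (hab : a ≤ b) {s : ℂ} (hs : 0 < s.re) :
    ‖(a : ℂ) ^ (-s) - (b : ℂ) ^ (-s)‖ ≤ ‖s‖ / s.re * (a ^ (-s.re) - b ^ (-s.re)) := by
  have hpos : ∀ x ∈ Set.Icc a b, 0 < x := fun x hx => ha.trans_le hx.1
  have hder : ∀ x ∈ Set.Icc a b,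
      HasDerivAt (fun y : ℝ => (y : ℂ) ^ (-s) - (a : ℂ) ^ (-s)) (-s * (x : ℂ) ^ (-s - 1)) x :=
    fun x hx => (hasDerivAt_cpow_neg (hpos x hx) s).sub_const _
  have hB : ∀ x ∈ Set.Icc a b,
      HasDerivAt (fun y : ℝ => ‖s‖ / s.re * (a ^ (-s.re) - y ^ (-s.re)))
        (‖s‖ * x ^ (-s.re - 1)) x := fun x hx => by
    have h1 := ((Real.hasDerivAt_rpow_const (p := -s.re) (Or.inl (hpos x hx).ne')).const_sub
      (a ^ (-s.re))).const_mul (‖s‖ / s.re)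
    refine h1.congr_deriv ?_
    rw [neg_mul, neg_neg, ← mul_assoc, div_mul_cancel₀ _ hs.ne']
  have := image_norm_le_of_norm_deriv_right_le_deriv_boundary'
    (f := fun y : ℝ => (y : ℂ) ^ (-s) - (a : ℂ) ^ (-s))
    (f' := fun x : ℝ => -s * (x : ℂ) ^ (-s - 1)) (a := a) (b := b)
    (B := fun y : ℝ => ‖s‖ / s.re * (a ^ (-s.re) - y ^ (-s.re)))
    (B' := fun x : ℝ => ‖s‖ * x ^ (-s.re - 1))
    (fun x hx => (hder x hx).continuousAt.continuousWithinAt)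
    (fun x hx => (hder x ⟨hx.1, hx.2.le⟩).hasDerivWithinAt) (by simp)
    (fun x hx => (hB x hx).continuousAt.continuousWithinAt)
    (fun x hx => (hB x ⟨hx.1, hx.2.le⟩).hasDerivWithinAt)
    (fun x hx => (norm_deriv_cpow_neg (hpos x ⟨hx.1, hx.2.le⟩) s).le)
    (Set.right_mem_Icc.mpr hab)
  rw [norm_sub_rev]
  exact this

lemma norm_cpow_neg_sub_le' {a b : ℝ} (ha : 0 < a) (hab : a ≤ b) {s : ℂ} (hs : -1 ≤ s.re) :
    ‖(a : ℂ) ^ (-s) - (b : ℂ) ^ (-s)‖ ≤ ‖s‖ * a ^ (-s.re - 1) * (b - a) := by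
  have hpos : ∀ x ∈ Set.Icc a b, 0 < x := fun x hx => ha.trans_le hx.1
  have := norm_image_sub_le_of_norm_deriv_le_segment'
    (f := fun y : ℝ => (y : ℂ) ^ (-s)) (f' := fun x : ℝ => -s * (x : ℂ) ^ (-s - 1))
    (a := a) (b := b) (C := ‖s‖ * a ^ (-s.re - 1))
    (fun x hx => (hasDerivAt_cpow_neg (hpos x hx) s).hasDerivWithinAt)
    (fun x hx => by
      rw [norm_deriv_cpow_neg (hpos x ⟨hx.1, hx.2.le⟩) s]
      refine mul_le_mul_of_nonneg_left ?_ (norm_nonneg _)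
      exact Real.rpow_le_rpow_of_nonpos ha hx.1 (by linarith)) b (Set.right_mem_Icc.mpr hab)
  rw [norm_sub_rev]
  exact this

/-- Analytic continuation of a series representation to the half-plane `0 < re s`. -/
lemma eq_tsum_of_forall_one_lt_re {F : ℂ → ℂ} {f : ℕ → ℂ → ℂ} (hF : Differentiable ℂ F)
    (hf : ∀ n, Differentiable ℂ (f n))
    (hb : ∀ δ R : ℝ, 0 < δ → 0 < R → ∃ K, ∀ n s, δ < s.re → ‖s‖ < R →
      ‖f n s‖ ≤ K * ((n : ℝ) + 1) ^ (-δ - 1))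
    (heq : ∀ s : ℂ, 1 < s.re → F s = ∑' n, f n s) {s : ℂ} (hs : 0 < s.re) :
    HasSum (fun n => f n s) (F s) := by
  set δ := min (s.re / 2) (1 / 2) with hδ
  set R := ‖s‖ + 3 with hR
  have hδ0 : 0 < δ := by positivity
  have hδs : δ < s.re := (min_le_left _ _).trans_lt (by linarith)
  have hδ1 : δ < 1 := (min_le_right _ _).trans_lt (by norm_num)
  obtain ⟨K, hK⟩ := hb δ R hδ0 (by positivity)
  set U : Set ℂ := {z | δ < z.re} ∩ Metric.ball 0 R with hU
  have hUo : IsOpen U := (isOpen_lt continuous_const Complex.continuous_re).inter Metric.isOpen_ball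
  have hUc : Convex ℝ U := (convex_halfSpace_re_gt δ).inter (convex_ball 0 R)
  have hu : Summable fun n : ℕ => K * ((n : ℝ) + 1) ^ (-δ - 1) := by
    have h1 : Summable fun n : ℕ => ((n : ℝ)) ^ (-δ - 1) :=
      Real.summable_nat_rpow.mpr (by linarith)
    have h2 := (summable_nat_add_iff 1).mpr h1
    simpa using h2.mul_left K
  have hbU : ∀ n z, z ∈ U → ‖f n z‖ ≤ K * ((n : ℝ) + 1) ^ (-δ - 1) := fun n z hz =>
    hK n z hz.1 (by simpa using hz.2)
  have hsU : s ∈ U := ⟨hδs, by simp [hR]⟩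
  have hd := Complex.differentiableOn_tsum_of_summable_norm hu (fun n => (hf n).differentiableOn) hUo hbU
  have h2U : (2 : ℂ) ∈ U := by
    refine ⟨?_, ?_⟩
    · simp only [Set.mem_ofPred_eq, Complex.re_ofNat]
      linarith
    · simp only [hR, Metric.mem_ball, dist_zero_right, Complex.norm_ofNat]
      linarith [norm_nonneg s]
  have hE : EqOn F (fun w => ∑' n, f n w) U := by
    refine (hF.differentiableOn.analyticOnNhd hUo).eqOn_of_preconnected_of_eventuallyEq
      (hd.analyticOnNhd hUo) hUc.isPreconnected h2U ?_
    have : {z : ℂ | 1 < z.re} ∈ 𝓝 (2 : ℂ) :=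
      (isOpen_lt continuous_const Complex.continuous_re).mem_nhds (by simp)
    filter_upwards [this] with z hz using heq z hz
  rw [hE hsU]
  exact (Summable.of_norm_bounded hu fun n => hbU n s hsU).hasSum

lemma sum_mul_cpow_eq (u : ℕ → ℂ) (s : ℂ) (N : ℕ) :
    ∑ j ∈ range N, u j * ((j : ℂ) + 1) ^ (-s) =
      (∑ j ∈ range N, u j) * ((N : ℂ) + 1) ^ (-s) +
      ∑ n ∈ range N, (∑ j ∈ range (n + 1), u j) *
        (((n : ℂ) + 1) ^ (-s) - ((n : ℂ) + 2) ^ (-s)) := by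
  induction N with
  | zero => simp
  | succ N ih =>
    rw [Finset.sum_range_succ, ih, Finset.sum_range_succ (fun n => (∑ j ∈ range (n + 1), u j) *
        (((n : ℂ) + 1) ^ (-s) - ((n : ℂ) + 2) ^ (-s))) N, Finset.sum_range_succ u N]
    push_cast
    have : ((N : ℂ) + 1 + 1) = N + 2 := by ring
    rw [this]
    ring

lemma sum_char_eq {q : ℕ} [NeZero q] {χ : DirichletCharacter ℂ q} (hχ : χ ≠ 1) (N : ℕ) :
    ‖∑ j ∈ range N, χ ((j + 1 : ℕ) : ZMod q)‖ ≤ q := by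
  have := norm_sum_char_le hχ N 1
  convert this using 4 with j
  push_cast
  ring_nf

lemma tendsto_dirichlet_sum {q : ℕ} [NeZero q] (χ : DirichletCharacter ℂ q) {s : ℂ}
    (hs : 1 < s.re) :
    Tendsto (fun N : ℕ => ∑ j ∈ range N, χ ((j + 1 : ℕ) : ZMod q) * ((j : ℂ) + 1) ^ (-s)) atTop
      (𝓝 (χ.LFunction s)) := by
  rw [DirichletCharacter.LFunction_eq_LSeries χ hs]
  have h1 := (ZMod.LSeriesSummable_of_one_lt_re χ hs).hasSum
  have h2 := (hasSum_nat_add_iff' 1).mpr h1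
  simp only [Finset.range_one, Finset.sum_singleton, LSeries.term_zero, sub_zero] at h2
  refine h2.tendsto_sum_nat.congr fun N => Finset.sum_congr rfl fun j _ => ?_
  rw [LSeries.term_of_ne_zero (Nat.succ_ne_zero j), Complex.cpow_neg, div_eq_mul_inv]
  push_cast
  rfl

lemma norm_natCast_succ_cpow (N : ℕ) (s : ℂ) :
    ‖((N : ℂ) + 1) ^ (-s)‖ = ((N : ℝ) + 1) ^ (-s.re) := by
  have := norm_cpow_neg (t := (N : ℝ) + 1) (by positivity) s
  push_cast at this
  exact this

lemma tendsto_natCast_succ_rpow {σ : ℝ} (hσ : 0 < σ) :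
    Tendsto (fun N : ℕ => ((N : ℝ) + 1) ^ (-σ)) atTop (𝓝 0) := by
  refine (tendsto_rpow_neg_atTop hσ).comp ?_
  exact tendsto_atTop_add_const_right _ _ tendsto_natCast_atTop_atTop

lemma differentiable_natCast_succ_cpow (N : ℕ) : Differentiable ℂ fun s : ℂ => ((N : ℂ) + 1) ^ (-s) := by
  intro s
  refine (differentiableAt_id.neg).const_cpow (Or.inl ?_)
  exact_mod_cast Nat.succ_ne_zero N

/-- Approximation of `L(s, χ)` by partial sums of its Dirichlet series for `0 < re s`. -/
theorem norm_LFunction_sub_sum_le {q : ℕ} [NeZero q] {χ : DirichletCharacter ℂ q} (hχ : χ ≠ 1)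
    {s : ℂ} (hs : 0 < s.re) (N : ℕ) :
    ‖χ.LFunction s - ∑ j ∈ range N, χ ((j + 1 : ℕ) : ZMod q) * ((j : ℂ) + 1) ^ (-s)‖ ≤
      q * (‖s‖ / s.re + 1) * ((N : ℝ) + 1) ^ (-s.re) := by
  set u : ℕ → ℂ := fun j => χ ((j + 1 : ℕ) : ZMod q) with hu
  have hS : ∀ N, ‖∑ j ∈ range N, u j‖ ≤ q := fun N => sum_char_eq hχ N
  set f : ℕ → ℂ → ℂ := fun n s => (∑ j ∈ range (n + 1), u j) *
    (((n : ℂ) + 1) ^ (-s) - ((n : ℂ) + 2) ^ (-s)) with hf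
  have hcast : ∀ (n : ℕ) (s : ℂ), ((n : ℂ) + 1) ^ (-s) - ((n : ℂ) + 2) ^ (-s) =
      (((n : ℝ) + 1 : ℝ) : ℂ) ^ (-s) - (((n : ℝ) + 2 : ℝ) : ℂ) ^ (-s) := fun n s => by
    push_cast
    rfl
  have hb : ∀ δ R : ℝ, 0 < δ → 0 < R → ∃ K, ∀ n (s : ℂ), δ < s.re → ‖s‖ < R →
      ‖f n s‖ ≤ K * ((n : ℝ) + 1) ^ (-δ - 1) := by
    intro δ R hδ hR
    refine ⟨q * R, fun n s hs hsR => ?_⟩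
    have h1 := norm_cpow_neg_sub_le' (a := (n : ℝ) + 1) (b := n + 2) (by positivity) (by linarith)
      (s := s) (by linarith)
    rw [← hcast] at h1
    have h2 : ((n : ℝ) + 1) ^ (-s.re - 1) ≤ ((n : ℝ) + 1) ^ (-δ - 1) :=
      Real.rpow_le_rpow_of_exponent_le (by linarith [Nat.cast_nonneg (α := ℝ) n]) (by linarith)
    have h3 : ((n : ℝ) + 2 - (n + 1)) = 1 := by ring
    rw [h3, mul_one] at h1
    calc ‖f n s‖ ≤ q * (‖s‖ * ((n : ℝ) + 1) ^ (-s.re - 1)) := by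
          rw [hf, norm_mul]
          exact mul_le_mul (hS _) h1 (norm_nonneg _) (Nat.cast_nonneg q)
      _ ≤ q * (R * ((n : ℝ) + 1) ^ (-δ - 1)) := by gcongr
      _ = _ := by ring
  have hd : ∀ n, Differentiable ℂ (f n) := fun n => by
    have h1 := differentiable_natCast_succ_cpow (n + 1)
    have h2 : (((n + 1 : ℕ) : ℂ) + 1) = (n : ℂ) + 2 := by push_cast; ring
    rw [h2] at h1
    exact ((differentiable_natCast_succ_cpow n).sub h1).const_mul _
  have heq : ∀ s : ℂ, 1 < s.re → χ.LFunction s = ∑' n, f n s := by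
    intro s hs
    have h1 := tendsto_dirichlet_sum χ hs
    have h2 : Summable fun n => f n s := by
      obtain ⟨K, hK⟩ := hb 1 (‖s‖ + 1) one_pos (by positivity)
      have h3 : Summable fun n : ℕ => ((n : ℝ)) ^ (-1 - 1 : ℝ) :=
        Real.summable_nat_rpow.mpr (by norm_num)
      have h4 := ((summable_nat_add_iff 1).mpr h3).mul_left K
      refine Summable.of_norm_bounded h4 fun n => ?_
      simpa using hK n s hs (by linarith)
    have h3 : Tendsto (fun N : ℕ => (∑ j ∈ range N, u j) * ((N : ℂ) + 1) ^ (-s)) atTop (𝓝 0) := by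
      refine squeeze_zero_norm (a := fun N : ℕ => q * ((N : ℝ) + 1) ^ (-s.re)) (fun N => ?_) ?_
      · rw [norm_mul, norm_natCast_succ_cpow]
        exact mul_le_mul_of_nonneg_right (hS N) (by positivity)
      · simpa using (tendsto_natCast_succ_rpow (σ := s.re) (by linarith)).const_mul (q : ℝ)
    have h4 := h3.add h2.hasSum.tendsto_sum_nat
    rw [zero_add] at h4
    refine tendsto_nhds_unique h1 (h4.congr fun N => ?_)
    exact (sum_mul_cpow_eq u s N).symm
  have hsum := eq_tsum_of_forall_one_lt_re
    (DirichletCharacter.differentiable_LFunction hχ) hd hb heq hs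
  rw [sum_mul_cpow_eq u s N]
  have htail : ‖χ.LFunction s - ∑ n ∈ range N, f n s‖ ≤
      q * (‖s‖ / s.re) * ((N : ℝ) + 1) ^ (-s.re) := by
    have h1 : Tendsto (fun M => ‖∑ n ∈ range M, f n s - ∑ n ∈ range N, f n s‖) atTop
        (𝓝 ‖χ.LFunction s - ∑ n ∈ range N, f n s‖) :=
      (hsum.tendsto_sum_nat.sub_const _).norm
    refine le_of_tendsto h1 ?_
    filter_upwards [eventually_ge_atTop N] with M hM
    obtain ⟨m, rfl⟩ := Nat.exists_eq_add_of_le hM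
    have h2 : ∀ m, ‖∑ n ∈ range (N + m), f n s - ∑ n ∈ range N, f n s‖ ≤
        q * (‖s‖ / s.re) * (((N : ℝ) + 1) ^ (-s.re) - (((N + m : ℕ) : ℝ) + 1) ^ (-s.re)) := by
      intro m
      induction m with
      | zero => simp
      | succ m ih =>
        rw [← add_assoc, Finset.sum_range_succ]
        have h3 := norm_cpow_neg_sub_le (a := ((N + m : ℕ) : ℝ) + 1) (b := ((N + m : ℕ) : ℝ) + 2)
          (by positivity) (by linarith) hs
        rw [← hcast] at h3
        have h4 : ‖f (N + m) s‖ ≤ q * (‖s‖ / s.re * ((((N + m : ℕ) : ℝ) + 1) ^ (-s.re) -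
            (((N + m : ℕ) : ℝ) + 2) ^ (-s.re))) := by
          rw [hf, norm_mul]
          exact mul_le_mul (hS _) h3 (norm_nonneg _) (Nat.cast_nonneg q)
        have h5 : (((N + m + 1 : ℕ) : ℝ) + 1) = ((N + m : ℕ) : ℝ) + 2 := by push_cast; ring
        rw [h5]
        calc _ = ‖(∑ n ∈ range (N + m), f n s - ∑ n ∈ range N, f n s) + f (N + m) s‖ := by
              congr 1; ring
          _ ≤ _ := norm_add_le _ _
          _ ≤ _ := add_le_add ih h4
          _ = _ := by ring
    refine (h2 m).trans ?_
    refine mul_le_mul_of_nonneg_left ?_ (by positivity)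
    have : 0 ≤ (((N + m : ℕ) : ℝ) + 1) ^ (-s.re) := by positivity
    linarith
  have hb0 : ‖(∑ j ∈ range N, u j) * ((N : ℂ) + 1) ^ (-s)‖ ≤ q * ((N : ℝ) + 1) ^ (-s.re) := by
    rw [norm_mul, norm_natCast_succ_cpow]
    exact mul_le_mul_of_nonneg_right (hS N) (by positivity)
  calc _ = ‖(χ.LFunction s - ∑ n ∈ range N, f n s) -
        (∑ j ∈ range N, u j) * ((N : ℂ) + 1) ^ (-s)‖ := by congr 1; ring
    _ ≤ _ := norm_sub_le _ _
    _ ≤ _ := add_le_add htail hb0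
    _ = _ := by ring

lemma norm_LFunction_le {q : ℕ} [NeZero q] {χ : DirichletCharacter ℂ q} (hχ : χ ≠ 1)
    {s : ℂ} (hs : 0 < s.re) : ‖χ.LFunction s‖ ≤ q * (‖s‖ / s.re + 1) := by
  simpa using norm_LFunction_sub_sum_le hχ hs 0

end LandauPage

namespace LandauPage
open Finset Set Filter Topology
open scoped BigOperators ComplexConjugate

/-- The entire function `(s - 1) ζ(s)`. -/
noncomputable def zetaOne : ℂ → ℂ := Function.update (fun s => (s - 1) * riemannZeta s) 1 1

lemma zetaOne_one : zetaOne 1 = 1 := Function.update_self ..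

lemma zetaOne_of_ne {s : ℂ} (hs : s ≠ 1) : zetaOne s = (s - 1) * riemannZeta s :=
  Function.update_of_ne hs ..

lemma differentiable_zetaOne : Differentiable ℂ zetaOne := by
  have h : zetaOne = DirichletCharacter.LFunctionTrivChar₁ 1 := by
    unfold zetaOne DirichletCharacter.LFunctionTrivChar₁
    rw [DirichletCharacter.LFunctionTrivChar, DirichletCharacter.LFunction_modOne_eq]
    simp
  rw [h]
  exact DirichletCharacter.differentiable_LFunctionTrivChar₁ 1

lemma norm_zetaOne_term_le {a : ℝ} (ha : 0 < a) {s : ℂ} (hs : -1 ≤ s.re) :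
    ‖(s - 1) * (a : ℂ) ^ (-s) - (a : ℂ) ^ (1 - s) + ((a + 1 : ℝ) : ℂ) ^ (1 - s)‖ ≤
      ‖s - 1‖ * (‖s‖ * a ^ (-s.re - 1)) := by
  have hder : ∀ x ∈ Set.Icc a (a + 1),
      HasDerivAt (fun y : ℝ => ((s - 1) * (a : ℂ) ^ (-s)) * (y : ℂ) + (y : ℂ) ^ (-(s - 1)))
        ((s - 1) * ((a : ℂ) ^ (-s) - (x : ℂ) ^ (-s))) x := fun x hx => by
    have h1 := hasDerivAt_cpow_neg (ha.trans_le hx.1) (s - 1)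
    have h2 := (Complex.ofRealCLM.hasDerivAt (x := x)).const_mul ((s - 1) * (a : ℂ) ^ (-s))
    refine (h2.add h1).congr_deriv ?_
    simp only [Complex.ofRealCLM_apply, Complex.ofReal_one, mul_one]
    have h3 : -(s - 1) - 1 = -s := by ring
    rw [h3]
    ring
  have h := norm_image_sub_le_of_norm_deriv_le_segment'
    (C := ‖s - 1‖ * (‖s‖ * a ^ (-s.re - 1))) (fun x hx => (hder x hx).hasDerivWithinAt)
    (fun x hx => by
      rw [norm_mul]
      refine mul_le_mul_of_nonneg_left ?_ (norm_nonneg _)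
      refine (norm_cpow_neg_sub_le' ha hx.1 hs).trans ?_
      exact mul_le_of_le_one_right (by positivity) (by linarith [hx.2])) (a + 1)
      (Set.right_mem_Icc.mpr (by linarith))
  rw [add_sub_cancel_left, mul_one] at h
  refine le_trans (le_of_eq ?_) h
  congr 1
  push_cast
  ring_nf

lemma sum_zetaOne_term (s : ℂ) (N : ℕ) :
    ∑ n ∈ range N, ((s - 1) * ((n : ℂ) + 1) ^ (-s) - ((n : ℂ) + 1) ^ (1 - s) +
      ((n : ℂ) + 2) ^ (1 - s)) =
    (s - 1) * (∑ n ∈ range N, ((n : ℂ) + 1) ^ (-s)) - 1 + ((N : ℂ) + 1) ^ (1 - s) := by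
  induction N with
  | zero => simp
  | succ N ih =>
    rw [Finset.sum_range_succ, ih, Finset.sum_range_succ]
    push_cast
    have : ((N : ℂ) + 1 + 1) = N + 2 := by ring
    rw [this]
    ring

lemma exists_norm_zetaOne_le :
    ∃ K : ℝ, 0 < K ∧ ∀ s : ℂ, 1 / 2 ≤ s.re → ‖zetaOne s‖ ≤ K * (1 + ‖s‖) ^ 2 := by
  set f : ℕ → ℂ → ℂ := fun n s => (s - 1) * ((n : ℂ) + 1) ^ (-s) - ((n : ℂ) + 1) ^ (1 - s) +
      ((n : ℂ) + 2) ^ (1 - s) with hf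
  have hbd : ∀ n (s : ℂ), -1 ≤ s.re →
      ‖f n s‖ ≤ ‖s - 1‖ * (‖s‖ * ((n : ℝ) + 1) ^ (-s.re - 1)) := fun n s hs => by
    have := norm_zetaOne_term_le (a := (n : ℝ) + 1) (by positivity) hs
    convert this using 5
    · push_cast; rfl
    · push_cast; rfl
    · push_cast; ring
  have hb : ∀ δ R : ℝ, 0 < δ → 0 < R → ∃ K, ∀ n (s : ℂ), δ < s.re → ‖s‖ < R →
      ‖f n s‖ ≤ K * ((n : ℝ) + 1) ^ (-δ - 1) := by
    intro δ R hδ hR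
    refine ⟨(R + 1) * R, fun n s hs hsR => (hbd n s (by linarith)).trans ?_⟩
    have h2 : ((n : ℝ) + 1) ^ (-s.re - 1) ≤ ((n : ℝ) + 1) ^ (-δ - 1) :=
      Real.rpow_le_rpow_of_exponent_le (by linarith [Nat.cast_nonneg (α := ℝ) n]) (by linarith)
    have h3 : ‖s - 1‖ ≤ R + 1 := (norm_sub_le _ _).trans (by rw [norm_one]; linarith)
    rw [mul_assoc]
    gcongr
  have hd1 : ∀ n : ℕ, Differentiable ℂ fun s : ℂ => ((n : ℂ) + 1) ^ (1 - s) := fun n s =>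
    ((differentiableAt_const _).sub differentiableAt_id).const_cpow
      (Or.inl (by exact_mod_cast Nat.succ_ne_zero n))
  have hd : ∀ n, Differentiable ℂ (f n) := fun n => by
    have h1 := hd1 (n + 1)
    have h2 : (((n + 1 : ℕ) : ℂ) + 1) = (n : ℂ) + 2 := by push_cast; ring
    rw [h2] at h1
    exact (((differentiable_id.sub_const _).mul (differentiable_natCast_succ_cpow n)).sub
      (hd1 n)).add h1
  have heq : ∀ s : ℂ, 1 < s.re → zetaOne s - 1 = ∑' n, f n s := by
    intro s hs
    have h2 : Summable fun n => f n s := by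
      obtain ⟨K, hK⟩ := hb 1 (‖s‖ + 1) one_pos (by positivity)
      have h3 : Summable fun n : ℕ => ((n : ℝ)) ^ (-1 - 1 : ℝ) :=
        Real.summable_nat_rpow.mpr (by norm_num)
      have h4 := ((summable_nat_add_iff 1).mpr h3).mul_left K
      refine Summable.of_norm_bounded h4 fun n => ?_
      simpa using hK n s hs (by linarith)
    have h3 : Tendsto (fun N : ℕ => ((N : ℂ) + 1) ^ (1 - s)) atTop (𝓝 0) := by
      refine squeeze_zero_norm (a := fun N : ℕ => ((N : ℝ) + 1) ^ (-(s.re - 1))) (fun N => ?_) ?_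
      · have := norm_natCast_succ_cpow N (s - 1)
        rw [neg_sub, Complex.sub_re, Complex.one_re] at this
        exact this.le
      · exact tendsto_natCast_succ_rpow (by linarith)
    have h4 : Tendsto (fun N : ℕ => ∑ n ∈ range N, ((n : ℂ) + 1) ^ (-s)) atTop
        (𝓝 (riemannZeta s)) := by
      have h5 := (Complex.summable_one_div_nat_cpow.mpr hs).hasSum
      rw [← zeta_eq_tsum_one_div_nat_cpow hs] at h5
      have h6 := (hasSum_nat_add_iff' 1).mpr h5
      have hs0 : s ≠ 0 := by
        rintro rfl
        simp at hs
        linarith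
      simp only [Finset.range_one, Finset.sum_singleton, Nat.cast_zero, Complex.zero_cpow hs0,
        div_zero, sub_zero] at h6
      refine h6.tendsto_sum_nat.congr fun N => Finset.sum_congr rfl fun j _ => ?_
      rw [Complex.cpow_neg, one_div]
      push_cast
      rfl
    have hs1 : s ≠ 1 := by
      rintro rfl
      simp at hs
    have h7 := ((h4.const_mul (s - 1)).sub_const 1).add h3
    rw [add_zero, ← zetaOne_of_ne hs1] at h7
    refine tendsto_nhds_unique h7 (h2.hasSum.tendsto_sum_nat.congr fun N => ?_)
    exact sum_zetaOne_term s N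
  have hS : Summable fun n : ℕ => ((n : ℝ) + 1) ^ (-(3 / 2) : ℝ) := by
    have h3 : Summable fun n : ℕ => ((n : ℝ)) ^ (-(3 / 2) : ℝ) :=
      Real.summable_nat_rpow.mpr (by norm_num)
    simpa using (summable_nat_add_iff 1).mpr h3
  refine ⟨1 + ∑' n : ℕ, ((n : ℝ) + 1) ^ (-(3 / 2) : ℝ), ?_, fun s hs => ?_⟩
  · have : 0 ≤ ∑' n : ℕ, ((n : ℝ) + 1) ^ (-(3 / 2) : ℝ) := tsum_nonneg fun n => by positivity
    linarith
  set K := ∑' n : ℕ, ((n : ℝ) + 1) ^ (-(3 / 2) : ℝ) with hK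
  have hK0 : 0 ≤ K := tsum_nonneg fun n => by positivity
  have hsum := eq_tsum_of_forall_one_lt_re (F := fun s => zetaOne s - 1)
    (differentiable_zetaOne.sub_const 1) hd hb heq (s := s) (by linarith)
  have hle : ∀ n, ‖f n s‖ ≤ ‖s - 1‖ * ‖s‖ * ((n : ℝ) + 1) ^ (-(3 / 2) : ℝ) := fun n => by
    refine (hbd n s (by linarith)).trans ?_
    rw [mul_assoc]
    have h2 : ((n : ℝ) + 1) ^ (-s.re - 1) ≤ ((n : ℝ) + 1) ^ (-(3 / 2) : ℝ) :=
      Real.rpow_le_rpow_of_exponent_le (by linarith [Nat.cast_nonneg (α := ℝ) n]) (by linarith)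
    gcongr
  have h1 : ‖zetaOne s - 1‖ ≤ ‖s - 1‖ * ‖s‖ * K := by
    rw [← hsum.tsum_eq]
    exact tsum_of_norm_bounded (hS.hasSum.mul_left _) hle
  have h2 : ‖zetaOne s‖ ≤ 1 + ‖s - 1‖ * ‖s‖ * K := by
    have := norm_add_le (zetaOne s - 1) 1
    rw [sub_add_cancel, norm_one] at this
    linarith
  have h3 : ‖s - 1‖ ≤ 1 + ‖s‖ := (norm_sub_le _ _).trans (by rw [norm_one]; linarith)
  have h4 : ‖s - 1‖ * ‖s‖ ≤ (1 + ‖s‖) ^ 2 := by nlinarith [norm_nonneg s, norm_nonneg (s - 1)]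
  have h5 : 1 ≤ (1 + ‖s‖) ^ 2 := by nlinarith [norm_nonneg s]
  have h6 := mul_le_mul_of_nonneg_right h4 hK0
  linarith

end LandauPage

namespace LandauPage
open Finset Set Filter Topology
open scoped BigOperators ComplexConjugate

lemma sum_inv_succ_le (N : ℕ) : ∑ j ∈ range N, ((j : ℝ) + 1)⁻¹ ≤ 1 + Real.log N := by
  have h := harmonic_le_one_add_log N
  unfold harmonic at h
  push_cast at h
  exact h

lemma rpow_neg_le {r σ a N : ℝ} (hr : 0 ≤ r) (hσ : 1 - r ≤ σ) (ha : 1 ≤ a) (haN : a ≤ N) :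
    a ^ (-σ) ≤ N ^ r * a⁻¹ := by
  have ha0 : 0 < a := by linarith
  calc a ^ (-σ) ≤ a ^ (r + -1) := Real.rpow_le_rpow_of_exponent_le ha (by linarith)
    _ = a ^ r * a⁻¹ := by rw [Real.rpow_add ha0, Real.rpow_neg_one]
    _ ≤ N ^ r * a⁻¹ := by
        refine mul_le_mul_of_nonneg_right ?_ (by positivity)
        exact Real.rpow_le_rpow ha0.le haN hr

lemma norm_sum_initial_le {q : ℕ} [NeZero q] (χ : DirichletCharacter ℂ q) {r : ℝ} (hr : 0 ≤ r)
    {s : ℂ} (hs : 1 - r ≤ s.re) (N : ℕ) :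
    ‖∑ j ∈ range N, χ ((j + 1 : ℕ) : ZMod q) * ((j : ℂ) + 1) ^ (-s)‖ ≤
      (N : ℝ) ^ r * (1 + Real.log N) := by
  calc _ ≤ ∑ j ∈ range N, (N : ℝ) ^ r * ((j : ℝ) + 1)⁻¹ := by
        refine norm_sum_le_of_le _ fun j hj => ?_
        rw [norm_mul, norm_natCast_succ_cpow]
        refine (mul_le_of_le_one_left (by positivity) (χ.norm_le_one _)).trans ?_
        refine rpow_neg_le hr hs (by linarith [Nat.cast_nonneg (α := ℝ) j]) ?_
        exact_mod_cast Finset.mem_range.mp hj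
    _ ≤ _ := by
        rw [← Finset.mul_sum]
        exact mul_le_mul_of_nonneg_left (sum_inv_succ_le N) (by positivity)

lemma norm_sum_block_le {q : ℕ} [NeZero q] (χ : DirichletCharacter ℂ q) {s : ℂ} (hs : 0 ≤ s.re)
    (m L : ℕ) {ε : ℝ} (h1 : ‖∑ j ∈ range L, χ (((m + 1 : ℤ) + j : ℤ) : ZMod q)‖ ≤ L * ε)
    (h2 : ‖s‖ * L ≤ ε * ((m : ℝ) + 1)) :
    ‖∑ j ∈ range L, χ ((m + j + 1 : ℕ) : ZMod q) * (((m + j : ℕ) : ℂ) + 1) ^ (-s)‖ ≤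
      2 * ε * (L * ((m : ℝ) + 1) ^ (-s.re)) := by
  have h3 : ∑ j ∈ range L, χ ((m + j + 1 : ℕ) : ZMod q) * (((m + j : ℕ) : ℂ) + 1) ^ (-s) =
      (∑ j ∈ range L, χ (((m + 1 : ℤ) + j : ℤ) : ZMod q)) * ((m : ℂ) + 1) ^ (-s) -
      ∑ j ∈ range L, χ ((m + j + 1 : ℕ) : ZMod q) *
        (((m : ℂ) + 1) ^ (-s) - (((m + j : ℕ) : ℂ) + 1) ^ (-s)) := by
    rw [Finset.sum_mul, ← Finset.sum_sub_distrib]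
    refine Finset.sum_congr rfl fun j _ => ?_
    have : (((m + 1 : ℤ) + j : ℤ) : ZMod q) = ((m + j + 1 : ℕ) : ZMod q) := by push_cast; ring
    rw [this]
    ring
  have hm : (0 : ℝ) < (m : ℝ) + 1 := by positivity
  have h4 : ‖(∑ j ∈ range L, χ (((m + 1 : ℤ) + j : ℤ) : ZMod q)) * ((m : ℂ) + 1) ^ (-s)‖ ≤
      L * ε * ((m : ℝ) + 1) ^ (-s.re) := by
    rw [norm_mul, norm_natCast_succ_cpow]
    exact mul_le_mul_of_nonneg_right h1 (by positivity)
  have h5 : ‖∑ j ∈ range L, χ ((m + j + 1 : ℕ) : ZMod q) *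
        (((m : ℂ) + 1) ^ (-s) - (((m + j : ℕ) : ℂ) + 1) ^ (-s))‖ ≤
      L * (ε * ((m : ℝ) + 1) ^ (-s.re)) := by
    calc _ ≤ ∑ j ∈ range L, ε * ((m : ℝ) + 1) ^ (-s.re) := by
          refine norm_sum_le_of_le _ fun j hj => ?_
          rw [norm_mul]
          refine (mul_le_of_le_one_left (norm_nonneg _) (χ.norm_le_one _)).trans ?_
          have h6 := norm_cpow_neg_sub_le' (a := (m : ℝ) + 1) (b := ((m + j : ℕ) : ℝ) + 1) hm
            (by push_cast; linarith [Nat.cast_nonneg (α := ℝ) j]) (s := s) (by linarith)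
          push_cast at h6 ⊢
          refine h6.trans ?_
          have h7 : (m : ℝ) + j + 1 - (m + 1) = j := by ring
          have h8 : ((m : ℝ) + 1) ^ (-s.re - 1) = ((m : ℝ) + 1) ^ (-s.re) / ((m : ℝ) + 1) := by
            rw [Real.rpow_sub hm, Real.rpow_one]
          have h9 : (j : ℝ) ≤ L := by exact_mod_cast (Finset.mem_range.mp hj).le
          rw [h7, h8]
          calc ‖s‖ * (((m : ℝ) + 1) ^ (-s.re) / ((m : ℝ) + 1)) * j
              ≤ ‖s‖ * (((m : ℝ) + 1) ^ (-s.re) / ((m : ℝ) + 1)) * L := by gcongr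
            _ = (‖s‖ * L) / ((m : ℝ) + 1) * ((m : ℝ) + 1) ^ (-s.re) := by ring
            _ ≤ ε * ((m : ℝ) + 1) ^ (-s.re) := by
                refine mul_le_mul_of_nonneg_right ?_ (by positivity)
                rw [div_le_iff₀ hm]
                exact h2
      _ = _ := by rw [Finset.sum_const, Finset.card_range, nsmul_eq_mul]
  rw [h3]
  refine (norm_sub_le _ _).trans ((add_le_add h4 h5).trans (le_of_eq ?_))
  ring

lemma sum_range_add_mul {M : Type*} [AddCommMonoid M] (f : ℕ → M) (N L K : ℕ) :
    ∑ j ∈ range (N + K * L), f j =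
      ∑ j ∈ range N, f j + ∑ i ∈ range K, ∑ j ∈ range L, f (N + i * L + j) := by
  induction K with
  | zero => simp
  | succ K ih =>
    rw [Nat.succ_mul, ← add_assoc, Finset.sum_range_add, ih, Finset.sum_range_succ, add_assoc]

lemma norm_sum_blocks_le {q : ℕ} [NeZero q] (χ : DirichletCharacter ℂ q) {r : ℝ} (hr : 0 ≤ r)
    {s : ℂ} (hs0 : 0 ≤ s.re) (hs : 1 - r ≤ s.re) {N L : ℕ} (hL : 0 < L) (hLN : L ≤ N) (K : ℕ)
    {ε : ℝ} (hε : 0 ≤ ε)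
    (h1 : ∀ M : ℤ, ‖∑ j ∈ range L, χ ((M + j : ℤ) : ZMod q)‖ ≤ L * ε)
    (h2 : ‖s‖ * L ≤ ε * N) :
    ‖∑ i ∈ range K, ∑ j ∈ range L, χ ((N + i * L + j + 1 : ℕ) : ZMod q) *
      (((N + i * L + j : ℕ) : ℂ) + 1) ^ (-s)‖ ≤
      2 * ε * (((N + K * L : ℕ) : ℝ) ^ r * (1 + Real.log K)) := by
  have hL0 : (0 : ℝ) < L := by exact_mod_cast hL
  calc _ ≤ ∑ i ∈ range K, 2 * ε * (((N + K * L : ℕ) : ℝ) ^ r * ((i : ℝ) + 1)⁻¹) := by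
        refine norm_sum_le_of_le _ fun i hi => ?_
        have hNi : (N : ℝ) ≤ ((N + i * L : ℕ) : ℝ) + 1 := by
          push_cast
          nlinarith [Nat.cast_nonneg (α := ℝ) i]
        have h3 := norm_sum_block_le χ hs0 (N + i * L) L (h1 _)
          (h2.trans (mul_le_mul_of_nonneg_left hNi hε))
        refine h3.trans (mul_le_mul_of_nonneg_left ?_ (by positivity))
        have h4 : ((N + i * L : ℕ) : ℝ) + 1 ≤ ((N + K * L : ℕ) : ℝ) := by
          have h5 : (i + 1) * L ≤ K * L := Nat.mul_le_mul_right L (Finset.mem_range.mp hi)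
          have : N + i * L + 1 ≤ N + K * L := by nlinarith
          exact_mod_cast this
        have h6 := rpow_neg_le hr hs (by linarith [Nat.cast_nonneg (α := ℝ) (N + i * L)]) h4
        calc (L : ℝ) * (((N + i * L : ℕ) : ℝ) + 1) ^ (-s.re)
            ≤ L * (((N + K * L : ℕ) : ℝ) ^ r * (((N + i * L : ℕ) : ℝ) + 1)⁻¹) := by gcongr
          _ = ((N + K * L : ℕ) : ℝ) ^ r * (L * (((N + i * L : ℕ) : ℝ) + 1)⁻¹) := by ring
          _ ≤ ((N + K * L : ℕ) : ℝ) ^ r * ((i : ℝ) + 1)⁻¹ := by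
              refine mul_le_mul_of_nonneg_left ?_ (by positivity)
              rw [← div_eq_mul_inv, div_le_iff₀ (by positivity), inv_mul_eq_div,
                le_div_iff₀ (by positivity)]
              have : (L : ℝ) ≤ N := by exact_mod_cast hLN
              push_cast
              nlinarith [Nat.cast_nonneg (α := ℝ) i]
    _ ≤ _ := by
        rw [← Finset.mul_sum, ← Finset.mul_sum]
        refine mul_le_mul_of_nonneg_left ?_ (by positivity)
        exact mul_le_mul_of_nonneg_left (sum_inv_succ_le K) (by positivity)

end LandauPage

namespace LandauPage
open Finset Set Filter Topology
open scoped BigOperators ComplexConjugate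

lemma ceil_exp_le {a : ℝ} (ha : 0 ≤ a) : (⌈Real.exp a⌉₊ : ℝ) ≤ Real.exp (a + 1) := by
  have h1 := (Nat.ceil_lt_add_one (Real.exp_pos a).le).le
  have h2 : 2 * Real.exp a ≤ Real.exp (a + 1) := by
    rw [Real.exp_add, mul_comm]
    exact mul_le_mul_of_nonneg_left (by linarith [Real.add_one_le_exp (1 : ℝ)]) (Real.exp_pos _).le
  linarith [Real.one_le_exp ha]

set_option maxHeartbeats 1000000 in
/-- Growth of `L(s, χ)` for smooth moduli slightly to the left of `re s = 1`. -/
theorem norm_LFunction_smooth_le {x Λ : ℝ} (hx : 10 ^ 20 ≤ x) (hΛ1 : x ^ 99 ≤ 100 * Λ)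
    (hΛ3 : x ^ 100 ≤ 100 * Real.log x * Λ) (hΛ4 : Λ ≤ x ^ 100) {q : ℕ} [NeZero q]
    (χ : DirichletCharacter ℂ q) (hχ : χ.IsPrimitive) (hχ1 : χ ≠ 1)
    (hq : Real.log q ≤ 2 * x ^ 100) (hsm : ∀ p : ℕ, p.Prime → p ∣ q → (p : ℝ) ≤ Real.exp Λ)
    {s : ℂ} (hs : 1 - 100 * Real.log x / Λ ≤ s.re) (hs2 : ‖s‖ ≤ Real.exp Λ) :
    ‖χ.LFunction s‖ ≤ Real.exp (10 ^ 6 * Real.log x) := by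
  have hx0 : 0 < x := by linarith
  have hx1 : (1 : ℝ) ≤ x := by linarith
  set l := Real.log x with hl
  have hxe : x = Real.exp l := (Real.exp_log hx0).symm
  have hl0 : 1 ≤ l := by
    rw [hl, Real.le_log_iff_exp_le hx0]
    linarith [Real.exp_one_lt_d9]
  have hlx : l ≤ x := by linarith [Real.log_le_sub_one_of_pos hx0]
  have hpow : ∀ m n : ℕ, m ≤ n → x ^ m ≤ x ^ n := fun m n h => pow_le_pow_right₀ hx1 h
  have hup : ∀ n m : ℕ, n + 1 = m → 10 ^ 20 * x ^ n ≤ x ^ m := fun n m h => by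
    rw [← h, pow_succ, mul_comm]
    exact mul_le_mul_of_nonneg_left hx (by positivity)
  have h98 : x ^ 98 ≤ Λ := by linarith [hup 98 99 rfl, pow_nonneg (zero_le_one.trans hx1) 98]
  have hΛx : ∀ n, n ≤ 98 → x ^ n ≤ Λ := fun n hn => (hpow n 98 hn).trans h98
  have hΛ0 : 1 ≤ Λ := by simpa using hΛx 0 (by norm_num)
  set r := 100 * l / Λ with hr
  have hr0 : 0 ≤ r := by positivity
  have hrΛ : r * Λ = 100 * l := by rw [hr]; field_simp
  have hr2 : r ≤ 1 / 2 := by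
    rw [hr, div_le_iff₀ (by linarith)]
    have h1 := hΛx 2 (by norm_num)
    have h2 := hup 1 2 rfl
    rw [pow_one] at h2
    linarith
  have hσ : 1 / 2 ≤ s.re := by linarith
  set ℓ := x ^ 100 with hℓ
  have hℓ1 : 1 ≤ ℓ := one_le_pow₀ hx1
  have hrℓ : r * ℓ ≤ 10000 * l ^ 2 := by
    have := mul_le_mul_of_nonneg_left hΛ3 hr0
    calc r * ℓ ≤ r * (100 * l * Λ) := this
      _ = 100 * l * (r * Λ) := by ring
      _ = 10000 * l ^ 2 := by rw [hrΛ]; ring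
  set L := ⌈Real.exp (1000 * Λ)⌉₊ with hL
  set N := ⌈Real.exp (1005 * Λ)⌉₊ with hN
  set E := 8 * ℓ + 4 * Λ with hE
  set K := ⌈Real.exp E⌉₊ with hK
  have hE0 : 0 ≤ E := by positivity
  have hL1 : Real.exp (1000 * Λ) ≤ L := Nat.le_ceil _
  have hN1 : Real.exp (1005 * Λ) ≤ N := Nat.le_ceil _
  have hK1 : Real.exp E ≤ K := Nat.le_ceil _
  have hL2 : (L : ℝ) ≤ Real.exp (1001 * Λ) :=
    (ceil_exp_le (by positivity)).trans (Real.exp_le_exp.mpr (by linarith))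
  have hN2 : (N : ℝ) ≤ Real.exp (1006 * Λ) :=
    (ceil_exp_le (by positivity)).trans (Real.exp_le_exp.mpr (by linarith))
  have hK2 : (K : ℝ) ≤ Real.exp (E + Λ) :=
    (ceil_exp_le (by positivity)).trans (Real.exp_le_exp.mpr (by linarith))
  have hL0 : 0 < L := Nat.ceil_pos.mpr (Real.exp_pos _)
  have hN0 : 0 < N := Nat.ceil_pos.mpr (Real.exp_pos _)
  have hK0 : 0 < K := Nat.ceil_pos.mpr (Real.exp_pos _)
  have hLN : L ≤ N := Nat.ceil_mono (Real.exp_le_exp.mpr (by linarith))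
  have hNR : (0 : ℝ) < N := by exact_mod_cast hN0
  have hKR : (0 : ℝ) < K := by exact_mod_cast hK0
  -- the three pieces
  have hA : ‖∑ j ∈ range N, χ ((j + 1 : ℕ) : ZMod q) * ((j : ℂ) + 1) ^ (-s)‖ ≤
      Real.exp (100800 * l) := by
    refine (norm_sum_initial_le χ hr0 hs N).trans ?_
    have h1 : (N : ℝ) ^ r ≤ Real.exp (100600 * l) := by
      calc (N : ℝ) ^ r ≤ (Real.exp (1006 * Λ)) ^ r := Real.rpow_le_rpow hNR.le hN2 hr0
        _ = Real.exp (100600 * l) := by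
            rw [← Real.exp_mul]
            congr 1
            linear_combination 1006 * hrΛ
    have h2 : 1 + Real.log N ≤ Real.exp (200 * l) := by
      have h3 : Real.log N ≤ 1006 * Λ := by
        rw [Real.log_le_iff_le_exp hNR]; exact hN2
      have h4 : Real.exp (200 * l) = x ^ 200 := by
        rw [hxe, ← Real.exp_nat_mul]; norm_num
      have h5 := hup 100 101 rfl
      have h6 := hpow 101 200 (by norm_num)
      rw [h4]
      linarith
    calc _ ≤ Real.exp (100600 * l) * Real.exp (200 * l) := by
          refine mul_le_mul h1 h2 ?_ (Real.exp_pos _).le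
          have : 0 ≤ Real.log N := Real.log_natCast_nonneg N
          linarith
      _ = _ := by rw [← Real.exp_add]; ring_nf
  have hB : ‖∑ i ∈ range K, ∑ j ∈ range L, χ ((N + i * L + j + 1 : ℕ) : ZMod q) *
      (((N + i * L + j : ℕ) : ℂ) + 1) ^ (-s)‖ ≤ 1 := by
    have h1 := fun M : ℤ => norm_sum_char_smooth_le hx hΛ1 hΛ3 χ hχ hχ1 hq hsm M L hL1
    have h2 : ‖s‖ * L ≤ Real.exp (-x ^ 10) * N := by
      calc ‖s‖ * L ≤ Real.exp Λ * Real.exp (1001 * Λ) :=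
            mul_le_mul hs2 hL2 (Nat.cast_nonneg L) (Real.exp_pos _).le
        _ ≤ Real.exp (-x ^ 10) * Real.exp (1005 * Λ) := by
            rw [← Real.exp_add, ← Real.exp_add]
            exact Real.exp_le_exp.mpr (by linarith [hΛx 10 (by norm_num)])
        _ ≤ _ := mul_le_mul_of_nonneg_left hN1 (Real.exp_pos _).le
    refine (norm_sum_blocks_le χ hr0 (by linarith) hs hL0 hLN K (Real.exp_pos _).le h1 h2).trans ?_
    have h3 : ((N + K * L : ℕ) : ℝ) ≤ Real.exp (E + 1007 * Λ) := by
      have h4 : (K : ℝ) * L ≤ Real.exp (E + 1002 * Λ) := by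
        calc (K : ℝ) * L ≤ Real.exp (E + Λ) * Real.exp (1001 * Λ) :=
              mul_le_mul hK2 hL2 (Nat.cast_nonneg L) (Real.exp_pos _).le
          _ = _ := by rw [← Real.exp_add]; ring_nf
      have h5 : Real.exp (E + 1002 * Λ) ≤ Real.exp (E + 1006 * Λ) :=
        Real.exp_le_exp.mpr (by linarith)
      have h6 : Real.exp (1006 * Λ) ≤ Real.exp (E + 1006 * Λ) := Real.exp_le_exp.mpr (by linarith)
      have h7 : 2 * Real.exp (E + 1006 * Λ) ≤ Real.exp (E + 1007 * Λ) := by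
        calc 2 * Real.exp (E + 1006 * Λ) ≤ Real.exp Λ * Real.exp (E + 1006 * Λ) :=
              mul_le_mul_of_nonneg_right (by linarith [Real.add_one_le_exp Λ]) (Real.exp_pos _).le
          _ = _ := by rw [← Real.exp_add]; ring_nf
      push_cast
      linarith
    have h4 : ((N + K * L : ℕ) : ℝ) ^ r ≤ Real.exp (80000 * l ^ 2 + 101100 * l) := by
      calc _ ≤ (Real.exp (E + 1007 * Λ)) ^ r := Real.rpow_le_rpow (Nat.cast_nonneg _) h3 hr0
        _ ≤ _ := by
            rw [← Real.exp_mul]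
            refine Real.exp_le_exp.mpr ?_
            calc (E + 1007 * Λ) * r = 8 * (r * ℓ) + 1011 * (r * Λ) := by rw [hE]; ring
              _ ≤ _ := by rw [hrΛ]; linarith
    have h5 : 1 + Real.log K ≤ Real.exp (200 * l) := by
      have h3 : Real.log K ≤ E + Λ := by
        rw [Real.log_le_iff_le_exp hKR]; exact hK2
      have h4 : Real.exp (200 * l) = x ^ 200 := by
        rw [hxe, ← Real.exp_nat_mul]; norm_num
      have h5 := hup 100 101 rfl
      have h6 := hpow 101 200 (by norm_num)
      rw [h4]
      linarith
    have h6 : (2 : ℝ) ≤ Real.exp 1 := by linarith [Real.add_one_le_exp (1 : ℝ)]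
    calc _ ≤ Real.exp 1 * Real.exp (-x ^ 10) *
          (Real.exp (80000 * l ^ 2 + 101100 * l) * Real.exp (200 * l)) := by
          have : 0 ≤ Real.log K := Real.log_natCast_nonneg K
          gcongr
      _ = Real.exp (1 - x ^ 10 + 80000 * l ^ 2 + 101300 * l) := by
          rw [← Real.exp_add, ← Real.exp_add, ← Real.exp_add]; ring_nf
      _ ≤ 1 := by
          refine Real.exp_le_one_iff.mpr ?_
          have h7 : l ^ 2 ≤ x ^ 2 := pow_le_pow_left₀ (by linarith) hlx 2
          have h8 := hup 2 3 rfl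
          have h9 := hpow 3 10 (by norm_num)
          have h10 := hpow 1 2 (by norm_num)
          have h11 := hpow 0 2 (by norm_num)
          rw [pow_one] at h10
          rw [pow_zero] at h11
          linarith
  have hC := norm_LFunction_sub_sum_le hχ1 (s := s) (by linarith) (N + K * L)
  have hC2 : q * (‖s‖ / s.re + 1) * (((N + K * L : ℕ) : ℝ) + 1) ^ (-s.re) ≤ 1 := by
    have hq0 : (0 : ℝ) < q := by exact_mod_cast Nat.pos_of_ne_zero (NeZero.ne q)
    have h1 : (q : ℝ) ≤ Real.exp (2 * ℓ) := (Real.log_le_iff_le_exp hq0).mp hq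
    have h2 : ‖s‖ / s.re + 1 ≤ Real.exp (2 * Λ) := by
      have h3 : ‖s‖ / s.re ≤ 2 * Real.exp Λ := by
        rw [div_le_iff₀ (by linarith)]
        nlinarith [Real.exp_pos Λ]
      have h4 : (2.7 : ℝ) ≤ Real.exp Λ := by
        have := Real.exp_le_exp.mpr hΛ0
        linarith [Real.exp_one_gt_d9]
      have h5 : Real.exp (2 * Λ) = Real.exp Λ * Real.exp Λ := by rw [← Real.exp_add]; ring_nf
      nlinarith
    have h3 : (((N + K * L : ℕ) : ℝ) + 1) ^ (-s.re) ≤ Real.exp (-(2 * ℓ) - 2 * Λ) := by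
      have h4 : Real.exp E ≤ ((N + K * L : ℕ) : ℝ) + 1 := by
        have : (1 : ℝ) ≤ L := by exact_mod_cast hL0
        push_cast
        nlinarith
      calc _ ≤ (Real.exp E) ^ (-s.re) :=
            Real.rpow_le_rpow_of_nonpos (Real.exp_pos _) h4 (by linarith)
        _ = Real.exp (-(E * s.re)) := by rw [← Real.exp_mul]; ring_nf
        _ ≤ _ := Real.exp_le_exp.mpr (by nlinarith)
    calc _ ≤ Real.exp (2 * ℓ) * Real.exp (2 * Λ) * Real.exp (-(2 * ℓ) - 2 * Λ) := by gcongr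
      _ = 1 := by rw [← Real.exp_add, ← Real.exp_add]; ring_nf; exact Real.exp_zero
  rw [sum_range_add_mul (fun j => χ ((j + 1 : ℕ) : ZMod q) * ((j : ℂ) + 1) ^ (-s))] at hC
  have hD : ‖χ.LFunction s‖ ≤ Real.exp (100800 * l) + 1 + 1 := by
    have h1 := norm_add_le (χ.LFunction s -
      (∑ j ∈ range N, χ ((j + 1 : ℕ) : ZMod q) * ((j : ℂ) + 1) ^ (-s) +
      ∑ i ∈ range K, ∑ j ∈ range L, χ ((N + i * L + j + 1 : ℕ) : ZMod q) *
      (((N + i * L + j : ℕ) : ℂ) + 1) ^ (-s)))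
      (∑ j ∈ range N, χ ((j + 1 : ℕ) : ZMod q) * ((j : ℂ) + 1) ^ (-s) +
      ∑ i ∈ range K, ∑ j ∈ range L, χ ((N + i * L + j + 1 : ℕ) : ZMod q) *
      (((N + i * L + j : ℕ) : ℂ) + 1) ^ (-s))
    rw [sub_add_cancel] at h1
    have h2 := norm_add_le (∑ j ∈ range N, χ ((j + 1 : ℕ) : ZMod q) * ((j : ℂ) + 1) ^ (-s))
      (∑ i ∈ range K, ∑ j ∈ range L, χ ((N + i * L + j + 1 : ℕ) : ZMod q) *
      (((N + i * L + j : ℕ) : ℂ) + 1) ^ (-s))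
    linarith [hC.trans hC2]
  refine hD.trans ?_
  have h1 : 3 * Real.exp (100800 * l) ≤ Real.exp (10 ^ 6 * l) := by
    have h2 : (3 : ℝ) ≤ Real.exp (2 * l) := by linarith [Real.add_one_le_exp (2 * l)]
    calc _ ≤ Real.exp (2 * l) * Real.exp (100800 * l) :=
          mul_le_mul_of_nonneg_right h2 (Real.exp_pos _).le
      _ ≤ _ := by
          rw [← Real.exp_add]
          exact Real.exp_le_exp.mpr (by linarith)
  have h2 : 1 ≤ Real.exp (100800 * l) := Real.one_le_exp (by positivity)
  linarith

end LandauPage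

namespace LandauPage
open Finset Set Filter Topology
open scoped BigOperators ComplexConjugate

lemma exp_one_le_of_div_log_le {l Λ : ℝ} (hl : 1 < l) (h : l / Real.log l ≤ Λ) :
    Real.exp 1 ≤ Λ := by
  refine le_trans ?_ h
  have h0 : 0 < Real.log l := Real.log_pos hl
  rw [le_div_iff₀ h0]
  have h1 := Real.log_le_sub_one_of_pos (x := l / Real.exp 1) (by positivity)
  rw [Real.log_div (by positivity) (Real.exp_pos _).ne', Real.log_exp] at h1
  have h2 : Real.log l ≤ l / Real.exp 1 := by linarith
  rw [le_div_iff₀ (Real.exp_pos _)] at h2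
  linarith

/-- A bound for `L(s, χ)` in a region suited to the zero-free region argument. -/
theorem exists_growth_bound : ∃ C : ℝ, 1 ≤ C ∧ ∀ l Λ : ℝ, 1 < l → l / Real.log l ≤ Λ →
    ∃ r A : ℝ, 0 < r ∧ r ≤ 1 / 2 ∧ 1 ≤ r * Λ ∧ 0 ≤ A ∧ A ≤ C * (r * Λ) ∧
      Real.log Λ ≤ C * (r * Λ) ∧
      ∀ (q : ℕ) [NeZero q] (χ : DirichletCharacter ℂ q), χ.IsPrimitive → χ ≠ 1 →
        Real.log q ≤ 2 * l → (∀ p : ℕ, p.Prime → p ∣ q → (p : ℝ) ≤ Real.exp Λ) →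
        ∀ s : ℂ, 1 - r ≤ s.re → ‖s‖ ≤ 2 * Real.exp (Λ / Real.sqrt l) + 5 →
          ‖χ.LFunction s‖ ≤ Real.exp A := by
  refine ⟨30000, by norm_num, fun l Λ hl hΛ => ?_⟩
  have hΛe := exp_one_le_of_div_log_le hl hΛ
  have hΛ2 : 2 ≤ Λ := by linarith [Real.exp_one_gt_d9]
  have hlogΛ : Real.log Λ ≤ Λ := by linarith [Real.log_le_sub_one_of_pos (x := Λ) (by linarith)]
  have hlog0 : 0 < Real.log l := Real.log_pos hl
  by_cases heasy : l ≤ 5000 * Λ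
  · refine ⟨1 / 2, 10003 * Λ, by norm_num, le_rfl, by linarith, by linarith, by linarith,
      by linarith, ?_⟩
    intro q _ χ hχ hχ1 hq hsm s hs hs2
    refine (norm_LFunction_le hχ1 (by linarith)).trans ?_
    have hq0 : (0 : ℝ) < q := by exact_mod_cast Nat.pos_of_ne_zero (NeZero.ne q)
    have h1 : (q : ℝ) ≤ Real.exp (10000 * Λ) :=
      ((Real.log_le_iff_le_exp hq0).mp hq).trans (Real.exp_le_exp.mpr (by linarith))
    have h2 : ‖s‖ / s.re ≤ 2 * ‖s‖ := by
      rw [div_le_iff₀ (by linarith)]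
      nlinarith [norm_nonneg s]
    have h3 : Real.exp (Λ / Real.sqrt l) ≤ Real.exp Λ :=
      Real.exp_le_exp.mpr (div_le_self (by linarith) (Real.one_le_sqrt.mpr hl.le))
    have h4 : (15 : ℝ) ≤ Real.exp (2 * Λ) := by
      have h5 : Real.exp (2 * Λ) = Real.exp Λ ^ 2 := by rw [← Real.exp_nat_mul]; norm_num
      have h6 : (7 : ℝ) ≤ Real.exp Λ := by
        have h7 := Real.exp_le_exp.mpr hΛ2
        have h8 : Real.exp 2 = Real.exp 1 ^ 2 := by rw [← Real.exp_nat_mul]; norm_num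
        have := Real.exp_one_gt_d9
        nlinarith
      nlinarith
    have h5 : ‖s‖ / s.re + 1 ≤ Real.exp (3 * Λ) := by
      have h6 : Real.exp (3 * Λ) = Real.exp (2 * Λ) * Real.exp Λ := by
        rw [← Real.exp_add]; ring_nf
      have h7 : 1 ≤ Real.exp Λ := Real.one_le_exp (by linarith)
      rw [h6]
      nlinarith
    calc _ ≤ Real.exp (10000 * Λ) * Real.exp (3 * Λ) := by gcongr
      _ = _ := by rw [← Real.exp_add]; ring_nf
  · push Not at heasy
    set x := l ^ (1 / 100 : ℝ) with hx
    have hl0 : 0 < l := by linarith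
    have hx0 : 0 < x := Real.rpow_pos_of_pos hl0 _
    have hxl : x ^ 100 = l := by
      rw [hx, ← Real.rpow_natCast, ← Real.rpow_mul hl0.le]
      norm_num
    have hlogl : Real.log l = 100 * Real.log x := by
      rw [← hxl, Real.log_pow]; norm_num
    have h50 : 50 < Real.log x := by
      have h1 : l ≤ Λ * Real.log l := (div_le_iff₀ hlog0).mp hΛ
      have h2 : 5000 * Λ < Real.log l * Λ := by linarith
      have h3 := lt_of_mul_lt_mul_right h2 (by linarith)
      linarith
    have hx20 : 10 ^ 20 ≤ x := by
      have h1 : Real.exp 50 ≤ x := by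
        rw [← Real.le_log_iff_exp_le hx0]; exact h50.le
      have h2 : Real.exp 50 = Real.exp 1 ^ 50 := by rw [← Real.exp_nat_mul]; norm_num
      have h3 : (2.7 : ℝ) ^ 50 ≤ Real.exp 1 ^ 50 :=
        pow_le_pow_left₀ (by norm_num) (by linarith [Real.exp_one_gt_d9]) 50
      have h4 : (10 : ℝ) ^ 20 ≤ 2.7 ^ 50 := by norm_num
      linarith
    have hx1 : 1 ≤ x := by linarith
    have hΛ3 : x ^ 100 ≤ 100 * Real.log x * Λ := by
      rw [hxl, ← hlogl, mul_comm]
      exact (div_le_iff₀ hlog0).mp hΛ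
    have hlogx : Real.log x ≤ x := by linarith [Real.log_le_sub_one_of_pos hx0]
    have hΛ1 : x ^ 99 ≤ 100 * Λ := by
      have h1 : x * x ^ 99 ≤ x * (100 * Λ) := by
        calc x * x ^ 99 = x ^ 100 := by ring
          _ ≤ 100 * Real.log x * Λ := hΛ3
          _ ≤ 100 * x * Λ := by gcongr
          _ = _ := by ring
      exact le_of_mul_le_mul_left h1 hx0
    have hΛ4 : Λ ≤ x ^ 100 := by rw [hxl]; linarith
    have hxΛ : 200 * x ≤ Λ := by
      have h1 : x ^ 2 ≤ x ^ 99 := pow_le_pow_right₀ hx1 (by norm_num)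
      nlinarith
    have hrΛ : 100 * Real.log x / Λ * Λ = 100 * Real.log x := by field_simp
    refine ⟨100 * Real.log x / Λ, 10 ^ 6 * Real.log x, by positivity, ?_, ?_, by positivity, ?_, ?_, ?_⟩
    · rw [div_le_iff₀ (by linarith)]
      linarith
    · rw [hrΛ]; linarith
    · rw [hrΛ]; linarith
    · rw [hrΛ]
      have h1 := Real.log_le_log (by linarith) hΛ4
      rw [hxl, hlogl] at h1
      linarith
    · intro q _ χ hχ hχ1 hq hsm s hs hs2
      refine norm_LFunction_smooth_le hx20 hΛ1 hΛ3 hΛ4 χ hχ hχ1 (by rw [hxl]; exact hq) hsm hs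
        (hs2.trans ?_)
      have h1 : 2 ≤ Real.sqrt l := by
        refine Real.le_sqrt_of_sq_le ?_
        have h2 : x ^ 1 ≤ x ^ 100 := pow_le_pow_right₀ hx1 (by norm_num)
        rw [hxl, pow_one] at h2
        linarith
      have h2 : Real.exp (Λ / Real.sqrt l) ≤ Real.exp (Λ / 2) :=
        Real.exp_le_exp.mpr (div_le_div_of_nonneg_left (by linarith) (by norm_num) h1)
      have h3 : Real.exp Λ = Real.exp (Λ / 2) * Real.exp (Λ / 2) := by
        rw [← Real.exp_add]; ring_nf
      have h4 : 7 ≤ Real.exp (Λ / 2) := by linarith [Real.add_one_le_exp (Λ / 2)]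
      rw [h3]
      nlinarith

end LandauPage

namespace LandauPage
open Finset Set Filter Topology
open scoped BigOperators ComplexConjugate

/-- Extracting the full power of `s - a` from an entire function. -/
theorem exists_eq_pow_mul {f : ℂ → ℂ} (hf : Differentiable ℂ f) {s₀ : ℂ} (h0 : f s₀ ≠ 0) (a : ℂ) :
    ∃ n : ℕ, ∃ g : ℂ → ℂ, Differentiable ℂ g ∧ g a ≠ 0 ∧ ∀ s, f s = (s - a) ^ n * g s := by
  have hne : ¬ ∀ᶠ z in 𝓝 a, f z = 0 := fun h ↦ h0 <|
    (AnalyticOnNhd.eqOn_zero_of_preconnected_of_eventuallyEq_zero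
      (f := f) (U := Set.univ) (fun z _ ↦ hf.analyticAt z) isPreconnected_univ (mem_univ a) h)
      (mem_univ s₀)
  obtain ⟨n, g, hg, hga, he⟩ := (hf.analyticAt a).exists_eventuallyEq_pow_smul_nonzero_iff.2 hne
  refine ⟨n, fun s ↦ if s = a then g a else f s / (s - a) ^ n, ?_, by simpa using hga, ?_⟩
  · intro s
    by_cases hs : s = a
    · subst hs
      have : (fun z ↦ if z = s then g s else f z / (z - s) ^ n) =ᶠ[𝓝 s] g := by
        filter_upwards [he] with z hz
        split_ifs with h
        · rw [h]
        · rw [hz, smul_eq_mul, mul_div_cancel_left₀]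
          exact pow_ne_zero _ (sub_ne_zero.2 h)
      exact (hg.differentiableAt).congr_of_eventuallyEq this
    · have : (fun z ↦ if z = a then g a else f z / (z - a) ^ n) =ᶠ[𝓝 s]
          fun z ↦ f z / (z - a) ^ n := by
        filter_upwards [isOpen_ne.mem_nhds hs] with z hz
        rw [if_neg hz]
      refine DifferentiableAt.congr_of_eventuallyEq ?_ this
      refine (hf s).div (by fun_prop) (pow_ne_zero _ (sub_ne_zero.2 hs))
  · intro s
    by_cases hs : s = a
    · subst hs
      simpa using he.self_of_nhds
    · simp only [hs, if_false]
      rw [mul_div_cancel₀]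
      exact pow_ne_zero _ (sub_ne_zero.2 hs)

/-- An entire function that is not identically zero is a finite product of linear factors times
an entire function without zeros in a given disc. -/
theorem exists_zeros_mul {f : ℂ → ℂ} (hf : Differentiable ℂ f) {s₀ : ℂ} (h0 : f s₀ ≠ 0) (R : ℝ) :
    ∃ Z : Multiset ℂ, ∃ g : ℂ → ℂ, Differentiable ℂ g ∧
      (∀ s ∈ Metric.closedBall s₀ R, g s ≠ 0) ∧ (∀ ρ ∈ Z, ρ ∈ Metric.closedBall s₀ R) ∧
      ∀ s, f s = (Z.map (fun ρ ↦ s - ρ)).prod * g s := by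
  have hfin : (Metric.closedBall s₀ R ∩ {z | f z = 0}).Finite := by
    have hd := (AnalyticOnNhd.eqOn_zero_or_eventually_ne_zero_of_preconnected
      (f := f) (U := Set.univ) (fun z _ ↦ hf.analyticAt z) isPreconnected_univ).resolve_left
      (fun h ↦ h0 (h (mem_univ s₀)))
    have h2 : {z | f z ≠ 0} ∈ codiscreteWithin (Metric.closedBall s₀ R) :=
      codiscreteWithin_mono (subset_univ _) hd
    refine ((isCompact_closedBall s₀ R).finite_sdiff_of_mem_codiscreteWithin h2).subset ?_
    rintro z ⟨hz, hz'⟩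
    exact ⟨hz, by simpa using hz'⟩
  have key : ∀ S : Finset ℂ, ∀ f : ℂ → ℂ, Differentiable ℂ f → f s₀ ≠ 0 →
      (∀ a ∈ S, a ∈ Metric.closedBall s₀ R) →
      (∀ z ∈ Metric.closedBall s₀ R, f z = 0 → z ∈ S) →
      ∃ Z : Multiset ℂ, ∃ g : ℂ → ℂ, Differentiable ℂ g ∧
      (∀ s ∈ Metric.closedBall s₀ R, g s ≠ 0) ∧ (∀ ρ ∈ Z, ρ ∈ Metric.closedBall s₀ R) ∧
      ∀ s, f s = (Z.map (fun ρ ↦ s - ρ)).prod * g s := by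
    intro S
    induction S using Finset.induction_on with
    | empty =>
      intro f hf _ _ h
      exact ⟨0, f, hf, fun s hs h' ↦ by simpa using h s hs h', by simp, by simp⟩
    | insert a S ha ih =>
      intro f hf h0 hS h
      obtain ⟨n, g, hg, hga, he⟩ := exists_eq_pow_mul hf h0 a
      obtain ⟨Z, k, hk, hk0, hZ, hgk⟩ := ih g hg (fun h ↦ h0 (by rw [he, h, mul_zero]))
        (fun b hb ↦ hS b (Finset.mem_insert_of_mem hb)) (fun z hz hz0 ↦ by
          have := h z hz (by rw [he, hz0, mul_zero])
          rcases Finset.mem_insert.1 this with rfl | h1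
          · exact absurd hz0 hga
          · exact h1)
      refine ⟨Multiset.replicate n a + Z, k, hk, hk0, ?_, ?_⟩
      · intro ρ hρ
        rcases Multiset.mem_add.1 hρ with h1 | h1
        · rw [Multiset.eq_of_mem_replicate h1]
          exact hS a (Finset.mem_insert_self _ _)
        · exact hZ ρ h1
      · intro s
        rw [he, hgk]
        simp [mul_assoc]
  refine key hfin.toFinset f hf h0 (fun a ha ↦ ?_) (fun z hz hz0 ↦ ?_)
  · exact ((Set.Finite.mem_toFinset _).1 ha).1
  · exact (Set.Finite.mem_toFinset _).2 ⟨hz, hz0⟩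

/-- The contribution of a zero `ρ` to the logarithmic derivative at `s₀`. -/
noncomputable def zeroTerm (s₀ : ℂ) (R : ℝ) (ρ : ℂ) : ℝ :=
  (s₀ - ρ).re / ‖s₀ - ρ‖ ^ 2 - (s₀ - ρ).re / R ^ 2

theorem zeroTerm_nonneg {s₀ ρ : ℂ} {R : ℝ} (hρ : ρ ∈ Metric.closedBall s₀ R)
    (h : ρ.re < s₀.re) : 0 ≤ zeroTerm s₀ R ρ := by
  have hre : 0 < (s₀ - ρ).re := by simpa using h
  have hn : 0 < ‖s₀ - ρ‖ := hre.trans_le (Complex.re_le_norm _)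
  have hR : ‖s₀ - ρ‖ ≤ R := by rwa [mem_closedBall_iff_norm'] at hρ
  unfold zeroTerm
  rw [sub_nonneg]
  gcongr

/-- Replacing linear factors by Blaschke factors. -/
theorem exists_blaschke {s₀ : ℂ} {R : ℝ} (hR : 0 < R) {g : ℂ → ℂ} (hg : Differentiable ℂ g)
    (hg0 : g s₀ ≠ 0) (Z : Multiset ℂ) :
    (∀ ρ ∈ Z, ρ ∈ Metric.closedBall s₀ R ∧ ρ.re < s₀.re) →
    ∃ G : ℂ → ℂ, Differentiable ℂ G ∧
      (∀ s ∈ Metric.sphere s₀ R, ‖G s‖ = ‖(Z.map (fun ρ ↦ s - ρ)).prod * g s‖) ∧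
      (∀ s ∈ Metric.ball s₀ R, G s = 0 → g s = 0) ∧
      ‖(Z.map (fun ρ ↦ s₀ - ρ)).prod * g s₀‖ ≤ ‖G s₀‖ ∧
      (Z.map (fun ρ ↦ s₀ - ρ)).prod * g s₀ ≠ 0 ∧
      (logDeriv (fun s ↦ (Z.map (fun ρ ↦ s - ρ)).prod * g s) s₀).re
        = (logDeriv G s₀).re + (Z.map (zeroTerm s₀ R)).sum := by
  induction Z using Multiset.induction_on with
  | empty => intro _; exact ⟨g, hg, by simp, by simp, by simp, by simpa using hg0, by simp⟩
  | cons ρ Z ih =>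
    intro hZ
    obtain ⟨G, hG, hGs, hGb, hG0, hne, hlog⟩ := ih fun ρ h ↦ hZ ρ (Multiset.mem_cons_of_mem h)
    obtain ⟨hρ, hre⟩ := hZ ρ (Multiset.mem_cons_self _ _)
    have hGne : G s₀ ≠ 0 := norm_pos_iff.1 ((norm_pos_iff.2 hne).trans_le hG0)
    have hρR : ‖s₀ - ρ‖ ≤ R := by rwa [mem_closedBall_iff_norm'] at hρ
    have hsρ : s₀ - ρ ≠ 0 := fun h ↦ by
      have := congrArg Complex.re h
      simp at this; linarith
    have hRc : (R : ℂ) ≠ 0 := by exact_mod_cast hR.ne'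
    set c : ℂ := conj (ρ - s₀) with hc
    set B : ℂ → ℂ := fun s ↦ (R ^ 2 - c * (s - s₀)) / R with hB
    have hBd : Differentiable ℂ B := by
      intro s; simp only [hB]; fun_prop
    have hB0 : B s₀ = R := by simp [hB]; field_simp
    have hcn : ‖c‖ ≤ R := by rw [hc, RCLike.norm_conj, norm_sub_rev]; exact hρR
    have hprod : Differentiable ℂ (fun s ↦ (Z.map (fun ρ ↦ s - ρ)).prod * g s) := by
      have : Differentiable ℂ (fun s : ℂ ↦ (Z.map (fun ρ ↦ s - ρ)).prod) := by
        clear hZ ih hGs hG0 hne hlog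
        induction Z using Multiset.induction_on with
        | empty => simp
        | cons a Z ih => simp only [Multiset.map_cons, Multiset.prod_cons]; fun_prop
      fun_prop
    refine ⟨fun s ↦ B s * G s, hBd.mul hG, ?_, ?_, ?_, ?_, ?_⟩
    · intro s hs
      have hs' : ‖s - s₀‖ = R := by simpa [dist_eq_norm] using hs
      have hBs : ‖B s‖ = ‖s - ρ‖ := by
        have e : (R : ℂ) ^ 2 = conj (s - s₀) * (s - s₀) := by
          rw [← Complex.normSq_eq_conj_mul_self, Complex.normSq_eq_norm_sq, hs']; push_cast; ring
        simp only [hB]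
        rw [e, hc, ← sub_mul, ← map_sub, norm_div, norm_mul, hs', RCLike.norm_conj,
          Complex.norm_real, Real.norm_of_nonneg hR.le, mul_div_cancel_right₀ _ hR.ne']
        congr 1; ring
      rw [norm_mul, hBs, hGs s hs, ← norm_mul]
      simp [mul_assoc]
    · intro s hs h
      refine hGb s hs ((mul_eq_zero.1 h).resolve_left fun h' ↦ ?_)
      simp only [hB] at h'
      rw [div_eq_zero_iff, or_iff_left hRc, sub_eq_zero] at h'
      have h2 := congrArg norm h'
      rw [norm_pow, Complex.norm_real, Real.norm_of_nonneg hR.le, norm_mul] at h2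
      have h3 : ‖s - s₀‖ < R := by simpa [dist_eq_norm] using hs
      nlinarith [norm_nonneg c, norm_nonneg (s - s₀)]
    · beta_reduce
      rw [Multiset.map_cons, Multiset.prod_cons, mul_assoc, norm_mul, norm_mul (B s₀), hB0,
        Complex.norm_real, Real.norm_of_nonneg hR.le]
      gcongr
    · rw [Multiset.map_cons, Multiset.prod_cons, mul_assoc]
      exact mul_ne_zero hsρ hne
    · have e1 : (fun s ↦ ((ρ ::ₘ Z).map (fun ρ ↦ s - ρ)).prod * g s)
          = fun s ↦ (s - ρ) * ((Z.map (fun ρ ↦ s - ρ)).prod * g s) := by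
        ext s; simp [mul_assoc]
      rw [e1, logDeriv_mul (f := fun s ↦ s - ρ) s₀ hsρ hne (by fun_prop) hprod.differentiableAt,
        logDeriv_mul s₀ (by rw [hB0]; exact hRc) hGne hBd.differentiableAt hG.differentiableAt,
        Complex.add_re, Complex.add_re, hlog, Multiset.map_cons, Multiset.sum_cons]
      have e2 : logDeriv (fun s ↦ s - ρ) s₀ = (s₀ - ρ)⁻¹ := by
        simp [logDeriv_apply]
      have e3 : logDeriv B s₀ = conj (s₀ - ρ) / R ^ 2 := by
        have : HasDerivAt B (-c / R) s₀ := by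
          have := (((((hasDerivAt_id s₀).sub_const s₀).const_mul c).const_sub ((R : ℂ) ^ 2)).div_const
            (R : ℂ))
          refine this.congr_deriv ?_
          ring
        rw [logDeriv_apply, this.deriv, hB0, hc, ← map_neg, neg_sub]
        field_simp
      have e4 : ((s₀ - ρ)⁻¹).re = (s₀ - ρ).re / ‖s₀ - ρ‖ ^ 2 := by
        rw [Complex.inv_re, Complex.normSq_eq_norm_sq]
      have e5 : (conj (s₀ - ρ) / (R : ℂ) ^ 2).re = (s₀ - ρ).re / R ^ 2 := by
        rw [← Complex.ofReal_pow, Complex.div_ofReal_re, Complex.conj_re]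
      rw [e2, e3, e4, e5]
      unfold zeroTerm
      ring

/-- Derivative form of the Borel–Carathéodory theorem for functions without zeros. -/
theorem norm_logDeriv_le {s₀ : ℂ} {R M : ℝ} (hR : 0 < R) {G : ℂ → ℂ} (hG : Differentiable ℂ G)
    (h0 : ∀ s ∈ Metric.ball s₀ R, G s ≠ 0) (hM : ∀ s ∈ Metric.ball s₀ R, ‖G s‖ ≤ M) :
    ‖logDeriv G s₀‖ ≤ 2 * Real.log (M / ‖G s₀‖) / R := by
  have hs₀ : s₀ ∈ Metric.ball s₀ R := Metric.mem_ball_self hR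
  have hG0 := norm_pos_iff.2 (h0 s₀ hs₀)
  have hM0 : 1 ≤ M / ‖G s₀‖ := by rw [one_le_div hG0]; exact hM s₀ hs₀
  have hmem : ∀ z ∈ Metric.ball (0 : ℂ) R, s₀ + z ∈ Metric.ball s₀ R := by
    intro z hz; simpa [dist_eq_norm] using hz
  have hd : DifferentiableOn ℂ (fun z ↦ deriv G (s₀ + z) / G (s₀ + z)) (Metric.ball 0 R) := by
    intro z hz
    have h1 : DifferentiableAt ℂ (deriv G) (s₀ + z) :=
      (hG.analyticAt (s₀ + z)).deriv.differentiableAt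
    have h2 : DifferentiableAt ℂ (fun z : ℂ ↦ s₀ + z) z := by fun_prop
    exact ((h1.comp z h2).div (hG.differentiableAt.comp z h2)
      (h0 _ (hmem z hz))).differentiableWithinAt
  obtain ⟨H, hH0, hH⟩ := hd.isExactOn_ball.with_val_at 0 0
  have hHd : DifferentiableOn ℂ H (Metric.ball 0 R) :=
    fun z hz ↦ (hH z hz).differentiableAt.differentiableWithinAt
  have hz0 : (0 : ℂ) ∈ Metric.ball (0 : ℂ) R := Metric.mem_ball_self hR
  have hGH : ∀ z ∈ Metric.ball (0 : ℂ) R, G (s₀ + z) = G s₀ * Complex.exp (H z) := by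
    have hd2 : ∀ z ∈ Metric.ball (0 : ℂ) R,
        HasDerivWithinAt (fun z ↦ G (s₀ + z) * Complex.exp (-H z)) 0 (Metric.ball 0 R) z := by
      intro z hz
      have h1 : HasDerivAt (fun z ↦ G (s₀ + z)) (deriv G (s₀ + z)) z := by
        have := (hG (s₀ + z)).hasDerivAt.comp_const_add s₀ z
        exact this
      have h2 := h1.mul ((hH z hz).neg.cexp)
      refine (h2.congr_deriv ?_).hasDerivWithinAt
      have := h0 _ (hmem z hz)
      field_simp
      simp
    intro z hz
    have := (convex_ball (0 : ℂ) R).is_const_of_fderivWithin_eq_zero (𝕜 := ℂ)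
      (f := fun z ↦ G (s₀ + z) * Complex.exp (-H z))
      (fun z hz ↦ (hd2 z hz).differentiableWithinAt)
      (fun z hz ↦ by
        rw [(hd2 z hz).hasFDerivWithinAt.fderivWithin (Metric.isOpen_ball.uniqueDiffWithinAt hz)]
        ext
        simp) hz hz0
    simp only [hH0, add_zero, neg_zero, Complex.exp_zero, mul_one] at this
    rw [← this, mul_assoc, ← Complex.exp_add]
    simp
  have hre : ∀ z ∈ Metric.ball (0 : ℂ) R, (H z).re ≤ Real.log (M / ‖G s₀‖) := by
    intro z hz
    rw [Real.le_log_iff_exp_le (by linarith), le_div_iff₀ hG0, ← Complex.norm_exp, ← norm_mul,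
      mul_comm, ← hGH z hz]
    exact hM _ (hmem z hz)
  have hHd0 : HasDerivAt H (logDeriv G s₀) 0 := by
    have := hH 0 hz0
    simpa [logDeriv_apply] using this
  refine le_of_forall_pos_le_add fun ε hε ↦ ?_
  set A := Real.log (M / ‖G s₀‖) with hA
  have hA0 : 0 ≤ A := Real.log_nonneg hM0
  set A' := A + ε * R / 2 with hA'
  have hA'0 : 0 < A' := by positivity
  have hbound : ∀ z ∈ Metric.ball (0 : ℂ) R, ‖H z‖ ≤ 2 * A' * ‖z‖ / (R - ‖z‖) := by
    intro z hz
    refine Complex.borelCaratheodory_zero hA'0 hHd (fun w hw ↦ ?_) hR hz hH0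
    have h1 : 0 < ε * R / 2 := by positivity
    simp only [Set.mem_ofPred_eq]
    have := hre w hw
    linarith
  have ht : Tendsto (fun z : ℂ ↦ 2 * A' / (R - ‖z‖)) (𝓝[≠] 0) (𝓝 (2 * A' / (R - ‖(0 : ℂ)‖))) := by
    refine Tendsto.mono_left ?_ nhdsWithin_le_nhds
    refine ContinuousAt.tendsto ?_
    refine ContinuousAt.div continuousAt_const (by fun_prop) ?_
    simpa using hR.ne'
  have hs := (hasDerivAt_iff_tendsto_slope.1 hHd0).norm
  have := le_of_tendsto_of_tendsto hs ht (by
    have hb : Metric.ball (0 : ℂ) R ∈ 𝓝[≠] (0 : ℂ) :=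
      nhdsWithin_le_nhds (Metric.ball_mem_nhds 0 hR)
    filter_upwards [hb, self_mem_nhdsWithin] with z hz hz0
    have hzn : 0 < ‖z‖ := norm_pos_iff.2 hz0
    rw [slope_def_field, hH0, sub_zero, sub_zero, norm_div, div_le_iff₀ hzn]
    refine (hbound z hz).trans (le_of_eq ?_)
    ring)
  refine this.trans (le_of_eq ?_)
  rw [norm_zero, sub_zero, hA']
  field_simp

/-- Lower bound for the real part of a logarithmic derivative in terms of selected zeros. -/
theorem re_logDeriv_ge {f g : ℂ → ℂ} {s₀ : ℂ} {R M : ℝ} (hR : 0 < R)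
    (h0 : f s₀ ≠ 0) (hM : ∀ s ∈ Metric.closedBall s₀ R, ‖f s‖ ≤ M)
    (hz : ∀ s, f s = 0 → s.re < s₀.re) (hg : Differentiable ℂ g) (Z : Multiset ℂ)
    (hZ : ∀ ρ ∈ Z, ρ ∈ Metric.closedBall s₀ R)
    (hfg : ∀ s, f s = (Z.map (fun ρ ↦ s - ρ)).prod * g s) :
    (Z.map (zeroTerm s₀ R)).sum - 2 * Real.log (M / ‖f s₀‖) / R ≤ (logDeriv f s₀).re := by
  have hg0 : g s₀ ≠ 0 := fun h ↦ h0 (by rw [hfg, h, mul_zero])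
  obtain ⟨Y, k, hk, hk0, hY, hgk⟩ := exists_zeros_mul hg hg0 R
  have hfk : f = fun s ↦ ((Z + Y).map (fun ρ ↦ s - ρ)).prod * k s := by
    ext s; rw [hfg, hgk]; simp [mul_assoc]
  have hball : ∀ ρ ∈ Z + Y, ρ ∈ Metric.closedBall s₀ R ∧ ρ.re < s₀.re := by
    intro ρ hρ
    refine ⟨?_, hz ρ ?_⟩
    · rcases Multiset.mem_add.1 hρ with h | h
      · exact hZ ρ h
      · exact hY ρ h
    · rw [hfk]
      simp only [mul_eq_zero]
      left
      exact Multiset.prod_eq_zero (Multiset.mem_map.2 ⟨ρ, hρ, sub_self ρ⟩)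
  obtain ⟨G, hG, hGs, hGb, hG0, hne, hlog⟩ := exists_blaschke hR hk
    (hk0 s₀ (Metric.mem_closedBall_self hR.le)) (Z + Y) hball
  have hGM : ∀ s ∈ Metric.ball s₀ R, ‖G s‖ ≤ M := by
    intro s hs
    refine Complex.norm_le_of_forall_mem_frontier_norm_le Metric.isBounded_ball
      hG.diffContOnCl (fun z hz ↦ ?_) (subset_closure hs)
    rw [frontier_ball s₀ hR.ne'] at hz
    rw [hGs z hz]
    have := hM z (Metric.sphere_subset_closedBall hz)
    rw [hfk] at this
    exact this
  have hGn : ∀ s ∈ Metric.ball s₀ R, G s ≠ 0 := fun s hs h ↦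
    hk0 s (Metric.ball_subset_closedBall hs) (hGb s hs h)
  have h1 := norm_logDeriv_le hR hG hGn hGM
  have hf0 : f s₀ = ((Z + Y).map (fun ρ ↦ s₀ - ρ)).prod * k s₀ := by rw [hfk]
  rw [← hf0] at hG0
  rw [← hfk] at hlog
  have hfp := norm_pos_iff.2 h0
  have hM0 : 0 < M := hfp.trans_le (hM s₀ (Metric.mem_closedBall_self hR.le))
  have h2 : Real.log (M / ‖G s₀‖) ≤ Real.log (M / ‖f s₀‖) := by
    apply Real.log_le_log (div_pos hM0 (hfp.trans_le hG0))
    gcongr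
  have h3 : 0 ≤ (Y.map (zeroTerm s₀ R)).sum := by
    refine Multiset.sum_nonneg fun x hx ↦ ?_
    obtain ⟨ρ, hρ, rfl⟩ := Multiset.mem_map.1 hx
    obtain ⟨h4, h5⟩ := hball ρ (Multiset.mem_add.2 (Or.inr hρ))
    exact zeroTerm_nonneg h4 h5
  have h4 := neg_le_of_abs_le ((Complex.abs_re_le_norm _).trans h1)
  have h5 : 2 * Real.log (M / ‖G s₀‖) / R ≤ 2 * Real.log (M / ‖f s₀‖) / R := by gcongr
  rw [Multiset.map_add, Multiset.sum_add] at hlog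
  linarith

end LandauPage

namespace LandauPage
open Finset Set Filter Topology
open scoped BigOperators ComplexConjugate

/-- An `L`-function is at least of size `σ - 1` to the right of the line `Re s = 1`. -/
theorem exists_sub_one_le_norm_LFunction : ∃ K : ℝ, 1 ≤ K ∧ ∀ (q : ℕ) [NeZero q]
    (χ : DirichletCharacter ℂ q) (s : ℂ), 1 < s.re → s.re ≤ 2 →
    s.re - 1 ≤ K * ‖χ.LFunction s‖ := by
  obtain ⟨K₀, hK₀, hK⟩ := exists_norm_zetaOne_le
  refine ⟨1 + K₀ * 9, by linarith, fun q _ χ s hs hs2 ↦ ?_⟩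
  set f : ℕ → ℂ := (fun n : ℕ ↦ χ n) * fun n ↦ (ArithmeticFunction.moebius n : ℂ) with hf
  have hmul := DirichletCharacter.LSeries.mul_mu_eq_one χ hs
  rw [← DirichletCharacter.LFunction_eq_LSeries χ hs] at hmul
  have hone : 1 < ((s.re : ℝ) : ℂ).re := by simpa using hs
  have hs1 : LSeriesSummable 1 (s.re : ℂ) := LSeriesSummable_one_iff.2 hone
  have hle : ∀ n, ‖LSeries.term f s n‖ ≤ ‖LSeries.term 1 (s.re : ℂ) n‖ := by
    intro n
    have h1 : ‖LSeries.term f s n‖ ≤ ‖LSeries.term 1 s n‖ := by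
      refine LSeries.norm_term_le s ?_
      simp only [hf, Pi.mul_apply, Pi.one_apply, norm_mul, norm_one]
      refine mul_le_one₀ (χ.norm_le_one _) (norm_nonneg _) ?_
      rw [Complex.norm_intCast]
      exact_mod_cast ArithmeticFunction.abs_moebius_le_one
    refine h1.trans (LSeries.norm_term_le_of_re_le_re 1 (by simp) n)
  have hn : ‖LSeries f s‖ ≤ ‖riemannZeta s.re‖ := by
    have h2 : HasSum (fun n ↦ ‖LSeries.term 1 (s.re : ℂ) n‖) (riemannZeta s.re).re := by
      have := Complex.hasSum_re (LSeriesHasSum_one hone)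
      refine this.congr_fun ?_
      intro n
      have h3 := LSeries.term_nonneg (a := 1) (n := n) (by simp [Complex.nonneg_iff]) s.re
      rw [Complex.nonneg_iff] at h3
      rw [← Complex.re_eq_norm.2 (Complex.nonneg_iff.2 h3)]
    refine (tsum_of_norm_bounded h2 hle).trans (Complex.re_le_norm _)
  have hz : (s.re - 1) * ‖riemannZeta s.re‖ ≤ K₀ * 9 := by
    have h3 := hK s.re (by simp; linarith)
    rw [zetaOne_of_ne (by intro h; have := congrArg Complex.re h; simp at this; linarith),
      norm_mul, ← Complex.ofReal_one, ← Complex.ofReal_sub, Complex.norm_real,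
      Complex.norm_real, Real.norm_of_nonneg (by linarith), Real.norm_of_nonneg (by linarith)] at h3
    refine h3.trans ?_
    have : (1 + s.re) ^ 2 ≤ 9 := by nlinarith
    gcongr
  have h1 : ‖χ.LFunction s‖ * ‖LSeries f s‖ = 1 := by rw [← norm_mul, hmul, norm_one]
  calc s.re - 1 = ‖χ.LFunction s‖ * ((s.re - 1) * ‖LSeries f s‖) := by
        rw [mul_left_comm, h1, mul_one]
    _ ≤ ‖χ.LFunction s‖ * ((s.re - 1) * ‖riemannZeta s.re‖) := by
        have : 0 ≤ s.re - 1 := by linarith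
        gcongr
    _ ≤ ‖χ.LFunction s‖ * (1 + K₀ * 9) := by gcongr; linarith
    _ = _ := mul_comm _ _

theorem zeroTerm_mono {s₀ ρ : ℂ} {R R' : ℝ} (hR : 0 < R) (hRR : R ≤ R') (h : ρ.re < s₀.re) :
    zeroTerm s₀ R ρ ≤ zeroTerm s₀ R' ρ := by
  have hre : 0 < (s₀ - ρ).re := by simpa using h
  unfold zeroTerm
  gcongr

theorem sum_zeroTerm_mono {s₀ : ℂ} {R R' : ℝ} (hR : 0 < R) (hRR : R ≤ R') (Z : Multiset ℂ)
    (h : ∀ ρ ∈ Z, ρ.re < s₀.re) :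
    (Z.map (zeroTerm s₀ R)).sum ≤ (Z.map (zeroTerm s₀ R')).sum :=
  Multiset.sum_map_le_sum_map _ _ fun ρ hρ ↦ zeroTerm_mono hR hRR (h ρ hρ)

theorem log_div_sq_le {Λ b : ℝ} (hΛ : 1 ≤ Λ) (hb : 0 < b) :
    Real.log (Λ / b ^ 2) ≤ Real.log Λ + 2 / b := by
  rw [Real.log_div (by linarith) (by positivity), Real.log_pow]
  have : Real.log b⁻¹ ≤ b⁻¹ := (Real.log_le_sub_one_of_pos (by positivity)).trans (by linarith)
  rw [Real.log_inv] at this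
  push_cast
  rw [div_eq_mul_inv]
  linarith

/-- The point `1 + b² / Λ + i t`. -/
noncomputable def basePt (Λ b t : ℝ) : ℂ := ⟨1 + b ^ 2 / Λ, t⟩

/-- Upper bound for `-Re L'/L` with the contribution of selected zeros retained. -/
theorem exists_re_logDeriv_LFunction_ge : ∃ K : ℝ, 1 ≤ K ∧ ∀ l Λ b t : ℝ, 1 < l →
    l / Real.log l ≤ Λ → 0 < b → b ≤ 1 → |t| ≤ 2 * Real.exp (Λ / √l) →
    ∀ (q : ℕ) [NeZero q] (χ : DirichletCharacter ℂ q), χ.IsPrimitive → χ ≠ 1 →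
    Real.log q ≤ 2 * l → (∀ p : ℕ, p.Prime → p ∣ q → (p : ℝ) ≤ Real.exp Λ) →
    ∀ (Z : Multiset ℂ) (g : ℂ → ℂ), Differentiable ℂ g →
    (∀ ρ ∈ Z, ρ ∈ Metric.closedBall (basePt Λ b t) (1 / Λ)) →
    (∀ s, χ.LFunction s = (Z.map (fun ρ ↦ s - ρ)).prod * g s) →
    (Z.map (zeroTerm (basePt Λ b t) (1 / Λ))).sum - K / b * Λ
      ≤ (logDeriv χ.LFunction (basePt Λ b t)).re := by
  obtain ⟨C, hC, hgrow⟩ := exists_growth_bound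
  obtain ⟨K₁, hK₁, hlow⟩ := exists_sub_one_le_norm_LFunction
  refine ⟨2 * (2 * C + Real.log K₁ + 2), by nlinarith [Real.log_nonneg hK₁], ?_⟩
  intro l Λ b t hl hΛ hb hb1 ht q _ χ hχ hχ1 hq hp Z g hg hZ hfg
  have hΛe := exp_one_le_of_div_log_le hl hΛ
  have hΛ1 : 1 < Λ := by linarith [Real.exp_one_gt_d9]
  obtain ⟨r, A, hr, hr2, hrΛ, hA0, hA, hlogΛ, hL⟩ := hgrow l Λ hl hΛ
  set s₀ := basePt Λ b t with hs₀
  have hre : s₀.re = 1 + b ^ 2 / Λ := rfl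
  have him : s₀.im = t := rfl
  have hb2 : 0 < b ^ 2 / Λ := by positivity
  have hb3 : b ^ 2 / Λ ≤ 1 / Λ := by gcongr; nlinarith
  have hb4 : 1 / Λ ≤ 1 := by rw [div_le_one (by linarith)]; linarith
  have hrr : 1 / Λ ≤ r := by rwa [div_le_iff₀ (by linarith)]
  have hz : ∀ s, χ.LFunction s = 0 → s.re < 1 := by
    intro s hs
    by_contra h
    exact χ.LFunction_ne_zero_of_one_le_re (Or.inl hχ1) (not_lt.1 h) hs
  have h0 : χ.LFunction s₀ ≠ 0 := fun h ↦ by have := hz _ h; linarith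
  have hM : ∀ s ∈ Metric.closedBall s₀ r, ‖χ.LFunction s‖ ≤ Real.exp A := by
    intro s hs
    rw [mem_closedBall_iff_norm] at hs
    have h1 := (Complex.abs_re_le_norm _).trans hs
    have h2 := (Complex.abs_im_le_norm _).trans hs
    rw [Complex.sub_re, hre, abs_le] at h1
    rw [Complex.sub_im, him, abs_le] at h2
    refine hL q χ hχ hχ1 hq hp s (by linarith) ?_
    refine (Complex.norm_le_abs_re_add_abs_im s).trans ?_
    have h3 : |s.re| ≤ 1 + 1 + r := by rw [abs_le]; constructor <;> linarith
    have h4 : |s.im| ≤ |t| + r := by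
      rw [abs_le]; constructor <;> linarith [neg_abs_le t, le_abs_self t]
    linarith
  have hmain := re_logDeriv_ge hr h0 hM (fun s hs ↦ (hz s hs).trans (by linarith)) hg Z
    (fun ρ hρ ↦ Metric.closedBall_subset_closedBall hrr (hZ ρ hρ)) hfg
  have hZre : ∀ ρ ∈ Z, ρ.re < s₀.re := by
    intro ρ hρ
    refine (hz ρ ?_).trans (by linarith)
    rw [hfg]
    simp only [mul_eq_zero]
    left
    exact Multiset.prod_eq_zero (Multiset.mem_map.2 ⟨ρ, hρ, sub_self ρ⟩)
  have hmono := sum_zeroTerm_mono (R := 1 / Λ) (by positivity) hrr Z hZre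
  have hlog : Real.log (Real.exp A / ‖χ.LFunction s₀‖)
      ≤ A + (Real.log K₁ + (Real.log Λ + 2 / b)) := by
    have hn := norm_pos_iff.2 h0
    have h1 : b ^ 2 / Λ ≤ K₁ * ‖χ.LFunction s₀‖ := by
      have := hlow q χ s₀ (by linarith) (by linarith)
      rw [hre] at this; linarith
    rw [Real.log_div (Real.exp_pos _).ne' hn.ne', Real.log_exp]
    have h2 : Real.log (b ^ 2 / Λ) ≤ Real.log K₁ + Real.log ‖χ.LFunction s₀‖ := by
      rw [← Real.log_mul (by linarith) hn.ne']
      exact Real.log_le_log hb2 h1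
    have h3 := log_div_sq_le hΛ1.le hb
    rw [Real.log_div (by linarith) (by positivity)] at h3
    rw [Real.log_div (by positivity) (by linarith)] at h2
    linarith
  have hfin : 2 * Real.log (Real.exp A / ‖χ.LFunction s₀‖) / r
      ≤ 2 * (2 * C + Real.log K₁ + 2) / b * Λ := by
    rw [div_le_iff₀ hr]
    have hlk := Real.log_nonneg hK₁
    have hib : 1 ≤ 1 / b := by rw [le_div_iff₀ hb]; linarith
    have e : 2 * (2 * C + Real.log K₁ + 2) / b * Λ * r
        = 2 * ((2 * C + Real.log K₁) * (1 / b) * (r * Λ) + (2 / b) * (r * Λ)) := by ring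
    rw [e]
    have h5 : 2 / b ≤ 2 / b * (r * Λ) := le_mul_of_one_le_right (by positivity) hrΛ
    have h6 : Real.log K₁ ≤ Real.log K₁ * (r * Λ) := le_mul_of_one_le_right hlk hrΛ
    have h7 : (2 * C + Real.log K₁) * (r * Λ) ≤ (2 * C + Real.log K₁) * (1 / b) * (r * Λ) := by
      have : 0 ≤ (2 * C + Real.log K₁) := by linarith
      exact mul_le_mul_of_nonneg_right (le_mul_of_one_le_right this hib) (by linarith)
    nlinarith
  linarith

/-- The analogue of `exists_re_logDeriv_LFunction_ge` for `(s - 1) ζ(s)`. -/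
theorem exists_re_logDeriv_zetaOne_ge : ∃ K : ℝ, 1 ≤ K ∧ ∀ l Λ b t : ℝ, 1 < l →
    l / Real.log l ≤ Λ → 0 < b → b ≤ 1 → |t| ≤ 2 * Real.exp (Λ / √l) →
    ∀ (Z : Multiset ℂ) (g : ℂ → ℂ), Differentiable ℂ g →
    (∀ ρ ∈ Z, ρ ∈ Metric.closedBall (basePt Λ b t) (1 / Λ)) →
    (∀ s, zetaOne s = (Z.map (fun ρ ↦ s - ρ)).prod * g s) →
    (Z.map (zeroTerm (basePt Λ b t) (1 / Λ))).sum - K / b * Λ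
      ≤ (logDeriv zetaOne (basePt Λ b t)).re := by
  obtain ⟨K₀, hK₀, hK⟩ := exists_norm_zetaOne_le
  obtain ⟨K₁, hK₁, hlow⟩ := exists_sub_one_le_norm_LFunction
  refine ⟨4 * (|Real.log K₀| + 18 + Real.log K₁ + 6), by
    linarith [Real.log_nonneg hK₁, abs_nonneg (Real.log K₀)], ?_⟩
  intro l Λ b t hl hΛ hb hb1 ht Z g hg hZ hfg
  have hΛe := exp_one_le_of_div_log_le hl hΛ
  have hΛ1 : 2 < Λ := by linarith [Real.exp_one_gt_d9]
  set s₀ := basePt Λ b t with hs₀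
  have hre : s₀.re = 1 + b ^ 2 / Λ := rfl
  have him : s₀.im = t := rfl
  have hb2 : 0 < b ^ 2 / Λ := by positivity
  have hb3 : b ^ 2 / Λ ≤ 1 / Λ := by gcongr; nlinarith
  have hb4 : 1 / Λ ≤ 1 / 2 := by gcongr
  have hs1 : s₀ ≠ 1 := fun h ↦ by
    have := congrArg Complex.re h
    rw [hre, Complex.one_re] at this; linarith
  have hz : ∀ s, zetaOne s = 0 → s.re < 1 := by
    intro s hs
    by_contra h
    by_cases h1 : s = 1
    · rw [h1, zetaOne_one] at hs; exact one_ne_zero hs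
    · rw [zetaOne_of_ne h1] at hs
      exact mul_ne_zero (sub_ne_zero.2 h1) (riemannZeta_ne_zero_of_one_le_re (not_lt.1 h)) hs
  have h0 : zetaOne s₀ ≠ 0 := fun h ↦ by have := hz _ h; linarith
  set τ := Real.exp (Λ / √l) with hτ
  have hl1 : 1 ≤ √l := Real.one_le_sqrt.2 hl.le
  have hτ1 : 1 ≤ τ := Real.one_le_exp (by positivity)
  have hM : ∀ s ∈ Metric.closedBall s₀ (1 / 2), ‖zetaOne s‖ ≤ K₀ * (8 * τ) ^ 2 := by
    intro s hs
    rw [mem_closedBall_iff_norm] at hs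
    have h1 := (Complex.abs_re_le_norm _).trans hs
    have h2 := (Complex.abs_im_le_norm _).trans hs
    rw [Complex.sub_re, hre, abs_le] at h1
    rw [Complex.sub_im, him, abs_le] at h2
    refine (hK s (by linarith)).trans ?_
    have h3 : |s.re| ≤ 2 := by rw [abs_le]; constructor <;> linarith
    have h4 : |s.im| ≤ |t| + 1 / 2 := by
      rw [abs_le]; constructor <;> linarith [neg_abs_le t, le_abs_self t]
    have h5 := Complex.norm_le_abs_re_add_abs_im s
    gcongr
    linarith
  have hmain := re_logDeriv_ge (R := 1 / 2) (by norm_num) h0 hM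
    (fun s hs ↦ (hz s hs).trans (by linarith)) hg Z
    (fun ρ hρ ↦ Metric.closedBall_subset_closedBall hb4 (hZ ρ hρ)) hfg
  have hZre : ∀ ρ ∈ Z, ρ.re < s₀.re := by
    intro ρ hρ
    refine (hz ρ ?_).trans (by linarith)
    rw [hfg]
    simp only [mul_eq_zero]
    left
    exact Multiset.prod_eq_zero (Multiset.mem_map.2 ⟨ρ, hρ, sub_self ρ⟩)
  have hmono := sum_zeroTerm_mono (R := 1 / Λ) (by positivity) hb4 Z hZre
  have hlogb := log_div_sq_le (by linarith : (1 : ℝ) ≤ Λ) hb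
  have hlogΛ : Real.log Λ ≤ Λ := (Real.log_le_sub_one_of_pos (by linarith)).trans (by linarith)
  have hlog : Real.log (K₀ * (8 * τ) ^ 2 / ‖zetaOne s₀‖)
      ≤ Real.log K₀ + 2 * (7 + Λ) + (Real.log K₁ + 2 * (Λ + 2 / b)) := by
    have hn := norm_pos_iff.2 h0
    have h1 : b ^ 2 / Λ * (b ^ 2 / Λ) ≤ K₁ * ‖zetaOne s₀‖ := by
      have := hlow 1 1 s₀ (by linarith) (by linarith)
      rw [hre, DirichletCharacter.LFunction_modOne_eq] at this
      rw [zetaOne_of_ne hs1, norm_mul]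
      have h2 : b ^ 2 / Λ ≤ ‖s₀ - 1‖ := by
        refine le_trans ?_ (Complex.re_le_norm _)
        rw [Complex.sub_re, hre, Complex.one_re]; linarith
      calc b ^ 2 / Λ * (b ^ 2 / Λ) ≤ ‖s₀ - 1‖ * (K₁ * ‖riemannZeta s₀‖) := by
            gcongr; linarith
        _ = _ := by ring
    rw [Real.log_div (by positivity) hn.ne', Real.log_mul (by positivity) (by positivity),
      Real.log_pow, Real.log_mul (by norm_num) (by positivity), hτ, Real.log_exp]
    have h2 : 2 * Real.log (b ^ 2 / Λ) ≤ Real.log K₁ + Real.log ‖zetaOne s₀‖ := by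
      rw [← Real.log_mul (by linarith) hn.ne', two_mul, ← Real.log_mul hb2.ne' hb2.ne']
      exact Real.log_le_log (by positivity) h1
    rw [Real.log_div (by linarith) (by positivity)] at hlogb
    rw [Real.log_div (by positivity) (by linarith)] at h2
    have h8 : Real.log 8 ≤ 7 := (Real.log_le_sub_one_of_pos (by norm_num)).trans (by norm_num)
    have h9 : Λ / √l ≤ Λ := div_le_self (by linarith) hl1
    push_cast
    linarith
  have hfin : 2 * Real.log (K₀ * (8 * τ) ^ 2 / ‖zetaOne s₀‖) / (1 / 2)
      ≤ 4 * (|Real.log K₀| + 18 + Real.log K₁ + 6) / b * Λ := by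
    have hlk := Real.log_nonneg hK₁
    have hib : 1 ≤ 1 / b := by rw [le_div_iff₀ hb]; linarith
    have hbΛ : 1 ≤ 1 / b * Λ := by nlinarith
    have e : 4 * (|Real.log K₀| + 18 + Real.log K₁ + 6) / b * Λ
        = 4 * ((|Real.log K₀| + 14 + Real.log K₁) * (1 / b * Λ) + 4 * (1 / b * Λ) + 6 * (1 / b * Λ)) := by
      ring
    rw [e]
    have h5 : 2 / b ≤ 2 * (1 / b * Λ) := by
      have : (2 / b) * 1 ≤ (2 / b) * Λ := by gcongr; linarith
      calc 2 / b ≤ 2 / b * Λ := by linarith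
        _ = _ := by ring
    have h6 : (|Real.log K₀| + 14 + Real.log K₁)
        ≤ (|Real.log K₀| + 14 + Real.log K₁) * (1 / b * Λ) :=
      le_mul_of_one_le_right (by positivity) hbΛ
    have h7 : Λ ≤ 1 / b * Λ := le_mul_of_one_le_left (by linarith) hib
    have h8 := le_abs_self (Real.log K₀)
    linarith
  linarith

end LandauPage

namespace LandauPage
open Finset Set Filter Topology
open scoped BigOperators ComplexConjugate

/-- The weight of the integer `n` in `-ζ'/ζ(σ)`. -/
noncomputable def vmWeight (σ : ℝ) (n : ℕ) : ℝ := ArithmeticFunction.vonMangoldt n * (n : ℝ) ^ (-σ)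

theorem vmWeight_nonneg (σ : ℝ) (n : ℕ) : 0 ≤ vmWeight σ n :=
  mul_nonneg ArithmeticFunction.vonMangoldt_nonneg (Real.rpow_nonneg (Nat.cast_nonneg n) _)

theorem vmWeight_zero (σ : ℝ) : vmWeight σ 0 = 0 := by simp [vmWeight]

theorem hasSum_vmWeight {q : ℕ} [NeZero q] (χ : DirichletCharacter ℂ q) {σ : ℝ} (hσ : 1 < σ)
    (t : ℝ) : HasSum (fun n : ℕ ↦ vmWeight σ n * (χ n * (n : ℂ) ^ (-(t * Complex.I))).re)
      (-(logDeriv χ.LFunction ⟨σ, t⟩).re) := by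
  have hs : 1 < (⟨σ, t⟩ : ℂ).re := hσ
  have h1 := (DirichletCharacter.LSeriesSummable_twist_vonMangoldt χ hs).LSeriesHasSum
  rw [DirichletCharacter.LSeries_twist_vonMangoldt_eq χ hs,
    ← DirichletCharacter.deriv_LFunction_eq_deriv_LSeries χ hs,
    ← DirichletCharacter.LFunction_eq_LSeries χ hs, neg_div, ← logDeriv_apply] at h1
  have h3 := Complex.hasSum_re h1
  rw [Complex.neg_re] at h3
  refine h3.congr_fun fun n ↦ ?_
  rcases eq_or_ne n 0 with rfl | hn
  · simp [vmWeight]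
  · rw [LSeries.term_of_ne_zero hn, Pi.mul_apply, div_eq_mul_inv, ← Complex.cpow_neg]
    have e : (-(⟨σ, t⟩ : ℂ)) = ((-σ : ℝ) : ℂ) + -(t * Complex.I) := by
      apply Complex.ext <;> simp
    have hn' : (n : ℂ) ≠ 0 := by exact_mod_cast hn
    rw [e, Complex.cpow_add _ _ hn', ← Complex.ofReal_natCast,
      ← Complex.ofReal_cpow (Nat.cast_nonneg n)]
    unfold vmWeight
    rw [← Complex.re_ofReal_mul]
    congr 1
    push_cast
    ring

theorem norm_cpow_mul_I (n : ℕ) (hn : n ≠ 0) (t : ℝ) :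
    ‖(n : ℂ) ^ (-(t * Complex.I))‖ = 1 := by
  rw [Complex.norm_natCast_cpow_of_pos (Nat.pos_of_ne_zero hn)]
  simp

theorem cpow_two_mul_I (n : ℕ) (t : ℝ) :
    (n : ℂ) ^ (-(((2 * t : ℝ) : ℂ) * Complex.I)) = ((n : ℂ) ^ (-(t * Complex.I))) ^ 2 := by
  rw [← Complex.cpow_nat_mul]
  congr 1
  push_cast
  ring

theorem norm_apply_of_coprime {q n : ℕ} (χ : DirichletCharacter ℂ q) (h : n.Coprime q) :
    ‖χ n‖ = 1 := by
  have := χ.unit_norm_eq_one (ZMod.unitOfCoprime n h)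
  simpa using this

theorem apply_of_not_coprime {q n : ℕ} (χ : DirichletCharacter ℂ q) (h : ¬ n.Coprime q) :
    χ n = 0 := χ.map_nonunit fun hu ↦ h ((ZMod.isUnit_iff_coprime n q).1 hu)

theorem three_four_one_nonneg {z : ℂ} (hz : ‖z‖ = 1) : 0 ≤ 3 + 4 * z.re + (z ^ 2).re := by
  have h : z.re ^ 2 + z.im ^ 2 = 1 := by
    have := Complex.sq_norm z
    rw [hz, Complex.normSq_apply] at this
    nlinarith
  rw [sq, Complex.mul_re]
  nlinarith [sq_nonneg (1 + z.re)]

theorem logDeriv_three_four_one {q q' : ℕ} [NeZero q] [NeZero q'] (χ : DirichletCharacter ℂ q)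
    (ψ : DirichletCharacter ℂ q') (h : ∀ n : ℕ, n.Coprime q → ψ n = χ n ^ 2) {σ : ℝ} (hσ : 1 < σ)
    (t : ℝ) : 3 * (logDeriv riemannZeta ⟨σ, 0⟩).re + 4 * (logDeriv χ.LFunction ⟨σ, t⟩).re
      + (logDeriv ψ.LFunction ⟨σ, 2 * t⟩).re ≤ 0 := by
  have h0 := hasSum_vmWeight (1 : DirichletCharacter ℂ 1) hσ 0
  rw [DirichletCharacter.LFunction_modOne_eq] at h0
  have := ((h0.mul_left 3).add ((hasSum_vmWeight χ hσ t).mul_left 4)).add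
    (hasSum_vmWeight ψ hσ (2 * t))
  have hn := this.nonneg (fun n ↦ by
    rcases eq_or_ne n 0 with rfl | hn
    · simp [vmWeight_zero]
    have e : 3 * (vmWeight σ n * ((1 : DirichletCharacter ℂ 1) n
        * (n : ℂ) ^ (-((0 : ℝ) * Complex.I))).re)
        + 4 * (vmWeight σ n * (χ n * (n : ℂ) ^ (-(t * Complex.I))).re)
        + vmWeight σ n * (ψ n * (n : ℂ) ^ (-(((2 * t : ℝ) : ℂ) * Complex.I))).re
        = vmWeight σ n * (3 + 4 * (χ n * (n : ℂ) ^ (-(t * Complex.I))).re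
          + (ψ n * (n : ℂ) ^ (-(((2 * t : ℝ) : ℂ) * Complex.I))).re) := by
      have : (1 : DirichletCharacter ℂ 1) n = 1 :=
        MulChar.one_apply (isUnit_of_subsingleton _)
      rw [this]
      simp
      ring
    rw [e]
    refine mul_nonneg (vmWeight_nonneg _ _) ?_
    by_cases hc : n.Coprime q
    · rw [h n hc, cpow_two_mul_I, ← mul_pow]
      refine three_four_one_nonneg ?_
      rw [norm_mul, norm_apply_of_coprime χ hc, norm_cpow_mul_I n hn, one_mul]
    · rw [apply_of_not_coprime χ hc, zero_mul, Complex.zero_re]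
      have h1 : ‖ψ n * (n : ℂ) ^ (-(((2 * t : ℝ) : ℂ) * Complex.I))‖ ≤ 1 := by
        rw [norm_mul, norm_cpow_mul_I n hn, mul_one]
        exact ψ.norm_le_one _
      have := neg_le_of_abs_le ((Complex.abs_re_le_norm _).trans h1)
      linarith)
  linarith

theorem logDeriv_one_one {q : ℕ} [NeZero q] (χ : DirichletCharacter ℂ q) {σ : ℝ} (hσ : 1 < σ) :
    (logDeriv riemannZeta ⟨σ, 0⟩).re + (logDeriv χ.LFunction ⟨σ, 0⟩).re ≤ 0 := by
  have h0 := hasSum_vmWeight (1 : DirichletCharacter ℂ 1) hσ 0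
  rw [DirichletCharacter.LFunction_modOne_eq] at h0
  have := h0.add (hasSum_vmWeight χ hσ 0)
  have hn := this.nonneg (fun n ↦ by
    have h1 : (1 : DirichletCharacter ℂ 1) n = 1 :=
      MulChar.one_apply (isUnit_of_subsingleton _)
    rw [h1, ← mul_add]
    refine mul_nonneg (vmWeight_nonneg _ _) ?_
    have := neg_le_of_abs_le ((Complex.abs_re_le_norm _).trans (χ.norm_le_one (n : ZMod q)))
    simp
    linarith)
  linarith

theorem eq_neg_one_or_zero_or_one {q : ℕ} (χ : DirichletCharacter ℂ q) (h : χ ^ 2 = 1)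
    (a : ZMod q) : χ a = -1 ∨ χ a = 0 ∨ χ a = 1 := by
  by_cases ha : IsUnit a
  · have h1 : χ a ^ 2 = 1 := by
      rw [← MulChar.pow_apply' χ (by norm_num), h, MulChar.one_apply ha]
    rcases mul_self_eq_one_iff.1 ((sq _).symm.trans h1) with h2 | h2
    · exact Or.inr (Or.inr h2)
    · exact Or.inl h2
  · exact Or.inr (Or.inl (χ.map_nonunit ha))

theorem logDeriv_five_three_three_one {q₁ q₂ q' : ℕ} [NeZero q₁] [NeZero q₂] [NeZero q']
    (χ₁ : DirichletCharacter ℂ q₁) (χ₂ : DirichletCharacter ℂ q₂) (ψ : DirichletCharacter ℂ q')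
    (hχ₁ : χ₁ ^ 2 = 1) (hχ₂ : χ₂ ^ 2 = 1)
    (h : ∀ n : ℕ, n.Coprime (q₁ * q₂) → ψ n = χ₁ n * χ₂ n) {σ : ℝ} (hσ : 1 < σ) :
    5 * (logDeriv riemannZeta ⟨σ, 0⟩).re + 3 * (logDeriv χ₁.LFunction ⟨σ, 0⟩).re
      + 3 * (logDeriv χ₂.LFunction ⟨σ, 0⟩).re + (logDeriv ψ.LFunction ⟨σ, 0⟩).re ≤ 0 := by
  have h0 := hasSum_vmWeight (1 : DirichletCharacter ℂ 1) hσ 0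
  rw [DirichletCharacter.LFunction_modOne_eq] at h0
  have := (((h0.mul_left 5).add ((hasSum_vmWeight χ₁ hσ 0).mul_left 3)).add
    ((hasSum_vmWeight χ₂ hσ 0).mul_left 3)).add (hasSum_vmWeight ψ hσ 0)
  have hn := this.nonneg (fun n ↦ by
    have h1 : (1 : DirichletCharacter ℂ 1) n = 1 :=
      MulChar.one_apply (isUnit_of_subsingleton _)
    have e : 0 ≤ vmWeight σ n * (5 + 3 * (χ₁ n).re + 3 * (χ₂ n).re + (ψ n).re) := by
      refine mul_nonneg (vmWeight_nonneg _ _) ?_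
      by_cases hc : n.Coprime (q₁ * q₂)
      · rw [h n hc]
        rcases eq_neg_one_or_zero_or_one χ₁ hχ₁ n with h2 | h2 | h2 <;>
        rcases eq_neg_one_or_zero_or_one χ₂ hχ₂ n with h3 | h3 | h3 <;>
        rw [h2, h3] <;> norm_num
      · have h4 := neg_le_of_abs_le ((Complex.abs_re_le_norm _).trans (ψ.norm_le_one (n : ZMod q')))
        have h5 : χ₁ n = 0 ∨ χ₂ n = 0 := by
          by_contra! h6
          refine hc (Nat.Coprime.mul_right ?_ ?_)
          · by_contra h7; exact h6.1 (apply_of_not_coprime χ₁ h7)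
          · by_contra h7; exact h6.2 (apply_of_not_coprime χ₂ h7)
        rcases h5 with h5 | h5
        · rw [h5]
          rcases eq_neg_one_or_zero_or_one χ₂ hχ₂ n with h3 | h3 | h3 <;>
          rw [h3] <;> norm_num <;> linarith
        · rw [h5]
          rcases eq_neg_one_or_zero_or_one χ₁ hχ₁ n with h3 | h3 | h3 <;>
          rw [h3] <;> norm_num <;> linarith
    refine e.trans (le_of_eq ?_)
    rw [h1]
    simp
    ring)
  linarith

end LandauPage

namespace LandauPage
open Finset Set Filter Topology
open scoped BigOperators ComplexConjugate

/-- A lower bound for `Re f'/f(s₀)` in terms of any selection of zeros of `f` within `R` of `s₀`. -/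
def ZeroBound (f : ℂ → ℂ) (s₀ : ℂ) (R E : ℝ) : Prop :=
  ∀ (Z : Multiset ℂ) (g : ℂ → ℂ), Differentiable ℂ g → (∀ ρ ∈ Z, ρ ∈ Metric.closedBall s₀ R) →
    (∀ s, f s = (Z.map (fun ρ ↦ s - ρ)).prod * g s) →
    (Z.map (zeroTerm s₀ R)).sum - E ≤ (logDeriv f s₀).re

theorem differentiable_dslope {f : ℂ → ℂ} (hf : Differentiable ℂ f) (ρ : ℂ) :
    Differentiable ℂ (dslope f ρ) := by
  rw [← differentiableOn_univ] at hf ⊢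
  exact (Complex.differentiableOn_dslope univ_mem).2 hf

theorem eq_sub_mul_dslope {f : ℂ → ℂ} {ρ : ℂ} (h : f ρ = 0) (s : ℂ) :
    f s = (s - ρ) * dslope f ρ s := by
  have := sub_smul_dslope f ρ s
  rw [h, sub_zero, smul_eq_mul] at this
  exact this.symm

section
variable {f : ℂ → ℂ} {s₀ : ℂ} {R E : ℝ}

theorem ZeroBound.none (h : ZeroBound f s₀ R E) (hf : Differentiable ℂ f) :
    -E ≤ (logDeriv f s₀).re := by
  have := h 0 f hf (by simp) (by simp)
  simpa using this

theorem ZeroBound.single (h : ZeroBound f s₀ R E) (hf : Differentiable ℂ f) {ρ : ℂ}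
    (hρ : ρ ∈ Metric.closedBall s₀ R) (h0 : f ρ = 0) :
    zeroTerm s₀ R ρ - E ≤ (logDeriv f s₀).re := by
  have := h {ρ} (dslope f ρ) (differentiable_dslope hf ρ) (by simpa using hρ)
    (fun s ↦ by simpa using eq_sub_mul_dslope h0 s)
  simpa using this

theorem ZeroBound.pair (h : ZeroBound f s₀ R E) (hf : Differentiable ℂ f) {ρ ρ' : ℂ}
    (hρ : ρ ∈ Metric.closedBall s₀ R) (hρ' : ρ' ∈ Metric.closedBall s₀ R) (h0 : f ρ = 0)
    (h1 : dslope f ρ ρ' = 0) :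
    zeroTerm s₀ R ρ + zeroTerm s₀ R ρ' - E ≤ (logDeriv f s₀).re := by
  have := h {ρ, ρ'} (dslope (dslope f ρ) ρ')
    (differentiable_dslope (differentiable_dslope hf ρ) ρ') (by simpa using ⟨hρ, hρ'⟩)
    (fun s ↦ by
      rw [eq_sub_mul_dslope h0 s, eq_sub_mul_dslope h1 s]
      simp
      ring)
  simpa using this
end

theorem zeroTerm_same_height_ge {x R : ℝ} (hx : 0 < x) (hR : 10 * x ≤ R) {ρ : ℂ}
    (h1 : 1 - x / 20 < ρ.re) (h2 : ρ.re < 1) :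
    ρ ∈ Metric.closedBall (⟨1 + x, ρ.im⟩ : ℂ) R ∧ 94 / 100 / x ≤ zeroTerm ⟨1 + x, ρ.im⟩ R ρ := by
  have e : (⟨1 + x, ρ.im⟩ : ℂ) - ρ = ((1 + x - ρ.re : ℝ) : ℂ) := by
    apply Complex.ext <;> simp
  set u := 1 + x - ρ.re with hu
  have hu0 : 0 < u := by linarith
  have hR0 : 0 < R := by linarith
  constructor
  · rw [Metric.mem_closedBall, dist_comm, dist_eq_norm, e, Complex.norm_real, Real.norm_eq_abs,
      abs_of_pos hu0]
    linarith
  · unfold zeroTerm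
    rw [e, Complex.ofReal_re, Complex.norm_real, Real.norm_eq_abs, abs_of_pos hu0]
    have e1 : u / u ^ 2 = 1 / u := by field_simp
    have h3 : 1 / (105 / 100 * x) ≤ 1 / u := one_div_le_one_div_of_le hu0 (by linarith)
    have h4 : u / R ^ 2 ≤ (105 / 100 * x) / (10 * x) ^ 2 := by
      gcongr
      linarith
    have h5 : 1 / (105 / 100 * x) = 100 / 105 / x := by field_simp
    have h6 : (105 / 100 * x) / (10 * x) ^ 2 = 105 / 10000 / x := by field_simp; norm_num
    rw [e1]
    have h7 : 94 / 100 / x ≤ 100 / 105 / x - 105 / 10000 / x := by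
      rw [← sub_div]
      gcongr
      norm_num
    linarith

theorem zeroTerm_low_height_ge {x R : ℝ} (hx : 0 < x) (hR : 10 * x ≤ R) {ρ : ℂ}
    (h1 : 1 - x / 20 < ρ.re) (h2 : ρ.re < 1) (h3 : |ρ.im| < x / 2) :
    ρ ∈ Metric.closedBall (⟨1 + x, 0⟩ : ℂ) R ∧ 76 / 100 / x ≤ zeroTerm ⟨1 + x, 0⟩ R ρ := by
  set u := 1 + x - ρ.re with hu
  have hu0 : 0 < u := by linarith
  have hR0 : 0 < R := by linarith
  have er : ((⟨1 + x, 0⟩ : ℂ) - ρ).re = u := by simp [hu]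
  have ei : ((⟨1 + x, 0⟩ : ℂ) - ρ).im = -ρ.im := by simp
  constructor
  · rw [Metric.mem_closedBall, dist_comm, dist_eq_norm]
    refine (Complex.norm_le_abs_re_add_abs_im _).trans ?_
    rw [er, ei, abs_neg, abs_of_pos hu0]
    linarith
  · unfold zeroTerm
    rw [er]
    have hn : ‖(⟨1 + x, 0⟩ : ℂ) - ρ‖ ^ 2 = u ^ 2 + ρ.im ^ 2 := by
      rw [Complex.sq_norm, Complex.normSq_apply, er, ei]
      ring
    rw [hn]
    have h4 : u / R ^ 2 ≤ (105 / 100 * x) / (10 * x) ^ 2 := by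
      gcongr
      linarith
    have h6 : (105 / 100 * x) / (10 * x) ^ 2 = 105 / 10000 / x := by field_simp; norm_num
    have hi : ρ.im ^ 2 ≤ x ^ 2 / 4 := by
      have := sq_lt_sq' (by linarith [neg_lt_of_abs_lt h3]) (lt_of_abs_lt h3)
      nlinarith
    have h5 : 775 / 1000 / x ≤ u / (u ^ 2 + ρ.im ^ 2) := by
      rw [div_le_div_iff₀ hx (by positivity)]
      have hux : x < u := by linarith
      have hux' : u < 105 / 100 * x := by linarith
      nlinarith [mul_pos (sub_pos.2 hux) (sub_pos.2 hux')]
    have h7 : 76 / 100 / x ≤ 775 / 1000 / x - 105 / 10000 / x := by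
      rw [← sub_div]
      gcongr
      norm_num
    linarith

theorem logDeriv_riemannZeta_eq {s : ℂ} (hs : 1 < s.re) :
    logDeriv riemannZeta s = logDeriv zetaOne s - 1 / (s - 1) := by
  have h1 : s ≠ 1 := by rintro rfl; simp at hs
  have hz : riemannZeta s ≠ 0 := riemannZeta_ne_zero_of_one_le_re hs.le
  have he : zetaOne =ᶠ[𝓝 s] fun w ↦ (w - 1) * riemannZeta w := by
    filter_upwards [isOpen_ne.mem_nhds h1] with w hw
    exact zetaOne_of_ne hw
  have h2 : logDeriv zetaOne s = logDeriv (fun w ↦ (w - 1) * riemannZeta w) s := by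
    rw [logDeriv_apply, logDeriv_apply, he.deriv_eq, he.eq_of_nhds]
  rw [h2, logDeriv_mul (f := fun w : ℂ ↦ w - 1) s (sub_ne_zero.2 h1) hz (by fun_prop)
    (differentiableAt_riemannZeta h1)]
  rw [logDeriv_apply (fun w : ℂ ↦ w - 1)]
  simp

theorem re_logDeriv_riemannZeta_eq {x : ℝ} (hx : 0 < x) (t : ℝ) :
    (logDeriv riemannZeta ⟨1 + x, t⟩).re
      = (logDeriv zetaOne ⟨1 + x, t⟩).re - x / (x ^ 2 + t ^ 2) := by
  have e : (⟨1 + x, t⟩ : ℂ) - 1 = ⟨x, t⟩ := by apply Complex.ext <;> simp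
  rw [logDeriv_riemannZeta_eq (by simpa using hx), Complex.sub_re, e, one_div, Complex.inv_re,
    Complex.normSq_mk]
  ring_nf

theorem re_logDeriv_riemannZeta_ge {x R E : ℝ} (hx : 0 < x) {t : ℝ}
    (h : ZeroBound zetaOne ⟨1 + x, t⟩ R E) :
    -E - x / (x ^ 2 + t ^ 2) ≤ (logDeriv riemannZeta ⟨1 + x, t⟩).re := by
  rw [re_logDeriv_riemannZeta_eq hx]
  linarith [h.none differentiable_zetaOne]

theorem re_logDeriv_riemannZeta_zero_ge {x R E : ℝ} (hx : 0 < x)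
    (h : ZeroBound zetaOne ⟨1 + x, 0⟩ R E) :
    -E - 1 / x ≤ (logDeriv riemannZeta ⟨1 + x, 0⟩).re := by
  have := re_logDeriv_riemannZeta_ge hx h
  have e : x / (x ^ 2 + 0 ^ 2) = 1 / x := by field_simp; ring
  rwa [e] at this

section
variable {x R E : ℝ}

theorem no_zero_of_sq_ne_one (hx : 0 < x) (hR : 10 * x ≤ R) (hE : E ≤ 1 / 1000 / x)
    {q q' : ℕ} [NeZero q] [NeZero q'] {χ : DirichletCharacter ℂ q}
    {ψ : DirichletCharacter ℂ q'} (hχ : χ ≠ 1) (hψ : ψ ≠ 1)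
    (hmul : ∀ n : ℕ, n.Coprime q → ψ n = χ n ^ 2) {ρ : ℂ}
    (hz : ZeroBound zetaOne ⟨1 + x, 0⟩ R E) (h1 : ZeroBound χ.LFunction ⟨1 + x, ρ.im⟩ R E)
    (h2 : ZeroBound ψ.LFunction ⟨1 + x, 2 * ρ.im⟩ R E) (h0 : χ.LFunction ρ = 0)
    (hl : 1 - x / 20 < ρ.re) (hr : ρ.re < 1) : False := by
  have a1 := logDeriv_three_four_one χ ψ hmul (σ := 1 + x) (by linarith) ρ.im
  obtain ⟨b1, b2⟩ := zeroTerm_same_height_ge hx hR hl hr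
  have a2 := h1.single (DirichletCharacter.differentiable_LFunction hχ) b1 h0
  have a3 := h2.none (DirichletCharacter.differentiable_LFunction hψ)
  have a4 := re_logDeriv_riemannZeta_zero_ge hx hz
  have hxi : 0 < 1 / x := by positivity
  rw [div_eq_mul_one_div] at b2 hE
  linarith

theorem no_zero_of_sq_eq_one_of_high (hx : 0 < x) (hR : 10 * x ≤ R) (hE : E ≤ 1 / 1000 / x)
    {q : ℕ} [NeZero q] {χ : DirichletCharacter ℂ q} (hχ : χ ≠ 1) (hsq : χ ^ 2 = 1) {ρ : ℂ}
    (hz : ZeroBound zetaOne ⟨1 + x, 0⟩ R E) (h1 : ZeroBound χ.LFunction ⟨1 + x, ρ.im⟩ R E)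
    (h2 : ZeroBound zetaOne ⟨1 + x, 2 * ρ.im⟩ R E) (h0 : χ.LFunction ρ = 0)
    (hl : 1 - x / 20 < ρ.re) (hr : ρ.re < 1) (hi : x / 2 ≤ |ρ.im|) : False := by
  have a1 := logDeriv_three_four_one χ (1 : DirichletCharacter ℂ 1) (fun n hn ↦ by
    rw [MulChar.one_apply (isUnit_of_subsingleton _), ← MulChar.pow_apply' χ (by norm_num), hsq,
      MulChar.one_apply ((ZMod.isUnit_iff_coprime n q).2 hn)]) (σ := 1 + x) (by linarith) ρ.im
  rw [DirichletCharacter.LFunction_modOne_eq] at a1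
  obtain ⟨b1, b2⟩ := zeroTerm_same_height_ge hx hR hl hr
  have a2 := h1.single (DirichletCharacter.differentiable_LFunction hχ) b1 h0
  have a3 := re_logDeriv_riemannZeta_ge hx h2
  have a4 := re_logDeriv_riemannZeta_zero_ge hx hz
  have hxi : 0 < 1 / x := by positivity
  have hsqi : x ^ 2 / 4 ≤ ρ.im ^ 2 := by
    have := pow_le_pow_left₀ (by linarith) hi 2
    rw [sq_abs] at this
    linarith
  have a5 : x / (x ^ 2 + (2 * ρ.im) ^ 2) ≤ 1 / 2 * (1 / x) := by
    rw [mul_one_div, div_le_div_iff₀ (by positivity) hx]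
    nlinarith
  rw [div_eq_mul_one_div] at b2 hE
  linarith

theorem riemannZeta_no_zero_of_high (hx : 0 < x) (hR : 10 * x ≤ R) (hE : E ≤ 1 / 1000 / x) {ρ : ℂ}
    (hz : ZeroBound zetaOne ⟨1 + x, 0⟩ R E) (h1 : ZeroBound zetaOne ⟨1 + x, ρ.im⟩ R E)
    (h2 : ZeroBound zetaOne ⟨1 + x, 2 * ρ.im⟩ R E) (h0 : zetaOne ρ = 0)
    (hl : 1 - x / 20 < ρ.re) (hr : ρ.re < 1) (hi : 3 * x ≤ |ρ.im|) : False := by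
  have a1 := logDeriv_three_four_one (1 : DirichletCharacter ℂ 1) (1 : DirichletCharacter ℂ 1)
    (fun n hn ↦ by rw [MulChar.one_apply (isUnit_of_subsingleton _), one_pow])
    (σ := 1 + x) (by linarith) ρ.im
  rw [DirichletCharacter.LFunction_modOne_eq] at a1
  obtain ⟨b1, b2⟩ := zeroTerm_same_height_ge hx hR hl hr
  have a2 := h1.single differentiable_zetaOne b1 h0
  have a2' := re_logDeriv_riemannZeta_eq hx ρ.im
  have a3 := re_logDeriv_riemannZeta_ge hx h2
  have a4 := re_logDeriv_riemannZeta_zero_ge hx hz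
  have hxi : 0 < 1 / x := by positivity
  have hsqi : 9 * x ^ 2 ≤ ρ.im ^ 2 := by
    have := pow_le_pow_left₀ (by linarith) hi 2
    rw [sq_abs] at this
    linarith
  have a5 : x / (x ^ 2 + (2 * ρ.im) ^ 2) ≤ 1 / 37 * (1 / x) := by
    rw [mul_one_div, div_le_div_iff₀ (by positivity) hx]
    nlinarith
  have a6 : x / (x ^ 2 + ρ.im ^ 2) ≤ 1 / 10 * (1 / x) := by
    rw [mul_one_div, div_le_div_iff₀ (by positivity) hx]
    nlinarith
  rw [div_eq_mul_one_div] at b2 hE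
  linarith

theorem no_two_zeros_of_low (hx : 0 < x) (hR : 10 * x ≤ R) (hE : E ≤ 1 / 1000 / x)
    {q : ℕ} [NeZero q] {χ : DirichletCharacter ℂ q} (hχ : χ ≠ 1) {ρ ρ' : ℂ}
    (hz : ZeroBound zetaOne ⟨1 + x, 0⟩ R E) (h1 : ZeroBound χ.LFunction ⟨1 + x, 0⟩ R E)
    (h0 : χ.LFunction ρ = 0) (h0' : dslope χ.LFunction ρ ρ' = 0)
    (hl : 1 - x / 20 < ρ.re) (hr : ρ.re < 1) (hi : |ρ.im| < x / 2)
    (hl' : 1 - x / 20 < ρ'.re) (hr' : ρ'.re < 1) (hi' : |ρ'.im| < x / 2) : False := by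
  have a1 := logDeriv_one_one χ (σ := 1 + x) (by linarith)
  obtain ⟨b1, b2⟩ := zeroTerm_low_height_ge hx hR hl hr hi
  obtain ⟨b1', b2'⟩ := zeroTerm_low_height_ge hx hR hl' hr' hi'
  have a2 := h1.pair (DirichletCharacter.differentiable_LFunction hχ) b1 b1' h0 h0'
  have a4 := re_logDeriv_riemannZeta_zero_ge hx hz
  have hxi : 0 < 1 / x := by positivity
  rw [div_eq_mul_one_div] at b2 b2' hE
  linarith

theorem no_zeros_of_two_characters (hx : 0 < x) (hR : 10 * x ≤ R) (hE : E ≤ 1 / 1000 / x)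
    {q₁ q₂ q' : ℕ} [NeZero q₁] [NeZero q₂] [NeZero q'] {χ₁ : DirichletCharacter ℂ q₁}
    {χ₂ : DirichletCharacter ℂ q₂} {ψ : DirichletCharacter ℂ q'} (hχ₁ : χ₁ ≠ 1) (hχ₂ : χ₂ ≠ 1)
    (hψ : ψ ≠ 1) (hsq₁ : χ₁ ^ 2 = 1) (hsq₂ : χ₂ ^ 2 = 1)
    (hmul : ∀ n : ℕ, n.Coprime (q₁ * q₂) → ψ n = χ₁ n * χ₂ n) {ρ₁ ρ₂ : ℂ}
    (hz : ZeroBound zetaOne ⟨1 + x, 0⟩ R E) (h1 : ZeroBound χ₁.LFunction ⟨1 + x, 0⟩ R E)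
    (h2 : ZeroBound χ₂.LFunction ⟨1 + x, 0⟩ R E) (h3 : ZeroBound ψ.LFunction ⟨1 + x, 0⟩ R E)
    (h0₁ : χ₁.LFunction ρ₁ = 0) (h0₂ : χ₂.LFunction ρ₂ = 0) (hi₁ : ρ₁.im = 0) (hi₂ : ρ₂.im = 0)
    (hl₁ : 1 - x / 20 < ρ₁.re) (hr₁ : ρ₁.re < 1) (hl₂ : 1 - x / 20 < ρ₂.re) (hr₂ : ρ₂.re < 1) :
    False := by
  have a1 := logDeriv_five_three_three_one χ₁ χ₂ ψ hsq₁ hsq₂ hmul (σ := 1 + x) (by linarith)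
  obtain ⟨b1, b2⟩ := zeroTerm_same_height_ge hx hR hl₁ hr₁
  obtain ⟨b1', b2'⟩ := zeroTerm_same_height_ge hx hR hl₂ hr₂
  rw [hi₁] at b1 b2
  rw [hi₂] at b1' b2'
  have a2 := h1.single (DirichletCharacter.differentiable_LFunction hχ₁) b1 h0₁
  have a2' := h2.single (DirichletCharacter.differentiable_LFunction hχ₂) b1' h0₂
  have a3 := h3.none (DirichletCharacter.differentiable_LFunction hψ)
  have a4 := re_logDeriv_riemannZeta_zero_ge hx hz
  have hxi : 0 < 1 / x := by positivity
  rw [div_eq_mul_one_div] at b2 b2' hE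
  linarith
end

end LandauPage

namespace LandauPage
open Finset Set Filter Topology
open scoped BigOperators ComplexConjugate

theorem eq_of_changeLevel_isPrimitive {q n : ℕ} [NeZero n] (h : q ∣ n)
    {χ : DirichletCharacter ℂ q} (hχ : χ.IsPrimitive) :
    (DirichletCharacter.changeLevel h χ).conductor = q := by
  have : NeZero q := ⟨fun hq ↦ NeZero.ne n (by rw [hq] at h; exact zero_dvd_iff.1 h)⟩
  set θ := DirichletCharacter.changeLevel h χ with hθ
  have h1 : θ.conductor ∣ q :=
    (DirichletCharacter.mem_conductorSet_iff_conductor_dvd θ h).1 ⟨h, χ, rfl⟩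
  have h2 : χ = DirichletCharacter.changeLevel h1 θ.primitiveCharacter := by
    refine DirichletCharacter.changeLevel_injective h ?_
    rw [← DirichletCharacter.changeLevel_trans, DirichletCharacter.changeLevel_primitiveCharacter]
  have h3 : χ.conductor ∣ θ.conductor :=
    (DirichletCharacter.mem_conductorSet_iff_conductor_dvd χ h1).1 ⟨h1, _, h2⟩
  rw [hχ] at h3
  exact Nat.dvd_antisymm h1 h3

theorem sigma_eq_of_changeLevel_eq {q₁ q₂ n : ℕ} [NeZero n] (h₁ : q₁ ∣ n) (h₂ : q₂ ∣ n)
    {χ₁ : DirichletCharacter ℂ q₁} {χ₂ : DirichletCharacter ℂ q₂} (hχ₁ : χ₁.IsPrimitive)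
    (hχ₂ : χ₂.IsPrimitive)
    (h : DirichletCharacter.changeLevel h₁ χ₁ = DirichletCharacter.changeLevel h₂ χ₂) :
    (⟨q₁, χ₁⟩ : Σ q : ℕ, DirichletCharacter ℂ q) = ⟨q₂, χ₂⟩ := by
  have e : q₁ = q₂ := by
    rw [← eq_of_changeLevel_isPrimitive h₁ hχ₁, h, eq_of_changeLevel_isPrimitive h₂ hχ₂]
  subst e
  rw [DirichletCharacter.changeLevel_injective h₁ h]

theorem primitiveCharacter_ne_one {q : ℕ} {χ : DirichletCharacter ℂ q} (hχ : χ ≠ 1) :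
    χ.primitiveCharacter ≠ 1 := by
  intro h
  apply hχ
  rw [← DirichletCharacter.changeLevel_primitiveCharacter χ, h, map_one]

theorem primitiveCharacter_apply_natCast {q n : ℕ} (χ : DirichletCharacter ℂ q)
    (h : n.Coprime q) : χ.primitiveCharacter n = χ n := by
  have := DirichletCharacter.primitiveCharacter_apply_of_isCoprime χ (a := n)
    (Nat.isCoprime_iff_coprime.2 h)
  simpa using this

theorem changeLevel_natCast {q m n : ℕ} (χ : DirichletCharacter ℂ q) (h : q ∣ m)
    (hn : n.Coprime m) : DirichletCharacter.changeLevel h χ n = χ n := by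
  have := DirichletCharacter.changeLevel_eq_cast_of_dvd χ h (ZMod.unitOfCoprime n hn)
  rw [ZMod.coe_unitOfCoprime] at this
  rw [this, ZMod.cast_natCast h]

theorem conj_apply_of_sq_eq_one {q : ℕ} {χ : DirichletCharacter ℂ q} (h : χ ^ 2 = 1) (a : ZMod q) :
    conj (χ a) = χ a := by
  rcases eq_neg_one_or_zero_or_one χ h a with h | h | h <;> simp [h]

theorem LFunction_conj {q : ℕ} [NeZero q] {χ : DirichletCharacter ℂ q} (h : χ ^ 2 = 1)
    (hχ : χ ≠ 1) (s : ℂ) : χ.LFunction (conj s) = conj (χ.LFunction s) := by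
  have hd := DirichletCharacter.differentiable_LFunction hχ
  have hd' : Differentiable ℂ (conj ∘ χ.LFunction ∘ conj) := fun z ↦ by
    have := (hd (conj z)).conj_conj
    rwa [Complex.conj_conj] at this
  have he : χ.LFunction = conj ∘ χ.LFunction ∘ conj := by
    refine AnalyticOnNhd.eq_of_eventuallyEq (z₀ := 2)
      (hd.differentiableOn.analyticOnNhd isOpen_univ)
      (hd'.differentiableOn.analyticOnNhd isOpen_univ) ?_
    have ho : IsOpen {z : ℂ | 1 < z.re} := isOpen_lt continuous_const Complex.continuous_re
    filter_upwards [ho.mem_nhds (show (2 : ℂ) ∈ {z : ℂ | 1 < z.re} by simp)] with z hz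
    have hz' : 1 < (conj z).re := by simpa using hz
    rw [Function.comp_apply, Function.comp_apply, DirichletCharacter.LFunction_eq_LSeries χ hz',
      DirichletCharacter.LFunction_eq_LSeries χ hz]
    unfold LSeries
    rw [Complex.conj_tsum]
    refine tsum_congr fun n ↦ ?_
    rcases eq_or_ne n 0 with rfl | hn
    · simp
    · rw [LSeries.term_of_ne_zero hn, LSeries.term_of_ne_zero hn, map_div₀,
        conj_apply_of_sq_eq_one h]
      congr 1
      have harg : (n : ℂ).arg ≠ Real.pi := by
        rw [Complex.natCast_arg]; exact Real.pi_ne_zero.symm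
      rw [Complex.cpow_conj _ _ harg, Complex.conj_conj, Complex.conj_natCast]
  have := congrFun he (conj s)
  simpa using this

theorem zetaOne_ne_zero_near_one : ∃ δ : ℝ, 0 < δ ∧ ∀ s : ℂ, ‖s - 1‖ < δ → zetaOne s ≠ 0 := by
  have h : ∀ᶠ s in 𝓝 (1 : ℂ), zetaOne s ≠ 0 :=
    differentiable_zetaOne.continuous.continuousAt.eventually_ne (by rw [zetaOne_one]; simp)
  obtain ⟨δ, hδ, h⟩ := Metric.eventually_nhds_iff.1 h
  exact ⟨δ, hδ, fun s hs ↦ h (by rwa [dist_eq_norm])⟩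

end LandauPage

namespace LandauPage
open Finset Set Filter Topology
open scoped BigOperators ComplexConjugate

theorem exists_zeroBounds {δ : ℝ} (hδ : 0 < δ) : ∃ a : ℝ, 0 < a ∧ a ≤ 1 / 10 ∧ a ≤ δ ∧
    ∀ l Λ : ℝ, 1 < l → l / Real.log l ≤ Λ → ∃ E : ℝ, E ≤ 1 / 1000 / (a / Λ) ∧
      (∀ t : ℝ, |t| ≤ 2 * Real.exp (Λ / √l) → ZeroBound zetaOne ⟨1 + a / Λ, t⟩ (1 / Λ) E) ∧
      ∀ t : ℝ, |t| ≤ 2 * Real.exp (Λ / √l) → ∀ (q : ℕ) [NeZero q] (χ : DirichletCharacter ℂ q),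
        χ.IsPrimitive → χ ≠ 1 → Real.log q ≤ 2 * l →
        (∀ p : ℕ, p.Prime → p ∣ q → (p : ℝ) ≤ Real.exp Λ) →
        ZeroBound χ.LFunction ⟨1 + a / Λ, t⟩ (1 / Λ) E := by
  obtain ⟨K₁, hK₁, h₁⟩ := exists_re_logDeriv_LFunction_ge
  obtain ⟨K₂, hK₂, h₂⟩ := exists_re_logDeriv_zetaOne_ge
  set K := max K₁ K₂ with hK
  have hK1 : 1 ≤ K := hK₁.trans (le_max_left _ _)
  set b := min (1 / (1000 * K)) (min (1 / 10) δ) with hb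
  have hb0 : 0 < b := by positivity
  have hb1 : b ≤ 1 / (1000 * K) := min_le_left _ _
  have hb2 : b ≤ 1 / 10 := (min_le_right _ _).trans (min_le_left _ _)
  have hb3 : b ≤ δ := (min_le_right _ _).trans (min_le_right _ _)
  have hbb : b ^ 2 ≤ b := by nlinarith
  refine ⟨b ^ 2, by positivity, by linarith, by linarith, fun l Λ hl hΛ ↦ ?_⟩
  have hΛ0 : 0 < Λ := (Real.exp_pos 1).trans_le (exp_one_le_of_div_log_le hl hΛ)
  have hle : ∀ K' ≤ K, K' / b * Λ ≤ K / b * Λ := fun K' h ↦ by gcongr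
  refine ⟨K / b * Λ, ?_, fun t ht Z g hg hZ hf ↦ ?_, fun t ht q _ χ hχ hχ1 hq hp Z g hg hZ hf ↦ ?_⟩
  · have e : 1 / 1000 / (b ^ 2 / Λ) = (1 / (1000 * b)) / b * Λ := by field_simp
    rw [e]
    gcongr
    rw [le_div_iff₀ (by positivity)]
    rw [le_div_iff₀ (by positivity)] at hb1
    linarith
  · have := h₂ l Λ b t hl hΛ hb0 (by linarith) ht Z g hg hZ hf
    have h3 := hle K₂ (le_max_right _ _)
    change (Z.map (zeroTerm (basePt Λ b t) (1 / Λ))).sum - K / b * Λ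
      ≤ (logDeriv zetaOne (basePt Λ b t)).re
    linarith
  · have := h₁ l Λ b t hl hΛ hb0 (by linarith) ht q χ hχ hχ1 hq hp Z g hg hZ hf
    have h3 := hle K₁ (le_max_left _ _)
    change (Z.map (zeroTerm (basePt Λ b t) (1 / Λ))).sum - K / b * Λ
      ≤ (logDeriv χ.LFunction (basePt Λ b t)).re
    linarith

/-- The region of the Landau–Page theorem with `l = log T` and `Λ = log P`. -/
def InRegion (c l Λ : ℝ) (s : ℂ) : Prop := 1 - c / Λ < s.re ∧ |s.im| ≤ Real.exp (Λ / √l)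

/-- The moduli and characters of the Landau–Page theorem. -/
def Admissible (l Λ : ℝ) (q : ℕ) (χ : DirichletCharacter ℂ q) : Prop :=
  χ.IsPrimitive ∧ Real.log q ≤ l ∧ ∀ p : ℕ, p.Prime → p ∣ q → (p : ℝ) ≤ Real.exp Λ

theorem log_natCast_le_of_dvd {d q : ℕ} (hq : q ≠ 0) (h : d ∣ q) : Real.log d ≤ Real.log q := by
  have hd : 0 < d := Nat.pos_of_dvd_of_pos h (Nat.pos_of_ne_zero hq)
  exact Real.log_le_log (by exact_mod_cast hd)
    (by exact_mod_cast Nat.le_of_dvd (Nat.pos_of_ne_zero hq) h)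

theorem primitiveCharacter_pow_two_apply {q n : ℕ} (χ : DirichletCharacter ℂ q)
    (h : n.Coprime q) : (χ ^ 2).primitiveCharacter n = χ n ^ 2 := by
  rw [primitiveCharacter_apply_natCast _ h, MulChar.pow_apply' χ (by norm_num)]

set_option maxHeartbeats 1000000 in
theorem exists_zero_free : ∃ c : ℝ, 0 < c ∧ c ≤ 1 ∧ ∀ l Λ : ℝ, 1 < l → l / Real.log l ≤ Λ →
    (∀ s : ℂ, InRegion c l Λ s → riemannZeta s ≠ 0) ∧
    (∀ (q : ℕ) [NeZero q] (χ : DirichletCharacter ℂ q), Admissible l Λ q χ → χ ≠ 1 →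
      ∀ s : ℂ, InRegion c l Λ s → χ.LFunction s = 0 →
        χ ^ 2 = 1 ∧ s.im = 0 ∧ s.re < 1 ∧ deriv χ.LFunction s ≠ 0 ∧
        ∀ s' : ℂ, InRegion c l Λ s' → χ.LFunction s' = 0 → s' = s) ∧
    ∀ (q₁ q₂ : ℕ) [NeZero q₁] [NeZero q₂] (χ₁ : DirichletCharacter ℂ q₁)
      (χ₂ : DirichletCharacter ℂ q₂), Admissible l Λ q₁ χ₁ → Admissible l Λ q₂ χ₂ → χ₁ ≠ 1 →
      χ₂ ≠ 1 → ∀ s₁ s₂ : ℂ, InRegion c l Λ s₁ → InRegion c l Λ s₂ → χ₁.LFunction s₁ = 0 →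
        χ₂.LFunction s₂ = 0 → (⟨q₁, χ₁⟩ : Σ q : ℕ, DirichletCharacter ℂ q) = ⟨q₂, χ₂⟩ := by
  obtain ⟨δ, hδ, hnear⟩ := zetaOne_ne_zero_near_one
  obtain ⟨a, ha, ha1, haδ, hbounds⟩ := exists_zeroBounds (δ := δ / 4) (by positivity)
  refine ⟨a / 20, by positivity, by linarith, fun l Λ hl hΛ ↦ ?_⟩
  have hΛe := exp_one_le_of_div_log_le hl hΛ
  have hΛ1 : 1 < Λ := by linarith [Real.exp_one_gt_d9]
  have hΛ0 : 0 < Λ := by linarith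
  obtain ⟨E, hE, hzeta, hL⟩ := hbounds l Λ hl hΛ
  set x := a / Λ with hx
  have hx0 : 0 < x := by positivity
  have hxa : x < a := div_lt_self ha hΛ1
  have hR : 10 * x ≤ 1 / Λ := by
    rw [hx, ← mul_div_assoc]
    gcongr
    linarith
  have hreg : a / 20 / Λ = x / 20 := by rw [hx]; ring
  set τ := Real.exp (Λ / √l) with hτ
  have hτ0 : 0 < τ := Real.exp_pos _
  have h0τ : |(0 : ℝ)| ≤ 2 * τ := by rw [abs_zero]; positivity
  have hz0 := hzeta 0 h0τ
  have hlow : ∀ s : ℂ, InRegion (a / 20) l Λ s → 1 - x / 20 < s.re := fun s hs ↦ by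
    have := hs.1
    rwa [hreg] at this
  have hone : ∀ s : ℂ, InRegion (a / 20) l Λ s → |s.im| ≤ 2 * τ := fun s hs ↦ by
    have := hs.2
    rw [← hτ] at this
    linarith
  have htwo : ∀ s : ℂ, InRegion (a / 20) l Λ s → |2 * s.im| ≤ 2 * τ := fun s hs ↦ by
    rw [abs_mul, abs_two]
    have := hs.2
    rw [← hτ] at this
    linarith
  have hre : ∀ (q : ℕ) [NeZero q] (χ : DirichletCharacter ℂ q), χ ≠ 1 → ∀ s : ℂ,
      χ.LFunction s = 0 → s.re < 1 := fun q _ χ hχ s h0 ↦ by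
    by_contra! h
    exact DirichletCharacter.LFunction_ne_zero_of_one_le_re χ (Or.inl hχ) h h0
  have key : ∀ (q : ℕ) [NeZero q] (χ : DirichletCharacter ℂ q), Admissible l Λ q χ → χ ≠ 1 →
      ∀ s : ℂ, InRegion (a / 20) l Λ s → χ.LFunction s = 0 →
        χ ^ 2 = 1 ∧ s.im = 0 ∧ s.re < 1 ∧ deriv χ.LFunction s ≠ 0 ∧
        ∀ s' : ℂ, InRegion (a / 20) l Λ s' → χ.LFunction s' = 0 → s' = s := by
    intro q _ χ hadm hχ s hs h0
    obtain ⟨hprim, hq, hp⟩ := hadm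
    have hl0 : 0 < l := by linarith
    have hsq : χ ^ 2 = 1 := by
      by_contra hsq
      have hdvd := DirichletCharacter.conductor_dvd_level (χ ^ 2)
      have : NeZero (χ ^ 2).conductor := ⟨DirichletCharacter.conductor_ne_zero _⟩
      have hlog := log_natCast_le_of_dvd (NeZero.ne q) hdvd
      exact no_zero_of_sq_ne_one hx0 hR hE hχ (primitiveCharacter_ne_one hsq)
        (fun n hn ↦ primitiveCharacter_pow_two_apply χ hn) hz0
        (hL _ (hone s hs) q χ hprim hχ (by linarith) hp)
        (hL _ (htwo s hs) _ _ (DirichletCharacter.primitiveCharacter_isPrimitive _)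
          (primitiveCharacter_ne_one hsq) (by linarith) (fun p hp' h ↦ hp p hp' (h.trans hdvd)))
        h0 (hlow s hs) (hre q χ hχ s h0)
    have hsmall : ∀ s : ℂ, InRegion (a / 20) l Λ s → χ.LFunction s = 0 → |s.im| < x / 2 := by
      intro s hs h0
      by_contra! hi
      exact no_zero_of_sq_eq_one_of_high hx0 hR hE hχ hsq hz0
        (hL _ (hone s hs) q χ hprim hχ (by linarith) hp) (hzeta _ (htwo s hs)) h0 (hlow s hs)
        (hre q χ hχ s h0) hi
    have hL0 := hL 0 h0τ q χ hprim hχ (by linarith) hp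
    have htwozeros : ∀ s' : ℂ, InRegion (a / 20) l Λ s' → χ.LFunction s' = 0 →
        dslope χ.LFunction s s' ≠ 0 := fun s' hs' h0' hd ↦
      no_two_zeros_of_low hx0 hR hE hχ hz0 hL0 h0 hd (hlow s hs) (hre q χ hχ s h0) (hsmall s hs h0)
        (hlow s' hs') (hre q χ hχ s' h0') (hsmall s' hs' h0')
    have huniq : ∀ s' : ℂ, InRegion (a / 20) l Λ s' → χ.LFunction s' = 0 → s' = s := by
      intro s' hs' h0'
      by_contra hne
      have := eq_sub_mul_dslope h0 s'
      rw [h0'] at this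
      rcases mul_eq_zero.1 this.symm with h | h
      · exact hne (sub_eq_zero.1 h)
      · exact htwozeros s' hs' h0' h
    refine ⟨hsq, ?_, hre q χ hχ s h0, ?_, huniq⟩
    · have := huniq (conj s) ⟨by simpa using hs.1, by simpa using hs.2⟩
        (by rw [LFunction_conj hsq hχ, h0, map_zero])
      exact Complex.conj_eq_iff_im.1 this
    · have := htwozeros s hs h0
      rwa [dslope_same] at this
  refine ⟨fun s hs h0 ↦ ?_, fun q _ χ ↦ key q χ, ?_⟩
  · have hr : s.re < 1 := by
      by_contra! h
      exact riemannZeta_ne_zero_of_one_le_re h h0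
    have hs1 : s ≠ 1 := by rintro rfl; simp at hr
    have h0' : zetaOne s = 0 := by rw [zetaOne_of_ne hs1, h0, mul_zero]
    by_cases hi : 3 * x ≤ |s.im|
    · exact riemannZeta_no_zero_of_high hx0 hR hE hz0 (hzeta _ (hone s hs)) (hzeta _ (htwo s hs))
        h0' (hlow s hs) hr hi
    · refine hnear s ?_ h0'
      push Not at hi
      have h1 := hlow s hs
      calc ‖s - 1‖ ≤ |(s - 1).re| + |(s - 1).im| := Complex.norm_le_abs_re_add_abs_im _
        _ ≤ x / 20 + 3 * x := by
          refine add_le_add ?_ ?_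
          · rw [Complex.sub_re, Complex.one_re, abs_le]
            constructor <;> linarith
          · simpa using hi.le
        _ < δ := by linarith
  · intro q₁ q₂ _ _ χ₁ χ₂ hadm₁ hadm₂ hχ₁ hχ₂ s₁ s₂ hs₁ hs₂ h0₁ h0₂
    obtain ⟨hsq₁, him₁, hr₁, -, -⟩ := key q₁ χ₁ hadm₁ hχ₁ s₁ hs₁ h0₁
    obtain ⟨hsq₂, him₂, hr₂, -, -⟩ := key q₂ χ₂ hadm₂ hχ₂ s₂ hs₂ h0₂
    obtain ⟨hprim₁, hq₁, hp₁⟩ := hadm₁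
    obtain ⟨hprim₂, hq₂, hp₂⟩ := hadm₂
    have : NeZero (q₁ * q₂) := ⟨mul_ne_zero (NeZero.ne _) (NeZero.ne _)⟩
    have hd₁ : q₁ ∣ q₁ * q₂ := dvd_mul_right _ _
    have hd₂ : q₂ ∣ q₁ * q₂ := dvd_mul_left _ _
    by_contra hne
    set θ := DirichletCharacter.changeLevel hd₁ χ₁ * DirichletCharacter.changeLevel hd₂ χ₂ with hθ
    have hθ1 : θ ≠ 1 := by
      intro h
      refine hne (sigma_eq_of_changeLevel_eq hd₁ hd₂ hprim₁ hprim₂ ?_)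
      have h2 : DirichletCharacter.changeLevel hd₂ χ₂ * DirichletCharacter.changeLevel hd₂ χ₂
          = 1 := by rw [← map_mul, ← sq, hsq₂, map_one]
      exact mul_right_cancel (h.trans h2.symm)
    have hdvd := DirichletCharacter.conductor_dvd_level θ
    have : NeZero θ.conductor := ⟨DirichletCharacter.conductor_ne_zero _⟩
    have hlog := log_natCast_le_of_dvd (NeZero.ne (q₁ * q₂)) hdvd
    rw [Nat.cast_mul, Real.log_mul (Nat.cast_ne_zero.2 (NeZero.ne _))
      (Nat.cast_ne_zero.2 (NeZero.ne _))] at hlog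
    have hl0 : 0 < l := by linarith
    refine no_zeros_of_two_characters hx0 hR hE hχ₁ hχ₂ (primitiveCharacter_ne_one hθ1) hsq₁ hsq₂
      (fun n hn ↦ ?_) hz0 (hL 0 h0τ q₁ χ₁ hprim₁ hχ₁ (by linarith) hp₁)
      (hL 0 h0τ q₂ χ₂ hprim₂ hχ₂ (by linarith) hp₂)
      (hL 0 h0τ _ _ (DirichletCharacter.primitiveCharacter_isPrimitive _)
        (primitiveCharacter_ne_one hθ1) (by linarith) fun p hp h ↦ ?_)
      h0₁ h0₂ him₁ him₂ (hlow s₁ hs₁) hr₁ (hlow s₂ hs₂) hr₂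
    · rw [primitiveCharacter_apply_natCast _ hn, hθ, MulChar.mul_apply, changeLevel_natCast _ _ hn,
        changeLevel_natCast _ _ hn]
    · rcases (Nat.Prime.dvd_mul hp).1 (h.trans hdvd) with h | h
      · exact hp₁ p hp h
      · exact hp₂ p hp h

end LandauPage

namespace LandauPage
open Finset Set Filter Topology
open scoped BigOperators ComplexConjugate

section Lambert

theorem sum_Ioc_divisors_eq (F : ℕ → ℕ → ℝ) (N : ℕ) :
    ∑ m ∈ Finset.Ioc 0 N, ∑ d ∈ m.divisors, F d m
      = ∑ d ∈ Finset.Ioc 0 N, ∑ k ∈ Finset.Ioc 0 (N / d), F d (d * k) := by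
  rw [Finset.sum_sigma', Finset.sum_sigma']
  refine Finset.sum_bij' (fun x _ ↦ ⟨x.2, x.1 / x.2⟩) (fun x _ ↦ ⟨x.1 * x.2, x.1⟩) ?_ ?_ ?_ ?_ ?_
  · rintro ⟨m, d⟩ h
    simp only [Finset.mem_sigma, Finset.mem_Ioc, Nat.mem_divisors] at h ⊢
    obtain ⟨⟨h1, h2⟩, h3, h4⟩ := h
    have hd := Nat.pos_of_dvd_of_pos h3 h1
    have hle := Nat.le_of_dvd h1 h3
    exact ⟨⟨hd, hle.trans h2⟩, Nat.div_pos hle hd, Nat.div_le_div_right h2⟩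
  · rintro ⟨d, k⟩ h
    simp only [Finset.mem_sigma, Finset.mem_Ioc, Nat.mem_divisors] at h ⊢
    obtain ⟨⟨h1, h2⟩, h3, h4⟩ := h
    have := (Nat.le_div_iff_mul_le h1).1 h4
    exact ⟨⟨by positivity, by rwa [mul_comm]⟩, dvd_mul_right _ _, by positivity⟩
  · rintro ⟨m, d⟩ h
    simp only [Finset.mem_sigma, Finset.mem_Ioc, Nat.mem_divisors] at h
    simp [Nat.mul_div_cancel' h.2.1]
  · rintro ⟨d, k⟩ h
    simp only [Finset.mem_sigma, Finset.mem_Ioc] at h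
    simp [Nat.mul_div_cancel_left _ h.1.1]
  · rintro ⟨m, d⟩ h
    simp only [Finset.mem_sigma, Finset.mem_Ioc, Nat.mem_divisors] at h
    simp [Nat.mul_div_cancel' h.2.1]

theorem abs_sum_mul_le_of_antitone {B c : ℕ → ℝ} {Q : ℝ} (hB : Antitone B) (hB0 : ∀ n, 0 ≤ B n)
    (hc : ∀ n, |∑ i ∈ Finset.range n, c i| ≤ Q) (N : ℕ) :
    |∑ i ∈ Finset.range N, B i * c i| ≤ Q * B 0 := by
  have h1 : ∀ N, ∑ i ∈ Finset.range N, B i * c i = B N * ∑ i ∈ Finset.range N, c i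
      + ∑ i ∈ Finset.range N, (B i - B (i + 1)) * ∑ j ∈ Finset.range (i + 1), c j := by
    intro N
    induction N with
    | zero => simp
    | succ n ih =>
      simp only [Finset.sum_range_succ] at ih ⊢
      rw [ih]
      ring
  rw [h1]
  refine (abs_add_le _ _).trans ?_
  have h2 : |B N * ∑ i ∈ Finset.range N, c i| ≤ B N * Q := by
    rw [abs_mul, abs_of_nonneg (hB0 N)]
    exact mul_le_mul_of_nonneg_left (hc N) (hB0 N)
  have h3 : |∑ i ∈ Finset.range N, (B i - B (i + 1)) * ∑ j ∈ Finset.range (i + 1), c j|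
      ≤ ∑ i ∈ Finset.range N, (B i - B (i + 1)) * Q := by
    refine (Finset.abs_sum_le_sum_abs _ _).trans (Finset.sum_le_sum fun i _ ↦ ?_)
    have : 0 ≤ B i - B (i + 1) := sub_nonneg.2 (hB (Nat.le_succ i))
    rw [abs_mul, abs_of_nonneg this]
    exact mul_le_mul_of_nonneg_left (hc _) this
  rw [← Finset.sum_mul, Finset.sum_range_sub'] at h3
  linarith

theorem geom_sum_ge (y : ℝ) (n : ℕ) :
    (n + 1) * y ^ n ≤ ∑ i ∈ Finset.range (n + 1), (y ^ 2) ^ i := by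
  have h1 : ∑ i ∈ Finset.range (n + 1), (y ^ 2) ^ (n - i)
      = ∑ i ∈ Finset.range (n + 1), (y ^ 2) ^ i := by
    have := Finset.sum_range_reflect (fun i ↦ (y ^ 2) ^ i) (n + 1)
    simpa using this
  have h2 : ∑ i ∈ Finset.range (n + 1), (2 * y ^ n)
      ≤ ∑ i ∈ Finset.range (n + 1), ((y ^ 2) ^ i + (y ^ 2) ^ (n - i)) := by
    refine Finset.sum_le_sum fun i hi ↦ ?_
    have hin : i ≤ n := Nat.lt_succ_iff.1 (Finset.mem_range.1 hi)
    have e : y ^ n = y ^ i * y ^ (n - i) := by rw [← pow_add, Nat.add_sub_cancel' hin]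
    rw [e, ← pow_mul, ← pow_mul, mul_comm 2 i, mul_comm 2 (n - i), pow_mul, pow_mul]
    nlinarith [sq_nonneg (y ^ i - y ^ (n - i))]
  rw [Finset.sum_add_distrib, h1] at h2
  simp only [Finset.sum_const, Finset.card_range, nsmul_eq_mul] at h2
  push_cast at h2
  linarith

/-- The coefficients comparing `Σ c(n)/n` with a Lambert series. -/
noncomputable def lambertCoeff (x : ℝ) (n : ℕ) : ℝ :=
  1 / ((n + 1) * (1 - x)) - x ^ (n + 1) / (1 - x ^ (n + 1))

theorem lambertCoeff_eq {x : ℝ} (hx1 : x < 1) (n : ℕ) :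
    lambertCoeff x n
      = (1 / (n + 1) - x ^ (n + 1) / ∑ i ∈ Finset.range (n + 1), x ^ i) / (1 - x) := by
  have h1 : 1 - x ≠ 0 := by linarith
  have h2 : 1 - x ^ (n + 1) = (∑ i ∈ Finset.range (n + 1), x ^ i) * (1 - x) := by
    have := geom_sum_mul_neg x (n + 1)
    linarith
  unfold lambertCoeff
  rw [h2, sub_div, div_div, div_div]

theorem antitone_lambertCoeff {x : ℝ} (hx0 : 0 < x) (hx1 : x < 1) :
    Antitone (lambertCoeff x) := by
  refine antitone_nat_of_succ_le fun n ↦ ?_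
  rw [lambertCoeff_eq hx1, lambertCoeff_eq hx1]
  refine div_le_div_of_nonneg_right ?_ (by linarith)
  set S := ∑ i ∈ Finset.range (n + 1), x ^ i with hS
  have hS0 : 0 < S := Finset.sum_pos (fun i _ ↦ by positivity) ⟨0, by simp⟩
  have hS1 : ∑ i ∈ Finset.range (n + 1 + 1), x ^ i = x * S + 1 := by
    rw [geom_sum_succ]
  rw [hS1]
  set y := √x with hy
  have hy0 : 0 < y := Real.sqrt_pos.2 hx0
  have hyx : y ^ 2 = x := Real.sq_sqrt hx0.le
  have hy1 : y ≤ 1 := by nlinarith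
  have g1 := geom_sum_ge y n
  have g2 := geom_sum_ge y (n + 1)
  rw [hyx] at g1 g2
  rw [← hS] at g1
  rw [hS1] at g2
  push_cast at g2 ⊢
  have hprod : ((n : ℝ) + 1) * (n + 1 + 1) * x ^ (n + 1) ≤ S * (x * S + 1) := by
    calc ((n : ℝ) + 1) * (n + 1 + 1) * x ^ (n + 1)
        = (((n : ℝ) + 1) * y ^ n) * ((n + 1 + 1) * y ^ (n + 1)) * y := by
          rw [← hyx]; ring
      _ ≤ (((n : ℝ) + 1) * y ^ n) * ((n + 1 + 1) * y ^ (n + 1)) * 1 := by gcongr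
      _ ≤ S * (x * S + 1) := by
          rw [mul_one]
          exact mul_le_mul g1 g2 (by positivity) hS0.le
  have hA : (1 : ℝ) / (n + 1) - 1 / (n + 1 + 1) = 1 / ((n + 1) * (n + 1 + 1)) := by
    field_simp
    ring
  have hB : x ^ (n + 1) / S - x ^ (n + 1 + 1) / (x * S + 1)
      = x ^ (n + 1) / (S * (x * S + 1)) := by
    have : x * S + 1 ≠ 0 := by positivity
    field_simp
    ring
  have hC : x ^ (n + 1) / (S * (x * S + 1)) ≤ 1 / (((n : ℝ) + 1) * (n + 1 + 1)) := by
    rw [div_le_div_iff₀ (by positivity) (by positivity)]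
    linarith
  linarith

theorem lambertCoeff_zero {x : ℝ} (hx1 : x < 1) : lambertCoeff x 0 = 1 := by
  have : 1 - x ≠ 0 := by linarith
  unfold lambertCoeff
  simp only [Nat.cast_zero, zero_add, pow_one, one_mul]
  field_simp

theorem lambertCoeff_nonneg {x : ℝ} (hx0 : 0 < x) (hx1 : x < 1) (n : ℕ) :
    0 ≤ lambertCoeff x n := by
  rw [lambertCoeff_eq hx1]
  refine div_nonneg ?_ (by linarith)
  rw [sub_nonneg, div_le_div_iff₀ (Finset.sum_pos (fun i _ ↦ by positivity) ⟨0, by simp⟩)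
    (by positivity), one_mul]
  calc x ^ (n + 1) * ((n : ℝ) + 1) = ∑ i ∈ Finset.range (n + 1), x ^ (n + 1) := by
        simp [mul_comm]
    _ ≤ _ := Finset.sum_le_sum fun i hi ↦
        pow_le_pow_of_le_one hx0.le hx1.le (Finset.mem_range.1 hi).le

theorem lambert_tail_le {x : ℝ} (hx0 : 0 < x) (hx1 : x < 1) {d : ℕ} (hd : 0 < d) (N : ℕ) :
    |x ^ d / (1 - x ^ d) - ∑ k ∈ Finset.Ioc 0 (N / d), x ^ (d * k)| ≤ x ^ N / (1 - x) := by
  set w := x ^ d with hw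
  have hw1 : w < 1 := pow_lt_one₀ hx0.le hx1 hd.ne'
  have hw0 : 0 < w := by positivity
  have hwx : w ≤ x := pow_le_of_le_one hx0.le hx1.le hd.ne'
  have h1 : ∑ k ∈ Finset.Ioc 0 (N / d), x ^ (d * k) = (w - w ^ (N / d + 1)) / (1 - w) := by
    have : ∀ K : ℕ, ∑ k ∈ Finset.Ioc 0 K, x ^ (d * k) = (w - w ^ (K + 1)) / (1 - w) := by
      intro K
      have h1w : 1 - w ≠ 0 := by linarith
      induction K with
      | zero => simp
      | succ K ih =>
        rw [Finset.sum_Ioc_succ_top (Nat.zero_le K), ih, pow_mul, ← hw]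
        field_simp
        ring
    exact this _
  have e : w / (1 - w) - (w - w ^ (N / d + 1)) / (1 - w) = w ^ (N / d + 1) / (1 - w) := by
    rw [← sub_div]; ring
  rw [h1, e, abs_of_nonneg (div_nonneg (by positivity) (by linarith))]
  refine div_le_div₀ (by positivity) ?_ (by linarith) (by linarith)
  rw [hw, ← pow_mul]
  exact pow_le_pow_of_le_one hx0.le hx1.le (Nat.lt_mul_div_succ N hd).le

set_option maxHeartbeats 1000000 in
/-- A quantitative lower bound for `Σ c(n)/n` when `1 * c` is nonnegative and large on squares. -/
theorem le_of_tendsto_sum_div {c : ℕ → ℝ} {L Q : ℝ} (hc1 : ∀ n, |c n| ≤ 1)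
    (hr : ∀ m : ℕ, 0 ≤ ∑ d ∈ m.divisors, c d) (hr2 : ∀ m : ℕ, m ≠ 0 → 1 ≤ ∑ d ∈ (m ^ 2).divisors, c d)
    (hQ : ∀ n, |∑ i ∈ Finset.range n, c (i + 1)| ≤ Q)
    (hL : Tendsto (fun N : ℕ ↦ ∑ i ∈ Finset.range N, c (i + 1) / (i + 1)) atTop (𝓝 L)) {M : ℕ}
    (hM : 0 < M) : M / 2 - Q ≤ 2 * M ^ 2 * L := by
  have hM' : (1 : ℝ) ≤ M := by exact_mod_cast hM
  set x : ℝ := 1 - 1 / (2 * M ^ 2) with hx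
  have hxM : 1 / (2 * (M : ℝ) ^ 2) ≤ 1 / 2 := by
    apply one_div_le_one_div_of_le <;> nlinarith
  have hpos : 0 < 1 / (2 * (M : ℝ) ^ 2) := by positivity
  have hx0 : 0 < x := by linarith
  have hx1 : x < 1 := by linarith
  have h1x : 1 - x = 1 / (2 * M ^ 2) := by rw [hx]; ring
  have key : ∀ N : ℕ, M ^ 2 ≤ N → (M : ℝ) / 2 - N * (x ^ N / (1 - x)) - Q
      ≤ 2 * M ^ 2 * ∑ i ∈ Finset.range N, c (i + 1) / (i + 1) := by
    intro N hN
    have a1 := abs_sum_mul_le_of_antitone (antitone_lambertCoeff hx0 hx1)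
      (lambertCoeff_nonneg hx0 hx1) hQ N
    rw [lambertCoeff_zero hx1, mul_one] at a1
    have a2 : ∑ i ∈ Finset.range N, lambertCoeff x i * c (i + 1)
        = 2 * M ^ 2 * ∑ i ∈ Finset.range N, c (i + 1) / (i + 1)
          - ∑ d ∈ Finset.Ioc 0 N, c d * (x ^ d / (1 - x ^ d)) := by
      have : ∑ d ∈ Finset.Ioc 0 N, c d * (x ^ d / (1 - x ^ d))
          = ∑ i ∈ Finset.range N, c (i + 1) * (x ^ (i + 1) / (1 - x ^ (i + 1))) := by
        rw [Finset.range_eq_Ico, Finset.sum_Ico_add' (fun d ↦ c d * (x ^ d / (1 - x ^ d))) 0 N 1]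
        rfl
      rw [this, Finset.mul_sum, ← Finset.sum_sub_distrib]
      refine Finset.sum_congr rfl fun i _ ↦ ?_
      unfold lambertCoeff
      rw [h1x]
      field_simp
    have a3 : |∑ d ∈ Finset.Ioc 0 N, c d * (x ^ d / (1 - x ^ d))
        - ∑ m ∈ Finset.Ioc 0 N, ∑ d ∈ m.divisors, c d * x ^ m| ≤ N * (x ^ N / (1 - x)) := by
      rw [sum_Ioc_divisors_eq (fun d m ↦ c d * x ^ m), ← Finset.sum_sub_distrib]
      refine (Finset.abs_sum_le_sum_abs _ _).trans ?_
      have : (N : ℝ) * (x ^ N / (1 - x)) = ∑ d ∈ Finset.Ioc 0 N, (x ^ N / (1 - x)) := by simp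
      rw [this]
      refine Finset.sum_le_sum fun d hd ↦ ?_
      rw [← Finset.mul_sum, ← mul_sub, abs_mul]
      calc _ ≤ 1 * _ := mul_le_mul_of_nonneg_right (hc1 d) (abs_nonneg _)
        _ ≤ _ := by
          rw [one_mul]
          exact lambert_tail_le hx0 hx1 (Finset.mem_Ioc.1 hd).1 N
    have a4 : (M : ℝ) / 2 ≤ ∑ m ∈ Finset.Ioc 0 N, ∑ d ∈ m.divisors, c d * x ^ m := by
      have hinj : Set.InjOn (fun m : ℕ ↦ m ^ 2) (Finset.Ioc 0 M : Finset ℕ) :=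
        fun a _ b _ h ↦ Nat.pow_left_injective (by norm_num) h
      calc (M : ℝ) / 2 = ∑ m ∈ Finset.Ioc 0 M, (1 / 2 : ℝ) := by simp; ring
        _ ≤ ∑ m ∈ Finset.Ioc 0 M, ∑ d ∈ (m ^ 2).divisors, c d * x ^ (m ^ 2) := by
          refine Finset.sum_le_sum fun m hm ↦ ?_
          obtain ⟨hm0, hmM⟩ := Finset.mem_Ioc.1 hm
          rw [← Finset.sum_mul]
          have b1 : (1 : ℝ) / 2 ≤ x ^ (m ^ 2) := by
            have := one_add_mul_le_pow (a := x - 1) (by linarith) (m ^ 2)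
            rw [add_sub_cancel] at this
            refine le_trans ?_ this
            have hmM' : (m : ℝ) ≤ M := by exact_mod_cast hmM
            have b2 : ((m ^ 2 : ℕ) : ℝ) * (1 - x) ≤ 1 / 2 := by
              rw [h1x]
              push_cast
              rw [mul_one_div, div_le_div_iff₀ (by positivity) (by norm_num)]
              have := pow_le_pow_left₀ (Nat.cast_nonneg m) hmM' 2
              linarith
            linarith
          have := hr2 m hm0.ne'
          calc (1 : ℝ) / 2 = 1 * (1 / 2) := by ring
            _ ≤ _ := mul_le_mul this b1 (by norm_num) (by linarith)
        _ = ∑ m ∈ (Finset.Ioc 0 M).image (fun m : ℕ ↦ m ^ 2), ∑ d ∈ m.divisors, c d * x ^ m :=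
          (Finset.sum_image (f := fun m ↦ ∑ d ∈ m.divisors, c d * x ^ m) hinj).symm
        _ ≤ _ := by
          refine Finset.sum_le_sum_of_subset_of_nonneg ?_ fun m _ _ ↦ ?_
          · intro m hm
            obtain ⟨a, ha, rfl⟩ := Finset.mem_image.1 hm
            obtain ⟨ha0, haM⟩ := Finset.mem_Ioc.1 ha
            exact Finset.mem_Ioc.2 ⟨by positivity, (Nat.pow_le_pow_left haM 2).trans hN⟩
          · rw [← Finset.sum_mul]
            exact mul_nonneg (hr m) (by positivity)
    have a5 := neg_le_of_abs_le a1
    have a6 := neg_le_of_abs_le a3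
    linarith
  have t1 : Tendsto (fun N : ℕ ↦ (M : ℝ) / 2 - N * (x ^ N / (1 - x)) - Q) atTop
      (𝓝 ((M : ℝ) / 2 - 0 - Q)) := by
    refine (tendsto_const_nhds.sub ?_).sub_const _
    have := (tendsto_self_mul_const_pow_of_lt_one hx0.le hx1).div_const (1 - x)
    rw [zero_div] at this
    exact this.congr fun N ↦ by ring
  rw [sub_zero] at t1
  exact le_of_tendsto_of_tendsto t1 (hL.const_mul _)
    (eventually_atTop.2 ⟨M ^ 2, key⟩)

end Lambert

end LandauPage

namespace LandauPage
open Finset Set Filter Topology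
open scoped BigOperators ComplexConjugate

section
variable {q : ℕ} {χ : DirichletCharacter ℂ q}

theorem zetaMul_eq_sum (χ : DirichletCharacter ℂ q) (m : ℕ) :
    χ.zetaMul m = ∑ d ∈ m.divisors, χ d := by
  rw [DirichletCharacter.zetaMul, ArithmeticFunction.coe_zeta_mul_apply]
  refine Finset.sum_congr rfl fun d hd ↦ ?_
  have : d ≠ 0 := (Nat.pos_of_mem_divisors hd).ne'
  simp [toArithmeticFunction, this]

theorem zetaMul_sq_prime_pow (hχ : χ ^ 2 = 1) {p : ℕ} (hp : p.Prime) (k : ℕ) :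
    ∃ r : ℝ, 1 ≤ r ∧ χ.zetaMul (p ^ (2 * k)) = r := by
  rw [zetaMul_eq_sum, Nat.sum_divisors_prime_pow hp]
  simp only [Nat.cast_pow, map_pow]
  rcases eq_neg_one_or_zero_or_one χ hχ p with h | h | h
  · refine ⟨1, le_rfl, ?_⟩
    rw [h, neg_one_geom_sum, if_neg (by simp)]
    simp
  · refine ⟨1, le_rfl, ?_⟩
    rw [h, Finset.sum_range_succ']
    simp
  · refine ⟨(2 * k + 1 : ℕ), by exact_mod_cast Nat.succ_pos _, ?_⟩
    rw [h]
    simp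

theorem zetaMul_sq (hχ : χ ^ 2 = 1) {m : ℕ} (hm : m ≠ 0) :
    ∃ r : ℝ, 1 ≤ r ∧ χ.zetaMul (m ^ 2) = r := by
  rw [χ.isMultiplicative_zetaMul.multiplicative_factorization _ (pow_ne_zero 2 hm)]
  unfold Finsupp.prod
  refine Finset.prod_induction _ (fun z : ℂ ↦ ∃ r : ℝ, 1 ≤ r ∧ z = r) ?_ ⟨1, le_rfl, by simp⟩ ?_
  · rintro a b ⟨r, hr, rfl⟩ ⟨s, hs, rfl⟩
    exact ⟨r * s, one_le_mul_of_one_le_of_one_le hr hs, by simp⟩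
  · intro p hp
    have hp' : p.Prime := Nat.prime_of_mem_primeFactors hp
    rw [Nat.factorization_pow, Finsupp.smul_apply, smul_eq_mul]
    exact zetaMul_sq_prime_pow hχ hp' _

theorem re_LFunction_one_ge [NeZero q] (hχ : χ ^ 2 = 1) (hχ1 : χ ≠ 1) :
    1 / (32 * q) ≤ (χ.LFunction 1).re := by
  have hq : (0 : ℝ) < q := Nat.cast_pos.2 (NeZero.pos q)
  have hsum : ∀ m : ℕ, ∑ d ∈ m.divisors, (χ d).re = (χ.zetaMul m).re := fun m ↦ by
    rw [zetaMul_eq_sum, Complex.re_sum]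
  have ht : Tendsto (fun N : ℕ ↦ ∑ j ∈ Finset.range N, χ ((j + 1 : ℕ) : ZMod q)
      * ((j : ℂ) + 1) ^ (-(1 : ℂ))) atTop (𝓝 (χ.LFunction 1)) := by
    rw [tendsto_iff_norm_sub_tendsto_zero]
    have h1 := (tendsto_natCast_succ_rpow (σ := 1) one_pos).const_mul
      ((q : ℝ) * (‖(1 : ℂ)‖ / (1 : ℂ).re + 1))
    rw [mul_zero] at h1
    refine squeeze_zero (fun _ ↦ norm_nonneg _) (fun N ↦ ?_) h1
    rw [norm_sub_rev]
    exact norm_LFunction_sub_sum_le hχ1 (by simp) N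
  have hre := (Complex.continuous_re.tendsto _).comp ht
  have := le_of_tendsto_sum_div (c := fun n ↦ (χ n).re) (L := (χ.LFunction 1).re) (Q := q)
    (fun n ↦ (Complex.abs_re_le_norm _).trans (χ.norm_le_one _))
    (fun m ↦ by
      rw [hsum]
      exact (Complex.nonneg_iff.1 (DirichletCharacter.zetaMul_nonneg hχ m)).1)
    (fun m hm ↦ by
      rw [hsum]
      obtain ⟨r, hr, h⟩ := zetaMul_sq hχ hm
      rw [h]
      exact hr)
    (fun n ↦ by
      rw [← Complex.re_sum]
      exact (Complex.abs_re_le_norm _).trans (sum_char_eq hχ1 n))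
    (hre.congr fun N ↦ by
      rw [Function.comp_apply, Complex.re_sum]
      refine Finset.sum_congr rfl fun j _ ↦ ?_
      rw [Complex.cpow_neg_one, ← Complex.ofReal_natCast, ← Complex.ofReal_one,
        ← Complex.ofReal_add, ← Complex.ofReal_inv, Complex.re_mul_ofReal]
      rfl) (M := 4 * q) (by have := NeZero.pos q; positivity)
  push_cast at this
  rw [div_le_iff₀ (by positivity)]
  nlinarith

theorem one_sub_zero_ge [NeZero q] (hχ : χ ^ 2 = 1) (hχ1 : χ ≠ 1) {β : ℝ} (hβ : β < 1)
    (h0 : χ.LFunction β = 0) : 1 / (448 * (q : ℝ) ^ 2) ≤ 1 - β := by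
  have hq : (1 : ℝ) ≤ q := by exact_mod_cast NeZero.pos q
  rcases lt_or_ge β (3 / 4) with h | h
  · have : 1 / (448 * (q : ℝ) ^ 2) ≤ 1 / 4 := one_div_le_one_div_of_le (by norm_num) (by nlinarith)
    linarith
  have hd : ∀ s ∈ Complex.ofReal '' Set.Icc (3 / 4 : ℝ) 1, ‖deriv χ.LFunction s‖ ≤ 14 * q := by
    rintro _ ⟨t, ⟨ht, ht1⟩, rfl⟩
    have := Complex.norm_deriv_le_of_forall_mem_sphere_norm_le (c := (t : ℂ)) (R := 1 / 2)
      (C := 7 * q) (f := χ.LFunction) (by norm_num)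
      (DirichletCharacter.differentiable_LFunction hχ1).diffContOnCl (fun z hz ↦ by
        rw [mem_sphere_iff_norm] at hz
        have hre : 1 / 4 ≤ z.re := by
          have := (Complex.abs_re_le_norm (z - t)).trans hz.le
          have := neg_le_of_abs_le this
          simp only [Complex.sub_re, Complex.ofReal_re] at this
          linarith
        have hn : ‖z‖ ≤ 3 / 2 := by
          have := norm_add_le (z - t) t
          rw [sub_add_cancel, hz, Complex.norm_real, Real.norm_eq_abs,
            abs_of_nonneg (by linarith)] at this
          linarith
        refine (norm_LFunction_le hχ1 (by linarith)).trans ?_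
        have : ‖z‖ / z.re ≤ 6 := by
          rw [div_le_iff₀ (by linarith)]
          linarith
        nlinarith)
    refine this.trans (le_of_eq (by ring))
  have hconv : Convex ℝ (Complex.ofReal '' Set.Icc (3 / 4 : ℝ) 1) :=
    (convex_Icc _ _).linear_image Complex.ofRealCLM.toLinearMap
  have := hconv.norm_image_sub_le_of_norm_deriv_le
    (fun s _ ↦ DirichletCharacter.differentiable_LFunction hχ1 s) hd
    (Set.mem_image_of_mem _ (⟨h, hβ.le⟩ : β ∈ Set.Icc (3 / 4 : ℝ) 1))
    (Set.mem_image_of_mem _ (⟨by norm_num, le_rfl⟩ : (1 : ℝ) ∈ Set.Icc (3 / 4 : ℝ) 1))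
  rw [h0, sub_zero, ← Complex.ofReal_sub, Complex.norm_real, Real.norm_eq_abs,
    abs_of_pos (by linarith), Complex.ofReal_one] at this
  have h1 := (re_LFunction_one_ge hχ hχ1).trans
    ((Complex.re_le_norm _).trans this)
  rw [div_le_iff₀ (by positivity)] at h1 ⊢
  nlinarith
end

end LandauPage

namespace LandauPage
open Finset Set Filter Topology
open scoped BigOperators ComplexConjugate

theorem exists_ne_one_of_isPrimitive {q : ℕ} [NeZero q] {χ : DirichletCharacter ℂ q}
    (hχ : χ.IsPrimitive) {p m : ℕ} (hp : p.Prime) (hq : q = p * m) :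
    ∃ z : ℤ, IsUnit ((1 + m * z : ℤ) : ZMod q) ∧ χ ((1 + m * z : ℤ) : ZMod q) ≠ 1 := by
  by_contra! hcon
  have hq0 : 0 < q := Nat.pos_of_ne_zero (NeZero.ne q)
  have hm0 : 0 < m := Nat.pos_of_ne_zero fun h => hq0.ne' (by rw [hq, h, mul_zero])
  have hdvd : m ∣ q := Dvd.intro_left p hq.symm
  have hfac : χ.FactorsThrough m := by
    rw [DirichletCharacter.factorsThrough_iff_ker_unitsMap hdvd]
    intro u hu
    rw [MonoidHom.mem_ker] at hu ⊢
    obtain ⟨U, hU⟩ : ∃ U : ℤ, (U : ZMod q) = u := ⟨(u : ZMod q).val, by simp⟩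
    have hU1 : (m : ℤ) ∣ U - 1 := by
      rw [← ZMod.intCast_zmod_eq_zero_iff_dvd]
      have h3 := congrArg Units.val hu
      rw [ZMod.unitsMap_val, ← hU, Units.val_one, ZMod.cast_intCast hdvd] at h3
      push_cast
      rw [h3, sub_self]
    obtain ⟨w, hw⟩ := hU1
    have hU2 : U = 1 + m * w := by rw [← hw]; ring
    apply Units.ext
    rw [MulChar.coe_toUnitHom, Units.val_one, ← hU, hU2]
    exact hcon w (by rw [← hU2, hU]; exact u.isUnit)
  have h3 := DirichletCharacter.conductor_dvd_of_mem_conductorSet (χ := χ) hfac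
  rw [(DirichletCharacter.isPrimitive_def χ).mp hχ] at h3
  have h4 := Nat.le_of_dvd hm0 h3
  rw [hq] at h4
  nlinarith [hp.two_le]

theorem not_pow_four_dvd {q : ℕ} [NeZero q] {χ : DirichletCharacter ℂ q} (hχ : χ.IsPrimitive)
    (h2 : χ ^ 2 = 1) {p : ℕ} (hp : p.Prime) : ¬ p ^ 4 ∣ q := by
  rintro ⟨m, hm⟩
  obtain ⟨z, hu, hz⟩ := exists_ne_one_of_isPrimitive hχ hp
    (show q = p * (p ^ 3 * m) by rw [hm]; ring)
  obtain ⟨v, k, hv⟩ : ∃ v k : ℤ, v ^ 2 = 1 + (p ^ 3 * m : ℕ) * z + q * k := by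
    rcases hp.eq_two_or_odd' with rfl | hodd
    · refine ⟨1 + 4 * m * z, m * z ^ 2, ?_⟩
      rw [hm]; push_cast; ring
    · obtain ⟨r, hr⟩ := hodd
      refine ⟨1 + p ^ 3 * m * (z * (r + 1)), z + p ^ 2 * m * (z * (r + 1)) ^ 2, ?_⟩
      have hr' : (2 * r : ℤ) = p - 1 := by rw [hr]; push_cast; ring
      rw [hm]; push_cast
      linear_combination (p ^ 3 * m * z : ℤ) * hr'
  have hcast : ((1 + (p ^ 3 * m : ℕ) * z : ℤ) : ZMod q) = (v : ZMod q) ^ 2 := by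
    have := congrArg (Int.cast : ℤ → ZMod q) hv
    push_cast at this ⊢
    rw [this]; simp
  rw [hcast] at hu hz
  have hvu : IsUnit (v : ZMod q) := (isUnit_pow_iff two_ne_zero).mp hu
  apply hz
  rw [map_pow, ← MulChar.pow_apply' χ two_ne_zero, h2, MulChar.one_apply hvu]

theorem log_le_mul_sup_primeFactors {q : ℕ} [NeZero q] {χ : DirichletCharacter ℂ q}
    (hχ : χ.IsPrimitive) (h2 : χ ^ 2 = 1) :
    1 / 5 * Real.log q ≤ ((q.primeFactors.sup id : ℕ) : ℝ) := by
  set n := q.primeFactors.sup id with hn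
  have hle : q ≤ 4 ^ (3 * n) := by
    have hsub : q.primeFactors ⊆ (Finset.range (n + 1)).filter Nat.Prime := by
      intro p hp
      rw [Finset.mem_filter, Finset.mem_range]
      exact ⟨Nat.lt_succ_of_le (Finset.le_sup (f := id) hp), Nat.prime_of_mem_primeFactors hp⟩
    calc q = ∏ p ∈ q.primeFactors, p ^ q.factorization p :=
          (Nat.prod_factorization_pow_eq_self (NeZero.ne q)).symm
      _ ≤ ∏ p ∈ q.primeFactors, p ^ 3 := by
          refine Finset.prod_le_prod' fun p hp => ?_
          have hpr := Nat.prime_of_mem_primeFactors hp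
          refine Nat.pow_le_pow_right hpr.pos ?_
          by_contra! h
          exact not_pow_four_dvd hχ h2 hpr
            ((hpr.pow_dvd_iff_le_factorization (NeZero.ne q)).mpr h)
      _ = (∏ p ∈ q.primeFactors, p) ^ 3 := Finset.prod_pow _ _ _
      _ ≤ (primorial n) ^ 3 := by
          refine Nat.pow_le_pow_left (Finset.prod_le_prod_of_subset_of_one_le' hsub ?_) 3
          intro p hp _
          exact (Finset.mem_filter.mp hp).2.one_le
      _ ≤ (4 ^ n) ^ 3 := Nat.pow_le_pow_left (primorial_le_four_pow n) 3
      _ = 4 ^ (3 * n) := by rw [← pow_mul, mul_comm]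
  have h3 : Real.log q ≤ Real.log ((4 : ℝ) ^ (3 * n)) :=
    Real.log_le_log (by exact_mod_cast Nat.pos_of_ne_zero (NeZero.ne q)) (by exact_mod_cast hle)
  rw [Real.log_pow, show (4 : ℝ) = 2 ^ 2 by norm_num, Real.log_pow] at h3
  push_cast at h3
  have h4 := Real.log_two_lt_d9
  have h5 : (0 : ℝ) ≤ n := Nat.cast_nonneg n
  nlinarith

theorem loglog_le_of_exceptional_zero {q : ℕ} [NeZero q] {χ : DirichletCharacter ℂ q}
    (h2 : χ ^ 2 = 1) (hχ1 : χ ≠ 1) {c l Λ β : ℝ} (hc : c ≤ 1) (hl : 1 < l)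
    (hΛ : l / Real.log l ≤ Λ) (hβ : β < 1) (hβ' : 1 - c / Λ < β) (h0 : χ.LFunction β = 0) :
    1 / 30 * Real.log l ≤ Real.log q := by
  have hq2 : (2 : ℝ) ≤ q := by
    have h1 : q ≠ 1 := by
      rintro rfl
      exact hχ1 (Subsingleton.elim _ _)
    have := NeZero.ne q
    exact_mod_cast (show 2 ≤ q by omega)
  have hlog : 0 < Real.log l := Real.log_pos hl
  have hΛ0 : 0 < Λ := (div_pos (by linarith) hlog).trans_le hΛ
  have h1 := one_sub_zero_ge h2 hχ1 hβ h0
  have h3 : 1 / (448 * (q : ℝ) ^ 2) < 1 / Λ := by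
    have : c / Λ ≤ 1 / Λ := by gcongr
    linarith
  have h4 : Λ < 448 * (q : ℝ) ^ 2 := lt_of_one_div_lt_one_div (by positivity) h3
  have hs : 0 < √l := Real.sqrt_pos.mpr (by linarith)
  have hsl : √l * √l = l := Real.mul_self_sqrt (by linarith)
  have hlogs : Real.log √l = Real.log l / 2 := Real.log_sqrt (by linarith)
  have h5 : Real.log √l ≤ √l - 1 := Real.log_le_sub_one_of_pos hs
  have h6 : l ≤ Λ * Real.log l := (div_le_iff₀ hlog).mp hΛ
  have h7 : √l ≤ 2 * Λ := by
    have : √l * √l ≤ 2 * Λ * √l := by nlinarith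
    exact le_of_mul_le_mul_right this hs
  have h8 : √l ≤ (2 : ℝ) ^ 10 * (q : ℝ) ^ 2 := by nlinarith
  have h9 := Real.log_le_log hs h8
  rw [Real.log_mul (by positivity) (by positivity), Real.log_pow, Real.log_pow, hlogs] at h9
  have h10 := Real.log_le_log (by norm_num) hq2
  push_cast at h9
  linarith

end LandauPage

theorem LFun_eq_LFunction {q : ℕ} [NeZero q] (χ : DirichletCharacter ℂ q) :
    LFun q χ = χ.LFunction := by
  funext s
  rw [LFun, dif_pos (NeZero.ne q)]

/-- Modified Landau–Page theorem: there is `c₀ > 0` such that for `T ≥ 3` and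
`P ≥ T^{1/log log T}`, among all moduli `q ≤ T` with `P⁺(q) ≤ P` and all primitive characters
`χ` mod `q`, at most one pair `(q₀, χ₀)` has `L(s, χ₀)` vanishing in the region
`Re s > 1 − c₀/log P`, `|Im s| ≤ exp(log P/√(log T))`; if such a zero exists it is unique,
real and simple, `χ₀` is real, and `P⁺(q₀) ≥ A log q₀`, `log q₀ ≥ B log log T` for absolute
constants `A, B > 0`. -/
theorem statement1 :
    ∃ c₀ A B : ℝ, 0 < c₀ ∧ 0 < A ∧ 0 < B ∧
      ∀ T P : ℝ, 3 ≤ T → T ^ (1 / Real.log (Real.log T)) ≤ P →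
        ∀ Bad : (Σ q : ℕ, DirichletCharacter ℂ q) → Prop,
          (∀ x, Bad x ↔
            (x.1 ≠ 0 ∧ (x.1 : ℝ) ≤ T ∧ ((maxPrimeFac x.1 : ℕ) : ℝ) ≤ P ∧
              x.2.IsPrimitive ∧
              ∃ s : ℂ, LFun x.1 x.2 s = 0 ∧ 1 - c₀ / Real.log P < s.re ∧
                |s.im| ≤ Real.exp (Real.log P / Real.sqrt (Real.log T)))) →
          (∀ x y, Bad x → Bad y → x = y) ∧
          ∀ x, Bad x →
            (∃! s : ℂ, LFun x.1 x.2 s = 0 ∧ 1 - c₀ / Real.log P < s.re ∧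
              |s.im| ≤ Real.exp (Real.log P / Real.sqrt (Real.log T))) ∧
            (∀ s : ℂ,
              (LFun x.1 x.2 s = 0 ∧ 1 - c₀ / Real.log P < s.re ∧
                |s.im| ≤ Real.exp (Real.log P / Real.sqrt (Real.log T))) →
              s.im = 0 ∧ deriv (LFun x.1 x.2) s ≠ 0) ∧
            (∀ a : ZMod x.1, (x.2 a).im = 0) ∧
            A * Real.log x.1 ≤ ((maxPrimeFac x.1 : ℕ) : ℝ) ∧
            B * Real.log (Real.log T) ≤ Real.log x.1 := by
  obtain ⟨c, hc, hc1, h⟩ := LandauPage.exists_zero_free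
  refine ⟨c, 1 / 5, 1 / 30, hc, by norm_num, by norm_num, fun T P hT hP Bad hBad => ?_⟩
  have hT0 : 0 < T := by linarith
  set l := Real.log T with hl
  set Λ := Real.log P with hΛ
  have hl1 : 1 < l := by
    rw [hl, Real.lt_log_iff_exp_lt hT0]
    linarith [Real.exp_one_lt_d9]
  have hP0 : 0 < P := (Real.rpow_pos_of_pos hT0 _).trans_le hP
  have hΛl : l / Real.log l ≤ Λ := by
    have := Real.log_le_log (Real.rpow_pos_of_pos hT0 _) hP
    rwa [Real.log_rpow hT0, one_div_mul_eq_div] at this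
  obtain ⟨hzeta, hchar, hpair⟩ := h l Λ hl1 hΛl
  have hadm : ∀ (q : ℕ) [NeZero q] (χ : DirichletCharacter ℂ q), (q : ℝ) ≤ T →
      ((maxPrimeFac q : ℕ) : ℝ) ≤ P → χ.IsPrimitive → LandauPage.Admissible l Λ q χ := by
    intro q _ χ hqT hqP hχ
    refine ⟨hχ, Real.log_le_log (by exact_mod_cast Nat.pos_of_ne_zero (NeZero.ne q)) hqT,
      fun p hp hpq => ?_⟩
    rw [hΛ, Real.exp_log hP0]
    refine le_trans ?_ hqP
    exact_mod_cast Finset.le_sup (f := id) (Nat.mem_primeFactors.mpr ⟨hp, hpq, NeZero.ne q⟩)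
  have hne : ∀ (q : ℕ) [NeZero q] (χ : DirichletCharacter ℂ q), χ.IsPrimitive → ∀ s : ℂ,
      LandauPage.InRegion c l Λ s → χ.LFunction s = 0 → χ ≠ 1 := by
    rintro q _ χ hχ s hs h0 rfl
    have hq1 : q = 1 := by
      rw [← (DirichletCharacter.isPrimitive_def _).mp hχ, DirichletCharacter.conductor_one]
    subst hq1
    rw [DirichletCharacter.LFunction_modOne_eq] at h0
    exact hzeta s hs h0
  constructor
  · rintro ⟨q₁, χ₁⟩ ⟨q₂, χ₂⟩ h₁ h₂
    obtain ⟨hq₁, hT₁, hP₁, hp₁, s₁, h0₁, hs₁⟩ := (hBad _).mp h₁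
    obtain ⟨hq₂, hT₂, hP₂, hp₂, s₂, h0₂, hs₂⟩ := (hBad _).mp h₂
    dsimp only at *
    have : NeZero q₁ := ⟨hq₁⟩
    have : NeZero q₂ := ⟨hq₂⟩
    rw [LFun_eq_LFunction] at h0₁ h0₂
    exact hpair q₁ q₂ χ₁ χ₂ (hadm q₁ χ₁ hT₁ hP₁ hp₁) (hadm q₂ χ₂ hT₂ hP₂ hp₂)
      (hne q₁ χ₁ hp₁ s₁ hs₁ h0₁) (hne q₂ χ₂ hp₂ s₂ hs₂ h0₂) s₁ s₂ hs₁ hs₂ h0₁ h0₂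
  · rintro ⟨q, χ⟩ hx
    obtain ⟨hq, hqT, hqP, hχ, s, h0, hs⟩ := (hBad _).mp hx
    dsimp only at *
    have : NeZero q := ⟨hq⟩
    rw [LFun_eq_LFunction] at h0 ⊢
    have hχ1 := hne q χ hχ s hs h0
    obtain ⟨h2, him, hre, -, huniq⟩ := hchar q χ (hadm q χ hqT hqP hχ) hχ1 s hs h0
    refine ⟨⟨s, ⟨h0, hs⟩, fun s' hs' => huniq s' hs'.2 hs'.1⟩, fun s' hs' => ?_, fun a => ?_,
      LandauPage.log_le_mul_sup_primeFactors hχ h2, ?_⟩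
    · obtain ⟨-, him', -, hd', -⟩ := hchar q χ (hadm q χ hqT hqP hχ) hχ1 s' hs'.2 hs'.1
      exact ⟨him', hd'⟩
    · rcases LandauPage.eq_neg_one_or_zero_or_one χ h2 a with h | h | h <;> simp [h]
    · refine LandauPage.loglog_le_of_exceptional_zero h2 hχ1 hc1 hl1 hΛl hre hs.1 ?_
      rwa [show ((s.re : ℝ) : ℂ) = s from Complex.ext rfl him.symm]
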